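/- Let (R, m) be a d-dimensional analytically unramified Noetherian local ring with conductor ideal 𝔠, and suppose R is quasi-Gorenstein, i.e. the top local cohomology module H^d_m(R) is isomorphic to the injective hull E_R(R/m) of the residue field. Then for every system of parameters x_1, …, x_d of R, the conductor is not contained in the parameter ideal: 𝔠 ⊄ (x_1, …, x_d)R. -/

import Mathlib

open CategoryTheory IsLocalRing

set_option synthInstance.maxHeartbeats 1000000
set_option maxHeartbeats 1000000

noncomputable section

/-- The integral closure `R̄` of `R` in its total ring of fractions, viewed as a type
(with its canonical `R`-algebra and `R`-module structures). -/
abbrev IntClosure (R : Type) [CommRing R] : Type :=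
  ↥(integralClosure R (FractionRing R))

/-- The quotient `R`-module `R̄/R`. -/
abbrev IntClosureQuot (R : Type) [CommRing R] : Type :=
  IntClosure R ⧸ LinearMap.range (Algebra.linearMap R (IntClosure R))

/-- The conductor ideal `𝔠 = Ann_R(R̄/R) = {r : R | r • R̄ ⊆ R}`. -/
def conductorIdeal (R : Type) [CommRing R] : Ideal R :=
  Module.annihilator R (IntClosureQuot R)

/-- A local ring `R` is analytically unramified if its `m`-adic completion is reduced. -/
def AnalyticallyUnramified (R : Type) [CommRing R] [IsLocalRing R] : Prop :=
  IsReduced (AdicCompletion (maximalIdeal R) R)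

/-- `R` is normal: it is reduced and equal to its integral closure `R̄` in its total
ring of fractions. -/
def IsNormalRing (R : Type) [CommRing R] : Prop :=
  IsReduced R ∧ integralClosure R (FractionRing R) = ⊥

/-- `Ext^i_R(M, N)` as a type. -/
abbrev ExtMod (R : Type) [CommRing R] (M : Type) [AddCommGroup M] [Module R M]
    (N : Type) [AddCommGroup N] [Module R N] (i : ℕ) : Type :=
  ↥(((Ext R (ModuleCat.{0} R) i).obj (Opposite.op (ModuleCat.of R M))).obj (ModuleCat.of R N))

/-- `M` has finite projective dimension over `R`:
`Ext^i_R(M, -)` vanishes for all `i` bigger than some `n`. -/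
def HasFiniteProjDim (R : Type) [CommRing R] (M : Type) [AddCommGroup M] [Module R M] : Prop :=
  ∃ n : ℕ, ∀ (N : ModuleCat.{0} R) (i : ℕ), n < i →
    Subsingleton ↥(((Ext R (ModuleCat.{0} R) i).obj (Opposite.op (ModuleCat.of R M))).obj N)

/-- `M` has finite injective dimension over `R`:
`Ext^i_R(-, M)` vanishes for all `i` bigger than some `n`. -/
def HasFiniteInjDim (R : Type) [CommRing R] (M : Type) [AddCommGroup M] [Module R M] : Prop :=
  ∃ n : ℕ, ∀ (N : ModuleCat.{0} R) (i : ℕ), n < i →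
    Subsingleton ↥(((Ext R (ModuleCat.{0} R) i).obj (Opposite.op N)).obj (ModuleCat.of R M))

/-- The depth of an `R`-module `M` over a local ring `(R, m)`: the least `i` such that
`Ext^i_R(R/m, M) ≠ 0` (`⊤` if there is no such `i`), valued in `WithBot (WithTop ℕ)`
for easy comparison with `ringKrullDim`. -/
def moduleDepth (R : Type) [CommRing R] [IsLocalRing R]
    (M : Type) [AddCommGroup M] [Module R M] : WithBot (WithTop ℕ) :=
  sInf { n : WithBot (WithTop ℕ) |
    ∃ i : ℕ, n = (i : ℕ) ∧ Nontrivial (ExtMod R (ResidueField R) M i) }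

/-- A Noetherian local ring is Gorenstein if it has finite injective dimension
as a module over itself. -/
def IsGorensteinLocal (R : Type) [CommRing R] [IsLocalRing R] : Prop :=
  IsNoetherianRing R ∧ HasFiniteInjDim R R

/-- A Noetherian local ring is Cohen–Macaulay if its depth equals its Krull dimension. -/
def IsCohenMacaulayLocal (R : Type) [CommRing R] [IsLocalRing R] : Prop :=
  IsNoetherianRing R ∧ moduleDepth R R = ringKrullDim R

/-- A ring is Cohen–Macaulay if it is Noetherian and all its localizations at primes
are Cohen–Macaulay local rings. -/
def IsCohenMacaulayRing (A : Type) [CommRing A] : Prop :=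
  IsNoetherianRing A ∧ ∀ (p : Ideal A) [p.IsPrime],
    moduleDepth (Localization.AtPrime p) (Localization.AtPrime p) =
      ringKrullDim (Localization.AtPrime p)

/-- Serre's condition `(S2)`: `depth (R_p) ≥ min {2, height p}` for every prime `p`
(`height p` being the dimension of `R_p`). -/
def SerreS2 (R : Type) [CommRing R] : Prop :=
  ∀ (p : Ideal R) [p.IsPrime],
    min 2 (ringKrullDim (Localization.AtPrime p)) ≤
      moduleDepth (Localization.AtPrime p) (Localization.AtPrime p)

/-- A Noetherian local ring is regular if its maximal ideal can be generated by
`dim R` elements. -/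
def IsRegularLocal (A : Type) [CommRing A] [IsLocalRing A] : Prop :=
  IsNoetherianRing A ∧ ∃ s : Finset A, Ideal.span (s : Set A) = maximalIdeal A ∧
    (s.card : WithBot (WithTop ℕ)) = ringKrullDim A

/-- Serre's condition `(R1)`: `R_p` is regular for every prime `p` of height at most `1`. -/
def SerreR1 (R : Type) [CommRing R] : Prop :=
  ∀ (p : Ideal R) [p.IsPrime], ringKrullDim (Localization.AtPrime p) ≤ 1 →
    IsRegularLocal (Localization.AtPrime p)

/-- The `i`-th local cohomology `H^i_m(M)` of `M` with support in the maximal ideal,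
as a type. -/
abbrev localCohMod (R : Type) [CommRing R] [IsLocalRing R] (i : ℕ)
    (M : Type) [AddCommGroup M] [Module R M] : Type :=
  ↥((localCohomology (maximalIdeal R) i).obj (ModuleCat.of R M))

/-- `x : Fin d → R` is a system of parameters for the local ring `(R, m)`:
`d = dim R`, all `x i` lie in `m`, and the ideal they generate is `m`-primary
(its radical is `m`). -/
def IsSystemOfParameters (R : Type) [CommRing R] [IsLocalRing R] {d : ℕ}
    (x : Fin d → R) : Prop :=
  (d : WithBot (WithTop ℕ)) = ringKrullDim R ∧ (∀ i, x i ∈ maximalIdeal R) ∧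
    (Ideal.span (Set.range x)).radical = maximalIdeal R

/-- `E` is an injective hull of the residue field of the local ring `R`:
`E` is injective and contains a copy of `R/m` as an essential submodule. -/
def IsInjectiveHullOfResidueField (R : Type) [CommRing R] [IsLocalRing R]
    (E : Type) [AddCommGroup E] [Module R E] : Prop :=
  Module.Injective R E ∧ ∃ f : ResidueField R →ₗ[R] E, Function.Injective f ∧
    ∀ N : Submodule R E, N ≠ ⊥ → N ⊓ LinearMap.range f ≠ ⊥

set_option linter.unusedSectionVars false

open Finset (sum_congr univ range prod_congr mul_sum sum_range_succ mem_univ mem_range)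

/-! ## Untilts of perfect domains -/

namespace Untilting

variable (p : ℕ) [hp : Fact p.Prime]

/-- The untilt `W(R) / (p - [t])` of a perfect ring `R` of characteristic `p`. -/
abbrev Ring (R : Type) [CommRing R] (t : R) : Type :=
  WittVector p R ⧸ Ideal.span {(p : WittVector p R) - WittVector.teichmuller p t}

variable {R : Type} [CommRing R] (t : R)

/-- The multiplicative map `r ↦ [r]`. -/
def sharp : R →* Ring p R t :=
  (Ideal.Quotient.mk _ : WittVector p R →+* Ring p R t).toMonoidHom.comp (WittVector.teichmuller p)

lemma sharp_apply (r : R) :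
    sharp p t r = Ideal.Quotient.mk _ (WittVector.teichmuller p r) := rfl

lemma sharp_t : sharp p t t = (p : Ring p R t) := by
  rw [sharp_apply, ← map_natCast (Ideal.Quotient.mk _), eq_comm, Ideal.Quotient.eq]
  exact Ideal.subset_span rfl

variable [CharP R p]

/-- Reduction modulo `p`. -/
def red : Ring p R t →+* R ⧸ Ideal.span {t} :=
  Ideal.Quotient.lift _ ((Ideal.Quotient.mk _).comp WittVector.constantCoeff) (by
    intro a ha
    obtain ⟨b, rfl⟩ := Ideal.mem_span_singleton'.mp ha
    have h0 : WittVector.constantCoeff (p : WittVector p R) = (0 : R) := by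
      rw [map_natCast]; exact CharP.cast_eq_zero R p
    have h1 : WittVector.constantCoeff (WittVector.teichmuller p t) = t := rfl
    rw [RingHom.comp_apply, map_mul, map_sub, h0, h1, Ideal.Quotient.eq_zero_iff_mem]
    exact Ideal.mul_mem_left _ _ (by simp))

@[simp] lemma red_mk (w : WittVector p R) :
    red p t (Ideal.Quotient.mk _ w) = Ideal.Quotient.mk _ (w.coeff 0) := rfl

@[simp] lemma red_sharp (r : R) : red p t (sharp p t r) = Ideal.Quotient.mk _ r := rfl

variable [PerfectRing R p]

lemma exists_root (r : R) (l : ℕ) : ∃ s : R, s ^ p ^ l = r := by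
  obtain ⟨s, hs⟩ := (bijective_iterateFrobenius R p l).2 r
  exact ⟨s, by simpa [iterateFrobenius_def] using hs⟩

lemma pow_inj {a b : R} {l : ℕ} (h : a ^ p ^ l = b ^ p ^ l) : a = b :=
  (bijective_iterateFrobenius R p l).1 (by simpa [iterateFrobenius_def] using h)

lemma dvd_of_pow_dvd {a b : R} {l : ℕ} (h : a ^ p ^ l ∣ b ^ p ^ l) : a ∣ b := by
  obtain ⟨c, hc⟩ := h
  obtain ⟨d, rfl⟩ := exists_root p c l
  exact ⟨d, pow_inj p (by rw [hc, mul_pow])⟩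

variable {t} in
lemma red_eq_zero_iff {z : Ring p R t} : red p t z = 0 ↔ (p : Ring p R t) ∣ z := by
  constructor
  · obtain ⟨w, rfl⟩ := Ideal.Quotient.mk_surjective z
    intro h
    rw [red_mk p t, Ideal.Quotient.eq_zero_iff_mem, Ideal.mem_span_singleton'] at h
    obtain ⟨a, ha⟩ := h
    have h2 : w - WittVector.teichmuller p a * WittVector.teichmuller p t ∈
        Ideal.span {(p : WittVector p R)} := by
      rw [WittVector.mem_span_p_iff_coeff_zero_eq_zero]
      have : (WittVector.constantCoeff : WittVector p R →+* R)
          (w - WittVector.teichmuller p a * WittVector.teichmuller p t) = w.coeff 0 - a * t := by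
        rw [map_sub, map_mul]; rfl
      exact this.trans (by rw [ha, sub_self])
    obtain ⟨b, hb⟩ := Ideal.mem_span_singleton'.mp h2
    have hw : w = WittVector.teichmuller p a * WittVector.teichmuller p t + b * p := by
      rw [hb]; ring
    rw [hw, map_add, map_mul, map_mul, ← sharp_apply, ← sharp_apply, sharp_t, map_natCast]
    exact ⟨sharp p t a + Ideal.Quotient.mk _ b, by ring⟩
  · rintro ⟨c, rfl⟩
    rw [map_mul, map_natCast]
    have : (p : R ⧸ Ideal.span {t}) = 0 := by
      rw [← map_natCast (Ideal.Quotient.mk _), CharP.cast_eq_zero, map_zero]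
    rw [this, zero_mul]

variable {t} in
lemma dvd_sub_sharp_iff {r s : R} :
    (p : Ring p R t) ∣ sharp p t r - sharp p t s ↔ t ∣ r - s := by
  rw [← red_eq_zero_iff, map_sub, red_sharp, red_sharp, ← map_sub, Ideal.Quotient.eq_zero_iff_mem,
    Ideal.mem_span_singleton]

variable {t} in
lemma dvd_sharp_iff {r : R} : (p : Ring p R t) ∣ sharp p t r ↔ t ∣ r := by
  rw [← red_eq_zero_iff, red_sharp, Ideal.Quotient.eq_zero_iff_mem, Ideal.mem_span_singleton]

variable {t} in
lemma exists_sharp_add (z : Ring p R t) : ∃ r y, z = sharp p t r + p * y := by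
  obtain ⟨r, hr⟩ := Ideal.Quotient.mk_surjective (red p t z)
  have : red p t (z - sharp p t r) = 0 := by rw [map_sub, red_sharp, hr, sub_self]
  obtain ⟨y, hy⟩ := (red_eq_zero_iff p).1 this
  exact ⟨r, y, by rw [← hy]; ring⟩

lemma exists_limit (a : ℕ → Ring p R t) (h : ∀ m, (p : Ring p R t) ^ m ∣ a (m + 1) - a m) :
    ∃ b, ∀ m, (p : Ring p R t) ^ m ∣ b - a m := by
  choose c hc using h
  choose w hw using fun m => Ideal.Quotient.mk_surjective (c m)
  obtain ⟨w0, hw0⟩ := Ideal.Quotient.mk_surjective (a 0)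
  have hpre := (inferInstance : IsAdicComplete (Ideal.span {(p : WittVector p R)})
    (WittVector p R)).toIsPrecomplete
  let S : ℕ → WittVector p R := fun m => w0 + ∑ i ∈ range m, p ^ i * w i
  obtain ⟨L, hL⟩ := hpre.prec (f := S) (by
    intro m n hmn
    rw [SModEq.sub_mem, smul_eq_mul, Ideal.mul_top, Ideal.span_singleton_pow,
      Ideal.mem_span_singleton, ← dvd_neg, neg_sub]
    have : S n - S m = ∑ i ∈ Finset.Ico m n, p ^ i * w i := by
      simp only [S]
      rw [Finset.sum_Ico_eq_sub _ hmn]; ring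
    rw [this]
    exact Finset.dvd_sum fun i hi =>
      (pow_dvd_pow _ (Finset.mem_Ico.1 hi).1).trans (dvd_mul_right _ _))
  refine ⟨Ideal.Quotient.mk _ L, fun m => ?_⟩
  have hS : ∀ m, Ideal.Quotient.mk _ (S m) = a m := by
    intro m
    induction m with
    | zero => simp [S, hw0]
    | succ m ih =>
      have : S (m + 1) = S m + p ^ m * w m := by
        simp only [S, sum_range_succ]; ring
      rw [this, map_add, ih, map_mul, map_pow, map_natCast, hw, ← hc]; ring
  have := hL m
  rw [SModEq.sub_mem, smul_eq_mul, Ideal.mul_top, Ideal.span_singleton_pow,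
    Ideal.mem_span_singleton] at this
  obtain ⟨v, hv⟩ := this
  have hv' : L - S m = p ^ m * -v := by rw [mul_neg, ← hv]; ring
  rw [← hS, ← map_sub, hv']
  exact ⟨Ideal.Quotient.mk _ (-v), by simp⟩

lemma sharp_dvd_of_pow_dvd_aux {τ : R} {l : ℕ} (hτ : τ ^ p ^ (l + 1) = t) {b : Ring p R t}
    (h : sharp p t τ ^ p ∣ b ^ p) : sharp p t τ ∣ b := by
  obtain ⟨r, y, rfl⟩ := exists_sharp_add p b
  have hτt : τ ^ p ∣ t := ⟨τ ^ (p ^ (l + 1) - p), by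
    rw [← pow_add, Nat.add_sub_cancel' (Nat.le_self_pow (by omega) p), hτ]⟩
  have hτ1 : sharp p t τ ∣ (p : Ring p R t) := by
    rw [← sharp_t]
    exact (map_dvd (sharp p t) ((dvd_pow_self τ hp.out.ne_zero).trans hτt))
  obtain ⟨c, hc⟩ := h
  have h1 := congrArg (red p t) hc
  rw [map_pow, map_add, map_mul, map_natCast, map_mul, map_pow, red_sharp, red_sharp] at h1
  have hp0 : (p : R ⧸ Ideal.span {t}) = 0 := by
    rw [← map_natCast (Ideal.Quotient.mk _), CharP.cast_eq_zero, map_zero]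
  obtain ⟨c', hc'⟩ := Ideal.Quotient.mk_surjective (red p t c)
  rw [hp0, zero_mul, add_zero, ← hc', ← map_pow, ← map_pow, ← map_mul, Ideal.Quotient.eq,
    Ideal.mem_span_singleton] at h1
  have h2 : τ ^ p ^ 1 ∣ r ^ p ^ 1 := by
    rw [pow_one]
    have := dvd_add (hτt.trans h1) (dvd_mul_right (τ ^ p) c')
    simpa using this
  have h3 := dvd_of_pow_dvd p h2
  exact dvd_add (map_dvd (sharp p t) h3) (hτ1.mul_right _)

variable [IsDomain R]

lemma sub_teichmuller_dvd_of_p_mul (ht : t ≠ 0) {a : WittVector p R} {w : WittVector p R}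
    (h : (p : WittVector p R) * w = ((p : WittVector p R) - WittVector.teichmuller p t) * a) :
    ∃ a', a = p * a' ∧ w = ((p : WittVector p R) - WittVector.teichmuller p t) * a' := by
  have h0 : a.coeff 0 = 0 := by
    have := congrArg WittVector.constantCoeff h
    rw [map_mul, map_mul, map_sub, map_natCast, CharP.cast_eq_zero, zero_mul, zero_sub] at this
    change (0 : R) = -t * a.coeff 0 at this
    simpa [ht] using this.symm
  rw [← WittVector.mem_span_p_iff_coeff_zero_eq_zero, Ideal.mem_span_singleton'] at h0
  obtain ⟨b, rfl⟩ := h0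
  refine ⟨b, mul_comm _ _, ?_⟩
  rw [← sub_eq_zero]
  apply WittVector.eq_zero_of_p_mul_eq_zero
  linear_combination h

lemma eq_zero_of_p_mul (ht : t ≠ 0) {z : Ring p R t} (h : (p : Ring p R t) * z = 0) : z = 0 := by
  obtain ⟨w, rfl⟩ := Ideal.Quotient.mk_surjective z
  rw [← map_natCast (Ideal.Quotient.mk _), ← map_mul, Ideal.Quotient.eq_zero_iff_mem,
    Ideal.mem_span_singleton] at h
  obtain ⟨a, ha⟩ := h
  obtain ⟨a', -, h2⟩ := sub_teichmuller_dvd_of_p_mul p t ht ha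
  rw [Ideal.Quotient.eq_zero_iff_mem, Ideal.mem_span_singleton]
  exact ⟨a', h2⟩

lemma p_mul_cancel (ht : t ≠ 0) {z y : Ring p R t} (h : (p : Ring p R t) * z = p * y) : z = y := by
  rw [← sub_eq_zero]
  exact eq_zero_of_p_mul p t ht (by rw [mul_sub, h, sub_self])

lemma p_pow_mul_cancel (ht : t ≠ 0) {z y : Ring p R t} (n : ℕ)
    (h : (p : Ring p R t) ^ n * z = p ^ n * y) : z = y := by
  induction n with
  | zero => simpa using h
  | succ n ih => exact ih (p_mul_cancel p t ht (by rw [← mul_assoc, ← mul_assoc, ← pow_succ', h]))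

lemma sharp_mul_cancel (ht : t ≠ 0) {s : R} {n : ℕ} (hs : s ∣ t ^ n) {z y : Ring p R t}
    (h : sharp p t s * z = sharp p t s * y) : z = y := by
  obtain ⟨s', hs'⟩ := hs
  apply p_pow_mul_cancel p t ht n
  rw [← sharp_t, ← map_pow, hs', map_mul, mul_right_comm, h, mul_right_comm]

lemma eq_zero_of_forall_dvd (ht : t ≠ 0) {z : Ring p R t} (h : ∀ m, (p : Ring p R t) ^ m ∣ z) : z = 0 := by
  obtain ⟨w, rfl⟩ := Ideal.Quotient.mk_surjective z
  set d := (p : WittVector p R) - WittVector.teichmuller p t with hd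
  have key : ∀ m, ∃ a b, w = d * a + p ^ m * b := by
    intro m
    obtain ⟨c, hc⟩ := h m
    obtain ⟨b, rfl⟩ := Ideal.Quotient.mk_surjective c
    rw [← map_natCast (Ideal.Quotient.mk _), ← map_pow, ← map_mul, Ideal.Quotient.eq,
      Ideal.mem_span_singleton] at hc
    obtain ⟨a, ha⟩ := hc
    exact ⟨a, b, by rw [← ha]; ring⟩
  choose a b hab using key
  have hdiv : ∀ m : ℕ, ∀ e f : WittVector p R, d * e = (p : WittVector p R) ^ m * f →
      (p : WittVector p R) ^ m ∣ e := by
    intro m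
    induction m with
    | zero => intro e f _; simp
    | succ m ih =>
      intro e f hef
      obtain ⟨e', rfl, h2⟩ := sub_teichmuller_dvd_of_p_mul p t ht (a := e) (w := p ^ m * f)
        (by rw [← mul_assoc, ← pow_succ', ← hef])
      obtain ⟨g, rfl⟩ := ih e' f h2.symm
      exact ⟨g, by ring⟩
  have hcauchy : ∀ m, (p : WittVector p R) ^ m ∣ a (m + 1) - a m := by
    intro m
    apply hdiv m _ (b m - p * b (m + 1))
    have h1 := hab m
    have h2 := hab (m + 1)
    linear_combination h1 - h2
  have hpre := (inferInstance : IsAdicComplete (Ideal.span {(p : WittVector p R)})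
    (WittVector p R))
  obtain ⟨L, hL⟩ := hpre.toIsPrecomplete.prec (f := a) (by
    intro m n hmn
    rw [SModEq.sub_mem, smul_eq_mul, Ideal.mul_top, Ideal.span_singleton_pow,
      Ideal.mem_span_singleton, ← dvd_neg, neg_sub]
    induction n, hmn using Nat.le_induction with
    | base => simp
    | succ n hmn ih =>
      have : a (n + 1) - a m = (a (n + 1) - a n) + (a n - a m) := by ring
      rw [this]
      exact dvd_add ((pow_dvd_pow _ hmn).trans (hcauchy n)) ih)
  have hz : w - d * L = 0 := by
    apply hpre.toIsHausdorff.haus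
    intro m
    rw [SModEq.zero, smul_eq_mul, Ideal.mul_top, Ideal.span_singleton_pow,
      Ideal.mem_span_singleton]
    have := hL m
    rw [SModEq.sub_mem, smul_eq_mul, Ideal.mul_top, Ideal.span_singleton_pow,
      Ideal.mem_span_singleton] at this
    obtain ⟨v, hv⟩ := this
    exact ⟨d * v + b m, by linear_combination hab m + d * hv⟩
  rw [Ideal.Quotient.eq_zero_iff_mem, Ideal.mem_span_singleton]
  exact ⟨L, sub_eq_zero.1 hz⟩

lemma sharp_pow_dvd_of_pow_dvd (ht : t ≠ 0) {τ : R} {l : ℕ} (hτ : τ ^ p ^ (l + 1) = t) (k : ℕ)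
    {b : Ring p R t} (h : sharp p t τ ^ (p * k) ∣ b ^ p) : sharp p t τ ^ k ∣ b := by
  induction k generalizing b with
  | zero => simp
  | succ k ih =>
    have h1 : sharp p t τ ^ p ∣ b ^ p := (pow_dvd_pow _ (by nlinarith)).trans h
    obtain ⟨b', rfl⟩ := sharp_dvd_of_pow_dvd_aux p t hτ h1
    rw [pow_succ']
    apply mul_dvd_mul_left
    apply ih
    obtain ⟨c, hc⟩ := h
    refine ⟨c, ?_⟩
    have hd : τ ^ p ∣ t ^ 1 := ⟨τ ^ (p ^ (l + 1) - p), by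
      rw [← pow_add, Nat.add_sub_cancel' (Nat.le_self_pow (by omega) p), hτ, pow_one]⟩
    apply sharp_mul_cancel p t ht hd
    rw [map_pow, ← mul_pow, hc, mul_add, mul_one, pow_add]; ring

lemma sharp_pow_dvd_of_pow_pow_dvd (ht : t ≠ 0) {τ : R} {l : ℕ} (hτ : τ ^ p ^ (l + 1) = t) (i k : ℕ)
    {b : Ring p R t} (h : sharp p t τ ^ (p ^ i * k) ∣ b ^ p ^ i) : sharp p t τ ^ k ∣ b := by
  induction i generalizing k with
  | zero => simpa using h
  | succ i ih =>
    apply ih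
    apply sharp_pow_dvd_of_pow_dvd p t ht hτ
    rw [← pow_mul]
    convert h using 2 <;> ring

end Untilting

/-! ## Subrings of a perfect field closed under `p`-th roots -/

section Hull

variable (p : ℕ) [hp : Fact p.Prime] {K : Type} [Field K]

/-- A subring closed under extracting `p`-th roots. -/
class RootClosed (S : Subring K) : Prop where
  mem_of_pow_mem : ∀ z : K, z ^ p ∈ S → z ∈ S

lemma RootClosed.mem_of_pow_pow_mem (S : Subring K) [h : RootClosed p S] {z : K} {n : ℕ}
    (hz : z ^ p ^ n ∈ S) : z ∈ S := by
  induction n with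
  | zero => simpa using hz
  | succ n ih => exact ih (h.mem_of_pow_mem _ (by rwa [← pow_mul, ← pow_succ]))

instance Subring.charP_of_field [CharP K p] (S : Subring K) : CharP S p :=
  (RingHom.charP_iff S.subtype Subtype.val_injective p).2 inferInstance

instance RootClosed.perfectRing [CharP K p] [PerfectRing K p] (S : Subring K) [h : RootClosed p S] :
    PerfectRing S p :=
  PerfectRing.ofSurjective S p fun z => by
    obtain ⟨y, hy⟩ := Untilting.exists_root p (z : K) 1
    rw [pow_one] at hy
    exact ⟨⟨y, h.mem_of_pow_mem _ (by rw [hy]; exact z.2)⟩, Subtype.ext (by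
      simpa [frobenius_def] using hy)⟩

variable [CharP K p]

/-- The elements of `K` with some `p`-power power in `S`. -/
def perfectHull (S : Subring K) : Subring K where
  carrier := {z | ∃ j, z ^ p ^ j ∈ S}
  mul_mem' := by
    rintro a b ⟨i, hi⟩ ⟨j, hj⟩
    refine ⟨i + j, ?_⟩
    rw [mul_pow]
    refine S.mul_mem ?_ ?_
    · rw [pow_add, pow_mul]; exact S.pow_mem hi _
    · rw [add_comm, pow_add, pow_mul]; exact S.pow_mem hj _
  one_mem' := ⟨0, by simp [S.one_mem]⟩
  add_mem' := by
    rintro a b ⟨i, hi⟩ ⟨j, hj⟩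
    refine ⟨i + j, ?_⟩
    rw [add_pow_char_pow]
    refine S.add_mem ?_ ?_
    · rw [pow_add, pow_mul]; exact S.pow_mem hi _
    · rw [add_comm, pow_add, pow_mul]; exact S.pow_mem hj _
  zero_mem' := ⟨0, by simp [S.zero_mem]⟩
  neg_mem' := by
    rintro a ⟨i, hi⟩
    refine ⟨i, ?_⟩
    rw [neg_pow]
    exact S.mul_mem (S.pow_mem (S.neg_mem S.one_mem) _) hi

lemma le_perfectHull (S : Subring K) : S ≤ perfectHull p S := fun z hz => ⟨0, by simpa using hz⟩

instance (S : Subring K) : RootClosed p (perfectHull p S) where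
  mem_of_pow_mem := fun z ⟨j, hj⟩ => ⟨j + 1, by rwa [pow_succ', pow_mul]⟩

lemma perfectHull_le {S T : Subring K} [RootClosed p T] (h : S ≤ T) : perfectHull p S ≤ T := by
  rintro z ⟨j, hj⟩
  exact RootClosed.mem_of_pow_pow_mem p T (h hj)

lemma perfectHull_mono {S T : Subring K} (h : S ≤ T) : perfectHull p S ≤ perfectHull p T :=
  perfectHull_le p (h.trans (le_perfectHull p T))

lemma pow_mem_of_le {S : Subring K} {z : K} {i j : ℕ} (h : z ^ p ^ i ∈ S) (hij : i ≤ j) :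
    z ^ p ^ j ∈ S := by
  obtain ⟨k, rfl⟩ := Nat.exists_eq_add_of_le hij
  rw [pow_add, pow_mul]; exact S.pow_mem h _

end Hull

/-- The subring `S[u]`. -/
def adjoinElem {K : Type} [Field K] (S : Subring K) (u : K) : Subring K :=
  (Algebra.adjoin S {u}).toSubring

section Adjoin

variable {K : Type} [Field K] {S : Subring K} {u : K}

lemma mem_adjoinElem {z : K} : z ∈ adjoinElem S u ↔
    ∃ (n : ℕ) (h : ℕ → K), (∀ k, h k ∈ S) ∧ z = ∑ k ∈ range n, h k * u ^ k := by
  constructor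
  · intro hz
    have hz' : z ∈ Algebra.adjoin S {u} := hz
    rw [Algebra.adjoin_singleton_eq_range_aeval] at hz'
    obtain ⟨f, rfl⟩ := hz'
    refine ⟨f.natDegree + 1, fun k => f.coeff k, fun k => (f.coeff k).2, ?_⟩
    change Polynomial.aeval u f = _
    rw [Polynomial.aeval_eq_sum_range]
    rfl
  · rintro ⟨n, h, hh, rfl⟩
    refine Subring.sum_mem _ fun k _ => Subring.mul_mem _ ?_ (Subring.pow_mem _ ?_ _)
    · exact (Algebra.adjoin S {u}).algebraMap_mem ⟨h k, hh k⟩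
    · exact Algebra.self_mem_adjoin_singleton S u

lemma le_adjoinElem : S ≤ adjoinElem S u := fun z hz =>
  (Algebra.adjoin S {u}).algebraMap_mem ⟨z, hz⟩

lemma self_mem_adjoinElem : u ∈ adjoinElem S u := Algebra.self_mem_adjoin_singleton S u

lemma adjoinElem_le {T : Subring K} (h : S ≤ T) (hu : u ∈ T) : adjoinElem S u ≤ T := by
  intro z hz
  obtain ⟨n, c, hc, rfl⟩ := mem_adjoinElem.1 hz
  exact T.sum_mem fun k _ => T.mul_mem (h (hc k)) (T.pow_mem hu _)

end Adjoin

namespace Untilting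

section Map

variable (p : ℕ) [hp : Fact p.Prime] {R R' R'' : Type} [CommRing R] [CommRing R'] [CommRing R'']

/-- Functoriality of the untilt. -/
def map (f : R →+* R') {t : R} {t' : R'} (h : f t = t') : Ring p R t →+* Ring p R' t' :=
  Ideal.quotientMap _ (WittVector.map f) (by
    rw [Ideal.span_le, Set.singleton_subset_iff, SetLike.mem_coe, Ideal.mem_comap, map_sub,
      map_natCast, WittVector.map_teichmuller, h]
    exact Ideal.mem_span_singleton_self _)

lemma map_sharp (f : R →+* R') {t : R} {t' : R'} (h : f t = t') (r : R) :
    map p f h (sharp p t r) = sharp p t' (f r) := by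
  rw [sharp_apply, map, Ideal.quotientMap_mk, WittVector.map_teichmuller, sharp_apply]

lemma map_map (f : R →+* R') (g : R' →+* R'') {t : R} {t' : R'} {t'' : R''} (h : f t = t')
    (h' : g t' = t'') (z : Ring p R t) :
    map p g h' (map p f h z) = map p (g.comp f) (by rw [RingHom.comp_apply, h, h']) z := by
  obtain ⟨w, rfl⟩ := Ideal.Quotient.mk_surjective z
  simp only [map, Ideal.quotientMap_mk]
  congr 1

end Map

end Untilting

namespace Untilting

variable (p : ℕ) [hp : Fact p.Prime] {K : Type} [Field K] [CharP K p] [PerfectRing K p]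

/-- The perfect hull of `R[t ^ n / γ]`. -/
def blowup (R : Subring K) (t γ : K) (n : ℕ) : Subring K :=
  perfectHull p (adjoinElem R (t ^ n / γ))

instance (R : Subring K) (t γ : K) (n : ℕ) : RootClosed p (blowup p R t γ n) :=
  inferInstanceAs (RootClosed p (perfectHull p _))

lemma le_blowup (R : Subring K) (t γ : K) (n : ℕ) : R ≤ blowup p R t γ n :=
  le_adjoinElem.trans (le_perfectHull p _)

lemma div_mem_blowup (R : Subring K) (t γ : K) (n : ℕ) : t ^ n / γ ∈ blowup p R t γ n :=
  le_perfectHull p _ self_mem_adjoinElem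

lemma blowup_anti {R : Subring K} {t : K} (ht : t ∈ R) (γ : K) {n N : ℕ} (h : n ≤ N) :
    blowup p R t γ N ≤ blowup p R t γ n := by
  apply perfectHull_mono
  apply adjoinElem_le le_adjoinElem
  have : t ^ N / γ = t ^ (N - n) * (t ^ n / γ) := by
    rw [← mul_div_assoc, ← pow_add, Nat.sub_add_cancel h]
  rw [this]
  exact Subring.mul_mem _ (Subring.pow_mem _ (le_adjoinElem ht) _) self_mem_adjoinElem

lemma exists_root_mul_eq_add {R : Subring K} [RootClosed p R] {t γ g : K} (ht : t ∈ R)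
    (hγ : γ ∈ R) (hγ0 : γ ≠ 0) {l : ℕ} (hg : g ^ p ^ l = γ) {n N : ℕ} (hN : n + p ^ l ≤ N)
    {r : K} (hr : r ∈ blowup p R t γ N) :
    ∃ a ∈ R, ∃ b ∈ blowup p R t γ n, g * r = a + t * b := by
  obtain ⟨i, hi⟩ := hr
  have hi' := pow_mem_of_le p hi (Nat.le_add_right i l)
  obtain ⟨M, h, hh, hsum⟩ := mem_adjoinElem.1 hi'
  have key : ∀ k, ∃ A ∈ R, ∃ B ∈ adjoinElem R (t ^ n / γ),
      γ ^ p ^ i * (h k * (t ^ N / γ) ^ k) = A + t ^ p ^ (i + l) * B := by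
    intro k
    by_cases hk : p ^ (i + l) ≤ k * (N - n)
    · refine ⟨0, R.zero_mem, γ ^ p ^ i * (h k * (t ^ (k * (N - n) - p ^ (i + l)) *
        (t ^ n / γ) ^ k)), ?_, ?_⟩
      · have hR : R ≤ adjoinElem R (t ^ n / γ) := le_adjoinElem
        exact Subring.mul_mem _ (Subring.pow_mem _ (hR hγ) _) (Subring.mul_mem _ (hR (hh k))
          (Subring.mul_mem _ (Subring.pow_mem _ (hR ht) _)
            (Subring.pow_mem _ self_mem_adjoinElem _)))
      · have h1 : t ^ N / γ = t ^ (N - n) * (t ^ n / γ) := by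
          rw [← mul_div_assoc, ← pow_add, Nat.sub_add_cancel (by omega)]
        have h2 : t ^ ((N - n) * k) =
            t ^ p ^ (i + l) * t ^ (k * (N - n) - p ^ (i + l)) := by
          rw [← pow_add, Nat.add_sub_cancel' hk, mul_comm]
        rw [h1, mul_pow, ← pow_mul, h2]; ring
    · have hk' : k ≤ p ^ i := by
        by_contra hcon
        push Not at hcon hk
        have : p ^ i * p ^ l ≤ k * (N - n) := Nat.mul_le_mul hcon.le (by omega)
        rw [pow_add] at hk
        omega
      refine ⟨h k * (t ^ (N * k) * γ ^ (p ^ i - k)), R.mul_mem (hh k)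
        (R.mul_mem (R.pow_mem ht _) (R.pow_mem hγ _)), 0, Subring.zero_mem _, ?_⟩
      have h2 : γ ^ p ^ i = γ ^ (p ^ i - k) * γ ^ k := by
        rw [← pow_add, Nat.sub_add_cancel hk']
      rw [h2, div_pow, ← pow_mul]
      field_simp
      ring
  choose A hA B hB hAB using key
  have htot : γ ^ p ^ i * r ^ p ^ (i + l) = (∑ k ∈ range M, A k) +
      t ^ p ^ (i + l) * ∑ k ∈ range M, B k := by
    rw [hsum, mul_sum, sum_congr rfl fun k _ => hAB k, Finset.sum_add_distrib,
      mul_sum]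
  obtain ⟨a, ha⟩ := exists_root p (∑ k ∈ range M, A k) (i + l)
  obtain ⟨b, hb⟩ := exists_root p (∑ k ∈ range M, B k) (i + l)
  refine ⟨a, RootClosed.mem_of_pow_pow_mem p R (n := i + l) ?_, b, ⟨i + l, ?_⟩, ?_⟩
  · rw [ha]; exact R.sum_mem fun k _ => hA k
  · rw [hb]; exact Subring.sum_mem _ fun k _ => hB k
  · apply pow_inj p (l := i + l)
    rw [add_pow_char_pow, mul_pow, mul_pow, ha, hb, ← htot, pow_add p, mul_comm (p ^ i) (p ^ l),
      pow_mul g, hg]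

lemma root_mul_mem {R : Subring K} [RootClosed p R] {t γ g : K} (ht : t ∈ R)
    (hγ : γ ∈ R) (hγ0 : γ ≠ 0) {l : ℕ} (hg : g ^ p ^ l = γ)
    {y : K} (hy : y ∈ blowup p R t γ (p ^ l * p)) (hty : t * y ∈ R) : g * y ∈ R := by
  obtain ⟨i, hi⟩ := hy
  set u := t ^ (p ^ l * p) / γ with hu
  have hi' := pow_mem_of_le p hi (Nat.le_add_right i (l + 1))
  obtain ⟨M, h, hh, hsum⟩ := mem_adjoinElem.1 hi'
  set q := p ^ (i + (l + 1)) with hq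
  have hqe : (p ^ l * p) * p ^ i = q := by rw [hq]; ring
  set e := p ^ i with he
  let N : Submodule R K := Submodule.span R {x | ∃ k ≤ M, x = u ^ k}
  have huN : ∀ k ≤ M, u ^ k ∈ N := fun k hk => Submodule.subset_span ⟨k, hk, rfl⟩
  have smulN : ∀ c ∈ R, ∀ x ∈ N, c * x ∈ N := fun c hc x hx => N.smul_mem ⟨c, hc⟩ hx
  have hw : y ^ q ∈ N := by
    rw [hsum]
    exact N.sum_mem fun k hk => smulN _ (hh k) _ (huN k (mem_range.1 hk).le)
  have htw : t ^ q * y ^ q ∈ R := by rw [← mul_pow]; exact R.pow_mem hty _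
  have hWN : ∀ x ∈ N, γ ^ e * y ^ q * x ∈ N := by
    intro x hx
    induction hx using Submodule.span_induction with
    | mem x hx =>
      obtain ⟨k, hk, rfl⟩ := hx
      rcases le_total e k with hek | hek
      · have : γ ^ e * y ^ q * u ^ k = t ^ q * y ^ q * u ^ (k - e) := by
          have h1 : u ^ k = u ^ e * u ^ (k - e) := by rw [← pow_add, Nat.add_sub_cancel' hek]
          have h2 : γ ^ e * u ^ e = t ^ q := by
            rw [← mul_pow, hu, mul_div_cancel₀ _ hγ0, ← pow_mul, hqe]
          rw [h1, ← h2]; ring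
        rw [this]
        exact smulN _ htw _ (huN _ (by omega))
      · have : γ ^ e * y ^ q * u ^ k = γ ^ (e - k) * (t ^ (p ^ l * p * k) * y ^ q) := by
          have h1 : γ ^ e = γ ^ (e - k) * γ ^ k := by rw [← pow_add, Nat.sub_add_cancel hek]
          have h2 : γ ^ k * u ^ k = t ^ (p ^ l * p * k) := by
            rw [← mul_pow, hu, mul_div_cancel₀ _ hγ0, ← pow_mul]
          rw [h1, ← h2]; ring
        rw [this]
        exact smulN _ (R.pow_mem hγ _) _ (smulN _ (R.pow_mem ht _) _ hw)
    | zero => simp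
    | add x y _ _ hx hy => rw [mul_add]; exact N.add_mem hx hy
    | smul a x _ hx => rw [mul_smul_comm]; exact N.smul_mem a hx
  have hpow : ∀ s, (γ ^ e * y ^ q) ^ s ∈ N := by
    intro s
    induction s with
    | zero => simpa using huN 0 (Nat.zero_le _)
    | succ s ih => rw [pow_succ']; exact hWN _ ih
  have hNR : ∀ x ∈ N, γ ^ M * x ∈ R := by
    intro x hx
    induction hx using Submodule.span_induction with
    | mem x hx =>
      obtain ⟨k, hk, rfl⟩ := hx
      have : γ ^ M * u ^ k = γ ^ (M - k) * t ^ (p ^ l * p * k) := by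
        have h1 : γ ^ M = γ ^ (M - k) * γ ^ k := by rw [← pow_add, Nat.sub_add_cancel hk]
        have h2 : γ ^ k * u ^ k = t ^ (p ^ l * p * k) := by
          rw [← mul_pow, hu, mul_div_cancel₀ _ hγ0, ← pow_mul]
        rw [h1, ← h2]; ring
      rw [this]
      exact R.mul_mem (R.pow_mem hγ _) (R.pow_mem ht _)
    | zero => simp
    | add x y _ _ hx hy => rw [mul_add]; exact R.add_mem hx hy
    | smul a x _ hx => rw [mul_smul_comm]; exact R.mul_mem a.2 hx
  have hfin := hNR _ (hpow (p ^ M))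
  have hle : e * p ^ M + M ≤ p ^ (i + 1 + M) := by
    have h1 : M < p ^ M := Nat.lt_pow_self hp.out.one_lt
    have h2 : 2 * (e * p ^ M) ≤ p ^ (i + 1 + M) := by
      have : p ^ (i + 1 + M) = p * (e * p ^ M) := by rw [he]; ring
      rw [this]; exact Nat.mul_le_mul_right _ hp.out.two_le
    have h3 : p ^ M ≤ e * p ^ M := Nat.le_mul_of_pos_left _ (pow_pos hp.out.pos _)
    omega
  apply RootClosed.mem_of_pow_pow_mem p R (n := i + (l + 1) + M)
  obtain ⟨D, hD⟩ := Nat.exists_eq_add_of_le hle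
  have : (g * y) ^ p ^ (i + (l + 1) + M) = γ ^ D * (γ ^ M * (γ ^ e * y ^ q) ^ p ^ M) := by
    have h1 : g ^ p ^ (i + (l + 1) + M) = γ ^ p ^ (i + 1 + M) := by
      rw [← hg, ← pow_mul]; congr 1; ring
    have h2 : y ^ p ^ (i + (l + 1) + M) = (y ^ q) ^ p ^ M := by
      rw [hq, ← pow_mul, ← pow_add p]
    rw [mul_pow, h1, h2, hD, mul_pow, ← pow_mul γ e, pow_add, pow_add]
    generalize γ ^ (e * p ^ M) = X, (y ^ q) ^ p ^ M = Y
    ring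
  rw [this]
  exact R.mul_mem (R.pow_mem hγ _) hfin

/-- The map of untilts induced by an inclusion of subrings. -/
def incl {S S' : Subring K} (h : S ≤ S') {t : K} (ht : t ∈ S) :
    Ring p S ⟨t, ht⟩ →+* Ring p S' ⟨t, h ht⟩ :=
  map p (Subring.inclusion h) rfl

lemma incl_sharp {S S' : Subring K} (h : S ≤ S') {t : K} (ht : t ∈ S) (r : S) :
    incl p h ht (sharp p _ r) = sharp p _ ⟨r, h r.2⟩ := map_sharp p _ _ r

lemma incl_incl {S S' S'' : Subring K} (h : S ≤ S') (h' : S' ≤ S'') {t : K} (ht : t ∈ S)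
    (z : Ring p S ⟨t, ht⟩) :
    incl p h' (h ht) (incl p h ht z) = incl p (h.trans h') ht z := map_map p _ _ _ _ z

end Untilting

namespace Untilting

variable (p : ℕ) [hp : Fact p.Prime] {K : Type} [Field K] [CharP K p] [PerfectRing K p]

lemma map_pow_succ_mul_eq {A B C D : Type} [CommRing A] [CommRing B] [CommRing C] [CommRing D]
    {f : D →+* B} {κ : B →+* C} {φ : D →+* C} {ι : A →+* B} {μ : A →+* C}
    (hφ : ∀ d, κ (f d) = φ d) (hμ : ∀ a, κ (ι a) = μ a) {gA : A} {gB : B} {gD : D}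
    (hgD : f gD = gB) (hgA : ι gA = gB) {z : D} {a a' : A} {y : B} {y' : C} {m : ℕ}
    (h1 : f (gD * z) = ι a + p * y) (h2 : κ (gB ^ m * y) = μ a' + p ^ m * y') :
    φ (gD ^ (m + 1) * z) = μ (gA ^ m * a + p * a') + p ^ (m + 1) * y' := by
  rw [← hφ, pow_succ, mul_assoc, map_mul, h1, map_pow, hgD, mul_add, map_add, mul_left_comm,
    map_mul κ (p : B), h2, ← hgA, ← map_pow, ← map_mul, hμ, map_natCast, map_add μ, map_mul μ (p : A),
    map_natCast]
  ring

lemma map_pow_mul_sub_eq {A C D : Type} [CommRing A] [CommRing C] [CommRing D]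
    {κ : D →+* C} {ι : A →+* D} {μ : A →+* C} (hμ : ∀ a, κ (ι a) = μ a) {hA : A} {hD : D}
    (hh : ι hA = hD) {x η a : A} {z : D} {y : C} {i : ℕ}
    (h1 : ι x = ι η * z) (h2 : κ (hD ^ i * z) = μ a + p ^ i * y) :
    μ (hA ^ i * x - η * a) = p ^ i * (μ η * y) := by
  rw [map_sub, map_mul, map_mul, ← hμ x, h1, map_mul, hμ, map_pow, ← hμ hA, hh]
  rw [map_mul, map_pow] at h2
  linear_combination μ η * h2

lemma mul_mul_eq_of_approx {A : Type} [CommRing A] {h τ c η a b : A} {i : ℕ} (D : ℕ)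
    (hb : h ^ i * (h ^ i * (τ * c) - η * a) = p ^ i * b) :
    τ * (h ^ D * (h ^ i * h ^ i)) * c = η * (h ^ D * (h ^ i * a)) + p ^ i * (h ^ D * b) := by
  linear_combination h ^ D * hb

section General

variable {R : Type} [CommRing R] [CharP R p] [PerfectRing R p] [IsDomain R] {t : R} (ht : t ≠ 0)

include ht

lemma sharp_dvd_of_mul_eq_pow {u γ τ : R} {l : ℕ} (hτ : τ ^ p ^ (l + 1) = t) {j n : ℕ}
    (huγ : u * γ = t ^ n) {c : Ring p R t}
    (hc : ∀ k : ℕ, sharp p t (t ^ j * γ) ^ k ∣ c ^ (k + 1)) :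
    sharp p t (t ^ j * γ) ∣ sharp p t τ * c := by
  set b := sharp p t u * c with hb
  have hpow : ∀ k : ℕ, (p : Ring p R t) ^ ((n + j) * k) ∣ b ^ (k + 1) := by
    intro k
    obtain ⟨d, hd⟩ := hc k
    refine ⟨sharp p t u * d, ?_⟩
    have h1 : (p : Ring p R t) ^ (n + j) = sharp p t u * sharp p t (t ^ j * γ) := by
      rw [← map_mul, mul_left_comm, huγ, ← pow_add, map_pow, sharp_t, add_comm]
    rw [hb, mul_pow, hd, pow_mul, h1]
    ring
  rcases Nat.eq_zero_or_pos (n + j) with hm0 | hm0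
  · have hn : n = 0 := by omega
    have hj : j = 0 := by omega
    refine ⟨sharp p t u * (sharp p t τ * c), ?_⟩
    rw [← mul_assoc, ← map_mul, hj, pow_zero, one_mul, mul_comm γ, huγ, hn]
    simp
  have hdiv : sharp p t τ ^ (p ^ (l + 1) * (n + j) - 1) ∣ b := by
    have hle : p ^ (l + 1) * (n + j) ≤ p ^ (p ^ (l + 1) * (n + j)) :=
      (Nat.lt_pow_self hp.out.one_lt).le
    apply sharp_pow_dvd_of_pow_pow_dvd p t ht hτ (p ^ (l + 1) * (n + j))
    obtain ⟨k, hk⟩ : ∃ k, p ^ (p ^ (l + 1) * (n + j)) = k + 1 :=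
      ⟨p ^ (p ^ (l + 1) * (n + j)) - 1, by
        have := pow_pos hp.out.pos (p ^ (l + 1) * (n + j)); omega⟩
    have h1 := hpow k
    have hpτ : (p : Ring p R t) = sharp p t τ ^ p ^ (l + 1) := by
      rw [← map_pow, hτ, sharp_t]
    rw [hpτ, ← pow_mul, ← mul_assoc] at h1
    rw [hk] at hle ⊢
    refine dvd_trans (pow_dvd_pow _ ?_) h1
    generalize p ^ (l + 1) * (n + j) = i at *
    rw [Nat.mul_sub, Nat.mul_comm (k + 1) i, Nat.mul_add]
    omega
  obtain ⟨z, hz⟩ := hdiv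
  refine ⟨z, ?_⟩
  apply sharp_mul_cancel p t ht (s := u) (n := n) ⟨γ, huγ.symm⟩
  rw [mul_left_comm, ← hb, hz, ← mul_assoc, ← pow_succ',
    Nat.sub_add_cancel (Nat.mul_pos (pow_pos hp.out.pos _) hm0), ← map_pow, pow_mul, hτ,
    pow_add, ← huγ, ← mul_assoc, ← map_mul]
  ring_nf

lemma p_pow_dvd_of_sharp_mul {γ : R} (hnzd : ∀ a, t ∣ γ * a → t ∣ a) (m : ℕ) (z : Ring p R t)
    (hz : (p : Ring p R t) ^ m ∣ sharp p t γ * z) : (p : Ring p R t) ^ m ∣ z := by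
  induction m generalizing z with
  | zero => simp
  | succ m ih =>
    have h0 : (p : Ring p R t) ∣ z := by
      have hz' : (p : Ring p R t) ∣ sharp p t γ * z := (dvd_pow_self _ (by omega)).trans hz
      obtain ⟨r, y, rfl⟩ := exists_sharp_add p z
      have h1 : (p : Ring p R t) ∣ sharp p t (γ * r) := by
        obtain ⟨w, hw⟩ := hz'
        refine ⟨w - sharp p t γ * y, ?_⟩
        rw [map_mul]
        linear_combination hw
      rw [dvd_sharp_iff] at h1
      exact dvd_add ((dvd_sharp_iff p).2 (hnzd r h1)) (dvd_mul_right _ _)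
    obtain ⟨y, rfl⟩ := h0
    rw [pow_succ']
    apply mul_dvd_mul_left
    apply ih
    obtain ⟨w, hw⟩ := hz
    refine ⟨w, p_mul_cancel p t ht ?_⟩
    rw [mul_left_comm, hw]; ring

lemma sharp_dvd_of_forall_approx {γ : R} (hnzd : ∀ a, t ∣ γ * a → t ∣ a) {j : ℕ} {x : Ring p R t}
    (h : ∀ i : ℕ, ∃ a b, x = sharp p t (t ^ j * γ) * a + p ^ i * b) :
    sharp p t (t ^ j * γ) ∣ x := by
  have hηp : sharp p t (t ^ j * γ) = p ^ j * sharp p t γ := by rw [map_mul, map_pow, sharp_t]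
  choose a b hab using h
  obtain ⟨A, hA⟩ := exists_limit p t (fun m => a (m + j)) (by
    intro m
    apply p_pow_dvd_of_sharp_mul p ht hnzd
    have h1 := hab (m + j)
    have h2 := hab (m + 1 + j)
    rw [hηp] at h1 h2
    refine ⟨b (m + j) - p * b (m + 1 + j), p_pow_mul_cancel p t ht j ?_⟩
    rw [pow_add] at h1
    rw [pow_add, pow_add, pow_one] at h2
    linear_combination h1 - h2)
  refine ⟨A, ?_⟩
  rw [← sub_eq_zero]
  apply eq_zero_of_forall_dvd p t ht
  intro m
  obtain ⟨w, hw⟩ := hA m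
  refine ⟨p ^ j * b (m + j) - sharp p t (t ^ j * γ) * w, ?_⟩
  have h1 := hab (m + j)
  rw [pow_add] at h1
  linear_combination h1 - sharp p t (t ^ j * γ) * hw

end General

section

variable {R : Subring K} [RootClosed p R] {t γ : K} (ht : t ∈ R) (ht0 : t ≠ 0)
  (hγ : γ ∈ R) (hγ0 : γ ≠ 0)

include hγ hγ0

lemma exists_root_sharp_mul_eq_add {g : K} (hgR : g ∈ R) {l : ℕ} (hg : g ^ p ^ l = γ) {n N : ℕ}
    (hN : n + p ^ l ≤ N) (z : Ring p (blowup p R t γ N) ⟨t, le_blowup p R t γ N ht⟩) :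
    ∃ (a : Ring p R ⟨t, ht⟩) (y : Ring p (blowup p R t γ n) ⟨t, le_blowup p R t γ n ht⟩),
      incl p (blowup_anti p ht γ (by omega : n ≤ N)) (le_blowup p R t γ N ht)
        (sharp p _ ⟨g, le_blowup p R t γ N hgR⟩ * z) =
      incl p (le_blowup p R t γ n) ht a + p * y := by
  obtain ⟨r, y, rfl⟩ := exists_sharp_add p z
  obtain ⟨a, ha, b, hb, hab⟩ := exists_root_mul_eq_add p ht hγ hγ0 hg hN r.2
  set ι := incl p (blowup_anti p ht γ (by omega : n ≤ N)) (le_blowup p R t γ N ht) with hι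
  have h1 : (p : Ring p (blowup p R t γ n) ⟨t, le_blowup p R t γ n ht⟩) ∣
      sharp p _ ⟨g * r, blowup_anti p ht γ (by omega : n ≤ N)
        (Subring.mul_mem _ (le_blowup p R t γ N hgR) r.2)⟩ -
      sharp p _ ⟨a, le_blowup p R t γ n ha⟩ := by
    rw [dvd_sub_sharp_iff]
    exact ⟨⟨b, hb⟩, Subtype.ext (by simp [hab])⟩
  obtain ⟨v, hv⟩ := h1
  refine ⟨sharp p _ ⟨a, ha⟩, v + ι (sharp p _ ⟨g, le_blowup p R t γ N hgR⟩ * y), ?_⟩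
  rw [incl_sharp, mul_add, ← map_mul, map_add, hι, incl_sharp, mul_add, ← add_assoc, ← hv,
    mul_left_comm, map_mul, map_natCast]
  simp

lemma exists_root_sharp_pow_mul_eq_add {g : K} (hgR : g ∈ R) {l : ℕ} (hg : g ^ p ^ l = γ)
    (n m : ℕ) {N : ℕ} (hN : n + m * p ^ l ≤ N)
    (z : Ring p (blowup p R t γ N) ⟨t, le_blowup p R t γ N ht⟩) :
    ∃ (a : Ring p R ⟨t, ht⟩) (y : Ring p (blowup p R t γ n) ⟨t, le_blowup p R t γ n ht⟩),
      incl p (blowup_anti p ht γ ((Nat.le_add_right _ _).trans hN : n ≤ N)) (le_blowup p R t γ N ht)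
        (sharp p _ ⟨g, le_blowup p R t γ N hgR⟩ ^ m * z) =
      incl p (le_blowup p R t γ n) ht a + p ^ m * y := by
  induction m generalizing N with
  | zero =>
    exact ⟨0, incl p (blowup_anti p ht γ ((Nat.le_add_right _ _).trans hN : n ≤ N))
      (le_blowup p R t γ N ht) z, by simp⟩
  | succ m ih =>
    obtain ⟨a, y, hay⟩ := exists_root_sharp_mul_eq_add p ht hγ hγ0 hgR hg
      (n := n + m * p ^ l) (N := N) (by rw [add_mul, one_mul] at hN; omega) z
    obtain ⟨a', y', hay'⟩ := ih le_rfl y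
    refine ⟨sharp p ⟨t, ht⟩ ⟨g, hgR⟩ ^ m * a + (p : Ring p R ⟨t, ht⟩) * a', y', ?_⟩
    have hle : n + m * p ^ l ≤ N := by rw [add_mul, one_mul] at hN; omega
    exact map_pow_succ_mul_eq p
      (incl_incl p (blowup_anti p ht γ hle) (blowup_anti p ht γ (Nat.le_add_right n (m * p ^ l)))
        (le_blowup p R t γ N ht))
      (incl_incl p (le_blowup p R t γ (n + m * p ^ l))
        (blowup_anti p ht γ (Nat.le_add_right n (m * p ^ l))) ht)
      (incl_sharp p (blowup_anti p ht γ hle) (le_blowup p R t γ N ht)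
        ⟨g, le_blowup p R t γ N hgR⟩)
      (incl_sharp p (le_blowup p R t γ (n + m * p ^ l)) ht ⟨g, hgR⟩) hay hay'

include ht0

lemma p_pow_dvd_root_sharp_pow_mul {g : K} (hgR : g ∈ R) {l : ℕ} (hg : g ^ p ^ l = γ) (m : ℕ)
    (v : Ring p R ⟨t, ht⟩)
    (y : Ring p (blowup p R t γ (p ^ l * p)) ⟨t, le_blowup p R t γ _ ht⟩)
    (h : incl p (le_blowup p R t γ (p ^ l * p)) ht v =
      (p : Ring p (blowup p R t γ (p ^ l * p)) ⟨t, le_blowup p R t γ _ ht⟩) ^ m * y) :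
    (p : Ring p R ⟨t, ht⟩) ^ m ∣ sharp p ⟨t, ht⟩ ⟨g, hgR⟩ ^ m * v := by
  induction m generalizing v y with
  | zero => simp
  | succ m ih =>
    have h1 : (p : Ring p R ⟨t, ht⟩) ∣ sharp p _ ⟨g, hgR⟩ * v := by
      obtain ⟨r, w, rfl⟩ := exists_sharp_add p v
      rw [map_add, map_mul, map_natCast, incl_sharp] at h
      have h2 : (p : Ring p (blowup p R t γ (p ^ l * p)) ⟨t, le_blowup p R t γ _ ht⟩) ∣
          sharp p _ ⟨r, le_blowup p R t γ _ r.2⟩ :=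
        ⟨(p : Ring p (blowup p R t γ (p ^ l * p)) ⟨t, le_blowup p R t γ _ ht⟩) ^ m * y -
          incl p (le_blowup p R t γ _) ht w, by linear_combination h⟩
      rw [dvd_sharp_iff] at h2
      obtain ⟨s, hs⟩ := h2
      have hs' : (r : K) = t * s := congrArg Subtype.val hs
      have hgs := root_mul_mem p ht hγ hγ0 hg s.2 (by rw [← hs']; exact r.2)
      rw [mul_add]
      refine dvd_add ?_ (dvd_mul_of_dvd_right (dvd_mul_right _ _) _)
      rw [← map_mul, dvd_sharp_iff]
      exact ⟨⟨g * s, hgs⟩, Subtype.ext (by simp [hs']; ring)⟩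
    obtain ⟨v', hv'⟩ := h1
    have h3 := ih v' (sharp p ⟨t, le_blowup p R t γ (p ^ l * p) ht⟩
      ⟨g, le_blowup p R t γ _ hgR⟩ * y) (by
      have hne : (⟨t, le_blowup p R t γ (p ^ l * p) ht⟩ : blowup p R t γ (p ^ l * p)) ≠ 0 :=
        fun h => ht0 (congrArg Subtype.val h)
      apply p_mul_cancel p _ hne
      have := congrArg (incl p (le_blowup p R t γ (p ^ l * p)) ht) hv'
      rw [map_mul, map_mul, h, map_natCast, incl_sharp] at this
      rw [← this]; ring)
    rw [pow_succ, pow_succ, mul_assoc, hv', mul_left_comm, mul_comm]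
    exact mul_dvd_mul_left _ h3

/-- A form of Riemann's extension theorem: almost integral elements with respect to a power of
`η = t ^ j * γ` become divisible after multiplication by small powers of `t` and `γ`. -/
theorem sharp_dvd_of_forall_pow_dvd {τ g : K} (hτR : τ ∈ R) (hgR : g ∈ R) {l l' : ℕ}
    (hτ : τ ^ p ^ (l + 1) = t) (hg : g ^ p ^ l' = γ) (j : ℕ)
    (hnzd : ∀ a : R, (⟨t, ht⟩ : R) ∣ ⟨γ, hγ⟩ * a → (⟨t, ht⟩ : R) ∣ a)
    (c : Ring p R ⟨t, ht⟩)
    (hc : ∀ k : ℕ, sharp p (⟨t, ht⟩ : R) (⟨t, ht⟩ ^ j * ⟨γ, hγ⟩) ^ k ∣ c ^ (k + 1)) :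
    sharp p (⟨t, ht⟩ : R) (⟨t, ht⟩ ^ j * ⟨γ, hγ⟩) ∣
      sharp p (⟨t, ht⟩ : R) (⟨τ, hτR⟩ * ⟨g, hgR⟩) * c := by
  have htR0 : (⟨t, ht⟩ : R) ≠ 0 := fun h => ht0 (congrArg Subtype.val h)
  refine sharp_dvd_of_forall_approx p htR0 hnzd fun i => ?_
  obtain ⟨h, hh⟩ := exists_root p g (i + 1)
  have hhR : h ∈ R := RootClosed.mem_of_pow_pow_mem p R (n := i + 1) (by rwa [hh])
  have hhγ : h ^ p ^ (i + 1 + l') = γ := by rw [pow_add, pow_mul, hh, hg]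
  generalize hQ : i + 1 + l' = L at hhγ
  obtain ⟨z, hz⟩ : ∃ z : Ring p (blowup p R t γ (p ^ L * p + i * p ^ L)) ⟨t, le_blowup p R t γ _ ht⟩,
      incl p (le_blowup p R t γ _) ht (sharp p _ ⟨τ, hτR⟩ * c) =
      incl p (le_blowup p R t γ _) ht (sharp p _ ((⟨t, ht⟩ : R) ^ j * ⟨γ, hγ⟩)) * z := by
    have hne : (⟨t, le_blowup p R t γ (p ^ L * p + i * p ^ L) ht⟩ : blowup p R t γ _) ≠ 0 :=
      fun h => ht0 (congrArg Subtype.val h)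
    have := sharp_dvd_of_mul_eq_pow p hne (u := ⟨_, div_mem_blowup p R t γ _⟩)
      (γ := ⟨γ, le_blowup p R t γ _ hγ⟩) (τ := ⟨τ, le_blowup p R t γ _ hτR⟩) (l := l)
      (Subtype.ext hτ) (j := j) (Subtype.ext (div_mul_cancel₀ _ hγ0))
      (c := incl p (le_blowup p R t γ _) ht c) (fun k => by
        have := map_dvd (incl p (le_blowup p R t γ (p ^ L * p + i * p ^ L)) ht) (hc k)
        rw [map_pow, map_pow, incl_sharp] at this
        exact this)
    obtain ⟨z, hz⟩ := this
    exact ⟨z, by rw [map_mul, incl_sharp, incl_sharp]; exact hz⟩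
  obtain ⟨a, y, hay⟩ := exists_root_sharp_pow_mul_eq_add p ht hγ hγ0 hhR hhγ (p ^ L * p) i le_rfl z
  have e1 : incl p (le_blowup p R t γ (p ^ L * p)) ht
      (sharp p ⟨t, ht⟩ ⟨h, hhR⟩ ^ i * (sharp p ⟨t, ht⟩ ⟨τ, hτR⟩ * c)
        - sharp p _ ((⟨t, ht⟩ : R) ^ j * ⟨γ, hγ⟩) * a) =
      (p : Ring p (blowup p R t γ (p ^ L * p)) ⟨t, le_blowup p R t γ _ ht⟩) ^ i *
        (incl p (le_blowup p R t γ (p ^ L * p)) ht (sharp p _ ((⟨t, ht⟩ : R) ^ j * ⟨γ, hγ⟩)) * y) := by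
    exact map_pow_mul_sub_eq p
      (incl_incl p (le_blowup p R t γ (p ^ L * p + i * p ^ L))
        (blowup_anti p ht γ (Nat.le_add_right (p ^ L * p) (i * p ^ L))) ht)
      (incl_sharp p (le_blowup p R t γ (p ^ L * p + i * p ^ L)) ht ⟨h, hhR⟩) hz hay
  obtain ⟨b, hb⟩ := p_pow_dvd_root_sharp_pow_mul p ht ht0 hγ hγ0 hhR hhγ i _ _ e1
  have hle : i + i ≤ p ^ (i + 1) := by
    have h1 : i < p ^ i := Nat.lt_pow_self hp.out.one_lt
    have h2 : 2 * p ^ i ≤ p ^ (i + 1) := by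
      rw [pow_succ']; exact Nat.mul_le_mul_right _ hp.out.two_le
    omega
  obtain ⟨D, hD⟩ := Nat.exists_eq_add_of_le hle
  refine ⟨sharp p ⟨t, ht⟩ ⟨h, hhR⟩ ^ D * (sharp p ⟨t, ht⟩ ⟨h, hhR⟩ ^ i * a),
    sharp p ⟨t, ht⟩ ⟨h, hhR⟩ ^ D * b, ?_⟩
  have e2 : (⟨g, hgR⟩ : R) = (⟨h, hhR⟩ : R) ^ D * (⟨h, hhR⟩ ^ i * ⟨h, hhR⟩ ^ i) := by
    rw [← pow_add, ← pow_add, add_comm D, ← hD]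
    exact Subtype.ext hh.symm
  rw [e2, map_mul, map_mul, map_mul, map_pow, map_pow]
  exact mul_mul_eq_of_approx p D hb

end

end Untilting

section

/-! ## Flatness through relations -/

/-- Relations over `κ` between elements of `S ⧸ I` are trivial, i.e. `S ⧸ I` is `κ`-flat. -/
def RelFlat {κ S : Type} [CommRing κ] [CommRing S] (c : κ →+* S) (I : Ideal S) : Prop :=
  ∀ (n : ℕ) (a : Fin n → κ) (h : Fin n → S), ∑ i, c (a i) * h i ∈ I →
    ∃ (J : Type) (_ : Fintype J) (b : Fin n → J → κ) (g : J → S),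
      (∀ i, h i - ∑ j, c (b i j) * g j ∈ I) ∧ ∀ j, ∑ i, a i * b i j = 0

/-- Proper ideals of `κ` generate proper ideals of `S ⧸ I`. -/
def RelProper {κ S : Type} [CommRing κ] [CommRing S] (c : κ →+* S) (I : Ideal S) : Prop :=
  ∀ (n : ℕ) (a : Fin n → κ) (h : Fin n → S), 1 - ∑ i, c (a i) * h i ∈ I →
    Ideal.span (Set.range a) = ⊤

namespace RelFlat

variable {κ S : Type} [CommRing κ] [CommRing S] {c : κ →+* S}

lemma top : RelFlat c (⊤ : Ideal S) := fun _ _ _ _ =>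
  ⟨Empty, inferInstance, fun _ => Empty.elim, Empty.elim, fun _ => Submodule.mem_top, fun j => j.elim⟩

lemma of_exact {I J : Ideal S} {s : S} (hJ : RelFlat c J) (hs : RelFlat c (I ⊔ Ideal.span {s}))
    (h1 : ∀ z, s * z ∈ I → z ∈ J) (h2 : ∀ z ∈ J, s * z ∈ I) : RelFlat c I := by
  intro n a h hrel
  obtain ⟨J1, _, b1, g1, hb1, ha1⟩ := hs n a h (le_sup_left (a := I) hrel)
  have hex : ∀ i, ∃ k : S, h i - ∑ j, c (b1 i j) * g1 j - s * k ∈ I := by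
    intro i
    obtain ⟨x, hx, y, hy, hxy⟩ := Submodule.mem_sup.1 (hb1 i)
    obtain ⟨k, rfl⟩ := Ideal.mem_span_singleton'.1 hy
    exact ⟨k, by rw [← hxy]; convert hx using 1; ring⟩
  choose k hk using hex
  have hrelk : ∑ i, c (a i) * k i ∈ J := by
    apply h1
    have hz : ∑ i, c (a i) * ∑ j, c (b1 i j) * g1 j = 0 := by
      simp_rw [mul_sum]
      rw [Finset.sum_comm]
      refine Finset.sum_eq_zero fun j _ => ?_
      simp_rw [← mul_assoc, ← map_mul]
      rw [← Finset.sum_mul, ← map_sum, ha1, map_zero, zero_mul]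
    have h3 : ∑ i, c (a i) * (h i - ∑ j, c (b1 i j) * g1 j - s * k i) ∈ I :=
      Ideal.sum_mem _ fun i _ => Ideal.mul_mem_left _ _ (hk i)
    have h4 : s * ∑ i, c (a i) * k i =
        ∑ i, c (a i) * h i - ∑ i, c (a i) * (h i - ∑ j, c (b1 i j) * g1 j - s * k i) := by
      have : ∑ i, c (a i) * (h i - ∑ j, c (b1 i j) * g1 j - s * k i) =
          ∑ i, c (a i) * h i - ∑ i, c (a i) * (∑ j, c (b1 i j) * g1 j)
            - s * ∑ i, c (a i) * k i := by
        rw [mul_sum, ← Finset.sum_sub_distrib, ← Finset.sum_sub_distrib]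
        exact sum_congr rfl fun i _ => by ring
      rw [this, hz]; ring
    rw [h4]
    exact I.sub_mem hrel h3
  obtain ⟨J2, _, b2, g2, hb2, ha2⟩ := hJ n a k hrelk
  refine ⟨J1 ⊕ J2, inferInstance, fun i => Sum.elim (b1 i) (b2 i),
    Sum.elim g1 fun j => s * g2 j, fun i => ?_, ?_⟩
  · rw [Fintype.sum_sum_type]
    simp only [Sum.elim_inl, Sum.elim_inr]
    have h5 := I.add_mem (hk i) (h2 _ (hb2 i))
    convert h5 using 1
    rw [mul_sub, mul_sum]
    have : ∑ j, c (b2 i j) * (s * g2 j) = ∑ j, s * (c (b2 i j) * g2 j) :=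
      sum_congr rfl fun j _ => by ring
    rw [this]; ring
  · rintro (j | j)
    · exact ha1 j
    · exact ha2 j

/-- `e` is a nonzerodivisor modulo `t`. -/
def _root_.NzdMod (t e : S) : Prop := ∀ z, t ∣ e * z → t ∣ z

lemma _root_.NzdMod.pow_left {t e : S} (h : NzdMod t e) (ht : ∀ z, t * z = 0 → z = 0) (a : ℕ) :
    NzdMod (t ^ a) e := by
  induction a with
  | zero => intro z _; simp
  | succ a ih =>
    intro z hz
    obtain ⟨y, rfl⟩ := h z ((dvd_pow_self t (by omega)).trans hz)
    rw [pow_succ']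
    apply mul_dvd_mul_left
    apply ih
    obtain ⟨w, hw⟩ := hz
    refine ⟨w, ?_⟩
    rw [← sub_eq_zero]
    apply ht
    linear_combination hw

lemma _root_.NzdMod.pow_right {t e : S} (h : NzdMod t e) (b : ℕ) : NzdMod t (e ^ b) := by
  induction b with
  | zero => intro z hz; simpa using hz
  | succ b ih => intro z hz; exact ih z (h _ (by rwa [← mul_assoc, ← pow_succ']))

lemma mem_span_pair' {t e z : S} : z ∈ Ideal.span {t, e} ↔ ∃ α β, z = t * α + e * β := by
  rw [Ideal.mem_span_pair]
  exact ⟨fun ⟨a, b, h⟩ => ⟨a, b, by rw [← h]; ring⟩, fun ⟨a, b, h⟩ => ⟨a, b, by rw [h]; ring⟩⟩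

lemma span_pair_pow {t e : S} (hF : RelFlat c (Ideal.span {t, e})) (h : NzdMod t e)
    (ht : ∀ z, t * z = 0 → z = 0) (a b : ℕ) : RelFlat c (Ideal.span {t ^ a, e ^ b}) := by
  have h1 : RelFlat c (Ideal.span {t, e ^ b}) := by
    induction b with
    | zero =>
      convert RelFlat.top (c := c)
      rw [Ideal.eq_top_iff_one]
      exact Ideal.subset_span (by simp)
    | succ b ih =>
      refine of_exact (s := e ^ b) hF ?_ ?_ ?_
      · convert ih using 1
        rw [← Ideal.span_union]
        apply le_antisymm
        · rw [Ideal.span_le]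
          rintro x ((rfl | rfl) | rfl)
          · exact Ideal.subset_span (by simp)
          · rw [pow_succ]
            exact Ideal.mul_mem_right _ _ (Ideal.subset_span (by simp))
          · exact Ideal.subset_span (by simp)
        · apply Ideal.span_mono
          rintro x (rfl | rfl) <;> simp
      · intro z hz
        obtain ⟨α, β, hz⟩ := mem_span_pair'.1 hz
        obtain ⟨w, hw⟩ := h.pow_right b (z - e * β) ⟨α, by linear_combination hz⟩
        exact mem_span_pair'.2 ⟨w, β, by linear_combination hw⟩
      · intro z hz
        obtain ⟨α, β, rfl⟩ := mem_span_pair'.1 hz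
        exact mem_span_pair'.2 ⟨e ^ b * α, β, by ring⟩
  induction a with
  | zero =>
    convert RelFlat.top (c := c)
    rw [Ideal.eq_top_iff_one]
    exact Ideal.subset_span (by simp)
  | succ a ih =>
    refine of_exact (s := t ^ a) h1 ?_ ?_ ?_
    · convert ih using 1
      rw [← Ideal.span_union]
      apply le_antisymm
      · rw [Ideal.span_le]
        rintro x ((rfl | rfl) | rfl)
        · rw [pow_succ]
          exact Ideal.mul_mem_right _ _ (Ideal.subset_span (by simp))
        · exact Ideal.subset_span (by simp)
        · exact Ideal.subset_span (by simp)
      · apply Ideal.span_mono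
        rintro x (rfl | rfl) <;> simp
    · intro z hz
      obtain ⟨α, β, hz⟩ := mem_span_pair'.1 hz
      obtain ⟨w, rfl⟩ := (h.pow_right b).pow_left ht a β ⟨z - t * α, by linear_combination -hz⟩
      refine mem_span_pair'.2 ⟨α, w, ?_⟩
      rw [← sub_eq_zero]
      have hta : ∀ (a : ℕ) (z : S), t ^ a * z = 0 → z = 0 := by
        intro a
        induction a with
        | zero => intro z hz; simpa using hz
        | succ a ih => intro z hz; exact ih z (ht _ (by rwa [← mul_assoc, ← pow_succ']))
      apply hta a
      linear_combination hz
    · intro z hz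
      obtain ⟨α, β, rfl⟩ := mem_span_pair'.1 hz
      exact mem_span_pair'.2 ⟨α, t ^ a * β, by ring⟩

end RelFlat

section PerfectHull

variable (p : ℕ) [hp : Fact p.Prime] {κ S H : Type} [CommRing κ] [CharP κ p] [PerfectRing κ p]
  [CommRing S] [CommRing H] [CharP H p] [PerfectRing H p] {c : κ →+* S} {f : S →+* H}
  (hf : Function.Injective f) (hpow : ∀ z : H, ∃ j, z ^ p ^ j ∈ f.range)

include hpow in
lemma exists_uniform_pow {n : ℕ} (z : Fin n → H) :
    ∃ j₀, ∀ j ≥ j₀, ∃ w : Fin n → S, ∀ i, f (w i) = z i ^ p ^ j := by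
  choose e he using hpow
  refine ⟨∑ i, e (z i), fun j hj => ?_⟩
  have : ∀ i, ∃ w, f w = z i ^ p ^ j := by
    intro i
    obtain ⟨w, hw⟩ := he (z i)
    have hle : e (z i) ≤ j :=
      (Finset.single_le_sum (f := fun i => e (z i)) (fun _ _ => Nat.zero_le _)
        (mem_univ i)).trans hj
    obtain ⟨k, rfl⟩ := Nat.exists_eq_add_of_le hle
    exact ⟨w ^ p ^ k, by rw [map_pow, hw, ← pow_mul, ← pow_add]⟩
  choose w hw using this
  exact ⟨w, hw⟩

include hf hpow

lemma RelFlat.of_pow {t e : S} (h : ∀ j, RelFlat c (Ideal.span {t ^ p ^ j, e ^ p ^ j})) :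
    RelFlat (f.comp c) (Ideal.span {f t, f e}) := by
  intro n a k hrel
  obtain ⟨α, β, hαβ⟩ := RelFlat.mem_span_pair'.1 hrel
  obtain ⟨j1, hj1⟩ := exists_uniform_pow p hpow k
  obtain ⟨j2, hj2⟩ := exists_uniform_pow p hpow ![α, β]
  obtain ⟨k', hk'⟩ := hj1 (j1 + j2) (by omega)
  obtain ⟨w, hw⟩ := hj2 (j1 + j2) (by omega)
  set j := j1 + j2
  have hw0 : f (w 0) = α ^ p ^ j := hw 0
  have hw1 : f (w 1) = β ^ p ^ j := hw 1
  obtain ⟨J, _, b, g, hb, hab⟩ := h j n (fun i => a i ^ p ^ j) k' (by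
    refine RelFlat.mem_span_pair'.2 ⟨w 0, w 1, hf ?_⟩
    rw [map_sum, map_add, map_mul, map_mul, hw0, hw1, map_pow, map_pow, ← mul_pow, ← mul_pow,
      ← add_pow_char_pow, ← hαβ, sum_pow_char_pow]
    exact sum_congr rfl fun i _ => by
      rw [map_mul, hk', map_pow, map_pow, mul_pow, RingHom.comp_apply])
  choose b' hb' using fun i j' => Untilting.exists_root p (b i j') j
  choose g' hg' using fun j' => Untilting.exists_root p (f (g j')) j
  refine ⟨J, inferInstance, b', g', fun i => ?_, fun j' => ?_⟩
  · obtain ⟨γ, δ, hγδ⟩ := RelFlat.mem_span_pair'.1 (hb i)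
    obtain ⟨γ', hγ'⟩ := Untilting.exists_root p (f γ) j
    obtain ⟨δ', hδ'⟩ := Untilting.exists_root p (f δ) j
    refine RelFlat.mem_span_pair'.2 ⟨γ', δ', ?_⟩
    apply Untilting.pow_inj p (l := j)
    have := congrArg f hγδ
    rw [map_sub, hk', map_add, map_mul, map_mul, ← hγ', ← hδ', map_sum, map_pow, map_pow] at this
    rw [sub_pow_char_pow, add_pow_char_pow, mul_pow, mul_pow, ← this, sum_pow_char_pow]
    congr 1
    exact sum_congr rfl fun j' _ => by
      rw [map_mul, mul_pow, hg', ← map_pow, hb', RingHom.comp_apply]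
  · apply Untilting.pow_inj p (l := j)
    rw [sum_pow_char_pow, zero_pow (pow_pos hp.out.pos _).ne', ← hab j']
    exact sum_congr rfl fun i _ => by rw [mul_pow, hb']

lemma RelProper.of_pow {t e : S} (h : RelProper c (Ideal.span {t, e})) :
    RelProper (f.comp c) (Ideal.span {f t, f e}) := by
  intro n a k hrel
  obtain ⟨α, β, hαβ⟩ := RelFlat.mem_span_pair'.1 hrel
  obtain ⟨j1, hj1⟩ := exists_uniform_pow p hpow k
  obtain ⟨j2, hj2⟩ := exists_uniform_pow p hpow ![α, β]
  obtain ⟨k', hk'⟩ := hj1 (j1 + j2) (by omega)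
  obtain ⟨w, hw⟩ := hj2 (j1 + j2) (by omega)
  set j := j1 + j2
  have hw0 : f (w 0) = α ^ p ^ j := hw 0
  have hw1 : f (w 1) = β ^ p ^ j := hw 1
  have hq : p ^ j ≠ 0 := (pow_pos hp.out.pos _).ne'
  have := h n (fun i => a i ^ p ^ j) k' (by
    refine RelFlat.mem_span_pair'.2 ⟨t ^ (p ^ j - 1) * w 0, e ^ (p ^ j - 1) * w 1, hf ?_⟩
    rw [← mul_assoc, ← mul_assoc, ← pow_succ', ← pow_succ', Nat.sub_add_cancel (Nat.pos_of_ne_zero hq)]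
    rw [map_sub, map_one, map_sum, map_add, map_mul, map_mul, hw0, hw1, map_pow, map_pow, ← mul_pow,
      ← mul_pow, ← add_pow_char_pow, ← hαβ, sub_pow_char_pow, one_pow, sum_pow_char_pow]
    congr 1
    exact sum_congr rfl fun i _ => by
      rw [map_mul, hk', map_pow, map_pow, mul_pow, RingHom.comp_apply])
  rw [eq_top_iff, ← this, Ideal.span_le]
  rintro _ ⟨i, rfl⟩
  exact Ideal.pow_mem_of_mem _ (Ideal.subset_span (Set.mem_range_self i)) _ (Nat.pos_of_ne_zero hq)

lemma NzdMod.of_pow {t e : S} (h : ∀ j, NzdMod (t ^ p ^ j) (e ^ p ^ j)) : NzdMod (f t) (f e) := by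
  rintro z ⟨y, hy⟩
  obtain ⟨j, hj⟩ := exists_uniform_pow p hpow ![z, y]
  obtain ⟨w, hw⟩ := hj j le_rfl
  have hw0 : f (w 0) = z ^ p ^ j := hw 0
  have hw1 : f (w 1) = y ^ p ^ j := hw 1
  have hdvd : t ^ p ^ j ∣ e ^ p ^ j * w 0 := ⟨w 1, hf (by
    rw [map_mul, map_mul, hw0, hw1, map_pow, map_pow, ← mul_pow, ← mul_pow, hy])⟩
  obtain ⟨v, hv⟩ := h j (w 0) hdvd
  apply Untilting.dvd_of_pow_dvd p (l := j)
  exact ⟨f v, by rw [← hw0, hv, map_mul, map_pow]⟩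

end PerfectHull

section Monic

open Polynomial

variable {κ H S : Type} [CommRing κ] [CommRing H] [CommRing S] {c : κ →+* H} {f : H →+* S} {u t : S}
  {I : Ideal H} (hgen : ∀ s : S, ∃ G : H[X], G.eval₂ f u = s)
  (hI : ∀ G : H[X], t ∣ G.eval₂ f u ↔ ∀ k, G.coeff k ∈ I) {F : H[X]} (hF : F.Monic)

include hI hF

lemma NzdMod.eval₂_monic (hgen : ∀ s : S, ∃ G : H[X], G.eval₂ f u = s) :
    NzdMod t (F.eval₂ f u) := by
  intro z hz
  obtain ⟨G, rfl⟩ := hgen z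
  rw [← eval₂_mul, hI] at hz
  rw [hI]
  have h0 : (F * G).map (Ideal.Quotient.mk I) = 0 := by
    ext k
    rw [coeff_map, coeff_zero, Ideal.Quotient.eq_zero_iff_mem]
    exact hz k
  rw [Polynomial.map_mul, (hF.map _).mul_right_eq_zero_iff] at h0
  intro k
  rw [← Ideal.Quotient.eq_zero_iff_mem, ← coeff_map, h0, coeff_zero]

lemma coeff_modByMonic_mem {G : H[X]} (hgen : ∀ s : S, ∃ G : H[X], G.eval₂ f u = s)
    (h : G.eval₂ f u ∈ Ideal.span {t, F.eval₂ f u}) (k : ℕ) : (G %ₘ F).coeff k ∈ I := by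
  obtain ⟨α, β, hαβ⟩ := RelFlat.mem_span_pair'.1 h
  obtain ⟨B, rfl⟩ := hgen β
  have h1 : t ∣ (G - F * B).eval₂ f u := ⟨α, by rw [eval₂_sub, eval₂_mul, hαβ]; ring⟩
  rw [hI] at h1
  have h2 : (G - F * B).map (Ideal.Quotient.mk I) = 0 := by
    ext k
    rw [coeff_map, coeff_zero, Ideal.Quotient.eq_zero_iff_mem]
    exact h1 k
  rw [Polynomial.map_sub, sub_eq_zero, Polynomial.map_mul] at h2
  rw [← Ideal.Quotient.eq_zero_iff_mem, ← coeff_map, map_modByMonic _ hF, h2,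
    (modByMonic_eq_zero_iff_dvd (hF.map _)).2 (dvd_mul_right _ _), coeff_zero]

include hgen

lemma RelFlat.eval₂_monic (hD : 0 < F.natDegree) (h : RelFlat c I) :
    RelFlat (f.comp c) (Ideal.span {t, F.eval₂ f u}) := by
  intro n a g hrel
  choose G hG using fun i => hgen (g i)
  have h1 : ∀ k, ∑ i, c (a i) * (G i %ₘ F).coeff k ∈ I := by
    intro k
    have h2 : (∑ i, C (c (a i)) * G i).eval₂ f u ∈ Ideal.span {t, F.eval₂ f u} := by
      rw [eval₂_finsetSum]
      simpa [hG] using hrel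
    have h3 := coeff_modByMonic_mem hI hF hgen h2 k
    have h4 : (∑ i, C (c (a i)) * G i) %ₘ F = ∑ i, C (c (a i)) * (G i %ₘ F) := by
      have := map_sum (modByMonicHom F) (fun i => C (c (a i)) * G i) univ
      simp only [modByMonicHom_apply] at this
      rw [this]
      refine sum_congr rfl fun i _ => ?_
      rw [← smul_eq_C_mul, ← smul_eq_C_mul, smul_modByMonic]
    rw [h4, finsetSum_coeff] at h3
    simpa using h3
  choose J hJ b e hb hab using fun k : Fin (F.natDegree) => h n a (fun i => (G i %ₘ F).coeff k) (h1 k)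
  refine ⟨Σ k, J k, inferInstance, fun i x => b x.1 i x.2, fun x => f (e x.1 x.2) * u ^ (x.1 : ℕ),
    fun i => ?_, fun x => hab x.1 x.2⟩
  rw [← hG i, Fintype.sum_sigma]
  have h5 : (G i).eval₂ f u = (∑ k : Fin F.natDegree, f ((G i %ₘ F).coeff k) * u ^ (k : ℕ)) +
      F.eval₂ f u * (G i /ₘ F).eval₂ f u := by
    conv_lhs => rw [← modByMonic_add_div (G i) F, eval₂_add, eval₂_mul]
    congr 1
    rw [Fin.sum_univ_eq_sum_range (fun k => f ((G i %ₘ F).coeff k) * u ^ k),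
      eval₂_eq_sum_range' f (natDegree_modByMonic_lt _ hF fun h1 => by simp [h1] at hD) u]
  have hIt : ∀ x ∈ I, t ∣ f x := fun x hx => by
    have := (hI (C x)).2 (fun k => by
      rw [coeff_C]; split_ifs
      · exact hx
      · exact I.zero_mem)
    rwa [eval₂_C] at this
  have h6 : (G i).eval₂ f u - ∑ k, ∑ j, (f.comp c) (b k i j) * (f (e k j) * u ^ (k : ℕ)) =
      (∑ k : Fin F.natDegree, f ((G i %ₘ F).coeff k - ∑ j, c (b k i j) * e k j) * u ^ (k : ℕ)) +
      F.eval₂ f u * (G i /ₘ F).eval₂ f u := by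
    rw [h5, add_sub_right_comm, ← Finset.sum_sub_distrib]
    congr 1
    refine sum_congr rfl fun k _ => ?_
    rw [map_sub, sub_mul, map_sum, Finset.sum_mul]
    congr 1
    exact sum_congr rfl fun j _ => by rw [map_mul, RingHom.comp_apply, mul_assoc]
  refine Eq.mpr (congrArg (· ∈ _) h6) (Ideal.add_mem _ (Ideal.sum_mem _ fun k _ => ?_) ?_)
  · obtain ⟨w, hw⟩ := hIt _ (hb k i)
    rw [hw, mul_assoc]
    exact Ideal.mul_mem_right _ _ (Ideal.subset_span (by simp))
  · exact Ideal.mul_mem_right _ _ (Ideal.subset_span (by simp))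

lemma RelProper.eval₂_monic (hD : 0 < F.natDegree) (h : RelProper c I) :
    RelProper (f.comp c) (Ideal.span {t, F.eval₂ f u}) := by
  intro n a g hrel
  have : Nontrivial H := by
    by_contra hn
    rw [not_nontrivial_iff_subsingleton] at hn
    simp [Subsingleton.elim F 0] at hD
  choose G hG using fun i => hgen (g i)
  have h2 : (1 - ∑ i, C (c (a i)) * G i).eval₂ f u ∈ Ideal.span {t, F.eval₂ f u} := by
    rw [eval₂_sub, eval₂_finsetSum]
    simpa [hG] using hrel
  have h3 := coeff_modByMonic_mem hI hF hgen h2 0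
  have h4 : (1 - ∑ i, C (c (a i)) * G i) %ₘ F = 1 - ∑ i, C (c (a i)) * (G i %ₘ F) := by
    have := map_sum (modByMonicHom F) (fun i => C (c (a i)) * G i) univ
    simp only [modByMonicHom_apply] at this
    rw [sub_modByMonic, this]
    congr 1
    · rw [modByMonic_eq_self_iff hF, degree_one, ← natDegree_pos_iff_degree_pos]
      exact hD
    · refine sum_congr rfl fun i _ => ?_
      rw [← smul_eq_C_mul, ← smul_eq_C_mul, smul_modByMonic]
  rw [h4, coeff_sub, finsetSum_coeff, coeff_one_zero] at h3
  exact h n a (fun i => (G i %ₘ F).coeff 0) (by simpa using h3)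

end Monic

end

section

/-! ## Adjoining roots of monic polynomials to untilts -/

open Polynomial

section Coeff

variable {K : Type} [Field K] {H : Subring K} {u : K}

lemma coe_eval₂_inclusion (G : H[X]) :
    ((G.eval₂ (Subring.inclusion le_adjoinElem) (⟨u, self_mem_adjoinElem⟩ : adjoinElem H u) :
      adjoinElem H u) : K) = G.eval₂ H.subtype u := by
  have := hom_eval₂ G (Subring.inclusion le_adjoinElem) (adjoinElem H u).subtype
    (⟨u, self_mem_adjoinElem⟩ : adjoinElem H u)
  exact this

lemma exists_eval₂_inclusion (s : adjoinElem H u) :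
    ∃ G : H[X], G.eval₂ (Subring.inclusion le_adjoinElem) ⟨u, self_mem_adjoinElem⟩ = s := by
  have hs : (s : K) ∈ Algebra.adjoin H {u} := s.2
  rw [Algebra.adjoin_singleton_eq_range_aeval] at hs
  obtain ⟨G, hG⟩ := hs
  exact ⟨G, Subtype.ext ((coe_eval₂_inclusion G).trans hG)⟩

lemma coeff_mem_span_pair_of_eval₂_eq_zero {t e : H} (h : NzdMod t e)
    (hu : (t : K) * u = e) (N : ℕ) (Φ : H[X]) (hN : Φ.natDegree ≤ N)
    (h0 : Φ.eval₂ H.subtype u = 0) (k : ℕ) : Φ.coeff k ∈ Ideal.span {t, e} := by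
  induction N generalizing Φ k with
  | zero =>
    rw [eq_C_of_natDegree_le_zero hN, eval₂_C] at h0
    have : Φ.coeff 0 = 0 := Subtype.ext h0
    rw [eq_C_of_natDegree_le_zero hN, this]
    simp
  | succ N ih =>
    have hsum := h0
    rw [eval₂_eq_sum_range' H.subtype (Nat.lt_succ_of_le hN), sum_range_succ] at hsum
    obtain ⟨ψ, hψ⟩ : t ∣ Φ.coeff (N + 1) := by
      apply h.pow_right (N + 1)
      refine ⟨-∑ k ∈ range (N + 1), Φ.coeff k * e ^ k * t ^ (N - k), Subtype.ext ?_⟩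
      push_cast
      rw [mul_neg, mul_sum, eq_neg_iff_add_eq_zero]
      have h1 : ∀ k ∈ range (N + 1), (t : K) * (Φ.coeff k * e ^ k * t ^ (N - k)) =
          t ^ (N + 1) * (Φ.coeff k * u ^ k) := by
        intro k hk
        have : N + 1 = 1 + k + (N - k) := by have := mem_range.1 hk; omega
        rw [this, ← hu, pow_add, pow_add]
        ring
      rw [sum_congr rfl h1, ← mul_sum, ← hu]
      simp only [Subring.subtype_apply] at hsum
      linear_combination (t : K) ^ (N + 1) * hsum
    have hlead : H.subtype (Φ.coeff (N + 1)) * u ^ (N + 1) = ψ * e * u ^ N := by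
      rw [hψ, ← hu]; simp; ring
    have key := ih (Φ - C (Φ.coeff (N + 1)) * X ^ (N + 1) + C (ψ * e) * X ^ N) (by
      rw [natDegree_le_iff_coeff_eq_zero]
      intro m hm
      rw [coeff_add, coeff_sub, coeff_C_mul_X_pow, coeff_C_mul_X_pow, if_neg (by omega : ¬ m = N)]
      rcases eq_or_lt_of_le (Nat.succ_le_of_lt hm) with h1 | h1
      · simp [← h1]
      · rw [if_neg (by omega), coeff_eq_zero_of_natDegree_lt (by omega)]; simp) (by
      rw [eval₂_add, eval₂_sub, eval₂_mul, eval₂_mul, eval₂_C, eval₂_C, eval₂_X_pow, eval₂_X_pow, h0,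
        hlead]
      simp)
    by_cases hk : k = N + 1
    · rw [hk, hψ]
      exact Ideal.mul_mem_right _ _ (Ideal.subset_span (by simp))
    · have := key k
      rw [coeff_add, coeff_sub, coeff_C_mul_X_pow, coeff_C_mul_X_pow, if_neg hk, sub_zero] at this
      refine (Ideal.add_mem_iff_left _ ?_).1 this
      split_ifs
      · exact Ideal.mul_mem_left _ _ (Ideal.subset_span (by simp))
      · exact Ideal.zero_mem _

lemma dvd_eval₂_iff_of_mul_eq {t e : H} (h : NzdMod t e) (hu : (t : K) * u = e)
    (G : H[X]) : Subring.inclusion le_adjoinElem t ∣ G.eval₂ (Subring.inclusion le_adjoinElem)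
      (⟨u, self_mem_adjoinElem⟩ : adjoinElem H u) ↔ ∀ k, G.coeff k ∈ Ideal.span {t, e} := by
  constructor
  · rintro ⟨s, hs⟩ k
    obtain ⟨G1, rfl⟩ := exists_eval₂_inclusion s
    have h0 : (G - C t * G1).eval₂ H.subtype u = 0 := by
      rw [← coe_eval₂_inclusion, eval₂_sub, hs, eval₂_mul, eval₂_C, sub_self]; rfl
    have := coeff_mem_span_pair_of_eval₂_eq_zero h hu _ _ le_rfl h0 k
    rw [coeff_sub, coeff_C_mul] at this
    rw [← sub_add_cancel (G.coeff k) (t * G1.coeff k)]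
    exact Ideal.add_mem _ this (Ideal.mul_mem_right _ _ (Ideal.subset_span (by simp)))
  · intro hG
    rw [eval₂_eq_sum_range]
    refine Finset.dvd_sum fun k _ => dvd_mul_of_dvd_left ?_ _
    obtain ⟨α, β, hαβ⟩ := RelFlat.mem_span_pair'.1 (hG k)
    have he : Subring.inclusion le_adjoinElem e =
        Subring.inclusion le_adjoinElem t * (⟨u, self_mem_adjoinElem⟩ : adjoinElem H u) :=
      Subtype.ext hu.symm
    rw [hαβ, map_add, map_mul, map_mul, he]
    exact dvd_add (dvd_mul_right _ _) ((dvd_mul_right _ _).mul_right _)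

lemma dvd_eval₂_iff_of_transcendental (htr : ∀ G : H[X], G.eval₂ H.subtype u = 0 → G = 0) {t : H}
    (G : H[X]) : Subring.inclusion le_adjoinElem t ∣ G.eval₂ (Subring.inclusion le_adjoinElem)
      (⟨u, self_mem_adjoinElem⟩ : adjoinElem H u) ↔ ∀ k, G.coeff k ∈ Ideal.span {t} := by
  constructor
  · rintro ⟨s, hs⟩ k
    obtain ⟨G1, rfl⟩ := exists_eval₂_inclusion s
    have h0 : (G - C t * G1).eval₂ H.subtype u = 0 := by
      rw [← coe_eval₂_inclusion, eval₂_sub, hs, eval₂_mul, eval₂_C, sub_self]; rfl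
    rw [sub_eq_zero.1 (htr _ h0), coeff_C_mul]
    exact Ideal.mul_mem_right _ _ (Ideal.mem_span_singleton_self t)
  · intro hG
    rw [eval₂_eq_sum_range]
    refine Finset.dvd_sum fun k _ => dvd_mul_of_dvd_left ?_ _
    exact map_dvd _ (Ideal.mem_span_singleton.1 (hG k))

end Coeff

section Step

variable (p : ℕ) [hp : Fact p.Prime] {K : Type} [Field K] [CharP K p] [PerfectRing K p]
  {κ : Type} [CommRing κ] [CharP κ p] [PerfectRing κ p] {H : Subring K} {c : κ →+* H} {u : K}

/-- The inclusion of `H` in the perfect hull of `H[u]`. -/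
def toHull (H : Subring K) (u : K) : H →+* perfectHull p (adjoinElem H u) :=
  (Subring.inclusion (le_perfectHull p _)).comp (Subring.inclusion le_adjoinElem)

/-- `e` is a nonzerodivisor mod `t` and the quotient by `(t, e)` is faithfully flat over `κ`. -/
structure GoodPair {S : Type} [CommRing S] (c : κ →+* S) (t e : S) : Prop where
  nzd : NzdMod t e
  flat : RelFlat c (Ideal.span {t, e})
  proper : RelProper c (Ideal.span {t, e})

lemma GoodPair.of_monic {H S H' : Type} [CommRing H] [CommRing S] [CommRing H'] [CharP H' p]
    [PerfectRing H' p] {c : κ →+* H} {f : H →+* S} {g : S →+* H'} (hg : Function.Injective g)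
    (hpow : ∀ z : H', ∃ j, z ^ p ^ j ∈ g.range) {u : S} {t : H} (ht : ∀ z, f t * z = 0 → z = 0)
    {I : Ideal H} (hgen : ∀ s : S, ∃ G : H[X], G.eval₂ f u = s)
    (hI : ∀ G : H[X], f t ∣ G.eval₂ f u ↔ ∀ k, G.coeff k ∈ I)
    (hflat : RelFlat c I) (hprop : RelProper c I) {F : H[X]} (hF : F.Monic)
    (hD : 0 < F.natDegree) :
    GoodPair ((g.comp f).comp c) (g (f t)) (g (F.eval₂ f u)) := by
  have h1 : NzdMod (f t) (F.eval₂ f u) := NzdMod.eval₂_monic hI hF hgen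
  have h2 := RelFlat.eval₂_monic hgen hI hF hD hflat
  have h3 := RelProper.eval₂_monic hgen hI hF hD hprop
  exact ⟨NzdMod.of_pow p hg hpow fun j => (h1.pow_right _).pow_left ht _,
    RelFlat.of_pow p hg hpow fun j => h2.span_pair_pow h1 ht _ _,
    RelProper.of_pow p hg hpow h3⟩

lemma exists_pow_mem_range (S : Subring K) (z : perfectHull p S) :
    ∃ j, z ^ p ^ j ∈ (Subring.inclusion (le_perfectHull p S)).range := by
  obtain ⟨z, j, hj⟩ := z
  exact ⟨j, ⟨⟨_, hj⟩, Subtype.ext rfl⟩⟩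

lemma GoodPair.hull {t : H} (ht : t ≠ 0) {I : Ideal H}
    (hI : ∀ G : H[X], Subring.inclusion le_adjoinElem t ∣ G.eval₂ (Subring.inclusion le_adjoinElem)
      (⟨u, self_mem_adjoinElem⟩ : adjoinElem H u) ↔ ∀ k, G.coeff k ∈ I)
    (hflat : RelFlat c I) (hprop : RelProper c I) {F : H[X]} (hF : F.Monic) (hD : 0 < F.natDegree)
    {e' : perfectHull p (adjoinElem H u)} (he' : (e' : K) = F.eval₂ H.subtype u) :
    GoodPair ((toHull p H u).comp c) (toHull p H u t) e' := by
  have hee : e' = Subring.inclusion (le_perfectHull p (adjoinElem H u))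
      (F.eval₂ (Subring.inclusion le_adjoinElem) ⟨u, self_mem_adjoinElem⟩) :=
    Subtype.ext (he'.trans (coe_eval₂_inclusion F).symm)
  rw [hee]
  refine GoodPair.of_monic p (Subring.inclusion_injective _) (exists_pow_mem_range p _)
    (fun z hz => (mul_eq_zero.1 hz).resolve_left fun h => ht ?_) exists_eval₂_inclusion hI hflat hprop
    hF hD
  exact Subring.inclusion_injective _ (h.trans (map_zero _).symm)

lemma GoodPair.adjoin_div {t e : H} (ht : t ≠ 0) (h : GoodPair c t e) (hu : (t : K) * u = e) (b : H)
    {e' : perfectHull p (adjoinElem H u)} (he' : (e' : K) = b + u) :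
    GoodPair ((toHull p H u).comp c) (toHull p H u t) e' :=
  GoodPair.hull p ht (dvd_eval₂_iff_of_mul_eq h.nzd hu) h.flat h.proper (monic_X_add_C b)
    (by rw [natDegree_X_add_C]; exact one_pos) (by rw [he', eval₂_add, eval₂_X, eval₂_C, add_comm]; rfl)

end Step

end

section

open Polynomial

namespace Untilting

section Stages

variable (p : ℕ) [hp : Fact p.Prime] {K : Type} [Field K] [CharP K p] [PerfectRing K p]
  {κ : Type} [CommRing κ] [CharP κ p] [PerfectRing κ p] {t : K} (ht0 : t ≠ 0) (c : κ →+* K)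

variable (t) in
/-- A perfect subring with a Witt vector that is to be made divisible by `p - [t]`. -/
structure Stage where
  H : Subring K
  root : RootClosed p H
  mem_t : t ∈ H
  mem_c : ∀ a, c a ∈ H
  Y : WittVector p H
  good : GoodPair (c.codRestrict H mem_c) ⟨t, mem_t⟩ (Y.coeff 0)

attribute [instance] Stage.root

variable {c}

lemma Stage.exists_eq_add (s : Stage p t c) :
    ∃ Z : WittVector p s.H, s.Y = WittVector.teichmuller p (s.Y.coeff 0) + p * Z := by
  have h : s.Y - WittVector.teichmuller p (s.Y.coeff 0) ∈ Ideal.span {(p : WittVector p s.H)} := by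
    rw [WittVector.mem_span_p_iff_coeff_zero_eq_zero]
    have : (WittVector.constantCoeff : WittVector p s.H →+* s.H)
        (s.Y - WittVector.teichmuller p (s.Y.coeff 0)) = s.Y.coeff 0 - s.Y.coeff 0 := by
      rw [map_sub]; rfl
    exact this.trans (sub_self _)
  obtain ⟨Z, hZ⟩ := Ideal.mem_span_singleton'.1 h
  exact ⟨Z, by rw [mul_comm, hZ]; ring⟩

/-- The element adjoined to a stage. -/
def Stage.elem (s : Stage p t c) : K := (s.Y.coeff 0 : s.H) / t

/-- The quotient of the Witt vector of a stage by `p`, up to a Teichmüller representative. -/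
def Stage.quot (s : Stage p t c) : WittVector p s.H := (s.exists_eq_add p).choose

lemma Stage.quot_spec (s : Stage p t c) :
    s.Y = WittVector.teichmuller p (s.Y.coeff 0) + p * s.quot p := (s.exists_eq_add p).choose_spec

/-- The element adjoined to a stage, inside the next ring. -/
def Stage.elem' (s : Stage p t c) : perfectHull p (adjoinElem s.H (s.elem p)) :=
  ⟨s.elem p, le_perfectHull p _ self_mem_adjoinElem⟩

include ht0 in
lemma Stage.mul_elem (s : Stage p t c) : t * s.elem p = (s.Y.coeff 0 : s.H) :=
  mul_div_cancel₀ _ ht0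

/-- The next stage. -/
def Stage.next (s : Stage p t c) : Stage p t c where
  H := perfectHull p (adjoinElem s.H (s.elem p))
  root := inferInstance
  mem_t := (toHull p s.H (s.elem p) ⟨t, s.mem_t⟩).2
  mem_c a := (toHull p s.H (s.elem p) ⟨c a, s.mem_c a⟩).2
  Y := WittVector.map (toHull p s.H (s.elem p)) (s.quot p) + WittVector.teichmuller p (s.elem' p)
  good := by
    refine GoodPair.adjoin_div p (fun h => ht0 (congrArg Subtype.val h)) s.good
      (s.mul_elem p ht0) ((s.quot p).coeff 0) ?_
    have : (WittVector.constantCoeff : WittVector p _ →+* perfectHull p (adjoinElem s.H (s.elem p)))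
      (WittVector.map (toHull p s.H (s.elem p)) (s.quot p) + WittVector.teichmuller p (s.elem' p)) =
      toHull p s.H (s.elem p) ((s.quot p).coeff 0) + s.elem' p := by rw [map_add]; rfl
    exact congrArg Subtype.val this

lemma Stage.le_next (s : Stage p t c) : s.H ≤ (s.next p ht0).H :=
  fun z hz => (toHull p s.H (s.elem p) ⟨z, hz⟩).2

/-- The value of the Witt vector of a stage in the untilt of a bigger ring. -/
def Stage.val (s : Stage p t c) {R : Subring K} (h : s.H ≤ R) : Ring p R ⟨t, h s.mem_t⟩ :=
  Ideal.Quotient.mk _ (WittVector.map (Subring.inclusion h) s.Y)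

lemma Stage.val_eq_p_mul (s : Stage p t c) {R : Subring K} (h : (s.next p ht0).H ≤ R) :
    s.val p ((s.le_next p ht0).trans h) = p * (s.next p ht0).val p h := by
  have h1 : WittVector.map (Subring.inclusion ((s.le_next p ht0).trans h)) s.Y =
      WittVector.teichmuller p ⟨t, h (s.next p ht0).mem_t⟩ *
        WittVector.teichmuller p (Subring.inclusion h (s.elem' p)) +
      (p : WittVector p R) *
        WittVector.map (Subring.inclusion ((s.le_next p ht0).trans h)) (s.quot p) := by
    conv_lhs => rw [s.quot_spec p]
    rw [map_add, map_mul, map_natCast, WittVector.map_teichmuller, ← map_mul]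
    congr 2
    exact Subtype.ext (s.mul_elem p ht0).symm
  have h2 : WittVector.map (Subring.inclusion h) (s.next p ht0).Y =
      WittVector.map (Subring.inclusion ((s.le_next p ht0).trans h)) (s.quot p) +
      WittVector.teichmuller p (Subring.inclusion h (s.elem' p)) := by
    have h' : perfectHull p (adjoinElem s.H (s.elem p)) ≤ R := h
    refine (map_add (WittVector.map (Subring.inclusion h')) _ _).trans ?_
    rw [WittVector.map_teichmuller]
    congr 1
  rw [Stage.val, Stage.val, h1, h2, map_add, map_add, map_mul, map_mul, ← sharp_apply, sharp_t,
    map_natCast]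
  ring

/-- The sequence of stages starting from a given one. -/
def Stage.seq (s : Stage p t c) : ℕ → Stage p t c
  | 0 => s
  | n + 1 => (s.seq n).next p ht0

lemma Stage.seq_mono (s : Stage p t c) : Monotone fun n => (s.seq p ht0 n).H :=
  monotone_nat_of_le_succ fun n => (s.seq p ht0 n).le_next p ht0

/-- The union of all stages. -/
def Stage.union (s : Stage p t c) : Subring K := ⨆ n, (s.seq p ht0 n).H

lemma Stage.mem_union (s : Stage p t c) {z : K} :
    z ∈ s.union p ht0 ↔ ∃ n, z ∈ (s.seq p ht0 n).H :=
  Subring.mem_iSup_of_directed (s.seq_mono p ht0).directed_le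

lemma Stage.seq_le_union (s : Stage p t c) (n : ℕ) : (s.seq p ht0 n).H ≤ s.union p ht0 :=
  le_iSup (fun n => (s.seq p ht0 n).H) n

instance (s : Stage p t c) : RootClosed p (s.union p ht0) where
  mem_of_pow_mem z hz := by
    obtain ⟨n, hn⟩ := (s.mem_union p ht0).1 hz
    exact (s.mem_union p ht0).2 ⟨n, (s.seq p ht0 n).root.mem_of_pow_mem z hn⟩

lemma Stage.exists_uniform (s : Stage p t c) {n : ℕ} (z : Fin n → K)
    (hz : ∀ i, z i ∈ s.union p ht0) : ∃ m₀, ∀ m ≥ m₀, ∀ i, z i ∈ (s.seq p ht0 m).H := by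
  choose e he using fun i => (s.mem_union p ht0).1 (hz i)
  exact ⟨∑ i, e i, fun m hm i => s.seq_mono p ht0 ((Finset.single_le_sum (f := e)
    (fun _ _ => Nat.zero_le _) (mem_univ i)).trans hm) (he i)⟩

lemma Stage.val_zero_eq (s : Stage p t c) (n : ℕ) :
    s.val p (s.seq_le_union p ht0 0) = p ^ n * (s.seq p ht0 n).val p (s.seq_le_union p ht0 n) := by
  induction n with
  | zero => rw [pow_zero, one_mul]; rfl
  | succ n ih =>
    rw [ih, pow_succ, mul_assoc]
    congr 1
    exact (s.seq p ht0 n).val_eq_p_mul p ht0 (s.seq_le_union p ht0 (n + 1))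

lemma Stage.val_eq_zero (s : Stage p t c) : s.val p (s.seq_le_union p ht0 0) = 0 :=
  eq_zero_of_forall_dvd p _ (fun h => ht0 (congrArg Subtype.val h))
    fun n => ⟨_, s.val_zero_eq p ht0 n⟩

lemma Stage.coeff_dvd (s : Stage p t c) (m : ℕ) :
    ∃ w ∈ s.union p ht0, (((s.seq p ht0 m).Y.coeff 0 : (s.seq p ht0 m).H) : K) = t * w :=
  ⟨(s.seq p ht0 m).elem p, s.seq_le_union p ht0 (m + 1) ((s.seq p ht0 m).elem' p).2,
    ((s.seq p ht0 m).mul_elem p ht0).symm⟩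

lemma Stage.mem_span_of_mem (s : Stage p t c) (m : ℕ) {z : (s.seq p ht0 m).H}
    (hz : z ∈ Ideal.span {⟨t, (s.seq p ht0 m).mem_t⟩, (s.seq p ht0 m).Y.coeff 0}) :
    Subring.inclusion (s.seq_le_union p ht0 m) z ∈
      Ideal.span {(⟨t, s.seq_le_union p ht0 0 s.mem_t⟩ : s.union p ht0)} := by
  obtain ⟨α, β, rfl⟩ := RelFlat.mem_span_pair'.1 hz
  obtain ⟨w, hw, hw'⟩ := s.coeff_dvd p ht0 m
  rw [Ideal.mem_span_singleton]
  refine ⟨Subring.inclusion (s.seq_le_union p ht0 m) α +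
    ⟨w, hw⟩ * Subring.inclusion (s.seq_le_union p ht0 m) β, Subtype.ext ?_⟩
  simp only [map_add, map_mul, Subring.coe_add, Subring.coe_mul, Subring.coe_inclusion, hw']
  ring

lemma Stage.mem_c_union (s : Stage p t c) (a : κ) : c a ∈ s.union p ht0 :=
  s.seq_le_union p ht0 0 (s.mem_c a)

lemma Stage.relFlat_union (s : Stage p t c) :
    RelFlat (c.codRestrict (s.union p ht0) (s.mem_c_union p ht0))
      (Ideal.span {(⟨t, s.seq_le_union p ht0 0 s.mem_t⟩ : s.union p ht0)}) := by
  intro n a h hrel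
  obtain ⟨w, hw⟩ := Ideal.mem_span_singleton.1 hrel
  obtain ⟨m1, hm1⟩ := s.exists_uniform p ht0 (fun i => (h i : K)) fun i => (h i).2
  obtain ⟨m2, hm2⟩ := (s.mem_union p ht0).1 w.2
  have hw2 := s.seq_mono p ht0 (Nat.le_add_left m2 m1) hm2
  have hh := hm1 (m1 + m2) (Nat.le_add_right _ _)
  set m := m1 + m2
  obtain ⟨J, _, b, g, hb, hab⟩ := (s.seq p ht0 m).good.flat n a (fun i => ⟨h i, hh i⟩) (by
    refine RelFlat.mem_span_pair'.2 ⟨⟨w, hw2⟩, 0, Subtype.ext ?_⟩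
    have := congrArg Subtype.val hw
    simpa using this)
  refine ⟨J, inferInstance, b, fun j => Subring.inclusion (s.seq_le_union p ht0 m) (g j),
    fun i => ?_, hab⟩
  have := s.mem_span_of_mem p ht0 m (hb i)
  rw [map_sub, map_sum] at this
  exact this

lemma Stage.relProper_union (s : Stage p t c) :
    RelProper (c.codRestrict (s.union p ht0) (s.mem_c_union p ht0))
      (Ideal.span {(⟨t, s.seq_le_union p ht0 0 s.mem_t⟩ : s.union p ht0)}) := by
  intro n a h hrel
  obtain ⟨w, hw⟩ := Ideal.mem_span_singleton.1 hrel
  obtain ⟨m1, hm1⟩ := s.exists_uniform p ht0 (fun i => (h i : K)) fun i => (h i).2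
  obtain ⟨m2, hm2⟩ := (s.mem_union p ht0).1 w.2
  have hw2 := s.seq_mono p ht0 (Nat.le_add_left m2 m1) hm2
  have hh := hm1 (m1 + m2) (Nat.le_add_right _ _)
  exact (s.seq p ht0 (m1 + m2)).good.proper n a (fun i => ⟨h i, hh i⟩) (by
    refine RelFlat.mem_span_pair'.2 ⟨⟨w, hw2⟩, 0, Subtype.ext ?_⟩
    have := congrArg Subtype.val hw
    simpa using this)

end Stages

section Root

lemma _root_.RelFlat.comp_equiv {κ S S' : Type} [CommRing κ] [CommRing S] [CommRing S'] {c : κ →+* S}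
    (e : S ≃+* S') {t : S} (h : RelFlat c (Ideal.span {t})) :
    RelFlat ((e : S →+* S').comp c) (Ideal.span {e t}) := by
  have key : ∀ z, z ∈ Ideal.span {e t} ↔ e.symm z ∈ Ideal.span {t} := fun z => by
    rw [Ideal.mem_span_singleton, Ideal.mem_span_singleton, ← map_dvd_iff e.symm, e.symm_apply_apply]
  intro n a h' hrel
  rw [key, map_sum] at hrel
  obtain ⟨J, _, b, g, hb, hab⟩ := h n a (fun i => e.symm (h' i)) (by simpa using hrel)
  refine ⟨J, inferInstance, b, fun j => e (g j), fun i => ?_, hab⟩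
  rw [key, map_sub, map_sum]
  simpa using hb i

lemma _root_.RelProper.comp_equiv {κ S S' : Type} [CommRing κ] [CommRing S] [CommRing S'] {c : κ →+* S}
    (e : S ≃+* S') {t : S} (h : RelProper c (Ideal.span {t})) :
    RelProper ((e : S →+* S').comp c) (Ideal.span {e t}) := by
  intro n a h' hrel
  rw [Ideal.mem_span_singleton, ← map_dvd_iff e.symm, e.symm_apply_apply,
    ← Ideal.mem_span_singleton, map_sub, map_sum] at hrel
  exact h n a (fun i => e.symm (h' i)) (by simpa using hrel)

variable (p : ℕ) [hp : Fact p.Prime]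

lemma eval₂_map_sharp {R H R' : Type} [CommRing R] [CommRing H] [CommRing R'] {t : R} (j₀ : R →+* H)
    (i : H →+* R') (F : (WittVector p R)[X]) (ξ : H) :
    (F.map (Ideal.Quotient.mk (Ideal.span {(p : WittVector p R) - WittVector.teichmuller p t}))).eval₂
      (map p (i.comp j₀) rfl) (sharp p (i (j₀ t)) (i ξ)) =
    (Ideal.Quotient.mk _ (WittVector.map i (F.eval₂ (WittVector.map j₀)
      (WittVector.teichmuller p ξ))) : Ring p R' (i (j₀ t))) := by
  rw [eval₂_map, hom_eval₂, hom_eval₂, WittVector.map_teichmuller]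
  rfl

/-- Every perfect field embeds in a perfect field with a transcendental element. -/
lemma exists_transcendental_extension (K : Type) [Field K] [CharP K p] :
    ∃ (K' : Type) (_ : Field K') (_ : CharP K' p) (_ : PerfectRing K' p) (ι : K →+* K') (ξ : K'),
      ∀ G : K[X], G.eval₂ ι ξ = 0 → G = 0 := by
  refine ⟨PerfectClosure (FractionRing K[X]) p, inferInstance, inferInstance, inferInstance,
    (PerfectClosure.of (FractionRing K[X]) p).comp ((algebraMap K[X] (FractionRing K[X])).comp C),
    PerfectClosure.of (FractionRing K[X]) p (algebraMap K[X] (FractionRing K[X]) X), fun G hG => ?_⟩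
  rw [← hom_eval₂, ← hom_eval₂, eval₂_C_X] at hG
  have h1 := (map_eq_zero_iff _ (RingHom.injective _)).1 hG
  exact (map_eq_zero_iff _ (IsFractionRing.injective K[X] (FractionRing K[X]))).1 h1

variable {K : Type} [Field K] [CharP K p] [PerfectRing K p]
  {κ : Type} [CommRing κ] [CharP κ p] [PerfectRing κ p]

/-- Monic polynomials over the untilt acquire a root `[ξ]` in an untilt that stays faithfully flat
over `κ` modulo `p`. -/
theorem exists_extension_root (R : Subring K) [RootClosed p R] (t : R) (ht : t ≠ 0) (c : κ →+* R)
    (hflat : RelFlat c (Ideal.span {t})) (hprop : RelProper c (Ideal.span {t}))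
    (f : (Ring p R t)[X]) (hf : f.Monic) (hdeg : 0 < f.natDegree) :
    ∃ (K' : Type) (_ : Field K') (_ : CharP K' p) (_ : PerfectRing K' p) (R' : Subring K')
      (_ : RootClosed p R') (j : R →+* R'), j t ≠ 0 ∧ RelFlat (j.comp c) (Ideal.span {j t}) ∧
      RelProper (j.comp c) (Ideal.span {j t}) ∧
      ∃ ξ : R', f.eval₂ (map p j rfl) (sharp p (j t) ξ) = 0 := by
  obtain ⟨K', _, _, _, ι, ξ, hξ⟩ := exists_transcendental_extension p K
  obtain ⟨F, hFf, hFdeg, hFm⟩ := lifts_and_natDegree_eq_and_monic (f := Ideal.Quotient.mk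
    (Ideal.span {(p : WittVector p R) - WittVector.teichmuller p t})) (p := f)
    ((mem_lifts f).2 (map_surjective _ Ideal.Quotient.mk_surjective f)) hf
  let S : Subring K' := R.map ι
  let r : R →+* S := (ι.comp R.subtype).codRestrict S fun z => ⟨z, z.2, rfl⟩
  have hr : Function.Bijective r := by
    constructor
    · intro x y hxy
      exact Subtype.ext (ι.injective (congrArg Subtype.val hxy))
    · rintro ⟨_, z, hz, rfl⟩
      exact ⟨⟨z, hz⟩, rfl⟩
  let e : R ≃+* S := RingEquiv.ofBijective r hr
  have hrt : r t ≠ 0 := fun h => ht (hr.1 (h.trans (map_zero r).symm))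
  have htr : ∀ G : S[X], G.eval₂ S.subtype ξ = 0 → G = 0 := by
    intro G hG
    obtain ⟨G, rfl⟩ := map_surjective r hr.2 G
    rw [eval₂_map] at hG
    have h1 : G.map R.subtype = 0 := hξ _ (by rw [eval₂_map]; exact hG)
    rw [(Polynomial.map_eq_zero_iff R.subtype_injective).1 h1, Polynomial.map_zero]
  let j₀ : R →+* perfectHull p (adjoinElem S ξ) := (toHull p S ξ).comp r
  let ξ₀ : perfectHull p (adjoinElem S ξ) := ⟨ξ, le_perfectHull p _ self_mem_adjoinElem⟩
  let Y := F.eval₂ (WittVector.map j₀) (WittVector.teichmuller p ξ₀)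
  have hY : Y.coeff 0 = ((F.map WittVector.constantCoeff).map r).eval₂ (toHull p S ξ) ξ₀ := by
    have h1 := hom_eval₂ F (WittVector.map j₀) (WittVector.constantCoeff) (WittVector.teichmuller p ξ₀)
    rw [eval₂_map, eval₂_map]
    exact h1
  have good : GoodPair ((toHull p S ξ).comp (r.comp c)) (toHull p S ξ (r t)) (Y.coeff 0) := by
    refine GoodPair.hull p hrt (dvd_eval₂_iff_of_transcendental htr) (RelFlat.comp_equiv e hflat)
      (RelProper.comp_equiv e hprop) (F := (F.map WittVector.constantCoeff).map r)
      ((hFm.map _).map _) ?_ ?_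
    · rw [(hFm.map _).natDegree_map, hFm.natDegree_map, hFdeg]
      exact hdeg
    · rw [hY]
      exact hom_eval₂ _ (toHull p S ξ) (perfectHull p (adjoinElem S ξ)).subtype ξ₀
  let c' : κ →+* K' := ((ι.comp R.subtype).comp c)
  let s : Stage p (ι t) c' :=
    { H := perfectHull p (adjoinElem S ξ)
      root := inferInstance
      mem_t := (toHull p S ξ (r t)).2
      mem_c := fun a => (toHull p S ξ (r (c a))).2
      Y := Y
      good := good }
  have ht0 : ι t ≠ 0 := fun h => hrt (Subtype.ext h)
  have hle : perfectHull p (adjoinElem S ξ) ≤ s.union p ht0 := s.seq_le_union p ht0 0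
  let j : R →+* s.union p ht0 := (Subring.inclusion hle).comp j₀
  refine ⟨K', inferInstance, inferInstance, inferInstance, s.union p ht0, inferInstance, j,
    fun h => ht0 (congrArg Subtype.val h), s.relFlat_union p ht0, s.relProper_union p ht0,
    Subring.inclusion hle ξ₀, ?_⟩
  have h0 := s.val_eq_zero p ht0
  have h1 : s.val p (s.seq_le_union p ht0 0) =
      Ideal.Quotient.mk _ (WittVector.map (Subring.inclusion hle) Y) := rfl
  rw [h1] at h0
  rw [← hFf]
  exact (eval₂_map_sharp p j₀ (Subring.inclusion hle) F ξ₀).trans h0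

end Root

end Untilting

end

section

/-! ## Lifts of Frobenius and Witt vectors -/

namespace WittVector

variable (p : ℕ) [hp : Fact p.Prime] {A : Type} [CommRing A]

lemma ghostComponent_eq_sum (n : ℕ) (x : WittVector p A) :
    ghostComponent n x = ∑ i ∈ range (n + 1), (p : A) ^ i * x.coeff i ^ p ^ (n - i) := by
  rw [ghostComponent_apply, aeval_wittPolynomial]

lemma ghost_injective (htf : ∀ a : A, (p : A) * a = 0 → a = 0) {x y : WittVector p A}
    (h : ∀ n, ghostComponent n x = ghostComponent n y) : x = y := by
  have htf' : ∀ (n : ℕ) (a : A), (p : A) ^ n * a = 0 → a = 0 := by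
    intro n
    induction n with
    | zero => intro a ha; simpa using ha
    | succ n ih => intro a ha; exact ih a (htf _ (by rwa [← mul_assoc, ← pow_succ']))
  ext n
  induction n using Nat.strong_induction_on with
  | _ n ih =>
    have := h n
    rw [ghostComponent_eq_sum, ghostComponent_eq_sum, sum_range_succ, sum_range_succ,
      sum_congr rfl fun i hi => by rw [ih i (mem_range.1 hi)]] at this
    have h2 := add_left_cancel this
    rw [Nat.sub_self, pow_zero, pow_one, pow_one] at h2
    rw [← sub_eq_zero]
    exact htf' n _ (by rw [mul_sub, h2, sub_self])

variable {φ : A →+* A} (hφ : ∀ a, (p : A) ∣ φ a - a ^ p)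

include hφ

lemma pow_dvd_iterate_sub (a : A) (n : ℕ) (w : ℕ → A)
    (hw : φ^[n] a = ∑ i ∈ range (n + 1), (p : A) ^ i * w i ^ p ^ (n - i)) :
    (p : A) ^ (n + 1) ∣ φ^[n + 1] a -
      ∑ i ∈ range (n + 1), (p : A) ^ i * w i ^ p ^ (n + 1 - i) := by
  rw [Function.iterate_succ_apply', hw, map_sum, ← Finset.sum_sub_distrib]
  refine Finset.dvd_sum fun i hi => ?_
  have hi' : i ≤ n := Nat.lt_succ_iff.1 (mem_range.1 hi)
  have h1 := dvd_sub_pow_of_dvd_sub (hφ (w i)) (n - i)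
  rw [map_mul, map_pow, map_natCast, map_pow, ← mul_sub]
  have h2 : n + 1 - i = 1 + (n - i) := by omega
  have h3 : n + 1 = i + (n - i + 1) := by omega
  rw [h2, pow_add p, pow_one, pow_mul, h3, pow_add]
  exact mul_dvd_mul_left _ h1

omit hφ in
lemma exists_eq_apply_fin {B : Type} (g : ∀ n : ℕ, (Fin n → B) → B) :
    ∃ w : ℕ → B, ∀ n, w n = g n fun i => w i :=
  ⟨fun n => Nat.strongRecOn n fun n ih => g n fun i => ih i i.2, fun n => by
    beta_reduce
    rw [Nat.strongRecOn_eq]⟩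

lemma exists_ghost_eq_iterate (a : A) :
    ∃ x : WittVector p A, ∀ n, ghostComponent n x = φ^[n] a := by
  have key : ∀ n : ℕ, ∀ w : Fin n → A, ∃ c : A, (∀ m, ∀ hm : m < n, φ^[m] a =
      ∑ i : Fin (m + 1), (p : A) ^ (i : ℕ) * w ⟨i, by omega⟩ ^ p ^ (m - i)) →
      φ^[n] a = (∑ i : Fin n, (p : A) ^ (i : ℕ) * w i ^ p ^ (n - i)) + p ^ n * c := by
    intro n w
    by_cases hcond : ∀ m, ∀ hm : m < n, φ^[m] a =
      ∑ i : Fin (m + 1), (p : A) ^ (i : ℕ) * w ⟨i, by omega⟩ ^ p ^ (m - i)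
    swap
    · exact ⟨0, fun h => absurd h hcond⟩
    cases n with
    | zero => exact ⟨a, fun _ => by simp⟩
    | succ n =>
      let w' : ℕ → A := fun i => if h : i < n + 1 then w ⟨i, h⟩ else 0
      have hw' : ∀ i : Fin (n + 1), w' i = w i := fun i => dif_pos i.2
      obtain ⟨c, hc⟩ := pow_dvd_iterate_sub p hφ a n w' (by
        rw [hcond n (Nat.lt_succ_self n), ← Fin.sum_univ_eq_sum_range
          (fun i => (p : A) ^ i * w' i ^ p ^ (n - i))]
        exact sum_congr rfl fun i _ => by rw [hw'])
      refine ⟨c, fun _ => ?_⟩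
      rw [← hc, ← Fin.sum_univ_eq_sum_range (fun i => (p : A) ^ i * w' i ^ p ^ (n + 1 - i))]
      simp only [hw']
      ring
  choose g hg using key
  obtain ⟨w, hw⟩ := exists_eq_apply_fin g
  refine ⟨WittVector.mk p w, fun n => ?_⟩
  induction n using Nat.strong_induction_on with
  | _ n ih =>
    have h1 := hg n (fun i => w i) (fun m hm => by
      rw [← ih m hm, ghostComponent_eq_sum, ← Fin.sum_univ_eq_sum_range
        (fun i => (p : A) ^ i * (WittVector.mk p w).coeff i ^ p ^ (m - i))]
      rfl)
    rw [h1, ghostComponent_eq_sum, sum_range_succ, Nat.sub_self, pow_zero, pow_one,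
      ← Fin.sum_univ_eq_sum_range (fun i => (p : A) ^ i * (WittVector.mk p w).coeff i ^ p ^ (n - i)),
      ← hw]
    rfl

/-- A lift of Frobenius on a `p`-torsion-free ring induces a map to its Witt vectors. -/
theorem exists_ringHom_ghost (htf : ∀ a : A, (p : A) * a = 0 → a = 0) :
    ∃ s : A →+* WittVector p A, ∀ a n, ghostComponent n (s a) = φ^[n] a := by
  choose s hs using exists_ghost_eq_iterate p hφ
  have hit : ∀ n, φ^[n] = ⇑(φ ^ n) := fun n => (RingHom.coe_pow φ n).symm
  refine ⟨{ toFun := s, map_one' := ?_, map_mul' := ?_, map_zero' := ?_, map_add' := ?_ }, hs⟩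
  · exact ghost_injective p htf fun n => by rw [hs, hit, map_one, map_one]
  · exact fun a b => ghost_injective p htf fun n => by rw [hs, map_mul, hs, hs, hit, map_mul]
  · exact ghost_injective p htf fun n => by rw [hs, hit, map_zero, map_zero]
  · exact fun a b => ghost_injective p htf fun n => by rw [hs, map_add, hs, hs, hit, map_add]

end WittVector

lemma MvPowerSeries.exists_coeff_eq {σ R : Type} [CommRing R] (b : (σ →₀ ℕ) → R) :
    ∃ f : MvPowerSeries σ R, ∀ m, MvPowerSeries.coeff m f = b m := ⟨b, fun _ => rfl⟩

section PowerSeriesLift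

variable (p : ℕ) [hp : Fact p.Prime] (k : Type) [Field k] [CharP k p] [PerfectRing k p] (n : ℕ)

open WittVector in
/-- The map `W(k)⟦X⟧ → W(k⟦X⟧)` with `X ↦ [X]` that reduces to the identity modulo `p`. -/
theorem exists_powerSeries_ringHom :
    ∃ σ : MvPowerSeries (Fin n) (WittVector p k) →+* WittVector p (MvPowerSeries (Fin n) k),
      (∀ i, σ (MvPowerSeries.X i) = WittVector.teichmuller p (MvPowerSeries.X i)) ∧
      ∀ a, (σ a).coeff 0 = MvPowerSeries.map WittVector.constantCoeff a := by
  let A := MvPowerSeries (Fin n) (WittVector p k)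
  let π : A →+* MvPowerSeries (Fin n) k := MvPowerSeries.map WittVector.constantCoeff
  have htf : ∀ a : A, (p : A) * a = 0 → a = 0 := by
    intro a ha
    ext m : 1
    apply WittVector.eq_zero_of_p_mul_eq_zero
    have := congrArg (MvPowerSeries.coeff m) ha
    rw [← map_natCast (MvPowerSeries.C : WittVector p k →+* A), MvPowerSeries.coeff_C_mul] at this
    rw [mul_comm]
    exact this
  have hdvd : ∀ a : A, π a = 0 → (p : A) ∣ a := by
    intro a ha
    have : ∀ m, ∃ b : WittVector p k, MvPowerSeries.coeff m a = p * b := by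
      intro m
      have h1 := congrArg (MvPowerSeries.coeff m) ha
      rw [MvPowerSeries.coeff_map] at h1
      have h2 := (WittVector.mem_span_p_iff_coeff_zero_eq_zero (MvPowerSeries.coeff m a)).2 h1
      exact Ideal.mem_span_singleton.1 h2
    choose b hb using this
    obtain ⟨f, hf⟩ := MvPowerSeries.exists_coeff_eq b
    refine ⟨f, ?_⟩
    ext m : 1
    rw [hb, ← map_natCast (MvPowerSeries.C : WittVector p k →+* A), MvPowerSeries.coeff_C_mul, hf]
  let φ : A →+* A := (MvPowerSeries.expand p hp.out.ne_zero :
    A →ₐ[WittVector p k] A).toRingHom.comp (MvPowerSeries.map WittVector.frobenius)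
  have hφ : ∀ a, (p : A) ∣ φ a - a ^ p := by
    intro a
    apply hdvd
    rw [map_sub, map_pow, sub_eq_zero, ← MvPowerSeries.map_frobenius_expand p hp.out.ne_zero]
    change MvPowerSeries.map _ (MvPowerSeries.expand p hp.out.ne_zero (MvPowerSeries.map _ a)) = _
    rw [MvPowerSeries.map_expand, MvPowerSeries.map_expand]
    congr 1
    ext m
    simp only [MvPowerSeries.coeff_map, π]
    exact WittVector.coeff_frobenius_charP (p := p) (R := k) (n := 0) _
  obtain ⟨s, hs⟩ := exists_ringHom_ghost p hφ htf
  refine ⟨(WittVector.map π).comp s, fun i => ?_, fun a => ?_⟩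
  · have h1 : s (MvPowerSeries.X i) = teichmuller p (MvPowerSeries.X i) := by
      apply ghost_injective p htf
      intro m
      rw [hs, ghostComponent_teichmuller]
      induction m with
      | zero => simp
      | succ m ih =>
        rw [Function.iterate_succ_apply', ih, map_pow, pow_succ', pow_mul]
        congr 1
        change MvPowerSeries.expand p hp.out.ne_zero (MvPowerSeries.map _ (MvPowerSeries.X i)) = _
        rw [MvPowerSeries.map_X, MvPowerSeries.expand_X]
    rw [RingHom.comp_apply, h1, WittVector.map_teichmuller, MvPowerSeries.map_X]
  · have h0 : (s a).coeff 0 = a := by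
      have := hs a 0
      rw [ghostComponent_eq_sum] at this
      simpa using this
    rw [RingHom.comp_apply, WittVector.map_coeff, h0]

end PowerSeriesLift

end

/-! ## Monomial ideals in power series rings and their perfections -/

namespace MvPowerSeries

variable {σ : Type} [DecidableEq σ] {k : Type} [CommRing k]

lemma mem_span_X_pow_iff (S : Finset σ) (a : ℕ) (f : MvPowerSeries σ k) :
    f ∈ Ideal.span ((fun i => (X i : MvPowerSeries σ k) ^ a) '' S) ↔
      ∀ m : σ →₀ ℕ, (∀ i ∈ S, m i < a) → coeff m f = 0 := by
  constructor
  · intro hf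
    induction hf using Submodule.span_induction with
    | mem x hx =>
      obtain ⟨i, hi, rfl⟩ := hx
      intro m hm
      exact X_pow_dvd_iff.1 (dvd_refl _) m (hm i hi)
    | zero => simp
    | add x y _ _ hx hy => intro m hm; rw [map_add, hx m hm, hy m hm, add_zero]
    | smul c x _ hx =>
      intro m hm
      rw [smul_eq_mul, coeff_mul]
      refine Finset.sum_eq_zero fun d hd => ?_
      rw [hx d.2 fun i hi => lt_of_le_of_lt ?_ (hm i hi), mul_zero]
      rw [← Finset.HasAntidiagonal.mem_antidiagonal.1 hd]
      simp
  · intro hf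
    induction S using Finset.induction_on generalizing f with
    | empty =>
      have : f = 0 := by ext m; exact hf m (by simp)
      rw [this]; exact Ideal.zero_mem _
    | insert i S hi ih =>
      obtain ⟨f1, hf1⟩ := exists_coeff_eq fun m => if m i < a then coeff m f else 0
      have h1 : (X i : MvPowerSeries σ k) ^ a ∣ f - f1 := by
        rw [X_pow_dvd_iff]
        intro m hm
        rw [map_sub, hf1, if_pos hm, sub_self]
      have h2 : f1 ∈ Ideal.span ((fun i => (X i : MvPowerSeries σ k) ^ a) '' S) := by
        apply ih
        intro m hm
        rw [hf1]
        split_ifs with h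
        · apply hf
          intro j hj
          rcases Finset.mem_insert.1 hj with rfl | hj
          · exact h
          · exact hm j hj
        · rfl
      rw [← sub_add_cancel f f1]
      refine Ideal.add_mem _ ?_ (Ideal.span_mono (Set.image_mono (by simp)) h2)
      obtain ⟨w, hw⟩ := h1
      rw [hw]
      exact Ideal.mul_mem_right _ _ (Ideal.subset_span ⟨i, by simp, rfl⟩)

lemma mem_of_mul_X_pow_mem {S : Finset σ} {a : ℕ} {i : σ} (hi : i ∉ S) {f : MvPowerSeries σ k}
    (h : f * X i ^ a ∈ Ideal.span ((fun i => (X i : MvPowerSeries σ k) ^ a) '' S)) :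
    f ∈ Ideal.span ((fun i => (X i : MvPowerSeries σ k) ^ a) '' S) := by
  rw [mem_span_X_pow_iff] at h ⊢
  intro m hm
  have := h (m + Finsupp.single i a) (fun j hj => by
    rw [Finsupp.add_apply, Finsupp.single_eq_of_ne (by rintro rfl; exact hi hj), add_zero]
    exact hm j hj)
  rwa [X_pow_eq, coeff_add_mul_monomial, mul_one] at this

lemma mem_of_mul_prod_X_pow_mem [Fintype σ] {N Q : ℕ} {f : MvPowerSeries σ k}
    (h : f * (∏ i, X i ^ N) ^ Q ∈
      Ideal.span ((fun i => (X i : MvPowerSeries σ k) ^ ((N + 1) * Q)) '' (univ : Finset σ))) :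
    f ∈ Ideal.span ((fun i => (X i : MvPowerSeries σ k) ^ Q) '' (univ : Finset σ)) := by
  rw [mem_span_X_pow_iff] at h ⊢
  intro m hm
  have hprod : (∏ i, (X i : MvPowerSeries σ k) ^ N) ^ Q =
      monomial (Finsupp.equivFunOnFinite.symm fun _ => N * Q) 1 := by
    have h1 : ∀ s : Finset σ, ∏ i ∈ s, (X i : MvPowerSeries σ k) ^ (N * Q) =
        monomial (∑ i ∈ s, Finsupp.single i (N * Q)) 1 := by
      intro s
      induction s using Finset.induction_on with
      | empty => simp
      | insert i s hi ih =>
        rw [Finset.prod_insert hi, Finset.sum_insert hi, ih, X_pow_eq, monomial_mul_monomial, mul_one]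
    rw [← Finset.prod_pow]
    simp_rw [← pow_mul]
    have h2 : ∑ i : σ, Finsupp.single i (N * Q) = Finsupp.equivFunOnFinite.symm fun _ => N * Q := by
      ext j
      rw [Finsupp.finsetSum_apply, Finset.sum_eq_single j (fun i _ hij =>
        Finsupp.single_eq_of_ne (Ne.symm hij)) (by simp), Finsupp.single_eq_same]
      rfl
    rw [h1, h2]
  have := h (m + Finsupp.equivFunOnFinite.symm fun _ => N * Q) (fun j hj => by
    have := hm j hj
    simp only [Finsupp.coe_add, Pi.add_apply, Finsupp.equivFunOnFinite_symm_apply_apply]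
    rw [add_mul]; omega)
  rwa [hprod, coeff_add_mul_monomial, mul_one] at this

lemma mem_of_pow_mem [Finite σ] (p : ℕ) [hp : Fact p.Prime] [CharP k p] [IsReduced k] (S : Finset σ)
    {a l : ℕ} {f : MvPowerSeries σ k}
    (h : f ^ p ^ l ∈ Ideal.span ((fun i => (X i : MvPowerSeries σ k) ^ (a * p ^ l)) '' S)) :
    f ∈ Ideal.span ((fun i => (X i : MvPowerSeries σ k) ^ a) '' S) := by
  rw [mem_span_X_pow_iff] at h ⊢
  intro m hm
  have h1 := h (p ^ l • m) (fun i hi => by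
    rw [Finsupp.smul_apply, smul_eq_mul, mul_comm]
    exact Nat.mul_lt_mul_of_pos_right (hm i hi) (pow_pos hp.out.pos _))
  have h2 : ∀ (l : ℕ) (f : MvPowerSeries σ k), coeff (p ^ l • m) (f ^ p ^ l) = coeff m f ^ p ^ l := by
    intro l f
    induction l generalizing f with
    | zero => simp
    | succ l ih =>
      rw [pow_succ (n := l), pow_mul, pow_mul, ← ih, mul_comm, mul_smul, ← map_frobenius_expand p hp.out.ne_zero,
        coeff_map, coeff_expand_smul]
      rfl
  rw [h2] at h1
  exact pow_eq_zero_iff (pow_pos hp.out.pos _).ne' |>.1 h1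

end MvPowerSeries

/-- The ideal generated by the `a`-th powers of the `y i`, `i ∈ S`. -/
def spanPow {σ A : Type} [CommRing A] (y : σ → A) (a : ℕ) (S : Finset σ) : Ideal A :=
  Ideal.span ((fun i => y i ^ a) '' S)

section SpanPow

variable {σ A B : Type} [CommRing A] [CommRing B]

lemma mem_spanPow {y : σ → A} {a : ℕ} {S : Finset σ} {z : A} :
    z ∈ spanPow y a S ↔ ∃ b : σ → A, ∑ i ∈ S, b i * y i ^ a = z := by
  constructor
  · intro h
    induction h using Submodule.span_induction with
    | mem x hx =>
      classical
      obtain ⟨i, hi, rfl⟩ := hx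
      exact ⟨fun j => if j = i then 1 else 0, by simp [Finset.mem_coe.1 hi]⟩
    | zero => exact ⟨0, by simp⟩
    | add x z _ _ hx hz =>
      obtain ⟨b, rfl⟩ := hx
      obtain ⟨c, rfl⟩ := hz
      exact ⟨b + c, by simp [add_mul, Finset.sum_add_distrib]⟩
    | smul r x _ hx =>
      obtain ⟨b, rfl⟩ := hx
      exact ⟨fun i => r * b i, by simp [mul_sum, mul_assoc]⟩
  · rintro ⟨b, rfl⟩
    exact Ideal.sum_mem _ fun i hi => Ideal.mul_mem_left _ _ (Ideal.subset_span ⟨i, hi, rfl⟩)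

lemma map_spanPow (f : A →+* B) (y : σ → A) (a : ℕ) (S : Finset σ) :
    (spanPow y a S).map f = spanPow (fun i => f (y i)) a S := by
  rw [spanPow, Ideal.map_span, spanPow, Set.image_image]
  simp

/-- If `π` is regular and the `y i ^ a` form a regular sequence modulo `π`, then `π` is regular
modulo all the `y i ^ a`. -/
lemma mem_spanPow_of_mul_mem {n : ℕ} {y : Fin n → A} {a : ℕ} {π : A} (hπ : ∀ z, π * z = 0 → z = 0)
    (hreg : ∀ (S : Finset (Fin n)) (i : Fin n) (z : A), i ∉ S →
      z * y i ^ a ∈ spanPow y a S ⊔ Ideal.span {π} → z ∈ spanPow y a S ⊔ Ideal.span {π})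
    (S : Finset (Fin n)) (z : A) (hz : π * z ∈ spanPow y a S) : z ∈ spanPow y a S := by
  induction S using Finset.induction_on generalizing z with
  | empty =>
    obtain ⟨b, hb⟩ := mem_spanPow.1 hz
    rw [hπ z (by rw [← hb]; simp)]
    exact Ideal.zero_mem _
  | insert i S hi ih =>
    obtain ⟨b, hb⟩ := mem_spanPow.1 hz
    rw [Finset.sum_insert hi] at hb
    have h1 : b i * y i ^ a ∈ spanPow y a S ⊔ Ideal.span {π} := by
      have : b i * y i ^ a = -(∑ j ∈ S, b j * y j ^ a) + π * z := by rw [← hb]; ring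
      rw [this]
      exact Ideal.add_mem _ (Ideal.neg_mem_iff _ |>.2 (le_sup_left (a := spanPow y a S)
        (mem_spanPow.2 ⟨b, rfl⟩)))
        (le_sup_right (a := spanPow y a S) (Ideal.mul_mem_right _ _ (Ideal.mem_span_singleton_self π)))
    obtain ⟨u, hu, v, hv, huv⟩ := Submodule.mem_sup.1 (hreg S i _ hi h1)
    obtain ⟨e, rfl⟩ := Ideal.mem_span_singleton'.1 hv
    have h2 : z - e * y i ^ a ∈ spanPow y a S := by
      apply ih
      have : π * (z - e * y i ^ a) = u * y i ^ a + ∑ j ∈ S, b j * y j ^ a := by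
        rw [mul_sub, ← hb, ← huv]; ring
      rw [this]
      exact Ideal.add_mem _ (Ideal.mul_mem_right _ _ hu) (mem_spanPow.2 ⟨b, rfl⟩)
    have h3 : spanPow y a S ≤ spanPow y a (insert i S) := Ideal.span_mono (Set.image_mono (by simp))
    rw [← sub_add_cancel z (e * y i ^ a)]
    exact Ideal.add_mem _ (h3 h2) (Ideal.mul_mem_left _ _ (Ideal.subset_span ⟨i, by simp, rfl⟩))

end SpanPow

section Transfer

variable {κ S : Type} [CommRing κ] [CommRing S] {c : κ →+* S} {I : Ideal S}

lemma RelFlat.exists_of_eq {σ : Type} (h : RelFlat c I) (T : Finset σ) (y : κ) (w : σ → κ) (z : S)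
    (s : σ → S) (hz : z * c y - ∑ i ∈ T, s i * c (w i) ∈ I) :
    ∃ (J : Type) (_ : Fintype J) (b : J → κ) (g : J → S), z - ∑ j, c (b j) * g j ∈ I ∧
      ∀ j, ∃ v : σ → κ, b j * y = ∑ i ∈ T, v i * w i := by
  classical
  let e := T.equivFin
  obtain ⟨J, _, b, g, hb, hab⟩ := h (T.card + 1) (Fin.cons y fun i => w (e.symm i))
    (Fin.cons z fun i => -s (e.symm i)) (by
      rw [Fin.sum_univ_succ]
      simp only [Fin.cons_zero, Fin.cons_succ]
      convert hz using 1
      rw [sub_eq_add_neg, mul_comm, ← Finset.sum_neg_distrib, ← Finset.sum_coe_sort T]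
      congr 1
      refine (Equiv.sum_comp e.symm fun i : T => c (w i) * -s i).trans ?_
      exact sum_congr rfl fun i _ => by ring)
  refine ⟨J, inferInstance, b 0, g, by simpa using hb 0, fun j => ?_⟩
  have h1 := hab j
  rw [Fin.sum_univ_succ] at h1
  simp only [Fin.cons_zero, Fin.cons_succ] at h1
  refine ⟨fun i => if hi : i ∈ T then -b (Fin.succ (e ⟨i, hi⟩)) j else 0, ?_⟩
  rw [← Finset.sum_coe_sort T]
  have h2 : ∑ i : T, (if hi : (i : σ) ∈ T then -b (Fin.succ (e ⟨i, hi⟩)) j else 0) * w i =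
      -∑ i : Fin T.card, w (e.symm i) * b i.succ j := by
    rw [← Equiv.sum_comp e.symm, ← Finset.sum_neg_distrib]
    refine sum_congr rfl fun i _ => ?_
    rw [dif_pos (e.symm i).2]
    simp [mul_comm]
  rw [h2]
  linear_combination h1

lemma RelFlat.mem_sup_of_mul_mem {σ : Type} (h : RelFlat c I) {T : Finset σ} {y : κ} {x : σ → κ}
    {a a' : ℕ} {T' : Finset σ}
    (hκ : ∀ z, z * y ∈ spanPow x a T → z ∈ spanPow x a' T') {z : S}
    (hz : z * c y ∈ spanPow (fun i => c (x i)) a T ⊔ I) :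
    z ∈ spanPow (fun i => c (x i)) a' T' ⊔ I := by
  obtain ⟨u, hu, v, hv, huv⟩ := Submodule.mem_sup.1 hz
  obtain ⟨s, hs⟩ := mem_spanPow.1 hu
  obtain ⟨J, _, b, g, hb, hbv⟩ := h.exists_of_eq T y (fun i => x i ^ a) z s (by
    simp only [map_pow]
    rw [hs, ← huv]; simpa using hv)
  rw [← sub_add_cancel z (∑ j, c (b j) * g j), add_comm]
  refine Submodule.add_mem_sup (Ideal.sum_mem _ fun j _ => Ideal.mul_mem_right _ _ ?_) hb
  rw [← map_spanPow]
  obtain ⟨v, hv⟩ := hbv j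
  exact Ideal.mem_map_of_mem _ (hκ _ (mem_spanPow.2 ⟨v, hv.symm⟩))

lemma RelFlat.mem_of_map_mem {σ : Type} (h : RelFlat c I) (hprop : RelProper c I) {T : Finset σ}
    {y : κ} {x : σ → κ} {a : ℕ} (hy : c y ∈ spanPow (fun i => c (x i)) a T ⊔ I) :
    y ∈ spanPow x a T := by
  obtain ⟨u, hu, v, hv, huv⟩ := Submodule.mem_sup.1 hy
  obtain ⟨s, hs⟩ := mem_spanPow.1 hu
  obtain ⟨J, _, b, g, hb, hbv⟩ := h.exists_of_eq T y (fun i => x i ^ a) 1 s (by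
    simp only [map_pow]
    rw [hs, one_mul, ← huv]; simpa using hv)
  have e := Fintype.equivFin J
  have htop := hprop _ (fun i => b (e.symm i)) (fun i => g (e.symm i)) (by
    rw [Equiv.sum_comp e.symm fun j => c (b j) * g j]; exact hb)
  have h1 : (1 : κ) ∈ Ideal.span (Set.range fun i => b (e.symm i)) := htop ▸ Submodule.mem_top
  obtain ⟨d, hd⟩ := Ideal.mem_span_range_iff_exists_fun.1 h1
  rw [← one_mul y, ← hd, Finset.sum_mul]
  refine Ideal.sum_mem _ fun i _ => ?_
  rw [mul_assoc]
  obtain ⟨v, hv⟩ := hbv (e.symm i)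
  exact Ideal.mul_mem_left _ _ (mem_spanPow.2 ⟨v, hv.symm⟩)

end Transfer

section Perfection

instance MvPowerSeries.isDomain_of_field {σ k : Type} [CommRing k] [IsDomain k] :
    IsDomain (MvPowerSeries σ k) := NoZeroDivisors.to_isDomain _

variable (p : ℕ) [hp : Fact p.Prime] {k : Type} [Field k] [CharP k p] {n : ℕ}

instance MvPowerSeries.charP {σ k : Type} [CommRing k] [CharP k p] : CharP (MvPowerSeries σ k) p :=
  (RingHom.charP_iff (MvPowerSeries.C : k →+* MvPowerSeries σ k)
    (MvPowerSeries.C_injective) p).1 inferInstance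

variable (k n) in
/-- Power series rings over fields embed in perfect domains of purely inseparable elements. -/
lemma exists_perfection : ∃ (L : Type) (_ : Field L) (_ : CharP L p) (_ : PerfectRing L p)
    (κ : Subring L) (_ : RootClosed p κ) (ε : MvPowerSeries (Fin n) k →+* κ),
    Function.Injective ε ∧ ∀ z : κ, ∃ j, z ^ p ^ j ∈ ε.range := by
  let F := FractionRing (MvPowerSeries (Fin n) k)
  have : CharP F p := charP_of_injective_algebraMap
    (IsFractionRing.injective (MvPowerSeries (Fin n) k) F) p
  let i : MvPowerSeries (Fin n) k →+* PerfectClosure F p :=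
    (PerfectClosure.of F p).comp (algebraMap _ F)
  have hi : Function.Injective i :=
    (PerfectClosure.of F p).injective.comp (IsFractionRing.injective _ F)
  refine ⟨PerfectClosure F p, inferInstance, inferInstance, inferInstance, perfectHull p i.range,
    inferInstance, i.codRestrict _ fun a => le_perfectHull p _ ⟨a, rfl⟩, fun a b h =>
      hi (congrArg Subtype.val h), ?_⟩
  rintro ⟨z, j, a, ha⟩
  exact ⟨j, a, Subtype.ext ha⟩

variable {κ : Type} [CommRing κ] [CharP κ p] [PerfectRing κ p] {ε : MvPowerSeries (Fin n) k →+* κ}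
  (hε : Function.Injective ε) (hpow : ∀ z : κ, ∃ j, z ^ p ^ j ∈ ε.range)

lemma mem_spanPow_of_pow_mem {a j : ℕ} {T : Finset (Fin n)} {z : κ} {w : MvPowerSeries (Fin n) k}
    (hw : ε w = z ^ p ^ j) (hwm : w ∈ spanPow MvPowerSeries.X (a * p ^ j) T) :
    z ∈ spanPow (fun i => ε (MvPowerSeries.X i)) a T := by
  obtain ⟨b, rfl⟩ := mem_spanPow.1 hwm
  choose b' hb' using fun i => Untilting.exists_root p (ε (b i)) j
  refine mem_spanPow.2 ⟨b', Untilting.pow_inj p (l := j) ?_⟩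
  rw [← hw, map_sum, sum_pow_char_pow]
  exact sum_congr rfl fun i _ => by rw [mul_pow, hb', map_mul, map_pow, ← pow_mul]

include hε hpow

lemma pow_mem_spanPow_of_mem {a : ℕ} {T : Finset (Fin n)} {z : κ}
    (hz : z ∈ spanPow (fun i => ε (MvPowerSeries.X i)) a T) :
    ∃ j₀, ∀ j ≥ j₀, ∀ w, ε w = z ^ p ^ j → w ∈ spanPow MvPowerSeries.X (a * p ^ j) T := by
  obtain ⟨b, rfl⟩ := mem_spanPow.1 hz
  obtain ⟨j₀, hj₀⟩ := exists_uniform_pow p hpow b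
  refine ⟨j₀, fun j hj w hw => ?_⟩
  obtain ⟨b', hb'⟩ := hj₀ j hj
  refine mem_spanPow.2 ⟨b', hε ?_⟩
  rw [hw, map_sum, sum_pow_char_pow]
  exact sum_congr rfl fun i _ => by rw [mul_pow, ← hb', map_mul, map_pow, ← pow_mul]

lemma mem_spanPow_of_mul_mem_perfection {z : κ} {y : MvPowerSeries (Fin n) k} {a a' : ℕ}
    {T T' : Finset (Fin n)}
    (h : ∀ (j : ℕ) (w : MvPowerSeries (Fin n) k), w * y ^ p ^ j ∈ spanPow MvPowerSeries.X (a * p ^ j) T →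
      w ∈ spanPow MvPowerSeries.X (a' * p ^ j) T')
    (hz : z * ε y ∈ spanPow (fun i => ε (MvPowerSeries.X i)) a T) :
    z ∈ spanPow (fun i => ε (MvPowerSeries.X i)) a' T' := by
  obtain ⟨j₀, hj₀⟩ := pow_mem_spanPow_of_mem p hε hpow hz
  obtain ⟨j₁, hj₁⟩ := exists_uniform_pow p hpow ![z]
  obtain ⟨w, hw⟩ := hj₁ (j₀ + j₁) (by omega)
  have hw0 : ε (w 0) = z ^ p ^ (j₀ + j₁) := hw 0
  refine mem_spanPow_of_pow_mem p hw0 (h _ _ (hj₀ (j₀ + j₁) (by omega) _ ?_))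
  rw [map_mul, hw0, map_pow, mul_pow]

/-- The variables form a regular sequence in the perfection. -/
lemma perfection_regular (a : ℕ) {T : Finset (Fin n)} {i : Fin n} (hi : i ∉ T) (z : κ)
    (hz : z * ε (MvPowerSeries.X i) ^ a ∈ spanPow (fun i => ε (MvPowerSeries.X i)) a T) :
    z ∈ spanPow (fun i => ε (MvPowerSeries.X i)) a T := by
  refine mem_spanPow_of_mul_mem_perfection p hε hpow (y := MvPowerSeries.X i ^ a) (fun j w hw => ?_)
    (by rwa [map_pow])
  rw [← pow_mul] at hw
  exact MvPowerSeries.mem_of_mul_X_pow_mem hi hw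

lemma perfection_colon (N : ℕ) (z : κ)
    (hz : z * ε (∏ i, MvPowerSeries.X i ^ N) ∈
      spanPow (fun i => ε (MvPowerSeries.X i)) (N + 1) univ) :
    z ∈ spanPow (fun i => ε (MvPowerSeries.X i)) 1 univ := by
  refine mem_spanPow_of_mul_mem_perfection p hε hpow (fun j w hw => ?_) hz
  rw [one_mul]
  exact MvPowerSeries.mem_of_mul_prod_X_pow_mem hw

lemma mem_spanPow_of_map_mem {a : ℕ} {T : Finset (Fin n)} {w : MvPowerSeries (Fin n) k}
    (h : ε w ∈ spanPow (fun i => ε (MvPowerSeries.X i)) a T) : w ∈ spanPow MvPowerSeries.X a T := by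
  obtain ⟨j₀, hj₀⟩ := pow_mem_spanPow_of_mem p hε hpow h
  exact MvPowerSeries.mem_of_pow_mem p T (hj₀ j₀ le_rfl (w ^ p ^ j₀) (by rw [map_pow]))

end Perfection

section

open Polynomial

namespace Untilting

variable (p : ℕ) [hp : Fact p.Prime]

lemma _root_.RelFlat.bot_of_equiv {κ H : Type} [CommRing κ] [CommRing H] (e : κ ≃+* H) :
    RelFlat (e : κ →+* H) (Ideal.span {(0 : H)}) := by
  intro n a h hrel
  rw [Ideal.mem_span_singleton, zero_dvd_iff] at hrel
  refine ⟨Unit, inferInstance, fun i _ => e.symm (h i), fun _ => 1, fun i => ?_, fun _ => ?_⟩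
  · simp
  · apply e.injective
    simpa using hrel

lemma _root_.RelProper.bot_of_equiv {κ H : Type} [CommRing κ] [CommRing H] (e : κ ≃+* H) :
    RelProper (e : κ →+* H) (Ideal.span {(0 : H)}) := by
  intro n a h hrel
  rw [Ideal.mem_span_singleton, zero_dvd_iff, sub_eq_zero] at hrel
  rw [Ideal.eq_top_iff_one]
  have : (1 : κ) = ∑ i, e.symm (h i) * a i := by
    apply e.injective
    rw [map_one, hrel, map_sum]
    exact sum_congr rfl fun i _ => by simp [mul_comm]
  rw [this]
  exact Ideal.sum_mem _ fun i _ => Ideal.mul_mem_left _ _ (Ideal.subset_span (Set.mem_range_self i))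

/-- The base ring `κ[t ^ (1 / p ^ ∞)]`. -/
lemma exists_base {L : Type} [Field L] [CharP L p] [PerfectRing L p] (κ : Subring L)
    [RootClosed p κ] :
    ∃ (K : Type) (_ : Field K) (_ : CharP K p) (_ : PerfectRing K p) (R : Subring K)
      (_ : RootClosed p R) (t : R) (c : κ →+* R), t ≠ 0 ∧ RelFlat c (Ideal.span {t}) ∧
      RelProper c (Ideal.span {t}) := by
  obtain ⟨K, _, _, _, ι, ξ, hξ⟩ := exists_transcendental_extension p L
  let H : Subring K := κ.map ι
  let r : κ →+* H := (ι.comp κ.subtype).codRestrict H fun z => ⟨z, z.2, rfl⟩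
  have hr : Function.Bijective r := by
    constructor
    · intro x y hxy
      exact Subtype.ext (ι.injective (congrArg Subtype.val hxy))
    · rintro ⟨_, z, hz, rfl⟩
      exact ⟨⟨z, hz⟩, rfl⟩
  have htr : ∀ G : H[X], G.eval₂ H.subtype ξ = 0 → G = 0 := by
    intro G hG
    obtain ⟨G, rfl⟩ := map_surjective r hr.2 G
    rw [eval₂_map] at hG
    have h1 : G.map κ.subtype = 0 := hξ _ (by rw [eval₂_map]; exact hG)
    rw [(Polynomial.map_eq_zero_iff κ.subtype_injective).1 h1, Polynomial.map_zero]
  have hflat : RelFlat r (Ideal.span {(0 : H)}) := RelFlat.bot_of_equiv (RingEquiv.ofBijective r hr)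
  have hprop : RelProper r (Ideal.span {(0 : H)}) :=
    RelProper.bot_of_equiv (RingEquiv.ofBijective r hr)
  have hI := dvd_eval₂_iff_of_transcendental htr (t := 0)
  let uS : adjoinElem H ξ := ⟨ξ, self_mem_adjoinElem⟩
  let g := Subring.inclusion (le_perfectHull p (adjoinElem H ξ))
  have hg : Function.Injective g := Subring.inclusion_injective _
  have h1 : ∀ j, RelFlat ((Subring.inclusion le_adjoinElem).comp r)
      (Ideal.span {(0 : adjoinElem H ξ) ^ p ^ j, uS ^ p ^ j}) := by
    intro j
    have := RelFlat.eval₂_monic exists_eval₂_inclusion hI (monic_X_pow (p ^ j))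
      (by rw [natDegree_X_pow]; exact pow_pos hp.out.pos _) hflat
    rw [eval₂_X_pow, map_zero] at this
    rwa [zero_pow (pow_pos hp.out.pos _).ne']
  have h2 : RelProper ((Subring.inclusion le_adjoinElem).comp r)
      (Ideal.span {(0 : adjoinElem H ξ), uS}) := by
    have := RelProper.eval₂_monic exists_eval₂_inclusion hI monic_X
      (by rw [natDegree_X]; exact one_pos) hprop
    rwa [eval₂_X, map_zero] at this
  have h3 := RelFlat.of_pow p hg (exists_pow_mem_range p _) h1
  have h4 := RelProper.of_pow p hg (exists_pow_mem_range p _) h2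
  have hs : Ideal.span {g 0, g uS} = Ideal.span {g uS} := by
    rw [map_zero, Ideal.span_insert]; simp
  rw [hs] at h3 h4
  refine ⟨K, inferInstance, inferInstance, inferInstance, perfectHull p (adjoinElem H ξ),
    inferInstance, g uS, _, fun h => ?_, h3, h4⟩
  have h0 : ξ = 0 := congrArg Subtype.val h
  have := hξ X (by rw [eval₂_X, h0])
  exact X_ne_zero this

section Mod

variable {R : Type} [CommRing R] [CharP R p] [PerfectRing R p] {t : R}

lemma red_surjective : Function.Surjective (red p t) := by
  intro r
  obtain ⟨r, rfl⟩ := Ideal.Quotient.mk_surjective r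
  exact ⟨sharp p t r, red_sharp p t r⟩

lemma ker_red : RingHom.ker (red p t) = Ideal.span {(p : Ring p R t)} := by
  ext z
  rw [RingHom.mem_ker, red_eq_zero_iff, Ideal.mem_span_singleton]

lemma mem_sup_p_iff {σ : Type} {v : σ → R} {a : ℕ} {T : Finset σ} {w : Ring p R t} {r : R}
    (h : red p t w = Ideal.Quotient.mk _ r) :
    w ∈ spanPow (fun i => sharp p t (v i)) a T ⊔ Ideal.span {(p : Ring p R t)} ↔
      r ∈ spanPow v a T ⊔ Ideal.span {t} := by
  have h1 : spanPow v a T ⊔ Ideal.span {t} =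
      ((spanPow v a T).map (Ideal.Quotient.mk (Ideal.span {t}))).comap (Ideal.Quotient.mk _) := by
    rw [Ideal.comap_map_of_surjective' _ Ideal.Quotient.mk_surjective, Ideal.mk_ker]
  rw [h1, ← ker_red, ← Ideal.comap_map_of_surjective' _ (red_surjective p), Ideal.mem_comap,
    Ideal.mem_comap, h, map_spanPow, map_spanPow]
  rfl

variable [IsDomain R] (ht : t ≠ 0) {κ : Type} [CommRing κ] {c : κ →+* R} {n : ℕ} {x : Fin n → κ}
  (hflat : RelFlat c (Ideal.span {t})) (hprop : RelProper c (Ideal.span {t}))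
  (hreg : ∀ (a : ℕ) (T : Finset (Fin n)) (i : Fin n), i ∉ T → ∀ z : κ,
    z * x i ^ a ∈ spanPow x a T → z ∈ spanPow x a T)
  (hcol : ∀ (N : ℕ) (z : κ), z * ∏ i, x i ^ N ∈ spanPow x (N + 1) univ →
    z ∈ spanPow x 1 univ)

include hflat hreg

lemma mem_spanPow_of_t_mul_mem (ht : t ≠ 0) (a : ℕ) (T : Finset (Fin n)) (z : R)
    (hz : t * z ∈ spanPow (fun i => c (x i)) a T) : z ∈ spanPow (fun i => c (x i)) a T := by
  refine mem_spanPow_of_mul_mem (fun z hz => (mul_eq_zero.1 hz).resolve_left ht)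
    (fun S i z hi h => ?_) T z hz
  rw [← map_pow] at h
  exact hflat.mem_sup_of_mul_mem (hreg a S i hi) h

lemma mem_spanPow_of_p_mul_mem (ht : t ≠ 0) (a : ℕ) (T : Finset (Fin n)) (z : Ring p R t)
    (hz : p * z ∈ spanPow (fun i => sharp p t (c (x i))) a T) :
    z ∈ spanPow (fun i => sharp p t (c (x i))) a T := by
  refine mem_spanPow_of_mul_mem (fun z hz => eq_zero_of_p_mul p t ht hz)
    (fun S i z hi h => ?_) T z hz
  obtain ⟨r, hr⟩ := Ideal.Quotient.mk_surjective (red p t z)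
  rw [mem_sup_p_iff p hr.symm]
  rw [mem_sup_p_iff p (r := r * c (x i) ^ a) (by rw [map_mul, ← hr, map_pow, red_sharp, map_mul, map_pow]),
    ← map_pow] at h
  exact hflat.mem_sup_of_mul_mem (hreg a S i hi) h

include hcol

lemma mem_sup_of_mul_prod_mem (ht : t ≠ 0) (N M : ℕ) (z : Ring p R t)
    (hz : z * ∏ i, sharp p t (c (x i)) ^ N ∈
      spanPow (fun i => sharp p t (c (x i))) (N + 1) univ ⊔ Ideal.span {(p : Ring p R t) ^ M}) :
    z ∈ spanPow (fun i => sharp p t (c (x i))) 1 univ ⊔ Ideal.span {(p : Ring p R t) ^ M} := by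
  induction M generalizing z with
  | zero =>
    have : Ideal.span {(p : Ring p R t) ^ 0} = ⊤ := by simp
    rw [this, sup_top_eq]; exact Submodule.mem_top
  | succ M ih =>
    set X := ∏ i, sharp p t (c (x i)) ^ N with hX
    obtain ⟨u, hu, v, hv, huv⟩ := Submodule.mem_sup.1 hz
    obtain ⟨v, rfl⟩ := Ideal.mem_span_singleton'.1 hv
    have h1 : z ∈ spanPow (fun i => sharp p t (c (x i))) 1 univ ⊔
        Ideal.span {(p : Ring p R t)} := by
      obtain ⟨r, hr⟩ := Ideal.Quotient.mk_surjective (red p t z)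
      rw [mem_sup_p_iff p hr.symm]
      apply hflat.mem_sup_of_mul_mem (hcol N)
      have h2 : z * X ∈ spanPow (fun i => sharp p t (c (x i))) (N + 1) univ ⊔
          Ideal.span {(p : Ring p R t)} := by
        rw [← huv]
        refine Submodule.add_mem_sup hu ?_
        rw [pow_succ', mul_left_comm]
        exact Ideal.mul_mem_right _ _ (Ideal.mem_span_singleton_self _)
      rwa [mem_sup_p_iff p (r := r * c (∏ i, x i ^ N)) ?_] at h2
      rw [map_mul, ← hr, hX, map_prod, map_mul, map_prod, map_prod]
      simp
    obtain ⟨u', hu', v', hv', huv'⟩ := Submodule.mem_sup.1 h1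
    obtain ⟨w, rfl⟩ := Ideal.mem_span_singleton'.1 hv'
    have hu'X : u' * X ∈ spanPow (fun i => sharp p t (c (x i))) (N + 1) univ := by
      obtain ⟨b, rfl⟩ := mem_spanPow.1 hu'
      rw [Finset.sum_mul]
      refine Ideal.sum_mem _ fun i _ => ?_
      have : X = sharp p t (c (x i)) ^ N * ∏ j ∈ univ.erase i, sharp p t (c (x j)) ^ N :=
        (Finset.mul_prod_erase _ _ (mem_univ i)).symm
      rw [this, pow_one, mul_assoc, ← mul_assoc (sharp p t (c (x i))), ← pow_succ']
      exact Ideal.mul_mem_left _ _ (Ideal.mul_mem_right _ _ (Ideal.subset_span ⟨i, by simp, rfl⟩))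
    have h3 : p * (w * X - v * p ^ M) ∈
        spanPow (fun i => sharp p t (c (x i))) (N + 1) univ := by
      have : p * (w * X - v * p ^ M) = u - u' * X := by
        rw [← huv'] at huv
        linear_combination -huv
      rw [this]
      exact Ideal.sub_mem _ hu hu'X
    have h4 := mem_spanPow_of_p_mul_mem p hflat hreg ht _ _ _ h3
    have h5 := ih w (by
      rw [← sub_add_cancel (w * X) (v * p ^ M)]
      exact Submodule.add_mem_sup h4 (Ideal.mul_mem_left _ _ (Ideal.mem_span_singleton_self _)))
    obtain ⟨u'', hu'', v'', hv'', huv''⟩ := Submodule.mem_sup.1 h5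
    obtain ⟨y, rfl⟩ := Ideal.mem_span_singleton'.1 hv''
    have : z = (u' + u'' * p) + y * p ^ (M + 1) := by
      rw [← huv', ← huv'']; ring
    rw [this]
    exact Submodule.add_mem_sup (Ideal.add_mem _ hu' (Ideal.mul_mem_right _ _ hu''))
      (Ideal.mul_mem_left _ _ (Ideal.mem_span_singleton_self _))

end Mod

end Untilting

end

section

open Polynomial

lemma spanPow_mono_left {σ A : Type} [CommRing A] {y : σ → A} {a b : ℕ} (h : a ≤ b) (S : Finset σ) :
    spanPow y b S ≤ spanPow y a S := by
  refine Ideal.span_le.2 ?_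
  rintro _ ⟨i, hi, rfl⟩
  exact Ideal.mem_of_dvd _ (pow_dvd_pow _ h) (Ideal.subset_span ⟨i, hi, rfl⟩)

lemma MvPowerSeries.exists_notMem_spanPow {k : Type} [Field k] {n : ℕ} {g : MvPowerSeries (Fin n) k}
    (hg : g ≠ 0) : ∃ a, ∀ b ≥ a, g ∉ spanPow MvPowerSeries.X b univ := by
  obtain ⟨m, hm⟩ : ∃ m, MvPowerSeries.coeff m g ≠ 0 := by
    by_contra! h
    exact hg (MvPowerSeries.ext h)
  refine ⟨∑ i, m i + 1, fun b hb hmem => hm ?_⟩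
  refine (MvPowerSeries.mem_span_X_pow_iff univ b g).1 hmem m fun i _ => ?_
  have := Finset.single_le_sum (f := m) (fun i _ => Nat.zero_le _) (mem_univ i)
  omega

namespace Untilting

variable (p : ℕ) [hp : Fact p.Prime]

section

variable {R : Type} [CommRing R] [IsDomain R] [CharP R p] [PerfectRing R p] {t : R} (ht : t ≠ 0)
  {k : Type} [Field k] [CharP k p] {n : ℕ} {κ : Type} [CommRing κ] [CharP κ p] [PerfectRing κ p]
  {ε : MvPowerSeries (Fin n) k →+* κ} (hε : Function.Injective ε)
  (hpow : ∀ z : κ, ∃ j, z ^ p ^ j ∈ ε.range) {c : κ →+* R}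
  (hflat : RelFlat c (Ideal.span {t})) (hprop : RelProper c (Ideal.span {t}))

include ht hε hpow hflat hprop

lemma exists_pow_notMem {γ : R} {g : MvPowerSeries (Fin n) k} (hg : g ≠ 0) (hγ : t ∣ γ - c (ε g))
    (M : ℕ) : ∃ l, ∀ τ g' : R, τ ^ p ^ (l + 1) = t → g' ^ p ^ l = γ →
      sharp p t (τ * g') ^ M ∉ spanPow (fun i => sharp p t (c (ε (MvPowerSeries.X i)))) 1 univ ⊔
        Ideal.span {(p : Ring p R t)} := by
  obtain ⟨a, ha⟩ := MvPowerSeries.exists_notMem_spanPow hg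
  have hgt : a + 1 < p ^ (a + 1) := Nat.lt_pow_self hp.out.one_lt
  have hMlt : M < p ^ M := Nat.lt_pow_self hp.out.one_lt
  refine ⟨M + (a + 1), fun τ g' hτ hg' hmem => ha (p ^ (a + 1)) (by omega) ?_⟩
  rw [← map_pow, mem_sup_p_iff p (red_sharp p t _)] at hmem
  have hmem2 := Ideal.mul_mem_left _ ((τ * g') ^ (p ^ M - M)) hmem
  rw [← pow_add, Nat.sub_add_cancel hMlt.le] at hmem2
  obtain ⟨u, hu, v, hv, huv⟩ := Submodule.mem_sup.1 hmem2
  obtain ⟨b, rfl⟩ := mem_spanPow.1 hu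
  obtain ⟨e, rfl⟩ := Ideal.mem_span_singleton'.1 hv
  have h1 : (_ : R) ^ p ^ (a + 1) = _ := congrArg (· ^ p ^ (a + 1)) huv
  rw [add_pow_char_pow, sum_pow_char_pow, ← pow_mul, ← pow_add, mul_pow τ, hg'] at h1
  generalize hτ1 : τ ^ p ^ (M + (a + 1)) = τ1 at h1
  have hτ1p : τ1 ^ p = t := by rw [← hτ1, ← pow_mul, ← pow_succ, hτ]
  have hpp : τ1 ^ (p - 1) * τ1 = t := by
    rw [← pow_succ, Nat.sub_add_cancel hp.out.one_le, hτ1p]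
  have hq : t ^ p ^ (a + 1) = t * t ^ (p ^ (a + 1) - 1) := by
    rw [← pow_succ', Nat.sub_add_cancel (by omega)]
  have h2 : t * (γ - τ1 ^ (p - 1) * e ^ p ^ (a + 1) * t ^ (p ^ (a + 1) - 1)) ∈
      spanPow (fun i => c (ε (MvPowerSeries.X i))) (p ^ (a + 1)) univ := by
    refine mem_spanPow.2 ⟨fun i => τ1 ^ (p - 1) * b i ^ p ^ (a + 1), ?_⟩
    rw [mul_pow e, hq] at h1
    have : ∑ i, τ1 ^ (p - 1) * b i ^ p ^ (a + 1) * c (ε (MvPowerSeries.X i)) ^ p ^ (a + 1) =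
        τ1 ^ (p - 1) * ∑ i, (b i * c (ε (MvPowerSeries.X i)) ^ 1) ^ p ^ (a + 1) := by
      rw [mul_sum]
      exact sum_congr rfl fun i _ => by rw [pow_one, mul_pow, mul_assoc]
    rw [this]
    linear_combination τ1 ^ (p - 1) * h1 + γ * hpp
  have h3 := mem_spanPow_of_t_mul_mem (x := fun i => ε (MvPowerSeries.X i)) hflat
    (fun a T i hi z hz => perfection_regular p hε hpow a hi z hz) ht _ _ _ h2
  refine mem_spanPow_of_map_mem p hε hpow (hflat.mem_of_map_mem hprop ?_)
  obtain ⟨s, hs⟩ := hγ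
  have : c (ε g) = (γ - τ1 ^ (p - 1) * e ^ p ^ (a + 1) * t ^ (p ^ (a + 1) - 1)) +
      (τ1 ^ (p - 1) * e ^ p ^ (a + 1) * t ^ (p ^ (a + 1) - 1) - t * s) := by
    rw [← hs]; ring
  rw [this]
  refine Submodule.add_mem_sup h3 (Ideal.mem_span_singleton.2 (dvd_sub ?_ (dvd_mul_right _ _)))
  exact Dvd.dvd.mul_left (dvd_pow_self t (by omega)) _

lemma dvd_of_dvd_mul [IsDomain κ] {γ : R} {g : MvPowerSeries (Fin n) k} (hg : g ≠ 0)
    (hγ : t ∣ γ - c (ε g)) (a : R) (ha : t ∣ γ * a) : t ∣ a := by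
  have h1 : t ∣ a * c (ε g) := by
    have := dvd_sub ha (hγ.mul_right a)
    convert this using 1; ring
  have hbot : ∀ (A : Type) [CommRing A] (y : Fin n → A), spanPow y 1 ∅ = ⊥ := by
    intro A _ y; simp [spanPow]
  have := hflat.mem_sup_of_mul_mem (T := ∅) (T' := ∅) (a := 1) (a' := 1) (y := ε g)
    (x := fun i : Fin n => ε (MvPowerSeries.X i)) (z := a) (fun z hz => ?_) (by
      rw [hbot, bot_sup_eq]; exact Ideal.mem_span_singleton.2 h1)
  · rw [hbot, bot_sup_eq] at this
    exact Ideal.mem_span_singleton.1 this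
  · rw [hbot, Ideal.mem_bot] at hz ⊢
    exact (mul_eq_zero.1 hz).resolve_right fun h => hg (hε (by rw [h, map_zero]))

lemma ne_zero_of_dvd_sub {γ : R} {g : MvPowerSeries (Fin n) k} (hg : g ≠ 0)
    (hγ : t ∣ γ - c (ε g)) : γ ≠ 0 := by
  rintro rfl
  have h1 : c (ε g) ∈ spanPow (fun i => c (ε (MvPowerSeries.X i))) 1 ∅ ⊔ Ideal.span {t} := by
    refine Ideal.mem_sup_right (Ideal.mem_span_singleton.2 ?_)
    rwa [zero_sub, dvd_neg] at hγ
  have h2 := hflat.mem_of_map_mem hprop h1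
  simp only [spanPow, Finset.coe_empty, Set.image_empty, Ideal.span_empty, Ideal.mem_bot] at h2
  exact hg (hε (by rw [h2, map_zero]))

end

/-- The map from a power series ring over Witt vectors to an untilt. -/
def ofPowerSeries {k : Type} [Field k] {n : ℕ}
    (σ : MvPowerSeries (Fin n) (WittVector p k) →+* WittVector p (MvPowerSeries (Fin n) k))
    {R : Type} [CommRing R] (t : R) (c : MvPowerSeries (Fin n) k →+* R) :
    MvPowerSeries (Fin n) (WittVector p k) →+* Ring p R t :=
  (Ideal.Quotient.mk _).comp ((WittVector.map c).comp σ)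

section

variable {k : Type} [Field k] {n : ℕ}
    {σ : MvPowerSeries (Fin n) (WittVector p k) →+* WittVector p (MvPowerSeries (Fin n) k)}
    {R : Type} [CommRing R] (t : R) (c : MvPowerSeries (Fin n) k →+* R)

lemma map_ofPowerSeries {R' : Type} [CommRing R'] (j : R →+* R') {t' : R'} (h : j t = t') (a) :
    map p j h (ofPowerSeries p σ t c a) = ofPowerSeries p σ t' (j.comp c) a := by
  have : WittVector.map (p := p) (j.comp c) (σ a) = WittVector.map j (WittVector.map c (σ a)) := by
    ext i; simp
  unfold ofPowerSeries map
  simp only [RingHom.comp_apply, this]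
  rfl

lemma ofPowerSeries_X (hσ : ∀ i, σ (MvPowerSeries.X i) = WittVector.teichmuller p (MvPowerSeries.X i))
    (i : Fin n) : ofPowerSeries p σ t c (MvPowerSeries.X i) = sharp p t (c (MvPowerSeries.X i)) := by
  unfold ofPowerSeries
  simp only [RingHom.comp_apply, hσ, WittVector.map_teichmuller]
  rfl

lemma red_ofPowerSeries [CharP R p] (hσ : ∀ a, (σ a).coeff 0 = MvPowerSeries.map WittVector.constantCoeff a)
    (a) : red p t (ofPowerSeries p σ t c a) =
      Ideal.Quotient.mk _ (c (MvPowerSeries.map WittVector.constantCoeff a)) := by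
  unfold ofPowerSeries red
  simp only [RingHom.comp_apply, Ideal.Quotient.lift_mk]
  rw [← hσ]
  simp [WittVector.constantCoeff]

end

lemma nontrivial_of_relProper {R : Type} [CommRing R] [CharP R p] {t : R} {κ : Type} [CommRing κ]
    [Nontrivial κ] {c : κ →+* R} (h : RelProper c (Ideal.span {t})) : Nontrivial (Ring p R t) := by
  have : Nontrivial (R ⧸ Ideal.span {t}) := by
    refine Ideal.Quotient.nontrivial_iff.2 fun ht => ?_
    have := h 0 Fin.elim0 Fin.elim0 (by rw [ht]; exact Submodule.mem_top)
    rw [Set.range_eq_empty, Ideal.span_empty] at this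
    exact bot_ne_top this
  exact (red p t).domain_nontrivial

section

variable {K : Type} [Field K] [CharP K p] [PerfectRing K p] {R : Subring K} [RootClosed p R]
  {t : R} (ht : t ≠ 0)
  {k : Type} [Field k] [CharP k p] {n : ℕ} {κ : Type} [CommRing κ] [IsDomain κ] [CharP κ p]
  [PerfectRing κ p]
  {ε : MvPowerSeries (Fin n) k →+* κ} (hε : Function.Injective ε)
  (hpow : ∀ z : κ, ∃ j, z ^ p ^ j ∈ ε.range) {c : κ →+* R}
  (hflat : RelFlat c (Ideal.span {t})) (hprop : RelProper c (Ideal.span {t}))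

include ht hε hpow hflat hprop

lemma dvd_of_forall_pow_dvd {γ : R} {g : MvPowerSeries (Fin n) k} (hg : g ≠ 0)
    (hγ : t ∣ γ - c (ε g)) {τ g' : R} {l : ℕ} (hτ : τ ^ p ^ (l + 1) = t) (hg' : g' ^ p ^ l = γ)
    (j : ℕ) (z : Ring p R t) (hz : ∀ k : ℕ, (p ^ j * sharp p t γ) ^ k ∣ z ^ (k + 1)) :
    p ^ j * sharp p t γ ∣ sharp p t (τ * g') * z := by
  have hγ0 := ne_zero_of_dvd_sub p ht hε hpow hflat hprop hg hγ
  have hnzd := dvd_of_dvd_mul p ht hε hpow hflat hprop hg hγ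
  have hpj : (p : Ring p R t) ^ j * sharp p t γ = sharp p t (t ^ j * γ) := by
    rw [map_mul, map_pow, sharp_t]
  simp only [hpj] at hz ⊢
  obtain ⟨t, htR⟩ := t
  obtain ⟨γ, hγR⟩ := γ
  obtain ⟨τ, hτR⟩ := τ
  obtain ⟨g', hgR⟩ := g'
  exact sharp_dvd_of_forall_pow_dvd p htR (fun h => ht (Subtype.ext h)) hγR
    (fun h => hγ0 (Subtype.ext h)) hτR hgR (congrArg Subtype.val hτ) (congrArg Subtype.val hg') j
    hnzd z hz

lemma eq_zero_of_sharp_mul {γ : R} {g : MvPowerSeries (Fin n) k} (hg : g ≠ 0)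
    (hγ : t ∣ γ - c (ε g)) (z : Ring p R t) (hz : sharp p t γ * z = 0) : z = 0 := by
  refine eq_zero_of_forall_dvd p t ht fun m => ?_
  exact p_pow_dvd_of_sharp_mul p ht (dvd_of_dvd_mul p ht hε hpow hflat hprop hg hγ) m z
    (by rw [hz]; exact dvd_zero _)

end

lemma exists_almost_cohenMacaulay_algebra_aux {K : Type} [Field K] [CharP K p] [PerfectRing K p]
    {R : Subring K} [RootClosed p R] {k : Type} [Field k] [CharP k p] [PerfectRing k p] {n : ℕ}
    {σ : MvPowerSeries (Fin n) (WittVector p k) →+* WittVector p (MvPowerSeries (Fin n) k)}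
    (hσX : ∀ i, σ (MvPowerSeries.X i) = WittVector.teichmuller p (MvPowerSeries.X i))
    (hσ : ∀ a, (σ a).coeff 0 = MvPowerSeries.map WittVector.constantCoeff a)
    {t : R} (ht : t ≠ 0) {κ : Type} [CommRing κ] [IsDomain κ] [CharP κ p] [PerfectRing κ p]
    {ε : MvPowerSeries (Fin n) k →+* κ} (hε : Function.Injective ε)
    (hpow : ∀ z : κ, ∃ j, z ^ p ^ j ∈ ε.range) {c : κ →+* R}
    (hflat : RelFlat c (Ideal.span {t})) (hprop : RelProper c (Ideal.span {t}))
    {f : (MvPowerSeries (Fin n) (WittVector p k))[X]} {r : Ring p R t}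
    (hroot : f.eval₂ (ofPowerSeries p σ t (c.comp ε)) r = 0)
    {g : MvPowerSeries (Fin n) (WittVector p k)}
    (hg : MvPowerSeries.map WittVector.constantCoeff g ≠ 0) {γ : R}
    (hγ : sharp p t γ = ofPowerSeries p σ t (c.comp ε) g) :
    ∃ (P : Type) (_ : CommRing P) (Φ : MvPowerSeries (Fin n) (WittVector p k) →+* P) (E : Set P),
      (∃ r, f.eval₂ Φ r = 0) ∧
      (∀ (a : ℕ) (z : P), p * z ∈ spanPow (fun i => Φ (MvPowerSeries.X i)) a univ →
        z ∈ spanPow (fun i => Φ (MvPowerSeries.X i)) a univ) ∧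
      (∀ (N M : ℕ) (z : P), z * ∏ i, Φ (MvPowerSeries.X i) ^ N ∈
          spanPow (fun i => Φ (MvPowerSeries.X i)) (N + 1) univ ⊔ Ideal.span {(p : P) ^ M} →
        z ∈ spanPow (fun i => Φ (MvPowerSeries.X i)) 1 univ ⊔ Ideal.span {(p : P) ^ M}) ∧
      (∀ z : P, p * z = 0 → z = 0) ∧ (∀ z, Φ g * z = 0 → z = 0) ∧
      (∀ (j : ℕ) (z : P), (∀ k : ℕ, (p ^ j * Φ g) ^ k ∣ z ^ (k + 1)) → ∀ e ∈ E, p ^ j * Φ g ∣ e * z) ∧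
      (∀ M, ∃ e ∈ E, e ^ M ∉ spanPow (fun i => Φ (MvPowerSeries.X i)) 1 univ ⊔
        Ideal.span {(p : P)}) := by
  have hX : ∀ i, ofPowerSeries p σ t (c.comp ε) (MvPowerSeries.X i) =
      sharp p t (c (ε (MvPowerSeries.X i))) := fun i => ofPowerSeries_X p t _ hσX i
  have hγt : t ∣ γ - c (ε (MvPowerSeries.map WittVector.constantCoeff g)) := by
    have := red_ofPowerSeries p t (c.comp ε) hσ g
    rw [← hγ, red_sharp, Ideal.Quotient.eq, Ideal.mem_span_singleton] at this
    exact this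
  refine ⟨Ring p R t, inferInstance, ofPowerSeries p σ t (c.comp ε),
    {e | ∃ l, ∃ τ g' : R, τ ^ p ^ (l + 1) = t ∧ g' ^ p ^ l = γ ∧ e = sharp p t (τ * g')},
    ⟨r, hroot⟩, ?_, ?_, fun z hz => eq_zero_of_p_mul p t ht hz, ?_, ?_, ?_⟩
  · simp only [hX]
    exact fun a z => mem_spanPow_of_p_mul_mem (x := fun i => ε (MvPowerSeries.X i)) p hflat
      (fun a T i hi z hz => perfection_regular p hε hpow a hi z hz) ht a univ z
  · simp only [hX]
    refine fun N M z => mem_sup_of_mul_prod_mem (x := fun i => ε (MvPowerSeries.X i)) p hflat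
      (fun a T i hi z hz => perfection_regular p hε hpow a hi z hz) (fun N z hz => ?_) ht N M z
    refine perfection_colon p hε hpow N z ?_
    simpa only [map_prod, map_pow] using hz
  · simp only [← hγ]
    exact eq_zero_of_sharp_mul p ht hε hpow hflat hprop hg hγt
  · simp only [← hγ]
    rintro j z hz _ ⟨l, τ, g', hτ, hg', rfl⟩
    exact dvd_of_forall_pow_dvd p ht hε hpow hflat hprop hg hγt hτ hg' j z hz
  · simp only [hX]
    intro M
    obtain ⟨l, hl⟩ := exists_pow_notMem p ht hε hpow hflat hprop hg hγt M
    obtain ⟨τ, hτ⟩ := exists_root p t (l + 1)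
    obtain ⟨g', hg'⟩ := exists_root p γ l
    exact ⟨_, ⟨l, τ, g', hτ, hg', rfl⟩, hl τ g' hτ hg'⟩

/-- Almost Cohen–Macaulay algebras over power series rings over Witt vectors. -/
theorem exists_almost_cohenMacaulay_algebra {k : Type} [Field k] [CharP k p] [PerfectRing k p] {n : ℕ}
    (f : (MvPowerSeries (Fin n) (WittVector p k))[X]) (hf : f.Monic) (hdeg : 0 < f.natDegree)
    (g : MvPowerSeries (Fin n) (WittVector p k))
    (hg : MvPowerSeries.map WittVector.constantCoeff g ≠ 0) :
    ∃ (P : Type) (_ : CommRing P) (Φ : MvPowerSeries (Fin n) (WittVector p k) →+* P) (E : Set P),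
      (∃ r, f.eval₂ Φ r = 0) ∧
      (∀ (a : ℕ) (z : P), p * z ∈ spanPow (fun i => Φ (MvPowerSeries.X i)) a univ →
        z ∈ spanPow (fun i => Φ (MvPowerSeries.X i)) a univ) ∧
      (∀ (N M : ℕ) (z : P), z * ∏ i, Φ (MvPowerSeries.X i) ^ N ∈
          spanPow (fun i => Φ (MvPowerSeries.X i)) (N + 1) univ ⊔ Ideal.span {(p : P) ^ M} →
        z ∈ spanPow (fun i => Φ (MvPowerSeries.X i)) 1 univ ⊔ Ideal.span {(p : P) ^ M}) ∧
      (∀ z : P, p * z = 0 → z = 0) ∧ (∀ z, Φ g * z = 0 → z = 0) ∧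
      (∀ (j : ℕ) (z : P), (∀ k : ℕ, (p ^ j * Φ g) ^ k ∣ z ^ (k + 1)) → ∀ e ∈ E, p ^ j * Φ g ∣ e * z) ∧
      (∀ M, ∃ e ∈ E, e ^ M ∉ spanPow (fun i => Φ (MvPowerSeries.X i)) 1 univ ⊔
        Ideal.span {(p : P)}) := by
  obtain ⟨L, _, _, _, κ, _, ε, hε, hpow⟩ := exists_perfection p k n
  obtain ⟨σ, hσX, hσ⟩ := exists_powerSeries_ringHom p k n
  obtain ⟨K₀, _, _, _, R₀, _, t₀, c₀, ht₀, hflat₀, hprop₀⟩ := exists_base p κ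
  obtain ⟨K₁, _, _, _, R₁, _, j₁, ht₁, hflat₁, hprop₁, ξ, hξ⟩ := exists_extension_root p R₀ t₀ ht₀ c₀
    hflat₀ hprop₀ (f.map (ofPowerSeries p σ t₀ (c₀.comp ε))) (hf.map _) (by
      have := nontrivial_of_relProper p hprop₀
      rwa [hf.natDegree_map])
  obtain ⟨K₂, _, _, _, R, _, j₂, ht, hflat, hprop, γ, hγ⟩ := exists_extension_root p R₁ (j₁ t₀) ht₁
    (j₁.comp c₀) hflat₁ hprop₁ (X - C (ofPowerSeries p σ _ ((j₁.comp c₀).comp ε) g))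
      (monic_X_sub_C _) (by
      have := nontrivial_of_relProper p hprop₁
      rw [natDegree_X_sub_C]; exact one_pos)
  rw [eval₂_sub, eval₂_X, eval₂_C, map_ofPowerSeries, sub_eq_zero] at hγ
  have hroot : f.eval₂ (ofPowerSeries p σ (j₂ (j₁ t₀)) ((j₂.comp (j₁.comp c₀)).comp ε))
      (map p j₂ rfl (sharp p (j₁ t₀) ξ)) = 0 := by
    have h := congrArg (map p j₂ (t := j₁ t₀) rfl) hξ
    rw [map_zero, hom_eval₂, eval₂_map] at h
    rw [← h]
    congr 1
  exact exists_almost_cohenMacaulay_algebra_aux p hσX hσ ht hε hpow hflat hprop hroot hg hγ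

end Untilting

end

section

open Polynomial

section Almost

variable {A D P : Type} [CommRing A] [CommRing D] [CommRing P] [Algebra A D] (Φ : A →+* P)
  {ρ : D →+ P} (hlin : ∀ b δ, ρ (algebraMap A D b * δ) = Φ b * ρ δ)
  (hmul : ∀ δ δ', ρ δ * ρ δ' = ρ 1 * ρ (δ * δ')) {n : ℕ} {x : Fin n → A}

include hlin

lemma map_mem_spanPow {a : ℕ} {T : Finset (Fin n)} {z : D}
    (hz : z ∈ spanPow (fun i => algebraMap A D (x i)) a T) : ρ z ∈ spanPow (fun i => Φ (x i)) a T := by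
  obtain ⟨b, rfl⟩ := mem_spanPow.1 hz
  refine mem_spanPow.2 ⟨fun i => ρ (b i), ?_⟩
  rw [map_sum]
  refine sum_congr rfl fun i _ => ?_
  rw [← map_pow, ← map_pow, mul_comm (b i), hlin, mul_comm]

include hmul

/-- An almost multiplicative map to an algebra in which `p, x` behaves like a regular sequence
forces `ρ 1` to be topologically nilpotent in the presence of the given relations. -/
lemma pow_mem_of_relation {p : ℕ}
    (hreg : ∀ (a : ℕ) (z : P), p * z ∈ spanPow (fun i => Φ (x i)) a univ →
      z ∈ spanPow (fun i => Φ (x i)) a univ)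
    (hcol : ∀ (N M : ℕ) (z : P), z * ∏ i, Φ (x i) ^ N ∈
        spanPow (fun i => Φ (x i)) (N + 1) univ ⊔ Ideal.span {(p : P) ^ M} →
      z ∈ spanPow (fun i => Φ (x i)) 1 univ ⊔ Ideal.span {(p : P) ^ M})
    {N Q M : ℕ} {y w s : D}
    (hrel : (∏ i, algebraMap A D (x i) ^ N) * y ^ N - s * y ^ (N + 1) ∈
      spanPow (fun i => algebraMap A D (x i)) (N + 1) univ)
    (hw : y * w - p ^ Q ∈ spanPow (fun i => algebraMap A D (x i)) (N + 1) univ)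
    (hy : y ^ M ∈ spanPow (fun i => algebraMap A D (x i)) 1 univ ⊔ Ideal.span {(p : D)}) :
    ρ 1 ^ (3 * M + 1) ∈ spanPow (fun i => Φ (x i)) 1 univ ⊔ Ideal.span {(p : P)} := by
  have hreg' : ∀ (a m : ℕ) (z : P), p ^ m * z ∈ spanPow (fun i => Φ (x i)) a univ →
      z ∈ spanPow (fun i => Φ (x i)) a univ := by
    intro a m
    induction m with
    | zero => intro z hz; simpa using hz
    | succ m ih => intro z hz; exact ih z (hreg a _ (by rwa [← mul_assoc, ← pow_succ']))
  have hnat : ∀ (m : ℕ) (δ : D), ρ (p ^ m * δ) = p ^ m * ρ δ := by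
    intro m δ
    have := hlin (p ^ m) δ
    simpa using this
  have hpow : ∀ m, ρ 1 * ρ y ^ m = ρ 1 ^ m * ρ (y ^ m) := by
    intro m
    induction m with
    | zero => simp
    | succ m ih =>
      rw [pow_succ, ← mul_assoc, ih, mul_assoc, hmul, pow_succ, pow_succ, mul_assoc]
  have hX : ∀ δ, ρ ((∏ i, algebraMap A D (x i) ^ N) * δ) = (∏ i, Φ (x i) ^ N) * ρ δ := by
    intro δ
    have := hlin (∏ i, x i ^ N) δ
    simpa only [map_prod, map_pow] using this
  set J := spanPow (fun i => algebraMap A D (x i)) (N + 1) univ with hJ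
  set X := ∏ i, algebraMap A D (x i) ^ N with hXdef
  have h1 : (p : D) ^ (Q * N) * (X - s * y) ∈ J := by
    have e1 : (y * w) ^ N - ((p : D) ^ Q) ^ N ∈ J := Ideal.mem_of_dvd _ (sub_dvd_pow_sub_pow _ _ N) hw
    have e2 := Ideal.mul_mem_left _ (w ^ N) hrel
    have e3 := Ideal.mul_mem_left _ (X - s * y) e1
    have := Ideal.sub_mem _ e2 e3
    convert this using 1
    rw [pow_mul]; ring
  have h2 : (∏ i, Φ (x i) ^ N) * ρ 1 - ρ (s * y) ∈ spanPow (fun i => Φ (x i)) (N + 1) univ := by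
    have := map_mem_spanPow Φ hlin h1
    rw [hnat] at this
    have := hreg' _ _ _ this
    rwa [map_sub, ← mul_one X, hX] at this
  have h3 : ρ 1 * ρ w * (∏ i, Φ (x i) ^ N) ∈
      spanPow (fun i => Φ (x i)) (N + 1) univ ⊔ Ideal.span {(p : P) ^ Q} := by
    have e1 := map_mem_spanPow Φ hlin (Ideal.mul_mem_left _ s hw)
    rw [mul_sub, map_sub, mul_comm s (_ ^ Q), hnat] at e1
    have e2 := hmul (s * y) w
    rw [mul_assoc] at e2
    have : ρ 1 * ρ w * (∏ i, Φ (x i) ^ N) = (ρ w * ((∏ i, Φ (x i) ^ N) * ρ 1 - ρ (s * y)) +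
        ρ 1 * (ρ (s * (y * w)) - p ^ Q * ρ s)) + (ρ 1 * ρ s) * p ^ Q := by
      linear_combination e2
    rw [this]
    exact Submodule.add_mem_sup (Ideal.add_mem _ (Ideal.mul_mem_left _ _ h2)
      (Ideal.mul_mem_left _ _ e1)) (Ideal.mul_mem_left _ _ (Ideal.mem_span_singleton_self _))
  obtain ⟨u, hu, v, hv, huv⟩ := Submodule.mem_sup.1 (hcol _ _ _ h3)
  obtain ⟨v, rfl⟩ := Ideal.mem_span_singleton'.1 hv
  have h4 : ρ 1 ^ 3 - v * ρ y ∈ spanPow (fun i => Φ (x i)) 1 univ := by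
    refine hreg' 1 Q _ ?_
    have e1 := map_mem_spanPow Φ hlin hw
    have e0 : ρ ((p : D) ^ Q) = p ^ Q * ρ 1 := by rw [← hnat, mul_one]
    rw [map_sub, e0] at e1
    have e1 := spanPow_mono_left (Nat.le_add_left 1 N) _ e1
    have e2 := hmul y w
    have : (p : P) ^ Q * (ρ 1 ^ 3 - v * ρ y) = u * ρ y - ρ 1 ^ 2 * (ρ (y * w) - p ^ Q * ρ 1) := by
      linear_combination - ρ y * huv - ρ 1 * e2
    rw [this]
    exact Ideal.sub_mem _ (Ideal.mul_mem_right _ _ hu) (Ideal.mul_mem_left _ _ e1)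
  have h5 : ρ (y ^ M) ∈ spanPow (fun i => Φ (x i)) 1 univ ⊔ Ideal.span {(p : P)} := by
    obtain ⟨a, ha, b, hb, hab⟩ := Submodule.mem_sup.1 hy
    obtain ⟨b, rfl⟩ := Ideal.mem_span_singleton'.1 hb
    rw [← hab, map_add]
    refine Submodule.add_mem_sup (map_mem_spanPow Φ hlin ha) (Ideal.mem_span_singleton.2 ⟨ρ b, ?_⟩)
    simpa [mul_comm] using hnat 1 b
  have h6 : (ρ 1 ^ 3) ^ M - (v * ρ y) ^ M ∈ spanPow (fun i => Φ (x i)) 1 univ :=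
    Ideal.mem_of_dvd _ (sub_dvd_pow_sub_pow _ _ M) h4
  have : ρ 1 ^ (3 * M + 1) = ρ 1 * ((ρ 1 ^ 3) ^ M - (v * ρ y) ^ M) + v ^ M * ρ 1 ^ M * ρ (y ^ M) := by
    rw [mul_pow, pow_succ, pow_mul]
    linear_combination v ^ M * hpow M
  rw [this]
  exact Ideal.add_mem _ (Ideal.mem_sup_left (Ideal.mul_mem_left _ _ h6)) (Ideal.mul_mem_left _ _ h5)

end Almost

section Primitive

variable (A D : Type) [CommRing A] [IsDomain A] [CommRing D] [IsDomain D] [Algebra A D]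
  [Module.Finite A D] [FaithfulSMul A D]

/-- A finite extension of domains of characteristic zero is generated by one element up to a
nonzero factor. -/
lemma exists_forall_exists_aeval_eq_of_isFractionRing (K L : Type) [Field K] [Field L] [Algebra A K]
    [IsFractionRing A K] [Algebra D L] [IsFractionRing D L] [Algebra A L] [IsScalarTower A D L]
    [Algebra K L] [IsScalarTower A K L] [FiniteDimensional K L] [Algebra.IsSeparable K L] :
    ∃ (θ : D) (a : A), a ≠ 0 ∧ ∀ δ : D, ∃ h : A[X], aeval θ h = a • δ := by
  have hden : ∀ z : L, ∃ b : A, b ≠ 0 ∧ ∃ d : D, algebraMap D L d = algebraMap A L b * z := by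
    intro z
    obtain ⟨d₁, d₂, hd₂, rfl⟩ := IsFractionRing.div_surjective (A := D) z
    have := nonZeroDivisors.ne_zero hd₂
    obtain ⟨y, b, hb, hby⟩ : ∃ (y : D) (b : A), b ≠ 0 ∧ algebraMap A D b = d₂ * y := by
      have := (Algebra.IsIntegral.isIntegral (R := A) d₂).isAlgebraic
      have h2 := this.exists_nonzero_dvd (nonZeroDivisors.ne_zero hd₂ |> mem_nonZeroDivisors_of_ne_zero)
      obtain ⟨b, hb, y, hy⟩ := h2
      exact ⟨y, b, hb, hy⟩
    refine ⟨b, hb, d₁ * y, ?_⟩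
    have hne : algebraMap D L d₂ ≠ 0 := by simpa using this
    rw [IsScalarTower.algebraMap_apply A D L, hby, map_mul, map_mul]
    linear_combination -algebraMap D L y * mul_div_cancel₀ (algebraMap D L d₁) hne
  obtain ⟨θ₀, hθ₀⟩ := Field.exists_primitive_element K L
  obtain ⟨b, hb, θ, hθ⟩ := hden θ₀
  have hbK : algebraMap A K b ≠ 0 := by simpa using hb
  have htop : Algebra.adjoin K {algebraMap D L θ} = ⊤ := by
    rw [eq_top_iff, ← IntermediateField.top_toSubalgebra, ← hθ₀,
      IntermediateField.adjoin_simple_toSubalgebra_of_isAlgebraic (Algebra.IsAlgebraic.isAlgebraic _)]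
    refine Algebra.adjoin_le ?_
    rw [Set.singleton_subset_iff, SetLike.mem_coe]
    have h1 : θ₀ = (algebraMap A K b)⁻¹ • algebraMap D L θ := by
      rw [hθ, IsScalarTower.algebraMap_apply A K L, ← Algebra.smul_def, smul_smul,
        inv_mul_cancel₀ hbK, one_smul]
    have h2 := Subalgebra.smul_mem _ (Algebra.self_mem_adjoin_singleton K (algebraMap D L θ))
      (algebraMap A K b)⁻¹
    rwa [← h1] at h2
  have hone : ∀ δ : D, ∃ (a : A) (h : A[X]), a ≠ 0 ∧ aeval θ h = a • δ := by
    intro δ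
    have : algebraMap D L δ ∈ Algebra.adjoin K {algebraMap D L θ} := by rw [htop]; trivial
    rw [Algebra.adjoin_singleton_eq_range_aeval] at this
    obtain ⟨F, hF⟩ := this
    obtain ⟨a, ha, hh⟩ := IsLocalization.integerNormalization_spec (nonZeroDivisors A) F
    refine ⟨a, IsLocalization.integerNormalization (nonZeroDivisors A) F, nonZeroDivisors.ne_zero ha,
      IsFractionRing.injective D L ?_⟩
    have h1 := congrArg (aeval (algebraMap D L θ)) hh
    rw [aeval_map_algebraMap, aeval_algebraMap_apply] at h1
    rw [h1, ← IsScalarTower.algebraMap_smul K a F, map_smul, Algebra.smul_def, Algebra.smul_def,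
      map_mul, ← IsScalarTower.algebraMap_apply A D L, ← IsScalarTower.algebraMap_apply A K L]
    congr 1
  obtain ⟨m, v, hv⟩ := Module.Finite.exists_fin (R := A) (M := D)
  choose a h ha hh using fun i => hone (v i)
  refine ⟨θ, ∏ i, a i, Finset.prod_ne_zero_iff.2 fun i _ => ha i, fun δ => ?_⟩
  have hδ : δ ∈ Submodule.span A (Set.range v) := by rw [hv]; trivial
  obtain ⟨b, rfl⟩ := (Submodule.mem_span_range_iff_exists_fun A).1 hδ
  choose a' ha' using fun i => Finset.dvd_prod_of_mem a (mem_univ i)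
  refine ⟨∑ i, C (b i * a' i) * h i, ?_⟩
  rw [map_sum, Finset.smul_sum]
  refine sum_congr rfl fun i _ => ?_
  rw [map_mul, aeval_C, hh, ← Algebra.smul_def, smul_smul, smul_smul]
  congr 1
  rw [ha' i]; ring

lemma exists_forall_exists_aeval_eq [CharZero A] : ∃ (θ : D) (a : A), a ≠ 0 ∧
    ∀ δ : D, ∃ h : A[X], aeval θ h = a • δ := by
  let _ : Algebra (FractionRing A) (FractionRing D) := FractionRing.liftAlgebra A (FractionRing D)
  have : IsScalarTower A (FractionRing A) (FractionRing D) :=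
    FractionRing.isScalarTower_liftAlgebra A _
  exact exists_forall_exists_aeval_eq_of_isFractionRing A D (FractionRing A) (FractionRing D)

end Primitive

section Mixed

variable (p : ℕ) [hp : Fact p.Prime] {A D : Type} [CommRing A] [IsDomain A] [IsIntegrallyClosed A]
  [CharZero A] [CommRing D] [IsDomain D] [Algebra A D] [Module.Finite A D] [FaithfulSMul A D]
  {k : Type} [Field k] [CharP k p] [PerfectRing k p] {n : ℕ}
  (α : A →+* MvPowerSeries (Fin n) (WittVector p k))
  (hα : ∀ a ≠ 0, ∃ (j : ℕ) (g : A), a = p ^ j * g ∧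
    MvPowerSeries.map WittVector.constantCoeff (α g) ≠ 0)
  (x : Fin n → A) (hx : ∀ i, α (x i) = MvPowerSeries.X i)

include hα hx

/-- The key input in mixed characteristic. -/
theorem false_of_relation {N Q M : ℕ} {y w s : D}
    (hrel : (∏ i, algebraMap A D (x i) ^ N) * y ^ N - s * y ^ (N + 1) ∈
      spanPow (fun i => algebraMap A D (x i)) (N + 1) univ)
    (hw : y * w - p ^ Q ∈ spanPow (fun i => algebraMap A D (x i)) (N + 1) univ)
    (hy : y ^ M ∈ spanPow (fun i => algebraMap A D (x i)) 1 univ ⊔ Ideal.span {(p : D)}) :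
    False := by
  obtain ⟨θ, a, ha, hθ⟩ := exists_forall_exists_aeval_eq A D
  obtain ⟨j, g, rfl, hg⟩ := hα a ha
  have hint : IsIntegral A θ := Algebra.IsIntegral.isIntegral θ
  obtain ⟨P, _, Φ, E, ⟨r, hr⟩, hreg, hcol, hp0, hg0, hE, hEnot⟩ :=
    Untilting.exists_almost_cohenMacaulay_algebra p ((minpoly A θ).map α)
      ((minpoly.monic hint).map _) (by
        rw [(minpoly.monic hint).natDegree_map]; exact minpoly.natDegree_pos hint) (α g) hg
  rw [eval₂_map] at hr
  have hcongr : ∀ h h' : A[X], aeval θ h = aeval θ h' →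
      h.eval₂ (Φ.comp α) r = h'.eval₂ (Φ.comp α) r := by
    intro h h' hh
    obtain ⟨q, hq⟩ := minpoly.isIntegrallyClosed_dvd hint (p := h - h') (by rw [map_sub, hh, sub_self])
    rw [← sub_eq_zero, ← eval₂_sub, hq, eval₂_mul, hr, zero_mul]
  choose h hh using hθ
  obtain ⟨e, heE, he⟩ := hEnot (3 * M + 1)
  have hΦa : Φ (α (p ^ j * g)) = p ^ j * Φ (α g) := by simp
  have hnzd : ∀ z z', Φ (α (p ^ j * g)) * z = Φ (α (p ^ j * g)) * z' → z = z' := by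
    intro z z' hz
    rw [← sub_eq_zero, ← mul_sub, hΦa, mul_assoc] at hz
    have : ∀ m : ℕ, ∀ z : P, p ^ m * z = 0 → z = 0 := by
      intro m
      induction m with
      | zero => intro z hz; simpa using hz
      | succ m ih => intro z hz; exact ih z (hp0 _ (by rwa [← mul_assoc, ← pow_succ']))
    exact sub_eq_zero.1 (hg0 _ (this _ _ hz))
  have hρ : ∀ δ : D, ∃ z, Φ (α (p ^ j * g)) * z = e * (h δ).eval₂ (Φ.comp α) r := by
    intro δ
    obtain ⟨z, hz⟩ := hE j ((h δ).eval₂ (Φ.comp α) r) (fun m => by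
      refine ⟨(h (δ ^ (m + 1))).eval₂ (Φ.comp α) r, ?_⟩
      rw [← hΦa, ← eval₂_pow, ← RingHom.comp_apply, ← map_pow, ← eval₂_C (Φ.comp α) r, ← eval₂_mul]
      refine hcongr _ _ ?_
      rw [map_pow, map_mul, aeval_C, hh, hh, Algebra.smul_def, Algebra.smul_def, map_pow]
      ring) e heE
    exact ⟨z, by rw [hz, hΦa]⟩
  choose ρ hρ using hρ
  let ρ' : D →+ P := AddMonoidHom.mk' ρ fun δ δ' => hnzd _ _ (by
    rw [mul_add, hρ, hρ, hρ, ← mul_add, ← eval₂_add]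
    congr 1
    exact hcongr _ _ (by rw [map_add, hh, hh, hh, smul_add]))
  have hρ'1 : ρ' 1 = e := hnzd _ _ (by
    change Φ _ * ρ 1 = _
    rw [hρ, mul_comm, hcongr (h 1) (C (p ^ j * g)) (by rw [hh, aeval_C, Algebra.smul_def, mul_one]),
      eval₂_C]
    rfl)
  have := pow_mem_of_relation (Φ.comp α) (ρ := ρ') (x := x) (p := p) (fun b δ => hnzd _ _ ?_)
    (fun δ δ' => ?_) ?_ ?_ hrel hw hy
  · rw [hρ'1] at this
    simp only [RingHom.comp_apply, hx] at this
    exact he this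
  · change Φ _ * ρ _ = Φ _ * (_ * ρ δ)
    rw [mul_left_comm, hρ, hρ, mul_left_comm]
    congr 1
    rw [← eval₂_C (Φ.comp α) r, ← eval₂_mul]
    refine hcongr _ _ ?_
    rw [map_mul, aeval_C, hh, hh, Algebra.smul_def, Algebra.smul_def]; ring
  · refine hnzd _ _ (hnzd _ _ ?_)
    rw [hρ'1]
    change Φ _ * (Φ _ * (ρ δ * ρ δ')) = Φ _ * (Φ _ * (e * ρ (δ * δ')))
    have e1 : Φ (α (p ^ j * g)) * (h (δ * δ')).eval₂ (Φ.comp α) r =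
        (h δ).eval₂ (Φ.comp α) r * (h δ').eval₂ (Φ.comp α) r := by
      rw [← RingHom.comp_apply, ← eval₂_C (Φ.comp α) r, ← eval₂_mul, ← eval₂_mul]
      refine hcongr _ _ ?_
      rw [map_mul (aeval θ), map_mul (aeval θ), aeval_C, hh, hh, hh, Algebra.smul_def, Algebra.smul_def, Algebra.smul_def]
      ring
    linear_combination Φ (α (p ^ j * g)) * ρ δ' * hρ δ + e * (h δ).eval₂ (Φ.comp α) r * hρ δ' -
      e * Φ (α (p ^ j * g)) * hρ (δ * δ') - e ^ 2 * e1
  · simpa only [RingHom.comp_apply, hx] using hreg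
  · simpa only [RingHom.comp_apply, hx] using hcol

end Mixed

end

section

/-! ## p-bases -/

open Polynomial

variable (p : ℕ) [hp : Fact p.Prime] {k : Type} [Field k] [CharP k p]

/-- An element of height one over a subfield satisfying a polynomial of small degree lies in the
subfield. -/
lemma Subfield.mem_of_aeval_eq_zero (F : Subfield k) {a : k} (ha : a ^ p ∈ F) {Q : F[X]} (hQ : Q ≠ 0)
    (hdeg : Q.natDegree < p) (h : aeval a Q = 0) : a ∈ F := by
  have hint : IsIntegral F a := ⟨X ^ p - C ⟨a ^ p, ha⟩, monic_X_pow_sub_C _ hp.out.ne_zero, by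
    simp only [eval₂_sub, eval₂_X_pow, eval₂_C, sub_eq_zero]; rfl⟩
  have h1 : (minpoly F a).map (algebraMap F k) ∣ (X - C a) ^ p := by
    have h2 : minpoly F a ∣ X ^ p - C ⟨a ^ p, ha⟩ := minpoly.dvd F a (by
      simp only [map_sub, map_pow, aeval_X, aeval_C, sub_eq_zero]; rfl)
    have h3 := Polynomial.map_dvd (algebraMap F k) h2
    rw [sub_pow_char, ← C_pow]
    simp only [Polynomial.map_sub, Polynomial.map_pow, map_X, map_C] at h3
    exact h3
  obtain ⟨j, hj, hass⟩ := (dvd_prime_pow (prime_X_sub_C a) p).1 h1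
  have heq := eq_of_monic_of_associated ((minpoly.monic hint).map _) ((monic_X_sub_C a).pow j) hass
  have hjdeg : (minpoly F a).natDegree = j := by
    rw [← natDegree_map (algebraMap F k), heq, (monic_X_sub_C a).natDegree_pow, natDegree_X_sub_C,
      mul_one]
  have hj0 : 0 < j := hjdeg ▸ minpoly.natDegree_pos hint
  have hjp : j < p := by
    rw [← hjdeg]
    exact (natDegree_le_of_dvd (minpoly.dvd F a h) hQ).trans_lt hdeg
  have h4 : algebraMap F k (minpoly F a).nextCoeff = j • -a := by
    rw [← nextCoeff_map (algebraMap F k).injective, heq, (monic_X_sub_C a).nextCoeff_pow,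
      nextCoeff_X_sub_C]
  have hjk : (j : k) ≠ 0 := by
    rw [Ne, CharP.cast_eq_zero_iff k p]
    exact fun hd => absurd (Nat.le_of_dvd hj0 hd) (by omega)
  have h5 : a = -((j : k)⁻¹ * algebraMap F k (minpoly F a).nextCoeff) := by
    rw [h4, nsmul_eq_mul]; field_simp
  rw [h5]
  exact F.neg_mem (F.mul_mem (F.inv_mem (natCast_mem F j)) (minpoly F a).nextCoeff.2)

/-- `p`-independence: the monomials with exponents smaller than `p` are linearly independent
over the subfield of `p`-th powers. -/
def PIndep (B : Set k) : Prop :=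
  ∀ c : (k →₀ ℕ) →₀ k, (∀ m ∈ c.support, (∀ b, m b < p) ∧ ↑m.support ⊆ B) →
    (c.sum fun m a => a ^ p * m.prod fun b i => b ^ i) = 0 → c = 0

/-- The subfield generated by the `p`-th powers and a set. -/
def frobeniusAdjoin (B : Set k) : Subfield k where
  __ := Subring.closure (Set.range (fun a : k => a ^ p) ∪ B)
  inv_mem' := by
    intro z hz
    by_cases h : z = 0
    · subst h; rwa [inv_zero]
    have : z⁻¹ = z ^ (p - 1) * (z⁻¹) ^ p := by
      obtain ⟨q, hq⟩ : ∃ q, p = q + 1 := ⟨p - 1, (Nat.sub_add_cancel hp.out.one_le).symm⟩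
      rw [hq, Nat.add_sub_cancel, pow_succ, ← mul_assoc, ← mul_pow,
        mul_inv_cancel₀ h, one_pow, one_mul]
    rw [this]
    exact Subring.mul_mem _ (Subring.pow_mem _ hz _) (Subring.subset_closure (Or.inl ⟨_, rfl⟩))

lemma pow_mem_frobeniusAdjoin (B : Set k) (a : k) : a ^ p ∈ frobeniusAdjoin p B :=
  Subring.subset_closure (Or.inl ⟨_, rfl⟩)

lemma mem_frobeniusAdjoin {B : Set k} {a : k} (ha : a ∈ B) : a ∈ frobeniusAdjoin p B :=
  Subring.subset_closure (Or.inr ha)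

lemma PIndep.insert {B : Set k} (hB : PIndep p B) {a : k} (ha : a ∉ frobeniusAdjoin p B) :
    PIndep p (insert a B) := by
  classical
  intro c hc hsum
  have haB : a ∉ B := fun h => ha (mem_frobeniusAdjoin p h)
  let ci : ℕ → (k →₀ ℕ) →₀ k := fun i =>
    ∑ m ∈ c.support with m a = i, Finsupp.single (m.erase a) (c m)
  have hci : ∀ i, (∀ m ∈ (ci i).support, (∀ b, m b < p) ∧ ↑m.support ⊆ B) := by
    intro i m hm
    have hm' := Finsupp.support_finsetSum hm
    simp only [Finset.mem_biUnion, Finset.mem_filter] at hm'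
    obtain ⟨m', ⟨hm', hi⟩, hmm⟩ := hm'
    have := Finsupp.support_single_subset hmm
    rw [Finset.mem_singleton] at this
    subst this
    refine ⟨fun b => ?_, fun b hb => ?_⟩
    · by_cases hb : b = a
      · subst hb; simpa using hp.out.pos
      · rw [Finsupp.erase_ne hb]; exact (hc m' hm').1 b
    · simp only [Finsupp.support_erase, Finset.coe_erase] at hb
      exact ((hc m' hm').2 hb.1).resolve_left hb.2
  have hsumi : ∀ i, ((ci i).sum fun m a => a ^ p * m.prod fun b i => b ^ i) =
      ∑ m ∈ c.support with m a = i, c m ^ p * (m.erase a).prod fun b i => b ^ i := by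
    intro i
    rw [← Finsupp.sum_finsetSum_index]
    · exact sum_congr rfl fun m _ => Finsupp.sum_single_index (by
        rw [zero_pow hp.out.ne_zero, zero_mul])
    · intro m; rw [zero_pow hp.out.ne_zero, zero_mul]
    · intro m b b'; rw [add_pow_char, add_mul]
  have hmem : ∀ i, ((ci i).sum fun m a => a ^ p * m.prod fun b i => b ^ i) ∈ frobeniusAdjoin p B := by
    intro i
    refine sum_mem fun m hm => mul_mem (pow_mem_frobeniusAdjoin p B _) ?_
    exact prod_mem fun b hb => pow_mem (mem_frobeniusAdjoin p ((hci i m hm).2 hb)) _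
  have hzero : ∀ i < p, ci i = 0 := by
    let Q : (frobeniusAdjoin p B)[X] := ∑ i ∈ range p, C ⟨_, hmem i⟩ * X ^ i
    have hQ : aeval a Q = 0 := by
      rw [← hsum, map_sum]
      simp only [map_mul, aeval_C, map_pow, aeval_X]
      have : ∀ i, algebraMap (frobeniusAdjoin p B) k ⟨_, hmem i⟩ =
        ∑ m ∈ c.support with m a = i, c m ^ p * (m.erase a).prod fun b i => b ^ i := hsumi
      simp only [this]
      rw [Finsupp.sum, ← Finset.sum_fiberwise_of_maps_to (t := range p) (g := fun m => m a)
        fun m hm => mem_range.2 ((hc m hm).1 a)]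
      refine sum_congr rfl fun i _ => ?_
      rw [Finset.sum_mul]
      refine sum_congr rfl fun m hm => ?_
      rw [← (Finset.mem_filter.1 hm).2, mul_assoc]
      congr 1
      rw [mul_comm]
      by_cases hma : a ∈ m.support
      · exact Finsupp.mul_prod_erase m a _ hma
      · rw [Finsupp.notMem_support_iff.1 hma, pow_zero, one_mul,
          Finsupp.erase_of_notMem_support hma]
    have hdeg : Q.natDegree < p := by
      have : Q.degree < p := by
        refine (degree_sum_le _ _).trans_lt ((Finset.sup_lt_iff (WithBot.bot_lt_coe p)).2 fun i hi => ?_)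
        exact (degree_C_mul_X_pow_le _ _).trans_lt (Nat.cast_lt.2 (mem_range.1 hi))
      by_cases h0 : Q = 0
      · rw [h0]; simpa using hp.out.pos
      · exact (natDegree_lt_iff_degree_lt h0).2 this
    have hQ0 : Q = 0 := by
      by_contra h0
      exact ha (Subfield.mem_of_aeval_eq_zero p _ (pow_mem_frobeniusAdjoin p B a) h0 hdeg hQ)
    intro i hi
    refine hB _ (hci i) ?_
    have := congrArg (fun Q => ((Q.coeff i : frobeniusAdjoin p B) : k)) hQ0
    simpa [Q, finsetSum_coeff, hi] using this
  ext m
  by_contra hm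
  have hms : m ∈ c.support := Finsupp.mem_support_iff.2 hm
  have := DFunLike.congr_fun (hzero (m a) ((hc m hms).1 a)) (m.erase a)
  simp only [ci, Finsupp.finsetSum_apply, Finsupp.zero_apply] at this
  rw [Finset.sum_eq_single m] at this
  · exact hm (by simpa using this)
  · intro m' hm' hne
    refine Finsupp.single_eq_of_ne fun he => hne ?_
    ext b
    by_cases hb : b = a
    · subst hb; exact (Finset.mem_filter.1 hm').2
    · have := DFunLike.congr_fun he b
      rwa [Finsupp.erase_ne hb, Finsupp.erase_ne hb, eq_comm] at this
  · intro h; simp [hms] at h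

lemma Finsupp.eq_zero_of_sum_pow_mul_eq_zero {q : ℕ} (c : (k →₀ ℕ) →₀ k) (hc : ∀ m ∈ c.support, m = 0)
    (h : (c.sum fun m a => a ^ q * m.prod fun b i => b ^ i) = 0) : c = 0 := by
  have h1 : c = Finsupp.single 0 (c 0) := by
    ext m
    by_cases hm : m = 0
    · subst hm; simp
    · rw [Finsupp.single_eq_of_ne hm]
      exact Finsupp.notMem_support_iff.1 fun h => hm (hc m h)
  by_cases h0 : c 0 = 0
  · rw [h1, h0, Finsupp.single_zero]
  · rw [Finsupp.sum, Finset.sum_eq_single 0] at h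
    · simp only [Finsupp.prod_zero_index, mul_one] at h
      exact absurd (eq_zero_of_pow_eq_zero h) h0
    · intro m hm hne; exact absurd (hc m hm) hne
    · intro h; exact absurd (Finsupp.notMem_support_iff.1 h) h0

/-- Existence of `p`-bases. -/
theorem exists_pBasis : ∃ B : Set k, PIndep p B ∧
    ∀ a : k, a ∈ Subring.closure (Set.range (fun a : k => a ^ p) ∪ B) := by
  classical
  obtain ⟨B, hB⟩ := zorn_subset {B : Set k | PIndep p B} (by
    intro S hS hchain
    rcases S.eq_empty_or_nonempty with rfl | hne
    · refine ⟨∅, fun c hc hsum => ?_, by simp⟩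
      refine Finsupp.eq_zero_of_sum_pow_mul_eq_zero (q := p) c (fun m hm => ?_) hsum
      simpa using (hc m hm).2
    refine ⟨⋃₀ S, fun c hc hsum => ?_, fun s hs => Set.subset_sUnion_of_mem hs⟩
    obtain ⟨s, hs, hsub⟩ := hchain.directedOn.exists_mem_subset_of_finset_subset_biUnion (α := k) hne
      (s := c.support.biUnion fun m => m.support) (f := id) (by
        intro b hb
        simp only [Finset.coe_biUnion, Set.mem_iUnion] at hb
        obtain ⟨m, hm, hb⟩ := hb
        simpa using (hc m hm).2 hb)
    exact hS hs c (fun m hm => ⟨(hc m hm).1, fun b hb => hsub (by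
      simp only [Finset.coe_biUnion, Set.mem_iUnion]
      exact ⟨m, hm, hb⟩)⟩) hsum)
  refine ⟨B, hB.prop, fun a => ?_⟩
  by_contra ha
  have h1 := hB.le_of_ge (y := insert a B) (hB.prop.insert p ha) (Set.subset_insert a B)
  exact ha (mem_frobeniusAdjoin p (h1 (Set.mem_insert a B)))

/-- Monomials in a `p`-independent set with exponents smaller than `p ^ N` are independent over the
field of `p ^ N`-th powers. -/
lemma PIndep.pow {B : Set k} (hB : PIndep p B) (N : ℕ) (c : (k →₀ ℕ) →₀ k)
    (hc : ∀ m ∈ c.support, (∀ b, m b < p ^ N) ∧ ↑m.support ⊆ B)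
    (hsum : (c.sum fun m a => a ^ p ^ N * m.prod fun b i => b ^ i) = 0) : c = 0 := by
  classical
  induction N generalizing c with
  | zero =>
    refine Finsupp.eq_zero_of_sum_pow_mul_eq_zero (q := 1) c (fun m hm => ?_) (by simpa using hsum)
    ext b
    simpa using (hc m hm).1 b
  | succ N ih =>
    let R : (k →₀ ℕ) → (k →₀ ℕ) := fun m => m.mapRange (· % p) (Nat.zero_mod p)
    let D : (k →₀ ℕ) → (k →₀ ℕ) := fun m => m.mapRange (· / p) (Nat.zero_div p)
    have hRD : ∀ m, (m.prod fun b i => b ^ i) =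
        ((D m).prod fun b i => b ^ i) ^ p * (R m).prod fun b i => b ^ i := by
      intro m
      rw [Finsupp.prod_mapRange_index (by simp), Finsupp.prod_mapRange_index (by simp), Finsupp.prod,
        Finsupp.prod, Finsupp.prod, ← Finset.prod_pow, ← Finset.prod_mul_distrib]
      refine prod_congr rfl fun b _ => ?_
      rw [← pow_mul, ← pow_add, mul_comm, Nat.div_add_mod]
    let cr : (k →₀ ℕ) → (k →₀ ℕ) →₀ k := fun r =>
      ∑ m ∈ c.support with R m = r, Finsupp.single (D m) (c m)
    have hcr : ∀ r, ((cr r).sum fun m a => a ^ p ^ N * m.prod fun b i => b ^ i) =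
        ∑ m ∈ c.support with R m = r, c m ^ p ^ N * (D m).prod fun b i => b ^ i := by
      intro r
      rw [← Finsupp.sum_finsetSum_index]
      · exact sum_congr rfl fun m _ => Finsupp.sum_single_index (by
          rw [zero_pow (pow_pos hp.out.pos _).ne', zero_mul])
      · intro m; rw [zero_pow (pow_pos hp.out.pos _).ne', zero_mul]
      · intro m b b'; rw [add_pow_char_pow, add_mul]
    let v : (k →₀ ℕ) → k := fun r => (cr r).sum fun m a => a ^ p ^ N * m.prod fun b i => b ^ i
    let d : (k →₀ ℕ) →₀ k := ∑ r ∈ c.support.image R, Finsupp.single r (v r)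
    have hdv : ∀ r ∈ c.support.image R, d r = v r := by
      intro r hr
      simp only [d, Finsupp.finsetSum_apply]
      rw [Finset.sum_eq_single r]
      · simp
      · intro r' _ hne; exact Finsupp.single_eq_of_ne hne.symm
      · intro h; exact absurd hr h
    have hd0 : d = 0 := by
      refine hB d (fun r hr => ?_) ?_
      · have hr' := Finsupp.support_finsetSum hr
        simp only [Finset.mem_biUnion] at hr'
        obtain ⟨r', hr', hrr⟩ := hr'
        have := Finsupp.support_single_subset hrr
        rw [Finset.mem_singleton] at this
        subst this
        obtain ⟨m, hm, rfl⟩ := Finset.mem_image.1 hr'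
        refine ⟨fun b => Nat.mod_lt _ hp.out.pos, fun b hb => (hc m hm).2 ?_⟩
        exact Finsupp.support_mapRange (f := (· % p)) (hf := Nat.zero_mod p) hb
      · rw [← hsum, ← Finsupp.sum_finsetSum_index, Finsupp.sum]
        · have hmaps : ∀ m ∈ c.support, R m ∈ c.support.image R :=
            fun m hm => Finset.mem_image_of_mem R hm
          rw [← Finset.sum_fiberwise_of_maps_to hmaps]
          refine sum_congr rfl fun r _ => ?_
          rw [Finsupp.sum_single_index (by rw [zero_pow hp.out.ne_zero, zero_mul])]
          simp only [v]
          rw [hcr, sum_pow_char, Finset.sum_mul]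
          refine sum_congr rfl fun m hm => ?_
          rw [hRD m, (Finset.mem_filter.1 hm).2, mul_pow, ← pow_mul, ← pow_succ, mul_assoc]
        · intro m; rw [zero_pow hp.out.ne_zero, zero_mul]
        · intro m b b'; rw [add_pow_char, add_mul]
    have hcr0 : ∀ r ∈ c.support.image R, cr r = 0 := by
      intro r hr
      refine ih (cr r) (fun m hm => ?_) ?_
      · have hm' := Finsupp.support_finsetSum hm
        simp only [Finset.mem_biUnion, Finset.mem_filter] at hm'
        obtain ⟨m', ⟨hm', hi⟩, hmm⟩ := hm'
        have := Finsupp.support_single_subset hmm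
        rw [Finset.mem_singleton] at this
        subst this
        refine ⟨fun b => Nat.div_lt_of_lt_mul ?_, fun b hb => (hc m' hm').2 ?_⟩
        · rw [← pow_succ']; exact (hc m' hm').1 b
        · exact Finsupp.support_mapRange (f := (· / p)) (hf := Nat.zero_div p) hb
      · have := hdv r hr
        rw [hd0] at this
        exact this.symm
    ext m
    by_contra hm
    have hms : m ∈ c.support := Finsupp.mem_support_iff.2 hm
    have := DFunLike.congr_fun (hcr0 (R m) (Finset.mem_image_of_mem R hms)) (D m)
    simp only [cr, Finsupp.finsetSum_apply, Finsupp.zero_apply] at this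
    rw [Finset.sum_eq_single m] at this
    · exact hm (by simpa using this)
    · intro m' hm' hne
      refine Finsupp.single_eq_of_ne fun he => hne ?_
      ext b
      have h1 : m b / p = m' b / p := DFunLike.congr_fun he b
      have h2 : m' b % p = m b % p := DFunLike.congr_fun (Finset.mem_filter.1 hm').2 b
      rw [← Nat.div_add_mod (m' b) p, ← h1, h2, Nat.div_add_mod]
    · intro h; simp [hms] at h

end

/-! ## Coefficient rings -/

lemma PIndep.eq_zero_of_sum {p : ℕ} [hp : Fact p.Prime] {k : Type} [Field k] [CharP k p] {B : Set k}
    (hB : PIndep p B) (N : ℕ) (s : Finset (k →₀ ℕ)) (f : (k →₀ ℕ) → k)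
    (hs : ∀ m ∈ s, (∀ b, m b < p ^ N) ∧ ↑m.support ⊆ B)
    (hsum : (∑ m ∈ s, f m ^ p ^ N * m.prod fun b i => b ^ i) = 0) (m : k →₀ ℕ) (hm : m ∈ s) :
    f m = 0 := by
  classical
  let c : (k →₀ ℕ) →₀ k := Finsupp.onFinset s (fun m => if m ∈ s then f m else 0) (by
    intro m h; by_contra hm; simp [hm] at h)
  have hcs : c.support ⊆ s := Finsupp.support_onFinset_subset
  have h0 : c = 0 := hB.pow p N c (fun m hm => hs m (hcs hm)) (by
    rw [← hsum, Finsupp.sum_of_support_subset c hcs _ (by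
      intro m _; rw [zero_pow (pow_pos hp.out.pos _).ne', zero_mul])]
    exact sum_congr rfl fun m hm => by simp [c, hm])
  have := DFunLike.congr_fun h0 m
  simpa [c, hm] using this

namespace CoefficientRing

variable (p : ℕ) [hp : Fact p.Prime] {G : Type} [CommRing G]

variable (G) in
/-- The range of a ghost component map. -/
def ghostRange (N : ℕ) : Subring G := (WittVector.ghostComponent (p := p) (R := G) N).range

lemma pow_mem_ghostRange (N : ℕ) (a : G) : a ^ p ^ N ∈ ghostRange p G N :=
  ⟨WittVector.teichmuller p a, WittVector.ghostComponent_teichmuller p a N⟩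

lemma ghostRange_succ_le (N : ℕ) : ghostRange p G (N + 1) ≤ ghostRange p G N := by
  rintro _ ⟨x, rfl⟩
  exact ⟨WittVector.frobenius x, WittVector.ghostComponent_frobenius _ _⟩

lemma p_mul_mem_ghostRange {N : ℕ} {a : G} (ha : a ∈ ghostRange p G N) :
    p * a ∈ ghostRange p G (N + 1) := by
  obtain ⟨x, rfl⟩ := ha
  exact ⟨WittVector.verschiebung x, WittVector.ghostComponent_verschiebung _ _⟩

lemma exists_ghost_eq (x : WittVector p G) : ∃ y : WittVector p G, ∀ N,
    WittVector.ghostComponent (N + 1) x = x.coeff 0 ^ p ^ (N + 1) + p * WittVector.ghostComponent N y := by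
  obtain ⟨y, hy⟩ : ∃ y, x - WittVector.teichmuller p (x.coeff 0) = WittVector.verschiebung y := by
    have h0 : (x - WittVector.teichmuller p (x.coeff 0)).coeff 0 = 0 := by
      have : WittVector.constantCoeff (x - WittVector.teichmuller p (x.coeff 0)) = 0 := by
        rw [map_sub, sub_eq_zero]
        exact (WittVector.teichmuller_coeff_zero p _).symm
      exact this
    have h1 := WittVector.verschiebung_shift (x - WittVector.teichmuller p (x.coeff 0)) 0 fun i hi => by
      obtain rfl : i = 0 := by omega
      exact h0
    refine ⟨_, Eq.trans ?_ h1.symm⟩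
    ext i
    rw [WittVector.shift_coeff, zero_add]
  refine ⟨y, fun N => ?_⟩
  rw [← WittVector.ghostComponent_verschiebung, ← hy, map_sub, WittVector.ghostComponent_teichmuller]
  ring

lemma exists_eq_of_mem_ghostRange {N : ℕ} {a : G} (ha : a ∈ ghostRange p G (N + 1)) :
    ∃ b, ∃ c ∈ ghostRange p G N, a = b ^ p ^ (N + 1) + p * c := by
  obtain ⟨x, rfl⟩ := ha
  obtain ⟨y, hy⟩ := exists_ghost_eq p x
  exact ⟨_, _, ⟨y, rfl⟩, hy N⟩

lemma exists_add_pow_eq (N : ℕ) (a b : G) : ∃ c ∈ ghostRange p G N,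
    (a + b) ^ p ^ (N + 1) = a ^ p ^ (N + 1) + b ^ p ^ (N + 1) + p * c := by
  obtain ⟨y, hy⟩ := exists_ghost_eq p (WittVector.teichmuller p a + WittVector.teichmuller p b)
  refine ⟨-WittVector.ghostComponent N y, neg_mem ⟨y, rfl⟩, ?_⟩
  have h := hy N
  rw [map_add, WittVector.ghostComponent_teichmuller, WittVector.ghostComponent_teichmuller] at h
  have h0 : (WittVector.teichmuller p a + WittVector.teichmuller p b).coeff 0 = a + b := by
    simp [WittVector.add_coeff_zero]
  rw [h0] at h
  linear_combination -h

section Adjoin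

variable (Bt : Set G)

/-- The subring generated by a ghost range and a set. -/
def adj (N : ℕ) : Subring G := (Algebra.adjoin (ghostRange p G N) Bt).toSubring

lemma ghostRange_le_adj (N : ℕ) : ghostRange p G N ≤ adj p Bt N :=
  fun a ha => (Algebra.adjoin (ghostRange p G N) Bt).algebraMap_mem ⟨a, ha⟩

lemma subset_adj (N : ℕ) : Bt ⊆ adj p Bt N := Algebra.subset_adjoin

lemma adj_le {N : ℕ} {S : Subring G} (h1 : ghostRange p G N ≤ S) (h2 : Bt ⊆ S) : adj p Bt N ≤ S := by
  intro z hz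
  refine Algebra.adjoin_induction (p := fun z _ => z ∈ S) (fun x hx => h2 hx) (fun r => h1 r.2)
    (fun _ _ _ _ h h' => S.add_mem h h') (fun _ _ _ _ h h' => S.mul_mem h h') hz

lemma adj_succ_le (N : ℕ) : adj p Bt (N + 1) ≤ adj p Bt N :=
  adj_le p Bt ((ghostRange_succ_le p N).trans (ghostRange_le_adj p Bt N)) (subset_adj p Bt N)

lemma p_mul_mem_adj {N : ℕ} {z : G} (hz : z ∈ adj p Bt N) : p * z ∈ adj p Bt (N + 1) := by
  have hz' : z ∈ Subalgebra.toSubmodule (Algebra.adjoin (ghostRange p G N) Bt) := hz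
  rw [Algebra.adjoin_eq_span] at hz'
  have key : ∀ a ∈ ghostRange p G N, p * a * z ∈ adj p Bt (N + 1) := by
    clear hz
    induction hz' using Submodule.span_induction with
    | mem x hx =>
      intro a ha
      have h1 : x ∈ Subalgebra.toSubmodule (Algebra.adjoin (ghostRange p G (N + 1)) Bt) := by
        rw [Algebra.adjoin_eq_span]; exact Submodule.subset_span hx
      exact mul_mem (ghostRange_le_adj p Bt _ (p_mul_mem_ghostRange p ha)) h1
    | zero => intro a _; rw [mul_zero]; exact zero_mem _
    | add x y _ _ h h' => intro a ha; rw [mul_add]; exact add_mem (h a ha) (h' a ha)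
    | smul b x _ h =>
      intro a ha
      have := h (a * b) (mul_mem ha b.2)
      rwa [← mul_assoc, mul_assoc (_ * a)] at this
  simpa using key 1 (one_mem _)

end Adjoin

section Filtration

variable {k : Type} [Field k] [CharP k p] {F : ℕ → Ideal G} (hanti : Antitone F)
  (hmul : ∀ i j a b, a ∈ F i → b ∈ F j → a * b ∈ F (i + j)) (hpF : (p : G) ∈ F 1)
  {π : G →+* k} (hπ : ∀ a, π a = 0 ↔ a ∈ F 1) {ℓ : k → G} (hℓ : ∀ a, π (ℓ a) = a)
  {B : Set k} (hB : PIndep p B)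
  (hspan : ∀ a : k, a ∈ Subring.closure (Set.range (fun a : k => a ^ p) ∪ B))
  (hlim : ∀ s : ℕ → G, (∀ j, s (j + 1) - s j ∈ F (j + 1)) → ∃ l, ∀ j, l - s j ∈ F (j + 1))

include hanti hmul hpF in
lemma pow_mem (N : ℕ) {a : G} (ha : a ∈ F 1) : a ^ p ^ N ∈ F (N + 1) := by
  have h1 : ∀ i, a ^ (i + 1) ∈ F (i + 1) := by
    intro i
    induction i with
    | zero => simpa using ha
    | succ i ih => rw [pow_succ]; exact hmul _ _ _ _ ih ha
  have h2 : N < p ^ N := Nat.lt_pow_self hp.out.one_lt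
  have h3 := h1 (p ^ N - 1)
  rw [Nat.sub_add_cancel (by omega)] at h3
  exact hanti (by omega) h3

/-- The subring of elements congruent to an element of `S` modulo `I`. -/
def modSubring (S : Subring G) (I : Ideal G) : Subring G :=
  (S.map (Ideal.Quotient.mk I)).comap (Ideal.Quotient.mk I)

lemma mem_modSubring {S : Subring G} {I : Ideal G} {a : G} :
    a ∈ modSubring S I ↔ ∃ s ∈ S, a - s ∈ I := by
  simp only [modSubring, Subring.mem_comap, Subring.mem_map]
  refine exists_congr fun s => and_congr_right fun _ => ?_
  rw [eq_comm, Ideal.Quotient.eq]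

lemma le_modSubring (S : Subring G) (I : Ideal G) : S ≤ modSubring S I :=
  fun a ha => mem_modSubring.2 ⟨a, ha, by simp⟩

include hanti hmul hpF hπ hℓ hspan

lemma pow_mem_modSubring {N : ℕ} {a : G}
    (h : ∀ j, N = j + 1 → ∀ c ∈ ghostRange p G j, p * c ∈ modSubring (adj p (ℓ '' B) (N + 1)) (F (N + 1))) :
    a ^ p ^ N ∈ modSubring (adj p (ℓ '' B) (N + 1)) (F (N + 1)) := by
  set T := modSubring (adj p (ℓ '' B) (N + 1)) (F (N + 1)) with hT
  let U : Subring G :=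
    { carrier := {a | a ^ p ^ N ∈ T}
      mul_mem' := by
        intro a b ha hb
        simp only [Set.mem_ofPred_eq, mul_pow] at *
        exact mul_mem ha hb
      one_mem' := by simp only [Set.mem_ofPred_eq, one_pow]; exact one_mem _
      zero_mem' := by
        simp only [Set.mem_ofPred_eq, zero_pow (pow_pos hp.out.pos _).ne']; exact zero_mem _
      add_mem' := by
        intro a b ha hb
        simp only [Set.mem_ofPred_eq] at *
        cases N with
        | zero => simp only [pow_zero, pow_one] at *; exact add_mem ha hb
        | succ j =>
          obtain ⟨c, hc, hcc⟩ := exists_add_pow_eq p j a b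
          rw [hcc]
          exact add_mem (add_mem ha hb) (h j rfl c hc)
      neg_mem' := by
        intro a ha
        simp only [Set.mem_ofPred_eq] at *
        rw [neg_pow]
        exact mul_mem (Subring.pow_mem _ (neg_mem (one_mem _)) _) ha }
  have hFU : ∀ a ∈ F 1, a ∈ U := fun a ha =>
    mem_modSubring.2 ⟨0, zero_mem _, by rw [sub_zero]; exact pow_mem p hanti hmul hpF N ha⟩
  have h1 : (Subring.closure (Set.range (fun a : k => a ^ p) ∪ B)) ≤ U.map π := by
    rw [Subring.closure_le]
    rintro _ (⟨a, rfl⟩ | hb)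
    · refine ⟨ℓ a ^ p, ?_, by rw [map_pow, hℓ]⟩
      change (ℓ a ^ p) ^ p ^ N ∈ T
      rw [← pow_mul, ← pow_succ']
      exact le_modSubring _ _ (ghostRange_le_adj p _ _ (pow_mem_ghostRange p _ _))
    · rename_i b
      refine ⟨ℓ b, ?_, hℓ b⟩
      exact Subring.pow_mem _ (le_modSubring _ _ (subset_adj p _ _ (Set.mem_image_of_mem ℓ hb))) _
  obtain ⟨u, hu, hua⟩ := h1 (hspan (π a))
  have h2 : a - u ∈ U := hFU _ ((hπ _).1 (by rw [map_sub, hua, sub_self]))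
  have := U.add_mem h2 hu
  rwa [sub_add_cancel] at this

lemma ghostRange_le_modSubring (N : ℕ) :
    ghostRange p G N ≤ modSubring (adj p (ℓ '' B) (N + 1)) (F (N + 1)) := by
  induction N with
  | zero =>
    intro a _
    have := pow_mem_modSubring p hanti hmul hpF hπ hℓ hspan (N := 0) (a := a) (by intro j hj; omega)
    simpa using this
  | succ N ih =>
    have h1 : ∀ c ∈ ghostRange p G N, p * c ∈ modSubring (adj p (ℓ '' B) (N + 1 + 1)) (F (N + 1 + 1)) := by
      intro c hc
      obtain ⟨s, hs, hcs⟩ := mem_modSubring.1 (ih hc)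
      refine mem_modSubring.2 ⟨p * s, p_mul_mem_adj p _ hs, ?_⟩
      rw [← mul_sub, add_comm]
      exact hmul _ _ _ _ hpF hcs
    intro a ha
    obtain ⟨b, c, hc, rfl⟩ := exists_eq_of_mem_ghostRange p ha
    refine add_mem (pow_mem_modSubring p hanti hmul hpF hπ hℓ hspan ?_) (h1 c hc)
    rintro j hj
    obtain rfl : N = j := by omega
    exact h1

/-- The approximations to the coefficient ring. -/
def approx (F : ℕ → Ideal G) (ℓ : k → G) (B : Set k) (N : ℕ) : Subring G :=
  modSubring (adj p (ℓ '' B) N) (F (N + 1))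

lemma exists_approx_succ {N : ℕ} {s : G} (hs : s ∈ approx p F ℓ B N) :
    ∃ s' ∈ approx p F ℓ B (N + 1), s' - s ∈ F (N + 1) := by
  obtain ⟨a, ha, hsa⟩ := mem_modSubring.1 hs
  have h1 : adj p (ℓ '' B) N ≤ modSubring (adj p (ℓ '' B) (N + 1)) (F (N + 1)) :=
    adj_le p _ (ghostRange_le_modSubring p hanti hmul hpF hπ hℓ hspan N)
      ((subset_adj p _ _).trans (le_modSubring _ _))
  obtain ⟨s', hs', has⟩ := mem_modSubring.1 (h1 ha)
  refine ⟨s', le_modSubring _ _ hs', ?_⟩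
  have := neg_mem (add_mem hsa has)
  convert this using 1; ring

omit hmul hpF hπ hℓ hspan in
lemma approx_antitone : Antitone (approx p F ℓ B) := by
  refine antitone_nat_of_succ_le fun N s hs => ?_
  obtain ⟨a, ha, hsa⟩ := mem_modSubring.1 hs
  exact mem_modSubring.2 ⟨a, adj_succ_le p _ _ ha, hanti (by omega) hsa⟩

omit hanti hmul hpF hπ hℓ hspan in
lemma mem_approx_of_sub_mem {N : ℕ} {a b : G} (ha : a ∈ approx p F ℓ B N) (h : b - a ∈ F (N + 1)) :
    b ∈ approx p F ℓ B N := by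
  obtain ⟨s, hs, has⟩ := mem_modSubring.1 ha
  refine mem_modSubring.2 ⟨s, hs, ?_⟩
  have := add_mem h has
  rwa [sub_add_sub_cancel] at this

include hlim

lemma exists_mem_iInf_approx {N : ℕ} {s : G} (hs : s ∈ approx p F ℓ B N) :
    ∃ c ∈ ⨅ N, approx p F ℓ B N, c - s ∈ F (N + 1) := by
  have hstep : ∀ (j : ℕ) (x : approx p F ℓ B (N + j)),
      ∃ y : approx p F ℓ B (N + (j + 1)), (y : G) - x ∈ F (N + j + 1) := by
    intro j x
    obtain ⟨y, hy, hyx⟩ := exists_approx_succ p hanti hmul hpF hπ hℓ hspan x.2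
    exact ⟨⟨y, hy⟩, hyx⟩
  choose nxt hnxt using hstep
  let t : ∀ j, approx p F ℓ B (N + j) := fun j =>
    Nat.rec (motive := fun j => approx p F ℓ B (N + j)) ⟨s, hs⟩ (fun j x => nxt j x) j
  have ht : ∀ j, (t (j + 1) : G) - t j ∈ F (N + j + 1) := fun j => hnxt j (t j)
  obtain ⟨l, hl⟩ := hlim (fun j => t (j - N)) (fun j => by
    by_cases hj : j < N
    · rw [Nat.sub_eq_zero_of_le hj.le, Nat.sub_eq_zero_of_le (Nat.succ_le_of_lt hj), sub_self]
      exact zero_mem _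
    · obtain ⟨i, rfl⟩ := Nat.exists_eq_add_of_le (not_lt.1 hj)
      rw [Nat.add_sub_cancel_left, Nat.add_assoc, Nat.add_sub_cancel_left]
      exact ht i)
  refine ⟨l, Subring.mem_iInf.2 fun M => ?_, ?_⟩
  · have h1 := hl (N + M)
    rw [Nat.add_sub_cancel_left] at h1
    exact mem_approx_of_sub_mem p (approx_antitone p hanti (Nat.le_add_left M N) (t M).2)
      (hanti (by omega) h1)
  · have h1 := hl N
    rw [Nat.sub_self] at h1
    exact h1

lemma exists_mem_iInf_approx_map_eq (a : k) : ∃ c ∈ ⨅ N, approx p F ℓ B N, π c = a := by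
  have h0 : ℓ a ∈ approx p F ℓ B 0 := by
    refine le_modSubring _ _ (ghostRange_le_adj p _ _ ?_)
    simpa using pow_mem_ghostRange p 0 (ℓ a)
  obtain ⟨c, hc, hcs⟩ := exists_mem_iInf_approx p hanti hmul hpF hπ hℓ hspan hlim h0
  refine ⟨c, hc, ?_⟩
  have := (hπ _).2 hcs
  rwa [map_sub, sub_eq_zero, hℓ] at this

omit hanti hmul hpF hπ hℓ hspan hlim in
lemma exists_sum_of_mem_adj {N : ℕ} {a : G} (ha : a ∈ adj p (ℓ '' B) N) :
    ∃ (s : Finset (k →₀ ℕ)) (g : (k →₀ ℕ) → G), (∀ m, g m ∈ ghostRange p G N) ∧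
      (∀ m ∈ s, (∀ b, m b < p ^ N) ∧ ↑m.support ⊆ B) ∧
      a = ∑ m ∈ s, g m * m.prod fun b i => ℓ b ^ i := by
  let I := {m : k →₀ ℕ // (∀ b, m b < p ^ N) ∧ ↑m.support ⊆ B}
  let v : I → G := fun m => m.1.prod fun b i => ℓ b ^ i
  have h1 : a ∈ Submodule.span (ghostRange p G N) (Set.range v) := by
    have ha' : a ∈ Subalgebra.toSubmodule (Algebra.adjoin (ghostRange p G N) (ℓ '' B)) := ha
    rw [Algebra.adjoin_eq_span] at ha'
    refine Submodule.span_le.2 ?_ ha'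
    intro z hz
    obtain ⟨m, hm, rfl⟩ : ∃ m : k →₀ ℕ, ↑m.support ⊆ B ∧ z = m.prod fun b i => ℓ b ^ i := by
      classical
      refine Submonoid.closure_induction ?_ ?_ ?_ hz
      · rintro _ ⟨b, hb, rfl⟩
        refine ⟨Finsupp.single b 1, fun c hc => ?_, by simp⟩
        have := Finsupp.support_single_subset hc
        rw [Finset.mem_singleton] at this
        rwa [this]
      · exact ⟨0, by simp, by simp⟩
      · rintro _ _ _ _ ⟨m, hm, rfl⟩ ⟨m', hm', rfl⟩
        refine ⟨m + m', fun c hc => ?_, ?_⟩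
        · rcases Finset.mem_union.1 (Finsupp.support_add hc) with h | h
          exacts [hm h, hm' h]
        · rw [Finsupp.prod_add_index' (by simp) (by intro b i j; exact pow_add _ _ _)]
    have hN : 0 < p ^ N := pow_pos hp.out.pos N
    let R := m.mapRange (· % p ^ N) (Nat.zero_mod _)
    let D := m.mapRange (· / p ^ N) (Nat.zero_div _)
    have hRD : (m.prod fun b i => ℓ b ^ i) =
        ((D.prod fun b i => ℓ b ^ i) ^ p ^ N) * R.prod fun b i => ℓ b ^ i := by
      rw [Finsupp.prod_mapRange_index (by simp), Finsupp.prod_mapRange_index (by simp), Finsupp.prod,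
        Finsupp.prod, Finsupp.prod, ← Finset.prod_pow, ← Finset.prod_mul_distrib]
      refine prod_congr rfl fun b _ => ?_
      rw [← pow_mul, ← pow_add, mul_comm (_ / _), Nat.div_add_mod]
    rw [hRD]
    have hR : R.prod (fun b i => ℓ b ^ i) ∈ Submodule.span (ghostRange p G N) (Set.range v) :=
      Submodule.subset_span ⟨⟨R, fun b => Nat.mod_lt _ hN, fun b hb =>
        hm (Finsupp.support_mapRange (f := (· % p ^ N)) (hf := Nat.zero_mod _) hb)⟩, rfl⟩
    exact Submodule.smul_mem _ (⟨_, pow_mem_ghostRange p N _⟩ : ghostRange p G N) hR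
  obtain ⟨c, hc⟩ := (Finsupp.mem_span_range_iff_exists_finsupp).1 h1
  obtain ⟨g, hg, hgc⟩ : ∃ g : (k →₀ ℕ) → G, (∀ m, g m ∈ ghostRange p G N) ∧
      ∀ m : I, g m.1 = c m := by
    refine ⟨Function.extend Subtype.val (fun m : I => (c m : G)) 0, fun m => ?_, fun m =>
      Subtype.val_injective.extend_apply _ _ m⟩
    by_cases hm : (∀ b, m b < p ^ N) ∧ ↑m.support ⊆ B
    · have : Function.extend Subtype.val (fun m : I => (c m : G)) 0 m = c ⟨m, hm⟩ :=
        Subtype.val_injective.extend_apply _ _ (⟨m, hm⟩ : I)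
      rw [this]
      exact (c _).2
    · rw [Function.extend_apply' _ _ _ (by rintro ⟨m', rfl⟩; exact hm m'.2)]
      exact zero_mem _
  refine ⟨c.support.map (Function.Embedding.subtype _), g, hg, fun m hm => ?_, ?_⟩
  · obtain ⟨m, _, rfl⟩ := Finset.mem_map.1 hm
    exact m.2
  · rw [← hc, Finset.sum_map, Finsupp.sum]
    exact sum_congr rfl fun m _ => congrArg (· * v m) (hgc m).symm

include hB in
lemma exists_sub_p_mul_mem {c : G} (hc : c ∈ ⨅ N, approx p F ℓ B N) (hc0 : π c = 0) (N : ℕ) :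
    ∃ c' ∈ ⨅ N, approx p F ℓ B N, c - p * c' ∈ F (N + 2) := by
  obtain ⟨a, ha, hca⟩ := mem_modSubring.1 (Subring.mem_iInf.1 hc (N + 1))
  obtain ⟨s, g, hg, hs, rfl⟩ := exists_sum_of_mem_adj p ha
  choose x y hy hxy using fun m => exists_eq_of_mem_ghostRange p (hg m)
  have hπp : π (p : G) = 0 := (hπ _).2 hpF
  have hx0 : ∀ m ∈ s, π (x m) = 0 := by
    refine hB.eq_zero_of_sum (N + 1) s (fun m => π (x m)) hs ?_
    have h1 := (hπ _).2 (hanti (by omega : 1 ≤ N + 1 + 1) hca)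
    rw [map_sub, hc0, zero_sub, neg_eq_zero, map_sum] at h1
    rw [← h1]
    refine sum_congr rfl fun m _ => ?_
    rw [hxy, map_mul, map_add, map_mul, hπp, zero_mul, add_zero, map_pow, Finsupp.prod, Finsupp.prod,
      map_prod]
    simp only [map_pow, hℓ]
  have hS : (∑ m ∈ s, y m * m.prod fun b i => ℓ b ^ i) ∈ approx p F ℓ B N := by
    refine le_modSubring _ _ (sum_mem fun m hm => mul_mem (ghostRange_le_adj p _ _ (hy m)) ?_)
    exact prod_mem fun b hb => Subring.pow_mem _
      (subset_adj p _ _ (Set.mem_image_of_mem ℓ ((hs m hm).2 hb))) _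
  obtain ⟨c', hc', hcc⟩ := exists_mem_iInf_approx p hanti hmul hpF hπ hℓ hspan hlim hS
  refine ⟨c', hc', ?_⟩
  have e1 : p * (c' - ∑ m ∈ s, y m * m.prod fun b i => ℓ b ^ i) ∈ F (N + 2) := by
    have := hmul _ _ _ _ hpF hcc
    rwa [add_comm 1] at this
  have e2 : ∑ m ∈ s, x m ^ p ^ (N + 1) * (m.prod fun b i => ℓ b ^ i) ∈ F (N + 2) :=
    sum_mem fun m hm => Ideal.mul_mem_right _ _ (pow_mem p hanti hmul hpF (N + 1) ((hπ _).1 (hx0 m hm)))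
  have e3 : ∑ m ∈ s, g m * (m.prod fun b i => ℓ b ^ i) =
      ∑ m ∈ s, x m ^ p ^ (N + 1) * (m.prod fun b i => ℓ b ^ i) +
        p * ∑ m ∈ s, y m * m.prod fun b i => ℓ b ^ i := by
    rw [mul_sum, ← Finset.sum_add_distrib]
    exact sum_congr rfl fun m _ => by rw [hxy]; ring
  rw [e3] at hca
  have := add_mem (sub_mem hca e1) e2
  convert this using 1; ring

end Filtration

end CoefficientRing

lemma IsAdicComplete.exists_sub_mem {R : Type} [CommRing R] (I : Ideal R) [IsAdicComplete I R]
    (s : ℕ → R) (h : ∀ j, s (j + 1) - s j ∈ I ^ (j + 1)) : ∃ l, ∀ j, l - s j ∈ I ^ (j + 1) := by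
  have key : ∀ m i, s (m + i) - s m ∈ I ^ (m + 1) := by
    intro m i
    induction i with
    | zero => simp
    | succ i ih =>
      rw [← sub_add_sub_cancel _ (s (m + i))]
      exact add_mem (Ideal.pow_le_pow_right (by omega) (h (m + i))) ih
  obtain ⟨l, hl⟩ := IsPrecomplete.prec' (I := I) (fun n => s (n - 1)) (by
    intro m n hmn
    rw [SModEq.sub_mem, smul_eq_mul, Ideal.mul_top]
    cases m with
    | zero => simp
    | succ m =>
      obtain ⟨i, rfl⟩ := Nat.exists_eq_add_of_le hmn
      have := neg_mem (key m i)
      rw [neg_sub] at this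
      rwa [Nat.add_sub_cancel, show m + 1 + i - 1 = m + i by omega])
  refine ⟨l, fun j => ?_⟩
  have := hl (j + 1)
  rw [SModEq.sub_mem, smul_eq_mul, Ideal.mul_top, Nat.add_sub_cancel] at this
  rw [← neg_sub]
  exact neg_mem this

lemma IsHausdorff.eq_zero_of_forall_mem {R : Type} [CommRing R] (I : Ideal R) [IsHausdorff I R] {a : R}
    (h : ∀ j, a ∈ I ^ j) : a = 0 := by
  refine IsHausdorff.haus' (I := I) a fun n => ?_
  rw [SModEq.sub_mem, smul_eq_mul, Ideal.mul_top, sub_zero]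
  exact h n

/-- Complete local rings of prime characteristic contain coefficient fields. -/
theorem exists_coefficientField_of_charP (p : ℕ) [hp : Fact p.Prime] (T : Type) [CommRing T]
    [IsLocalRing T] [CharP T p] [IsAdicComplete (maximalIdeal T) T] :
    ∃ β : ResidueField T →+* T, ∀ a, residue T (β a) = a := by
  have : CharP (ResidueField T) p := by
    refine (CharP.charP_iff_prime_eq_zero hp.out).2 ?_
    rw [← map_natCast (residue T), CharP.cast_eq_zero, map_zero]
  obtain ⟨B, hB, hspan⟩ := exists_pBasis p (k := ResidueField T)
  let ℓ : ResidueField T → T := Function.surjInv (residue_surjective (R := T))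
  have hℓ : ∀ a, residue T (ℓ a) = a := Function.surjInv_eq _
  let F : ℕ → Ideal T := fun j => maximalIdeal T ^ j
  have hanti : Antitone F := fun i j h => Ideal.pow_le_pow_right h
  have hmul : ∀ i j a b, a ∈ F i → b ∈ F j → a * b ∈ F (i + j) := by
    intro i j a b ha hb
    simp only [F, pow_add]
    exact Ideal.mul_mem_mul ha hb
  have hpF : (p : T) ∈ F 1 := by rw [CharP.cast_eq_zero]; exact zero_mem _
  have hπ : ∀ a, residue T a = 0 ↔ a ∈ F 1 := by
    intro a; simp only [F, pow_one]; exact residue_eq_zero_iff a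
  have hlim : ∀ s : ℕ → T, (∀ j, s (j + 1) - s j ∈ F (j + 1)) → ∃ l, ∀ j, l - s j ∈ F (j + 1) :=
    IsAdicComplete.exists_sub_mem _
  let C := ⨅ N, CoefficientRing.approx p F ℓ B N
  let ρ : C →+* ResidueField T := (residue T).comp C.subtype
  have hρ : Function.Bijective ρ := by
    constructor
    · rw [injective_iff_map_eq_zero]
      intro c hc
      apply Subtype.ext
      refine IsHausdorff.eq_zero_of_forall_mem (maximalIdeal T) fun j => ?_
      obtain ⟨c', _, h⟩ :=
        CoefficientRing.exists_sub_p_mul_mem p hanti hmul hpF hπ hℓ hB hspan hlim c.2 hc j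
      rw [CharP.cast_eq_zero, zero_mul, sub_zero] at h
      exact hanti (by omega : j ≤ j + 2) h
    · intro a
      obtain ⟨c, hc, hca⟩ :=
        CoefficientRing.exists_mem_iInf_approx_map_eq p hanti hmul hpF hπ hℓ hspan hlim a
      exact ⟨⟨c, hc⟩, hca⟩
  refine ⟨C.subtype.comp (RingEquiv.ofBijective ρ hρ).symm.toRingHom, fun a => ?_⟩
  exact (RingEquiv.ofBijective ρ hρ).apply_symm_apply a

/-- Complete local rings of residue characteristic zero contain coefficient fields. -/
theorem exists_coefficientField_of_charZero (T : Type) [CommRing T]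
    [IsLocalRing T] [CharZero (ResidueField T)] [IsAdicComplete (maximalIdeal T) T] :
    ∃ β : ResidueField T →+* T, ∀ a, residue T (β a) = a := by
  have hu : ∀ n : ℕ, n ≠ 0 → IsUnit (n : T) := by
    intro n hn
    by_contra h
    have : (n : T) ∈ maximalIdeal T := h
    rw [← residue_eq_zero_iff, map_natCast] at this
    exact hn (by exact_mod_cast this)
  let _ : Algebra ℚ T := 
    (IsLocalization.lift (M := nonZeroDivisors ℤ) (S := ℚ) (g := Int.castRingHom T) (by
      rintro ⟨n, hn⟩
      have h1 := hu n.natAbs (Int.natAbs_ne_zero.2 (nonZeroDivisors.ne_zero hn))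
      change IsUnit (n : T)
      rcases Int.natAbs_eq n with h | h
      · rw [h]; simpa using h1
      · rw [h]; simpa using h1)).toAlgebra
  obtain ⟨s, hs⟩ := exists_isTranscendenceBasis ℚ (ResidueField T)
  have := hs.isAlgebraic_field
  have : Algebra.FormallySmooth ℚ (ResidueField T) :=
    Algebra.FormallySmooth.of_algebraicIndependent_of_isSeparable hs.1
  obtain ⟨g, hg⟩ := Algebra.FormallySmooth.exists_mkₐ_comp_eq_of_isAdicComplete
    (R := ℚ) (A := ResidueField T) (I := maximalIdeal T)
    (RingHom.toRatAlgHom (RingHom.id (ResidueField T)))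
  exact ⟨g, fun a => DFunLike.congr_fun hg a⟩

/-- A subring closed for a complete filtration whose residue ring is a field, and in which the
elements of positive filtration are the multiples of `p`. -/
structure IsClosedCoefficientRing (p : ℕ) {G : Type} [CommRing G] (F : ℕ → Ideal G) (C : Subring G) :
    Prop where
  anti : Antitone F
  mul_mem : ∀ i j a b, a ∈ F i → b ∈ F j → a * b ∈ F (i + j)
  p_mem : (p : G) ∈ F 1
  exists_limit : ∀ s : ℕ → G, (∀ j, s (j + 1) - s j ∈ F (j + 1)) → ∃ l, ∀ j, l - s j ∈ F (j + 1)
  eq_zero : ∀ a, (∀ j, a ∈ F (j + 1)) → a = 0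
  closed : ∀ a, (∀ j, ∃ c ∈ C, a - c ∈ F (j + 1)) → a ∈ C
  dvd : ∀ c ∈ C, c ∈ F 1 → ∃ d ∈ C, c = p * d
  exists_inv : ∀ c ∈ C, c ∉ F 1 → ∃ d ∈ C, 1 - c * d ∈ F 1

namespace IsClosedCoefficientRing

variable {p : ℕ} [hp : Fact p.Prime] {G : Type} [CommRing G] {F : ℕ → Ideal G} {C : Subring G}
  (h : IsClosedCoefficientRing p F C)

include h

lemma pow_mem {a : G} (ha : a ∈ F 1) (j : ℕ) : a ^ (j + 1) ∈ F (j + 1) := by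
  induction j with
  | zero => simpa using ha
  | succ i ih => rw [pow_succ]; exact h.mul_mem _ _ _ _ ih ha

lemma exists_limit_mem (s : ℕ → C) (hs : ∀ j, (s (j + 1) - s j : G) ∈ F (j + 1)) :
    ∃ l : C, ∀ j, (l - s j : G) ∈ F (j + 1) := by
  obtain ⟨l, hl⟩ := h.exists_limit (fun j => s j) hs
  exact ⟨⟨l, h.closed l fun j => ⟨s j, (s j).2, hl j⟩⟩, hl⟩

lemma isUnit {c : C} (hc : (c : G) ∉ F 1) : IsUnit c := by
  obtain ⟨d, hd, hcd⟩ := h.exists_inv c c.2 hc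
  obtain ⟨l, hl⟩ := h.exists_limit_mem (fun j => ∑ i ∈ range (j + 1), (1 - c * ⟨d, hd⟩) ^ i) (by
    intro j
    have := h.pow_mem hcd j
    rw [← AddSubgroupClass.coe_sub, sum_range_succ, add_sub_cancel_left]
    exact this)
  refine IsUnit.of_mul_eq_one (⟨d, hd⟩ * l) (Subtype.ext (sub_eq_zero.1 (h.eq_zero _ fun j => ?_)))
  have h1 := Ideal.mul_mem_left _ ((c : G) * d) (hl j)
  have h2 := h.pow_mem hcd j
  have h3 := geom_sum_mul (1 - c * ⟨d, hd⟩ : C) (j + 1)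
  have h4 := congrArg (Subtype.val : C → G) h3
  simp only [Subring.coe_mul, AddSubgroupClass.coe_sub, Subring.coe_one, Subring.coe_pow] at h4 ⊢
  have := sub_mem h1 h2
  convert this using 1
  linear_combination -h4

lemma mem_span_iff {c : C} : c ∈ Ideal.span {(p : C)} ↔ (c : G) ∈ F 1 := by
  rw [Ideal.mem_span_singleton]
  constructor
  · rintro ⟨d, rfl⟩
    have : (((p : C) * d : C) : G) = p * d := by simp
    rw [this]
    exact Ideal.mul_mem_right _ _ h.p_mem
  · intro hc
    obtain ⟨d, hd, hcd⟩ := h.dvd c c.2 hc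
    exact ⟨⟨d, hd⟩, Subtype.ext (by simpa using hcd)⟩

lemma p_pow_mem (j : ℕ) : (p : G) ^ (j + 1) ∈ F (j + 1) := h.pow_mem h.p_mem j

lemma isAdicComplete : IsAdicComplete (Ideal.span {(p : C)}) C where
  haus' := by
    intro x hx
    refine Subtype.ext (h.eq_zero _ fun j => ?_)
    have := hx (j + 1)
    rw [SModEq.sub_mem, smul_eq_mul, Ideal.mul_top, sub_zero, Ideal.span_singleton_pow,
      Ideal.mem_span_singleton] at this
    obtain ⟨d, rfl⟩ := this
    have e : (((p : C) ^ (j + 1) * d : C) : G) = p ^ (j + 1) * d := by simp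
    rw [e]
    exact Ideal.mul_mem_right _ _ (h.p_pow_mem j)
  prec' := by
    intro f hf
    have hd : ∀ j, ∃ d : C, f (j + 1) - f j = p ^ j * d := by
      intro j
      have := hf (Nat.le_succ j)
      rw [SModEq.sub_mem, smul_eq_mul, Ideal.mul_top, Ideal.span_singleton_pow,
        Ideal.mem_span_singleton] at this
      obtain ⟨d, hd⟩ := this
      exact ⟨-d, by rw [mul_neg, ← hd]; ring⟩
    choose d hd using hd
    have hlim : ∀ m, ∃ l : C, ∀ j,
        (l - (∑ i ∈ range (j + 1), p ^ i * d (m + i) : C) : G) ∈ F (j + 1) := by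
      intro m
      refine h.exists_limit_mem (fun j => ∑ i ∈ range (j + 1), p ^ i * d (m + i)) fun j => ?_
      rw [← AddSubgroupClass.coe_sub, sum_range_succ _ (j + 1), add_sub_cancel_left]
      have e : (((p : C) ^ (j + 1) * d (m + (j + 1)) : C) : G) = p ^ (j + 1) * d (m + (j + 1)) := by simp
      rw [e]
      exact Ideal.mul_mem_right _ _ (h.p_pow_mem j)
    choose l hl using hlim
    have htel : ∀ m j, f (m + j) - f m = p ^ m * ∑ i ∈ range j, p ^ i * d (m + i) := by
      intro m j
      induction j with
      | zero => simp
      | succ j ih =>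
        rw [sum_range_succ, mul_add, ← ih, ← mul_assoc, ← pow_add, ← hd]
        rw [← add_assoc]; ring
    have hrel : ∀ m, l 0 = (f m - f 0) + p ^ m * l m := by
      intro m
      refine Subtype.ext (sub_eq_zero.1 (h.eq_zero _ fun j => ?_))
      have h1 := h.anti (by omega : j + 1 ≤ m + j + 1) (hl 0 (m + j))
      have h2 := Ideal.mul_mem_left _ ((p : G) ^ m) (hl m j)
      have h3 := htel m (j + 1)
      have h4 := htel 0 (m + j + 1)
      simp only [pow_zero, one_mul, zero_add] at h4
      simp only [zero_add] at h1
      rw [← h4] at h1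
      have h5 := congrArg (Subtype.val : C → G) h3
      have := sub_mem h1 h2
      convert this using 1
      simp only [Subring.coe_mul, AddSubgroupClass.coe_sub, Subring.coe_pow, Subring.coe_add,
        Subring.coe_natCast] at h5 ⊢
      rw [show m + (j + 1) = m + j + 1 by ring] at h5
      linear_combination h5
    refine ⟨f 0 + l 0, fun n => ?_⟩
    rw [SModEq.sub_mem, smul_eq_mul, Ideal.mul_top, Ideal.span_singleton_pow, Ideal.mem_span_singleton]
    exact ⟨-l n, by rw [hrel n]; ring⟩

lemma exists_eq_pow_mul {c : C} (hc : c ≠ 0) : ∃ (j : ℕ) (u : Cˣ), c = p ^ j * u := by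
  have hex : ∃ j, ¬ (p : C) ^ j ∣ c := by
    by_contra! hall
    refine hc (Subtype.ext (h.eq_zero _ fun j => ?_))
    obtain ⟨d, rfl⟩ := hall (j + 1)
    have e : (((p : C) ^ (j + 1) * d : C) : G) = p ^ (j + 1) * d := by simp
    rw [e]
    exact Ideal.mul_mem_right _ _ (h.p_pow_mem j)
  classical
  obtain ⟨j, hj⟩ : ∃ j, Nat.find hex = j + 1 := by
    refine ⟨Nat.find hex - 1, (Nat.sub_add_cancel (Nat.pos_of_ne_zero fun h0 => ?_)).symm⟩
    have := Nat.find_spec hex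
    rw [h0, pow_zero] at this
    exact this (one_dvd _)
  obtain ⟨d, hd⟩ := not_not.1 (Nat.find_min hex (m := j) (by omega))
  have hdu : IsUnit d := by
    refine h.isUnit fun hd1 => ?_
    obtain ⟨e, rfl⟩ := Ideal.mem_span_singleton.1 (h.mem_span_iff.2 hd1)
    have := Nat.find_spec hex
    rw [hj] at this
    exact this ⟨e, by rw [hd, pow_succ]; ring⟩
  exact ⟨j, hdu.unit, hd⟩

lemma isDiscreteValuationRing [IsDomain C] (hp0 : (p : C) ≠ 0) (hp1 : ¬ IsUnit (p : C)) :
    IsDiscreteValuationRing C ∧ Irreducible (p : C) := by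
  have hirr : Irreducible (p : C) := by
    refine ⟨hp1, fun a b hab => ?_⟩
    by_contra! hcon
    have ha : a ∈ Ideal.span {(p : C)} := h.mem_span_iff.2 (not_not.1 fun h0 => hcon.1 (h.isUnit h0))
    have hb : b ∈ Ideal.span {(p : C)} := h.mem_span_iff.2 (not_not.1 fun h0 => hcon.2 (h.isUnit h0))
    obtain ⟨a, rfl⟩ := Ideal.mem_span_singleton.1 ha
    obtain ⟨b, rfl⟩ := Ideal.mem_span_singleton.1 hb
    have : (p : C) * (p * (a * b)) = p * 1 := by rw [mul_one]; linear_combination -hab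
    exact hp1 (IsUnit.of_mul_eq_one _ (mul_left_cancel₀ hp0 this))
  refine ⟨IsDiscreteValuationRing.ofHasUnitMulPowIrreducibleFactorization ⟨p, hirr, fun {c} hc => ?_⟩,
    hirr⟩
  obtain ⟨j, u, rfl⟩ := h.exists_eq_pow_mul hc
  exact ⟨j, u, rfl⟩

end IsClosedCoefficientRing

/-- Complete local domains of mixed characteristic contain images of complete discrete valuation
rings which also map to the Witt vectors of a perfect field. -/
theorem exists_cohenRing (p : ℕ) [hp : Fact p.Prime] (T : Type) [CommRing T] [IsDomain T]
    [IsLocalRing T] [IsNoetherianRing T] [CharZero T] (hpm : (p : T) ∈ maximalIdeal T)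
    [IsAdicComplete (maximalIdeal T) T] :
    ∃ (C : Type) (_ : CommRing C) (_ : IsDomain C) (_ : IsDiscreteValuationRing C) (β : C →+* T)
      (k' : Type) (_ : Field k') (_ : CharP k' p) (_ : PerfectRing k' p) (ω : C →+* WittVector p k'),
      Irreducible (p : C) ∧ IsAdicComplete (Ideal.span {(p : C)}) C ∧
      (∀ a, ∃ c, residue T (β c) = a) ∧ ∀ c, WittVector.constantCoeff (ω c) = 0 → (p : C) ∣ c := by
  have hchar : CharP (ResidueField T) p := by
    refine (CharP.charP_iff_prime_eq_zero hp.out).2 ?_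
    rw [← map_natCast (residue T), residue_eq_zero_iff]; exact hpm
  obtain ⟨B, hB, hspan⟩ := exists_pBasis p (k := ResidueField T)
  let k' := PerfectClosure (ResidueField T) p
  let ι : ResidueField T →+* k' := PerfectClosure.of (ResidueField T) p
  let G : Subring (WittVector p k' × T) :=
    RingHom.eqLocus (WittVector.constantCoeff.comp (RingHom.fst _ _))
      ((ι.comp (residue T)).comp (RingHom.snd _ _))
  let fstG : G →+* WittVector p k' := (RingHom.fst _ _).comp G.subtype
  let sndG : G →+* T := (RingHom.snd _ _).comp G.subtype
  have hG : ∀ g : G, WittVector.constantCoeff (fstG g) = ι (residue T (sndG g)) := fun g => g.2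
  have hGext : ∀ g g' : G, fstG g = fstG g' → sndG g = sndG g' → g = g' :=
    fun g g' h h' => Subtype.ext (Prod.ext h h')
  obtain ⟨mk, hmk1, hmk2⟩ : ∃ mk : ∀ (w : WittVector p k') (t : T),
      WittVector.constantCoeff w = ι (residue T t) → G,
      (∀ w t h, fstG (mk w t h) = w) ∧ (∀ w t h, sndG (mk w t h) = t) :=
    ⟨fun w t h => ⟨(w, t), h⟩, fun _ _ _ => rfl, fun _ _ _ => rfl⟩
  clear_value fstG sndG
  let F : ℕ → Ideal G := fun j =>
    (Ideal.span {(p : WittVector p k')} ^ j).comap fstG ⊓ (maximalIdeal T ^ j).comap sndG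
  have hFmem : ∀ j g, g ∈ F j ↔ fstG g ∈ Ideal.span {(p : WittVector p k')} ^ j ∧
      sndG g ∈ maximalIdeal T ^ j := fun j g => Iff.rfl
  clear_value F
  have hanti : Antitone F := fun i j hij g hg =>
    (hFmem _ _).2 ⟨Ideal.pow_le_pow_right hij ((hFmem _ _).1 hg).1,
      Ideal.pow_le_pow_right hij ((hFmem _ _).1 hg).2⟩
  have hmul : ∀ i j a b, a ∈ F i → b ∈ F j → a * b ∈ F (i + j) := by
    intro i j a b ha hb
    rw [hFmem] at *
    rw [map_mul, map_mul, pow_add, pow_add]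
    exact ⟨Ideal.mul_mem_mul ha.1 hb.1, Ideal.mul_mem_mul ha.2 hb.2⟩
  have hpF : (p : G) ∈ F 1 := by
    rw [hFmem, map_natCast, map_natCast, pow_one, pow_one]
    exact ⟨Ideal.mem_span_singleton_self _, hpm⟩
  let π : G →+* ResidueField T := (residue T).comp sndG
  have hker : ∀ w : WittVector p k', WittVector.constantCoeff w = 0 ↔
      w ∈ Ideal.span {(p : WittVector p k')} := by
    intro w
    rw [← WittVector.ker_constantCoeff, RingHom.mem_ker]
  have hπ : ∀ a, π a = 0 ↔ a ∈ F 1 := by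
    intro a
    rw [hFmem, pow_one, pow_one, ← hker, hG, ← residue_eq_zero_iff]
    refine ⟨fun h => ⟨?_, h⟩, fun h => h.2⟩
    have : residue T (sndG a) = 0 := h
    rw [this, map_zero]
  have hπs : Function.Surjective π := by
    intro a
    obtain ⟨t, ht⟩ := residue_surjective (R := T) a
    refine ⟨mk (WittVector.teichmuller p (ι a)) t ?_, ?_⟩
    · rw [ht]; exact WittVector.teichmuller_coeff_zero p _
    · change residue T (sndG _) = a
      rw [hmk2, ht]
  let ℓ : ResidueField T → G := Function.surjInv hπs
  have hℓ : ∀ a, π (ℓ a) = a := Function.surjInv_eq _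
  have hlim : ∀ s : ℕ → G, (∀ j, s (j + 1) - s j ∈ F (j + 1)) → ∃ l, ∀ j, l - s j ∈ F (j + 1) := by
    intro s hs
    simp only [hFmem, map_sub] at hs
    obtain ⟨w, hw⟩ := IsAdicComplete.exists_sub_mem (Ideal.span {(p : WittVector p k')})
      (fun j => fstG (s j)) fun j => (hs j).1
    obtain ⟨t, ht⟩ := IsAdicComplete.exists_sub_mem (maximalIdeal T)
      (fun j => sndG (s j)) fun j => (hs j).2
    have hwt : WittVector.constantCoeff w = ι (residue T t) := by
      have h1 := hw 0
      have h2 := ht 0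
      rw [zero_add, pow_one, ← hker, map_sub, sub_eq_zero] at h1
      rw [zero_add, pow_one, ← residue_eq_zero_iff, map_sub, sub_eq_zero] at h2
      rw [h1, h2, hG]
    refine ⟨mk w t hwt, fun j => ?_⟩
    rw [hFmem, map_sub, map_sub, hmk1, hmk2]
    exact ⟨hw j, ht j⟩
  have hsep : ∀ a, (∀ j, a ∈ F (j + 1)) → a = 0 := by
    intro a ha
    simp only [hFmem] at ha
    refine hGext _ _ ?_ ?_
    · rw [map_zero]
      refine IsHausdorff.eq_zero_of_forall_mem (Ideal.span {(p : WittVector p k')}) fun j => ?_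
      exact Ideal.pow_le_pow_right (Nat.le_succ j) (ha j).1
    · rw [map_zero]
      refine IsHausdorff.eq_zero_of_forall_mem (maximalIdeal T) fun j => ?_
      exact Ideal.pow_le_pow_right (Nat.le_succ j) (ha j).2
  have hpT : (p : T) ≠ 0 := Nat.cast_ne_zero.2 hp.out.ne_zero
  obtain ⟨r, hr⟩ : ∃ r, ∀ (j : ℕ) (g : G), p * g ∈ F (j + r) → g ∈ F j := by
    obtain ⟨r₀, hr₀⟩ := Ideal.exists_pow_inf_eq_pow_smul (maximalIdeal T)
      (Ideal.span {(p : T)} : Submodule T T)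
    refine ⟨r₀ + 1, fun j g hg => ?_⟩
    rw [hFmem, map_mul, map_mul, map_natCast, map_natCast] at hg
    rw [hFmem]
    constructor
    · have h1 := hg.1
      rw [Ideal.span_singleton_pow, Ideal.mem_span_singleton] at h1 ⊢
      have h2 : (p : WittVector p k') * p ^ j ∣ p * fstG g := by
        rw [← pow_succ']
        exact (pow_dvd_pow _ (by omega)).trans h1
      obtain ⟨e, he⟩ := h2
      refine ⟨e, ?_⟩
      have h3 : (fstG g - p ^ j * e) * p = 0 := by linear_combination he
      exact sub_eq_zero.1 (WittVector.eq_zero_of_p_mul_eq_zero _ h3)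
    · have h1 : (p : T) * sndG g ∈ (maximalIdeal T ^ (j + (r₀ + 1)) • ⊤ ⊓ Ideal.span {(p : T)} :
          Submodule T T) := by
        refine ⟨?_, Ideal.mul_mem_right _ _ (Ideal.mem_span_singleton_self _)⟩
        have := hg.2
        rwa [smul_eq_mul, Ideal.mul_top]
      rw [hr₀ _ (by omega)] at h1
      have h2 : (p : T) * sndG g ∈ maximalIdeal T ^ (j + (r₀ + 1) - r₀) * Ideal.span {(p : T)} :=
        Ideal.mul_mono_right inf_le_right h1
      obtain ⟨e, he, hee⟩ := Ideal.mem_mul_span_singleton.1 h2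
      have h3 : e = sndG g := mul_right_cancel₀ hpT (by rw [hee, mul_comm])
      rw [← h3]
      exact Ideal.pow_le_pow_right (by omega) he
  let C := ⨅ N, CoefficientRing.approx p F ℓ B N
  have hclosed : ∀ a, (∀ j, ∃ c ∈ C, a - c ∈ F (j + 1)) → a ∈ C := by
    intro a ha
    refine Subring.mem_iInf.2 fun N => ?_
    obtain ⟨c, hc, hac⟩ := ha N
    exact CoefficientRing.mem_approx_of_sub_mem p (Subring.mem_iInf.1 hc N) hac
  have hC : IsClosedCoefficientRing p F C :=
    { anti := hanti
      mul_mem := hmul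
      p_mem := hpF
      exists_limit := hlim
      eq_zero := hsep
      closed := hclosed
      dvd := by
        intro c hc hc1
        choose c' hc' hcc using
          CoefficientRing.exists_sub_p_mul_mem p hanti hmul hpF hπ hℓ hB hspan hlim hc ((hπ c).2 hc1)
        obtain ⟨l, hl⟩ := hlim (fun j => c' (j + r)) (fun j => by
          refine hr _ _ ?_
          have h1 := hanti (by omega : j + 1 + r ≤ j + r + 2) (hcc (j + r))
          have h2 := hanti (by omega : j + 1 + r ≤ j + 1 + r + 2) (hcc (j + 1 + r))
          have := sub_mem h1 h2
          convert this using 1; ring)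
        refine ⟨l, hclosed l fun j => ⟨_, hc' (j + r), hl j⟩, sub_eq_zero.1 (hsep _ fun j => ?_)⟩
        have h1 := hanti (by omega : j + 1 ≤ j + r + 2) (hcc (j + r))
        have h2 := Ideal.mul_mem_left _ (p : G) (hl j)
        have := sub_mem h1 h2
        convert this using 1; ring
      exists_inv := by
        intro c hc hc1
        obtain ⟨d, hd, hdc⟩ := CoefficientRing.exists_mem_iInf_approx_map_eq p hanti hmul hpF hπ hℓ
          hspan hlim (π c)⁻¹
        refine ⟨d, hd, (hπ _).1 ?_⟩
        rw [map_sub, map_one, map_mul, hdc, mul_inv_cancel₀ fun h => hc1 ((hπ c).1 h), sub_self] }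
  let ω : C →+* WittVector p k' := fstG.comp C.subtype
  have hωp : ∀ c, WittVector.constantCoeff (ω c) = 0 → (p : C) ∣ c := by
    intro c hc
    rw [← Ideal.mem_span_singleton, hC.mem_span_iff, ← hπ]
    have h1 : WittVector.constantCoeff (fstG c) = 0 := hc
    rw [hG] at h1
    exact (map_eq_zero ι).1 h1
  have hωu : ∀ u : Cˣ, ω u ≠ 0 := fun u => (u.isUnit.map ω).ne_zero
  have hpW : (p : WittVector p k') ≠ 0 := by
    intro h
    have := WittVector.eq_zero_of_p_mul_eq_zero (1 : WittVector p k') (by rw [one_mul, h])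
    exact one_ne_zero this
  have hωinj : Function.Injective ω := by
    rw [injective_iff_map_eq_zero]
    intro c hc
    by_contra hc0
    obtain ⟨j, u, rfl⟩ := hC.exists_eq_pow_mul hc0
    rw [map_mul, map_pow, map_natCast] at hc
    exact (mul_ne_zero (pow_ne_zero _ hpW) (hωu u)) hc
  have : IsDomain C := hωinj.isDomain ω
  have hpC : (p : C) ≠ 0 := by
    intro h
    apply hpW
    rw [← map_natCast ω, h, map_zero]
  have hpu : ¬ IsUnit (p : C) := by
    intro h
    have := (h.map (sndG.comp C.subtype))
    rw [map_natCast] at this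
    exact hpm this
  obtain ⟨hdvr, hirr⟩ := hC.isDiscreteValuationRing hpC hpu
  refine ⟨C, inferInstance, inferInstance, hdvr, sndG.comp C.subtype, k', inferInstance, inferInstance,
    inferInstance, ω, hirr, hC.isAdicComplete, fun a => ?_, hωp⟩
  obtain ⟨c, hc, hca⟩ :=
    CoefficientRing.exists_mem_iInf_approx_map_eq p hanti hmul hpF hπ hℓ hspan hlim a
  exact ⟨⟨c, hc⟩, hca⟩

/-! ## Complete local rings as finite extensions of power series rings -/

/-- Evaluation of power series in a complete ring. -/
theorem MvPowerSeries.exists_eval {C T : Type} [CommRing C] [CommRing T] (I : Ideal T) [IsAdicComplete I T]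
    (β : C →+* T) {n : ℕ} (x : Fin n → T) (hx : ∀ i, x i ∈ I) :
    ∃ Ψ : MvPowerSeries (Fin n) C →+* T, (∀ c, Ψ (MvPowerSeries.C c) = β c) ∧
      ∀ i, Ψ (MvPowerSeries.X i) = x i := by
  let φ : MvPolynomial (Fin n) C →+* T := MvPolynomial.eval₂Hom β x
  have hφ : (MvPolynomial.idealOfVars (Fin n) C).map φ ≤ I := by
    rw [Ideal.map_le_iff_le_comap, MvPolynomial.idealOfVars, Ideal.span_le]
    rintro _ ⟨i, rfl⟩
    simpa [φ] using hx i
  have hφN : ∀ N, MvPolynomial.idealOfVars (Fin n) C ^ N ≤ (I ^ N).comap φ := by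
    intro N
    rw [← Ideal.map_le_iff_le_comap, Ideal.map_pow]
    exact Ideal.pow_right_mono hφ N
  let f : ∀ N, MvPowerSeries (Fin n) C →+* T ⧸ I ^ N := fun N =>
    (Ideal.quotientMap (I ^ N) φ (hφN N)).comp
      (MvPowerSeries.truncTotalAlgHom (Fin n) C N : _ →+* _)
  have hf : ∀ {m N : ℕ} (hle : m ≤ N), (Ideal.Quotient.factorPow I hle).comp (f N) = f m := by
    intro m N hle
    ext z
    change Ideal.Quotient.factorPow I hle (Ideal.Quotient.mk _ (φ (MvPowerSeries.truncTotal N z))) =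
      Ideal.Quotient.mk _ (φ (MvPowerSeries.truncTotal m z))
    change Ideal.Quotient.mk _ (φ (MvPowerSeries.truncTotal N z)) = _
    rw [Ideal.Quotient.eq, ← map_sub]
    exact hφN m (MvPowerSeries.truncTotal_sub_truncTotal_mem_pow_idealOfVars hle le_rfl z)
  have hpoly : ∀ q : MvPolynomial (Fin n) C, IsAdicComplete.liftRingHom I f hf q = φ q := by
    intro q
    rw [← sub_eq_zero]
    refine IsHausdorff.eq_zero_of_forall_mem I fun N => ?_
    rw [← Ideal.Quotient.eq, IsAdicComplete.mk_liftRingHom]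
    have := (MvPowerSeries.truncTotalAlgHom (Fin n) C N).commutes q
    change Ideal.quotientMap (I ^ N) φ (hφN N) ((MvPowerSeries.truncTotalAlgHom (Fin n) C N) q) = _
    erw [this]
    rfl
  refine ⟨IsAdicComplete.liftRingHom I f hf, fun c => ?_, fun i => ?_⟩
  · rw [← MvPolynomial.coe_C, hpoly]; simp [φ]
  · rw [← MvPolynomial.coe_X, hpoly]; simp [φ]

/-- A separated module over a complete ring is finite if it is finite modulo the ideal. -/
theorem Module.Finite.of_isAdicComplete {R M : Type} [CommRing R] [AddCommGroup M] [Module R M]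
    (I : Ideal R) [IsAdicComplete I R] [IsHausdorff I M] {r : ℕ} (v : Fin r → M)
    (hv : ∀ m : M, ∃ c : Fin r → R, m - ∑ i, c i • v i ∈ (I • ⊤ : Submodule R M)) :
    Module.Finite R M := by
  have hstep : ∀ (N : ℕ) (m : M), m ∈ (I ^ N • ⊤ : Submodule R M) → ∃ e : Fin r → R,
      (∀ i, e i ∈ I ^ N) ∧ m - ∑ i, e i • v i ∈ (I ^ (N + 1) • ⊤ : Submodule R M) := by
    intro N m hm
    have htop : (⊤ : Submodule R M) = Submodule.span R (Set.range v) ⊔ I • ⊤ := by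
      refine (eq_top_iff.2 fun m _ => ?_).symm
      obtain ⟨c, hc⟩ := hv m
      rw [← add_sub_cancel (∑ i, c i • v i) m]
      exact Submodule.add_mem_sup (Submodule.sum_mem _ fun i _ => Submodule.smul_mem _ _
        (Submodule.subset_span ⟨i, rfl⟩)) hc
    rw [htop, Submodule.smul_sup, ← Submodule.mul_smul, ← pow_succ] at hm
    obtain ⟨a, ha, b, hb, rfl⟩ := Submodule.mem_sup.1 hm
    obtain ⟨e, he, hea⟩ := (Submodule.mem_ideal_smul_span_iff_exists_sum _ v a).1 ha
    refine ⟨e, he, ?_⟩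
    rw [Finsupp.sum_fintype _ _ (by simp)] at hea
    rw [← hea, add_sub_cancel_left]
    exact hb
  refine Module.finite_def.2 (Submodule.fg_def.2 ⟨Set.range v, Set.finite_range v, eq_top_iff.2 ?_⟩)
  rintro m -
  choose e heI he using hstep
  let seq : ∀ N, {q : Fin r → R // m - ∑ i, q i • v i ∈ (I ^ N • ⊤ : Submodule R M)} := fun N =>
    Nat.rec (motive := fun N => {q : Fin r → R // m - ∑ i, q i • v i ∈ (I ^ N • ⊤ : Submodule R M)})
      ⟨0, by simp⟩ (fun N q => ⟨q.1 + e N _ q.2, by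
        have := he N _ q.2
        simp only [Pi.add_apply, add_smul, Finset.sum_add_distrib]
        rwa [← sub_sub]⟩) N
  have hseq : ∀ N i, (seq (N + 1)).1 i - (seq N).1 i ∈ I ^ N := by
    intro N i
    have : (seq (N + 1)).1 = (seq N).1 + e N _ (seq N).2 := rfl
    rw [this, Pi.add_apply, add_sub_cancel_left]
    exact heI N _ _ i
  choose c hc using fun i => IsAdicComplete.exists_sub_mem I (fun N => (seq (N + 1)).1 i)
    (fun N => hseq (N + 1) i)
  have hm : m - ∑ i, c i • v i = 0 := by
    refine IsHausdorff.haus' (I := I) _ fun N => ?_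
    rw [SModEq.sub_mem, sub_zero]
    have h1 := (seq (N + 1)).2
    have h2 : ∑ i, (c i - (seq (N + 1)).1 i) • v i ∈ (I ^ (N + 1) • ⊤ : Submodule R M) :=
      Submodule.sum_mem _ fun i _ => Submodule.smul_mem_smul (hc i N) Submodule.mem_top
    have h3 := Submodule.sub_mem _ h1 h2
    have : m - ∑ i, c i • v i = m - ∑ i, (seq (N + 1)).1 i • v i -
        ∑ i, (c i - (seq (N + 1)).1 i) • v i := by
      simp only [sub_smul, Finset.sum_sub_distrib]; abel
    rw [this]
    exact Submodule.smul_mono_left (Ideal.pow_le_pow_right (Nat.le_succ N)) h3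
  rw [sub_eq_zero.1 hm]
  exact Submodule.sum_mem _ fun i _ => Submodule.smul_mem _ _ (Submodule.subset_span ⟨i, rfl⟩)

section

variable {C T : Type} [CommRing C] [CommRing T] [IsLocalRing T] [IsNoetherianRing T] (β : C →+* T)
  (hβ : ∀ a, ∃ c, residue T (β c) = a)

include hβ

/-- Modulo a power of the maximal ideal, a Noetherian local ring is finite over any ring which
surjects onto the residue field. -/
lemma exists_finset_sub_mem_pow (N : ℕ) : ∃ (r : ℕ) (v : Fin r → T), ∀ t, ∃ c : Fin r → C,
    t - ∑ i, β (c i) * v i ∈ maximalIdeal T ^ N := by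
  induction N with
  | zero => exact ⟨0, Fin.elim0, fun t => ⟨Fin.elim0, by simp⟩⟩
  | succ N ih =>
    obtain ⟨r, v, hv⟩ := ih
    obtain ⟨s, g, hg⟩ := Submodule.fg_iff_exists_fin_generating_family.1
      ((isNoetherianRing_iff_ideal_fg T).1 inferInstance (maximalIdeal T ^ N))
    refine ⟨r + s, Fin.append v g, fun t => ?_⟩
    obtain ⟨c, hc⟩ := hv t
    rw [← hg] at hc
    obtain ⟨u, hu⟩ := (Submodule.mem_span_range_iff_exists_fun T).1 hc
    choose c' hc' using fun i => hβ (residue T (u i))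
    refine ⟨Fin.append c c', ?_⟩
    rw [Fin.sum_univ_add]
    simp only [Fin.append_left, Fin.append_right]
    have : t - (∑ i, β (c i) * v i + ∑ i, β (c' i) * g i) = ∑ i, (u i - β (c' i)) * g i := by
      rw [← sub_sub, ← hu, ← Finset.sum_sub_distrib]
      exact sum_congr rfl fun i _ => by rw [smul_eq_mul]; ring
    rw [this, pow_succ']
    refine Ideal.sum_mem _ fun i _ => Ideal.mul_mem_mul ?_ ?_
    · rw [← residue_eq_zero_iff, map_sub, hc', sub_self]
    · rw [← hg]; exact Submodule.subset_span ⟨i, rfl⟩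

variable [IsLocalRing C] [IsAdicComplete (maximalIdeal C) C] (hloc : (maximalIdeal C).map β ≤ maximalIdeal T)
  {n : ℕ} {x : Fin n → T} (hx : ∀ i, x i ∈ maximalIdeal T) {N : ℕ}
  (hN : maximalIdeal T ^ N ≤ Ideal.span (Set.range x) ⊔ (maximalIdeal C).map β)

include hloc hN in
lemma exists_finset_sub_mem_span : ∃ (r : ℕ) (v : Fin r → T), ∀ t, ∃ c : Fin r → C,
    t - ∑ i, β (c i) * v i ∈ Ideal.span (Set.range x) := by
  let _ : Algebra C T := β.toAlgebra
  let M := T ⧸ Ideal.span (Set.range x)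
  have : IsHausdorff (maximalIdeal C) M := IsHausdorff.of_map (S := T) (J := maximalIdeal T) hloc
  obtain ⟨r, v, hv⟩ := exists_finset_sub_mem_pow β hβ N
  have : Module.Finite C M := by
    refine Module.Finite.of_isAdicComplete (maximalIdeal C)
      (fun i => Ideal.Quotient.mk (Ideal.span (Set.range x)) (v i)) fun m => ?_
    obtain ⟨t, rfl⟩ := Ideal.Quotient.mk_surjective m
    obtain ⟨c, hc⟩ := hv t
    refine ⟨c, ?_⟩
    rw [Ideal.smul_top_eq_map, Submodule.restrictScalars_mem]
    have h1 := Ideal.mem_map_of_mem (Ideal.Quotient.mk (Ideal.span (Set.range x))) (hN hc)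
    rw [Ideal.map_sup, Ideal.map_quotient_self, bot_sup_eq, Ideal.map_map, map_sub, map_sum] at h1
    have h2 : ∑ i, c i • Ideal.Quotient.mk (Ideal.span (Set.range x)) (v i) =
        ∑ i, Ideal.Quotient.mk (Ideal.span (Set.range x)) (β (c i) * v i) := by
      refine sum_congr rfl fun i _ => ?_
      rw [map_mul, Algebra.smul_def]
      rfl
    rw [h2]
    exact h1
  obtain ⟨r, w, hw⟩ := Module.Finite.exists_fin (R := C) (M := M)
  choose w' hw' using fun i => Ideal.Quotient.mk_surjective (w i)
  refine ⟨r, w', fun t => ?_⟩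
  have ht : (Ideal.Quotient.mk (Ideal.span (Set.range x)) t : M) ∈ Submodule.span C (Set.range w) := by
    rw [hw]; trivial
  obtain ⟨c, hc⟩ := (Submodule.mem_span_range_iff_exists_fun C).1 ht
  refine ⟨c, ?_⟩
  rw [← Ideal.Quotient.eq, ← hc, map_sum]
  refine sum_congr rfl fun i _ => ?_
  rw [map_mul, hw', Algebra.smul_def]
  rfl

include hloc hN hx in
lemma MvPowerSeries.finite_eval {Ψ : MvPowerSeries (Fin n) C →+* T}
    (hC : ∀ c, Ψ (MvPowerSeries.C c) = β c) (hX : ∀ i, Ψ (MvPowerSeries.X i) = x i) : Ψ.Finite := by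
  let _ : Algebra (MvPowerSeries (Fin n) C) T := Ψ.toAlgebra
  let I : Ideal (MvPowerSeries (Fin n) C) := Ideal.span (Set.range MvPowerSeries.X)
  have hI : I.map (algebraMap (MvPowerSeries (Fin n) C) T) = Ideal.span (Set.range x) := by
    rw [Ideal.map_span, ← Set.range_comp]
    congr 2
    ext i
    exact hX i
  have : IsHausdorff I T := IsHausdorff.of_map (S := T) (J := maximalIdeal T) (by
    rw [hI, Ideal.span_le]
    rintro _ ⟨i, rfl⟩
    exact hx i)
  obtain ⟨r, v, hv⟩ := exists_finset_sub_mem_span β hβ hloc hN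
  refine Module.Finite.of_isAdicComplete I v fun t => ?_
  obtain ⟨c, hc⟩ := hv t
  refine ⟨fun i => MvPowerSeries.C (c i), ?_⟩
  rw [Ideal.smul_top_eq_map, Submodule.restrictScalars_mem, hI]
  have h2 : ∑ i, (MvPowerSeries.C (c i) : MvPowerSeries (Fin n) C) • v i = ∑ i, β (c i) * v i := by
    refine sum_congr rfl fun i _ => ?_
    rw [Algebra.smul_def]
    exact congrArg (· * v i) (hC (c i))
  rw [h2]
  exact hc

end

lemma MvPowerSeries.mem_span_range_X_of_constantCoeff_eq_zero {C : Type} [CommRing C] {n : ℕ}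
    {f : MvPowerSeries (Fin n) C} (hf : MvPowerSeries.constantCoeff f = 0) :
    f ∈ Ideal.span (Set.range (MvPowerSeries.X : Fin n → MvPowerSeries (Fin n) C)) := by
  have h1 := (MvPowerSeries.mem_span_X_pow_iff univ 1 f).2 (fun m hm => by
    have : m = 0 := by ext i; simpa using hm i (mem_univ i)
    rw [this]; exact hf)
  simpa using h1

lemma MvPowerSeries.ringKrullDim_le {C : Type} [CommRing C] [IsLocalRing C] [IsNoetherianRing C] (n : ℕ) :
    ringKrullDim (MvPowerSeries (Fin n) C) ≤ ringKrullDim C + n := by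
  classical
  let s : Finset (MvPowerSeries (Fin n) C) := univ.image MvPowerSeries.X
  have hs : (s : Set (MvPowerSeries (Fin n) C)) = Set.range MvPowerSeries.X := by simp [s]
  have h1 := ringKrullDim_le_ringKrullDim_quotient_add_card s (by
    rw [hs, IsLocalRing.ringJacobson_eq_maximalIdeal]
    rintro _ ⟨i, rfl⟩
    rw [SetLike.mem_coe, mem_maximalIdeal, mem_nonunits_iff, MvPowerSeries.isUnit_iff_constantCoeff]
    simp)
  have h2 : ringKrullDim (MvPowerSeries (Fin n) C ⧸ Ideal.span (s : Set (MvPowerSeries (Fin n) C))) ≤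
      ringKrullDim C := by
    refine ringKrullDim_le_of_surjective
      ((Ideal.Quotient.mk (Ideal.span (s : Set (MvPowerSeries (Fin n) C)))).comp MvPowerSeries.C) ?_
    intro z
    obtain ⟨f, rfl⟩ := Ideal.Quotient.mk_surjective z
    refine ⟨MvPowerSeries.constantCoeff f, ?_⟩
    rw [RingHom.comp_apply, Ideal.Quotient.eq, hs, ← neg_mem_iff, neg_sub]
    exact MvPowerSeries.mem_span_range_X_of_constantCoeff_eq_zero (by simp)
  refine h1.trans (add_le_add h2 ?_)
  have : s.card ≤ n := by simpa using Finset.card_image_le (s := univ) (f := (MvPowerSeries.X : Fin n → MvPowerSeries (Fin n) C))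
  exact_mod_cast this

lemma ringKrullDim_le_of_isIntegral (A B : Type) [CommRing A] [CommRing B] [Algebra A B]
    [Algebra.IsIntegral A B] : ringKrullDim B ≤ ringKrullDim A := by
  refine Order.krullDim_le_of_strictMono (fun P : PrimeSpectrum B => P.comap (algebraMap A B)) ?_
  intro P Q hPQ
  exact Ideal.IsIntegral.comap_lt_comap (R := A) hPQ

/-- Finite maps from a domain to a ring of at least the same dimension are injective. -/
lemma RingHom.injective_of_finite_of_ringKrullDim_le {A B : Type} [CommRing A] [IsDomain A] [CommRing B]
    {Ψ : A →+* B} (hΨ : Ψ.Finite) {d : ℕ} (hA : ringKrullDim A ≤ d) (hB : d ≤ ringKrullDim B) :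
    Function.Injective Ψ := by
  rw [injective_iff_map_eq_zero]
  intro a ha
  by_contra h0
  have h1 : ringKrullDim (A ⧸ Ideal.span {a}) + 1 ≤ ringKrullDim A :=
    ringKrullDim_quotient_succ_le_of_nonZeroDivisor (mem_nonZeroDivisors_of_ne_zero h0)
  let Φ : A ⧸ Ideal.span {a} →+* B := Ideal.Quotient.lift _ Ψ (fun b hb => by
    obtain ⟨c, rfl⟩ := Ideal.mem_span_singleton'.1 hb
    rw [map_mul, ha, mul_zero])
  have hΦ : Φ.Finite := RingHom.Finite.of_comp_finite (f := Ideal.Quotient.mk (Ideal.span {a})) (g := Φ) hΨ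
  let _ : Algebra (A ⧸ Ideal.span {a}) B := Φ.toAlgebra
  have : Module.Finite (A ⧸ Ideal.span {a}) B := hΦ
  have h2 := ringKrullDim_le_of_isIntegral (A ⧸ Ideal.span {a}) B
  have h3 : (d : WithBot ℕ∞) + 1 ≤ d := (add_le_add_left (hB.trans h2) 1).trans (h1.trans hA)
  have h4 : d + 1 ≤ d := by exact_mod_cast h3
  omega

/-- Complete local domains are finite over power series rings. -/
theorem exists_finite_injective_eval {C T : Type} [CommRing C] [IsDomain C] [IsLocalRing C]
    [IsNoetherianRing C] [IsAdicComplete (maximalIdeal C) C] [CommRing T] [IsLocalRing T] [IsNoetherianRing T]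
    [IsAdicComplete (maximalIdeal T) T] (β : C →+* T) (hβ : ∀ a, ∃ c, residue T (β c) = a)
    (hloc : (maximalIdeal C).map β ≤ maximalIdeal T)
    {n : ℕ} {x : Fin n → T} (hx : ∀ i, x i ∈ maximalIdeal T) {N : ℕ}
    (hN : maximalIdeal T ^ N ≤ Ideal.span (Set.range x) ⊔ (maximalIdeal C).map β) {d : ℕ}
    (hC : ringKrullDim C + n ≤ d) (hT : d ≤ ringKrullDim T) :
    ∃ Ψ : MvPowerSeries (Fin n) C →+* T, (∀ c, Ψ (MvPowerSeries.C c) = β c) ∧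
      (∀ i, Ψ (MvPowerSeries.X i) = x i) ∧ Function.Injective Ψ ∧ Ψ.Finite := by
  obtain ⟨Ψ, h1, h2⟩ := MvPowerSeries.exists_eval (maximalIdeal T) β x hx
  have h3 := MvPowerSeries.finite_eval β hβ hloc hx hN h1 h2
  exact ⟨Ψ, h1, h2, RingHom.injective_of_finite_of_ringKrullDim_le h3
    ((MvPowerSeries.ringKrullDim_le n).trans hC) hT, h3⟩

section

/-- A domain `B` is completely integrally closed: every element of the fraction field all of whose
powers have a common denominator lies in `B`. -/
def IsCompletelyIntegrallyClosed (B : Type) [CommRing B] : Prop :=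
  ∀ a b c : B, c ≠ 0 → b ≠ 0 → (∀ n : ℕ, b ^ n ∣ c * a ^ n) → b ∣ a

namespace IsCompletelyIntegrallyClosed

variable {B : Type} [CommRing B] [IsDomain B]

lemma of_isIntegrallyClosed [IsNoetherianRing B] [IsIntegrallyClosed B] :
    IsCompletelyIntegrallyClosed B := by
  intro a b c hc hb h
  let K := FractionRing B
  have hb' : algebraMap B K b ≠ 0 := (map_ne_zero_iff _ (IsFractionRing.injective B K)).2 hb
  have h1 : IsAlmostIntegral B (algebraMap B K a / algebraMap B K b) := by
    refine ⟨c, mem_nonZeroDivisors_of_ne_zero hc, fun n => ?_⟩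
    obtain ⟨u, hu⟩ := h n
    refine ⟨u, ?_⟩
    rw [Algebra.smul_def, div_pow, ← mul_div_assoc, eq_div_iff (pow_ne_zero _ hb'), ← map_pow, ← map_pow,
      ← map_mul, ← map_mul, hu, mul_comm]
  obtain ⟨y, hy⟩ := IsIntegrallyClosed.isIntegral_iff.1 (IsAlmostIntegral.isIntegral h1)
  refine ⟨y, IsFractionRing.injective B K ?_⟩
  rw [map_mul, hy, mul_div_cancel₀ _ hb']

lemma isIntegrallyClosed (h : IsCompletelyIntegrallyClosed B) : IsIntegrallyClosed B := by
  rw [isIntegrallyClosed_iff (FractionRing B)]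
  intro x hx
  obtain ⟨c, hc, h1⟩ := hx.isAlmostIntegral
  obtain ⟨a, b, hb, rfl⟩ := IsFractionRing.div_surjective (A := B) x
  have hb0 := nonZeroDivisors.ne_zero hb
  have hb' : algebraMap B (FractionRing B) b ≠ 0 :=
    (map_ne_zero_iff _ (IsFractionRing.injective B (FractionRing B))).2 hb0
  obtain ⟨y, hy⟩ := h a b c (nonZeroDivisors.ne_zero hc) hb0 (fun n => by
    obtain ⟨u, hu⟩ := h1 n
    refine ⟨u, IsFractionRing.injective B (FractionRing B) ?_⟩
    rw [Algebra.smul_def, div_pow, ← mul_div_assoc, eq_div_iff (pow_ne_zero _ hb'), ← map_pow, ← map_pow,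
      ← map_mul, ← map_mul] at hu
    rw [← hu, mul_comm])
  exact ⟨y, by rw [hy, map_mul, mul_div_cancel_left₀ _ hb']⟩

lemma of_ringEquiv {B' : Type} [CommRing B'] (e : B ≃+* B') (h : IsCompletelyIntegrallyClosed B) :
    IsCompletelyIntegrallyClosed B' := by
  intro a b c hc hb h1
  have := h (e.symm a) (e.symm b) (e.symm c) (by simpa using hc) (by simpa using hb) (fun n => by
    simpa using map_dvd e.symm (h1 n))
  simpa using map_dvd e this

open PowerSeries in
lemma exists_monomial_of_pow_dvd (h : IsCompletelyIntegrallyClosed B) {a b c : PowerSeries B} (hc : c ≠ 0)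
    (hb : b ≠ 0) (ha : a ≠ 0) (hd : ∀ n : ℕ, b ^ n ∣ c * a ^ n) :
    ∃ g, b.order.toNat ≤ a.order.toNat ∧
      X ^ (a.order.toNat + 1) ∣ a - b * (X ^ (a.order.toNat - b.order.toNat) * C g) := by
  have hord : b.order.toNat ≤ a.order.toNat := by
    by_contra! hlt
    obtain ⟨u, hu⟩ := hd (c.order.toNat + 1)
    have h1 := congrArg order hu
    rw [order_mul, order_mul, order_pow, order_pow] at h1
    nth_rewrite 1 [← coe_toNat_order hc] at h1
    rw [← coe_toNat_order ha, ← coe_toNat_order hb] at h1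
    have h2 : (c.order.toNat + 1) • (b.order.toNat : ℕ∞) ≤ c.order.toNat + (c.order.toNat + 1) • (a.order.toNat : ℕ∞) := by
      rw [h1]; exact le_self_add
    simp only [nsmul_eq_mul] at h2
    norm_cast at h2
    nlinarith
  have hl : constantCoeff (divXPowOrder b) ∣ constantCoeff (divXPowOrder a) := by
    refine h _ _ (constantCoeff (divXPowOrder c)) (by simpa [constantCoeff_divXPowOrder_eq_zero_iff] using hc)
      (by simpa [constantCoeff_divXPowOrder_eq_zero_iff] using hb) fun n => ?_
    obtain ⟨u, hu⟩ := hd n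
    refine ⟨constantCoeff (divXPowOrder u), ?_⟩
    have h1 := congrArg (fun f => constantCoeff (divXPowOrder f)) hu
    simpa [divXPowOrder_mul, divXPowOrder_pow] using h1
  obtain ⟨g, hg⟩ := hl
  refine ⟨g, hord, ?_⟩
  have h1 : X ∣ divXPowOrder a - divXPowOrder b * C g := by
    rw [X_dvd_iff, map_sub, map_mul, hg, constantCoeff_C, sub_self]
  have h2 : a - b * (X ^ (a.order.toNat - b.order.toNat) * C g) =
      X ^ a.order.toNat * (divXPowOrder a - divXPowOrder b * C g) := by
    have h3 : (X : PowerSeries B) ^ a.order.toNat = X ^ b.order.toNat * X ^ (a.order.toNat - b.order.toNat) := by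
      rw [← pow_add, Nat.add_sub_cancel' hord]
    have h4 := X_pow_order_mul_divXPowOrder (f := b)
    rw [mul_sub, X_pow_order_mul_divXPowOrder (f := a), h3]
    linear_combination (X ^ (a.order.toNat - b.order.toNat) * C g) * h4
  rw [h2, pow_succ]
  exact mul_dvd_mul_left _ h1

lemma pow_dvd_sub_mul {a b c : B} (hd : ∀ n : ℕ, b ^ n ∣ c * a ^ n) (g : B) (n : ℕ) :
    b ^ n ∣ c * (a - b * g) ^ n := by
  rw [sub_eq_add_neg, add_pow, mul_sum]
  refine Finset.dvd_sum fun i hi => ?_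
  obtain ⟨u, hu⟩ := hd i
  have : i ≤ n := Nat.lt_succ_iff.1 (mem_range.1 hi)
  refine ⟨u * (-g) ^ (n - i) * (n.choose i), ?_⟩
  calc _ = (c * a ^ i) * (b ^ (n - i) * (-g) ^ (n - i)) * (n.choose i) := by
        rw [neg_mul_eq_mul_neg, mul_pow]; ring
    _ = b ^ i * b ^ (n - i) * (u * (-g) ^ (n - i) * (n.choose i)) := by rw [hu]; ring
    _ = _ := by rw [← pow_add, Nat.add_sub_cancel' this]

open PowerSeries in
lemma powerSeries (h : IsCompletelyIntegrallyClosed B) : IsCompletelyIntegrallyClosed (PowerSeries B) := by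
  intro a b c hc hb hd
  have hstep : ∀ (k : ℕ) (G : PowerSeries B), ∃ G' : PowerSeries B, X ^ (b.order.toNat + k) ∣ a - b * G →
      (X ^ (b.order.toNat + (k + 1)) ∣ a - b * G' ∧ G' - G ∈ Ideal.span {(X : PowerSeries B)} ^ k) := by
    intro k G
    by_cases h0 : a - b * G = 0
    · exact ⟨G, fun _ => by simp [h0]⟩
    by_cases h1 : X ^ (b.order.toNat + k) ∣ a - b * G
    swap
    · exact ⟨G, fun h => absurd h h1⟩
    obtain ⟨g, hg1, hg2⟩ := h.exists_monomial_of_pow_dvd hc hb h0 (pow_dvd_sub_mul hd G)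
    have h2 : b.order.toNat + k ≤ (a - b * G).order.toNat := by
      have := (order_eq_emultiplicity_X (a - b * G)) ▸ le_emultiplicity_of_pow_dvd h1
      rw [← coe_toNat_order h0] at this
      exact_mod_cast this
    refine ⟨G + X ^ ((a - b * G).order.toNat - b.order.toNat) * C g, fun _ => ⟨?_, ?_⟩⟩
    · rw [mul_add, ← sub_sub]
      exact (pow_dvd_pow _ (by omega)).trans hg2
    · rw [add_sub_cancel_left, Ideal.span_singleton_pow, Ideal.mem_span_singleton]
      exact (pow_dvd_pow _ (by omega)).mul_right _
  choose! F hF using hstep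
  have h0 : X ^ (b.order.toNat + 0) ∣ a - b * 0 := by
    rw [mul_zero, sub_zero, add_zero]
    by_cases ha : a = 0
    · simp [ha]
    obtain ⟨g, hg1, -⟩ := h.exists_monomial_of_pow_dvd hc hb ha hd
    exact (pow_dvd_pow _ hg1).trans X_pow_order_dvd
  let G : ℕ → PowerSeries B := fun k => Nat.rec 0 (fun k G => F k G) k
  have hG : ∀ k, X ^ (b.order.toNat + k) ∣ a - b * G k := by
    intro k
    induction k with
    | zero => exact h0
    | succ k ih => exact (hF k (G k) ih).1
  obtain ⟨L, hL⟩ := IsAdicComplete.exists_sub_mem (Ideal.span {(X : PowerSeries B)})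
    (fun k => G (k + 1)) (fun k => (hF (k + 1) (G (k + 1)) (hG (k + 1))).2)
  refine ⟨L, sub_eq_zero.1 (IsHausdorff.eq_zero_of_forall_mem (Ideal.span {(X : PowerSeries B)}) fun k => ?_)⟩
  have : a - b * L = (a - b * G (k + 1)) + b * (G (k + 1) - L) := by ring
  rw [this]
  refine add_mem ?_ (Ideal.mul_mem_left _ _ ?_)
  · rw [Ideal.span_singleton_pow, Ideal.mem_span_singleton]
    exact (pow_dvd_pow _ (by omega)).trans (hG (k + 1))
  · rw [← neg_mem_iff, neg_sub]; exact Ideal.pow_le_pow_right k.le_succ (hL k)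

lemma mvPowerSeries (h : IsCompletelyIntegrallyClosed B) (n : ℕ) :
    IsCompletelyIntegrallyClosed (MvPowerSeries (Fin n) B) := by
  induction n with
  | zero => exact of_ringEquiv (MvPowerSeries.isEmptyEquiv (Fin 0) B).symm.toRingEquiv h
  | succ n ih => exact of_ringEquiv (MvPowerSeries.finSuccEquiv B n).symm.toRingEquiv ih.powerSeries

end IsCompletelyIntegrallyClosed

instance MvPowerSeries.isIntegrallyClosed (B : Type) [CommRing B] [IsDomain B] [IsNoetherianRing B]
    [IsIntegrallyClosed B] (n : ℕ) : IsIntegrallyClosed (MvPowerSeries (Fin n) B) :=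
  (IsCompletelyIntegrallyClosed.of_isIntegrallyClosed.mvPowerSeries n).isIntegrallyClosed

end

section

/-- Let `F` be an endomorphism of `B` and view a `B`-module `V` as a module along `F`. All submodules of
`V` of finite rank are finitely generated. -/
def TwistedFinite {B : Type} [CommRing B] (F : B →+* B) (V : Type) [AddCommGroup V] [Module B V] : Prop :=
  ∀ M : AddSubgroup V, (∀ b, ∀ m ∈ M, F b • m ∈ M) →
    (∃ N, ∀ (r : ℕ) (v : Fin r → V), (∀ i, v i ∈ M) →
      (∀ c : Fin r → B, ∑ i, F (c i) • v i = 0 → ∀ i, c i = 0) → r ≤ N) →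
    ∃ (r : ℕ) (g : Fin r → V), (∀ i, g i ∈ M) ∧ ∀ m ∈ M, ∃ c : Fin r → B, m = ∑ i, F (c i) • g i

namespace TwistedFinite

lemma of_field {k : Type} [Field k] (F : k →+* k) : TwistedFinite F k := by
  classical
  rintro M hM ⟨N, hN⟩
  let Q : ℕ → Prop := fun r => ∃ v : Fin r → k, (∀ i, v i ∈ M) ∧
    (∀ c : Fin r → k, ∑ i, F (c i) • v i = 0 → ∀ i, c i = 0)
  have hQ0 : Q 0 := ⟨Fin.elim0, fun i => i.elim0, fun _ _ i => i.elim0⟩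
  have hQN : ∀ r, Q r → r ≤ N := fun r ⟨v, h1, h2⟩ => hN r v h1 h2
  obtain ⟨g, hg1, hg2⟩ := Nat.findGreatest_spec (P := Q) (Nat.zero_le N) hQ0
  refine ⟨_, g, hg1, fun m hm => ?_⟩
  have h1 : ¬ Q (Nat.findGreatest Q N + 1) := fun h => by
    have := Nat.le_findGreatest (hQN _ h) h
    omega
  have h2 : ∃ c : Fin (Nat.findGreatest Q N + 1) → k,
      ∑ i, F (c i) • (Fin.cons m g : Fin (Nat.findGreatest Q N + 1) → k) i = 0 ∧ ∃ i, c i ≠ 0 := by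
    by_contra! h
    exact h1 ⟨Fin.cons m g, fun i => by refine Fin.cases ?_ (fun j => ?_) i <;> simp [hm, hg1], h⟩
  obtain ⟨c, hc, j, hj⟩ := h2
  rw [Fin.sum_univ_succ] at hc
  simp only [Fin.cons_zero, Fin.cons_succ, smul_eq_mul] at hc
  have hc0 : c 0 ≠ 0 := by
    intro h0
    rw [h0, map_zero, zero_mul, zero_add] at hc
    have := hg2 (fun i => c i.succ) hc
    refine hj ?_
    refine Fin.cases h0 this j
  have hF0 : F (c 0) ≠ 0 := (map_ne_zero F).2 hc0
  refine ⟨fun i => -(c i.succ / c 0), ?_⟩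
  refine mul_left_cancel₀ hF0 ?_
  rw [mul_sum]
  refine (eq_neg_of_add_eq_zero_left hc).trans ?_
  rw [← Finset.sum_neg_distrib]
  refine sum_congr rfl fun i _ => ?_
  rw [smul_eq_mul, map_neg, map_div₀]
  field_simp

section

variable {B : Type} [CommRing B] {F : B →+* B} {V W : Type} [AddCommGroup V] [Module B V]
  [AddCommGroup W] [Module B W]

lemma of_exact {U : Type} [AddCommGroup U] [Module B U] (ι : U →ₗ[B] V) (hι : Function.Injective ι)
    (π : V →ₗ[B] W) (hex : ∀ v, π v = 0 → ∃ u, ι u = v) (hU : TwistedFinite F U)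
    (hW : TwistedFinite F W) : TwistedFinite F V := by
  rintro M hM ⟨N, hN⟩
  obtain ⟨r, g, hg, hgen⟩ := hW (M.map π.toAddMonoidHom)
    (by
      rintro b _ ⟨m, hm, rfl⟩
      exact ⟨F b • m, hM b m hm, by simp⟩)
    ⟨N, fun r v hv hc => by
      choose v' hv' hv'' using hv
      refine hN r v' hv' fun c h => hc c ?_
      have := congrArg π h
      rw [map_sum, map_zero] at this
      rw [← this]
      refine sum_congr rfl fun i _ => ?_
      rw [map_smul]
      exact congrArg _ (hv'' i).symm⟩
  choose g' hg' hg'' using hg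
  obtain ⟨s, f, hf, hfen⟩ := hU (M.comap ι.toAddMonoidHom)
    (by
      intro b m hm
      change ι (F b • m) ∈ M
      rw [map_smul]
      exact hM b _ hm)
    ⟨N, fun r v hv hc => by
      refine hN r (fun i => ι (v i)) hv fun c h => hc c (hι ?_)
      rw [map_zero, ← h, map_sum]
      exact sum_congr rfl fun i _ => map_smul _ _ _⟩
  refine ⟨r + s, Fin.append g' (fun i => ι (f i)), fun i => ?_, fun m hm => ?_⟩
  · refine Fin.addCases (fun i => ?_) (fun i => ?_) i
    · rw [Fin.append_left]; exact hg' i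
    · rw [Fin.append_right]; exact hf i
  · obtain ⟨c, hc⟩ := hgen (π m) ⟨m, hm, rfl⟩
    have h1 : π (m - ∑ i, F (c i) • g' i) = 0 := by
      rw [map_sub, map_sum, hc, sub_eq_zero]
      refine sum_congr rfl fun i _ => ?_
      rw [map_smul]
      exact congrArg _ (hg'' i).symm
    obtain ⟨u, hu⟩ := hex _ h1
    obtain ⟨c', hc'⟩ := hfen u (by
      change ι u ∈ M
      rw [hu]
      exact sub_mem hm (sum_mem fun i _ => hM _ _ (hg' i)))
    refine ⟨Fin.append c c', ?_⟩
    rw [Fin.sum_univ_add]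
    simp only [Fin.append_left, Fin.append_right]
    rw [hc', map_sum] at hu
    simp only [map_smul] at hu
    rw [hu, add_sub_cancel]

lemma pi (h : TwistedFinite F B) (n : ℕ) : TwistedFinite F (Fin n → B) := by
  induction n with
  | zero => exact fun M _ _ => ⟨0, Fin.elim0, fun i => i.elim0, fun m _ => ⟨Fin.elim0, Subsingleton.elim _ _⟩⟩
  | succ n ih =>
    let ι : (Fin n → B) →ₗ[B] (Fin (n + 1) → B) :=
      { toFun := fun v => Fin.cons 0 v
        map_add' := fun v w => by ext i; refine Fin.cases ?_ (fun j => ?_) i <;> simp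
        map_smul' := fun b w => by ext i; refine Fin.cases ?_ (fun j => ?_) i <;> simp }
    refine of_exact ι (fun v w h => ?_) (LinearMap.proj (0 : Fin (n + 1))) (fun v hv => ?_) ih h
    · ext i; simpa [ι] using congrFun h i.succ
    · refine ⟨fun i => v i.succ, ?_⟩
      ext i
      refine Fin.cases ?_ (fun j => ?_) i
      · exact hv.symm
      · rfl

lemma of_ringEquiv {B' : Type} [CommRing B'] (e : B ≃+* B') {F' : B' →+* B'}
    (hF : ∀ b, F' (e b) = e (F b)) (h : TwistedFinite F B) : TwistedFinite F' B' := by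
  rintro M hM ⟨N, hN⟩
  obtain ⟨r, g, hg, hgen⟩ := h (M.comap e.toAddMonoidHom)
    (by
      intro b m hm
      change e (F b * m) ∈ M
      rw [map_mul, ← hF]
      exact hM _ _ hm)
    ⟨N, fun r v hv hc => by
      refine hN r (fun i => e (v i)) hv fun c h i => ?_
      have := hc (fun i => e.symm (c i)) (e.injective (by
        rw [map_zero, ← h, map_sum]
        refine sum_congr rfl fun i _ => ?_
        rw [smul_eq_mul, smul_eq_mul, map_mul, ← hF, e.apply_symm_apply])) i
      simpa using this⟩
  refine ⟨r, fun i => e (g i), hg, fun m hm => ?_⟩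
  obtain ⟨c, hc⟩ := hgen (e.symm m) (by change e (e.symm m) ∈ M; rwa [e.apply_symm_apply])
  refine ⟨fun i => e (c i), ?_⟩
  rw [← e.apply_symm_apply m, hc, map_sum]
  refine sum_congr rfl fun i _ => ?_
  rw [smul_eq_mul, smul_eq_mul, map_mul, hF]

end

section PowerSeries

open PowerSeries

variable {B : Type} [CommRing B] {F : B →+* B} {G : PowerSeries B →+* PowerSeries B} {q : ℕ}
  (hC : ∀ b, G (C b) = C (F b)) (hX : G X = X ^ q)

/-- The coefficients of `X ^ i` of the elements of order at least `i`. -/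
def initialCoeff (M : AddSubgroup (PowerSeries B)) (i : ℕ) : AddSubgroup B where
  carrier := {b | ∃ f, X ^ i * f ∈ M ∧ constantCoeff f = b}
  add_mem' := by
    rintro _ _ ⟨f, hf, rfl⟩ ⟨g, hg, rfl⟩
    exact ⟨f + g, by rw [mul_add]; exact add_mem hf hg, by simp⟩
  zero_mem' := ⟨0, by simp, by simp⟩
  neg_mem' := by
    rintro _ ⟨f, hf, rfl⟩
    exact ⟨-f, by rw [mul_neg]; exact neg_mem hf, by simp⟩

variable {M : AddSubgroup (PowerSeries B)} (hM : ∀ b, ∀ m ∈ M, G b • m ∈ M)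

include hC hM in
lemma smul_mem_initialCoeff (i : ℕ) (b : B) {m : B} (hm : m ∈ initialCoeff M i) :
    F b • m ∈ initialCoeff M i := by
  obtain ⟨f, hf, rfl⟩ := hm
  refine ⟨C (F b) * f, ?_, by simp⟩
  rw [← hC, mul_left_comm]
  exact hM _ _ hf

include hX hM in
lemma initialCoeff_le (i j : ℕ) : initialCoeff M i ≤ initialCoeff M (i + q * j) := by
  rintro _ ⟨f, hf, rfl⟩
  refine ⟨f, ?_, rfl⟩
  have := hM (X ^ j) _ hf
  rwa [map_pow, hX, ← pow_mul, smul_eq_mul, ← mul_assoc, ← pow_add, add_comm] at this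

include hC hX in
lemma constantCoeff_twist (hq : q ≠ 0) (f : PowerSeries B) : constantCoeff (G f) = F (constantCoeff f) := by
  obtain ⟨h, hh⟩ := X_dvd_iff.2 (show constantCoeff (f - C (constantCoeff f)) = 0 by simp)
  rw [eq_add_of_sub_eq hh, map_add, map_mul, hX, hC]
  simp [hq]

include hC hX in
lemma independent_of_constantCoeff [IsDomain B] (hq : q ≠ 0) {r : ℕ} {f : Fin r → PowerSeries B}
    (h : ∀ c : Fin r → B, ∑ i, F (c i) • constantCoeff (f i) = 0 → ∀ i, c i = 0)
    (c : Fin r → PowerSeries B) (hc : ∑ i, G (c i) • f i = 0) (i : Fin r) : c i = 0 := by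
  have key : ∀ k, ∀ i, X ^ k ∣ c i := by
    intro k
    induction k with
    | zero => simp
    | succ k ih =>
      choose c' hc' using ih
      have h1 : ∑ i, G (c' i) • f i = 0 := by
        have : (X : PowerSeries B) ^ (q * k) * ∑ i, G (c' i) • f i = 0 := by
          rw [← hc, mul_sum]
          refine sum_congr rfl fun i _ => ?_
          rw [hc' i, map_mul, map_pow, hX, smul_eq_mul, smul_eq_mul, pow_mul, mul_assoc]
        exact (mul_eq_zero.1 this).resolve_left (pow_ne_zero _ X_ne_zero)
      have h2 := h (fun i => constantCoeff (c' i)) (by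
        have := congrArg constantCoeff h1
        rw [map_sum, map_zero] at this
        rw [← this]
        refine sum_congr rfl fun i _ => ?_
        rw [smul_eq_mul, smul_eq_mul, map_mul, constantCoeff_twist hC hX hq])
      intro i
      rw [hc' i, pow_succ]
      exact mul_dvd_mul_left _ (X_dvd_iff.2 (h2 i))
  refine IsHausdorff.eq_zero_of_forall_mem (Ideal.span {(X : PowerSeries B)}) fun k => ?_
  rw [Ideal.span_singleton_pow, Ideal.mem_span_singleton]
  exact key k i

end PowerSeries

end TwistedFinite

end

section

namespace TwistedFinite

open PowerSeries

section

variable {B : Type} [CommRing B] [IsDomain B] {F : B →+* B} {G : PowerSeries B →+* PowerSeries B} {q : ℕ}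
  (hC : ∀ b, G (C b) = C (F b)) (hX : G X = X ^ q) (hq : q ≠ 0)
  {M : AddSubgroup (PowerSeries B)} (hM : ∀ b, ∀ m ∈ M, G b • m ∈ M) {N : ℕ}
  (hN : ∀ (r : ℕ) (v : Fin r → PowerSeries B), (∀ i, v i ∈ M) →
      (∀ c : Fin r → PowerSeries B, ∑ i, G (c i) • v i = 0 → ∀ i, c i = 0) → r ≤ N)

include hC hX hq hN in
lemma initialCoeff_rank_le (i : ℕ) (r : ℕ) (v : Fin r → B) (hv : ∀ s, v s ∈ initialCoeff M i)
    (hc : ∀ c : Fin r → B, ∑ i, F (c i) • v i = 0 → ∀ i, c i = 0) : r ≤ N := by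
  choose f hf hfv using hv
  refine hN r (fun s => X ^ i * f s) hf fun c h => ?_
  refine independent_of_constantCoeff (f := f) hC hX hq (by simpa only [hfv] using hc) c ?_
  have : (X : PowerSeries B) ^ i * ∑ s, G (c s) • f s = 0 := by
    rw [← h, mul_sum]
    exact sum_congr rfl fun s _ => by rw [smul_eq_mul, smul_eq_mul, mul_left_comm]
  exact (mul_eq_zero.1 this).resolve_left (pow_ne_zero _ X_ne_zero)

include hC hX hM hq hN in
lemma exists_initialCoeff_le (h : TwistedFinite F B) (t : ℕ) :
    ∃ J, ∀ j, initialCoeff M (t + q * j) ≤ initialCoeff M (t + q * J) := by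
  have hmono : ∀ {j j'}, j ≤ j' → initialCoeff M (t + q * j) ≤ initialCoeff M (t + q * j') := by
    intro j j' hj
    obtain ⟨l, rfl⟩ := Nat.exists_eq_add_of_le hj
    have := initialCoeff_le hX hM (t + q * j) l
    rwa [add_assoc, ← mul_add] at this
  let U : AddSubgroup B :=
    { carrier := {b | ∃ j, b ∈ initialCoeff M (t + q * j)}
      add_mem' := by
        rintro a b ⟨j, hj⟩ ⟨l, hl⟩
        exact ⟨max j l, add_mem (hmono (le_max_left _ _) hj) (hmono (le_max_right _ _) hl)⟩
      zero_mem' := ⟨0, zero_mem _⟩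
      neg_mem' := by rintro a ⟨j, hj⟩; exact ⟨j, neg_mem hj⟩ }
  have hU : ∀ {r : ℕ} {v : Fin r → B}, (∀ i, v i ∈ U) → ∃ J, ∀ i, v i ∈ initialCoeff M (t + q * J) := by
    intro r v hv
    choose j hj using hv
    exact ⟨univ.sup j, fun i => hmono (Finset.le_sup (mem_univ i)) (hj i)⟩
  obtain ⟨r, g, hg, hgen⟩ := h U
    (by
      rintro b m ⟨j, hj⟩
      exact ⟨j, smul_mem_initialCoeff hC hM _ b hj⟩)
    ⟨N, fun r v hv hc => by
      obtain ⟨J, hJ⟩ := hU hv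
      exact initialCoeff_rank_le hC hX hq hN _ r v hJ hc⟩
  obtain ⟨J, hJ⟩ := hU hg
  refine ⟨J, fun j b hb => ?_⟩
  obtain ⟨c, rfl⟩ := hgen b ⟨j, hb⟩
  exact sum_mem fun i _ => smul_mem_initialCoeff hC hM _ _ (hJ i)

include hC hX hM hq hN in
/-- There are finitely many elements of `M` whose initial coefficients generate all initial
coefficients of elements of `M`. -/
lemma exists_generators (h : TwistedFinite F B) : ∃ (J r : ℕ) (g : Fin r → PowerSeries B), (∀ s, g s ∈ M) ∧
    ∀ (i j : ℕ), i < q * (J + 1) → (q * J ≤ i ∨ j = 0) → ∀ f ∈ M, X ^ (i + q * j) ∣ f →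
      ∃ c : Fin r → PowerSeries B, (∀ s, X ^ j ∣ c s) ∧ X ^ (i + q * j + 1) ∣ f - ∑ s, G (c s) • g s := by
  classical
  choose J hJ using exists_initialCoeff_le hC hX hq hM hN h
  let K := (range q).sup J
  have hK : ∀ i, q * K ≤ i → i < q * (K + 1) → ∀ j, initialCoeff M (i + q * j) ≤ initialCoeff M i := by
    intro i h1 h2 j
    obtain ⟨t, rfl⟩ := Nat.exists_eq_add_of_le h1
    have ht : t < q := by rw [mul_add, mul_one] at h2; omega
    have h3 := hJ t (K + j)
    have h4 : J t ≤ K := Finset.le_sup (mem_range.2 ht)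
    obtain ⟨l, hl⟩ := Nat.exists_eq_add_of_le h4
    have h5 := initialCoeff_le hX hM (t + q * J t) l
    rw [add_assoc, ← mul_add, ← hl] at h5
    have e1 : q * K + t + q * j = t + q * (K + j) := by ring
    rw [e1, add_comm (q * K) t]
    exact h3.trans h5
  choose r g hg hgen using fun i => h (initialCoeff M i)
    (fun b m hm => smul_mem_initialCoeff hC hM i b hm) ⟨N, initialCoeff_rank_le hC hX hq hN i⟩
  choose f hf hfg using hg
  let ι := Σ i : Fin (q * (K + 1)), Fin (r i)
  let e := Fintype.equivFin ι
  refine ⟨K, Fintype.card ι, fun s => X ^ ((e.symm s).1 : ℕ) * f _ (e.symm s).2, fun s => hf _ _, ?_⟩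
  rintro i j hi hij m hm ⟨u, rfl⟩
  have hu : constantCoeff u ∈ initialCoeff M i := by
    have h1 : constantCoeff u ∈ initialCoeff M (i + q * j) := ⟨u, hm, rfl⟩
    rcases hij with hij | rfl
    · exact hK i hij hi j h1
    · exact h1
  obtain ⟨c, hc⟩ := hgen i _ hu
  let c' : ι → PowerSeries B := fun s => if hs : (s.1 : ℕ) = i then X ^ j * C (c (Fin.cast (by rw [hs]) s.2)) else 0
  refine ⟨fun s => c' (e.symm s), fun s => ?_, ?_⟩
  · simp only [c']
    split_ifs
    · exact dvd_mul_right _ _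
    · exact dvd_zero _
  · rw [e.symm.sum_comp (fun s => G (c' s) • (X ^ (s.1 : ℕ) * f _ s.2))]
    have h1 : ∑ s : ι, G (c' s) • (X ^ (s.1 : ℕ) * f _ s.2) =
        X ^ (i + q * j) * ∑ s, C (F (c s)) * f i s := by
      rw [Fintype.sum_sigma, Finset.sum_eq_single (⟨i, hi⟩ : Fin (q * (K + 1)))]
      · rw [mul_sum]
        refine sum_congr rfl fun s _ => ?_
        simp only [c', dif_pos, Fin.cast_refl, id_eq, smul_eq_mul]
        rw [map_mul, map_pow, hX, hC]
        ring
      · intro b _ hb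
        refine Finset.sum_eq_zero fun s _ => ?_
        have : (b : ℕ) ≠ i := fun h => hb (Fin.ext h)
        simp [c', this]
      · intro h; exact absurd (mem_univ _) h
    rw [h1, ← mul_sub, pow_succ]
    refine mul_dvd_mul_left _ (X_dvd_iff.2 ?_)
    rw [map_sub, map_sum, hc, sub_eq_zero]
    refine sum_congr rfl fun s _ => ?_
    rw [map_mul, constantCoeff_C, hfg, smul_eq_mul]

include hC hX hq in
lemma powerSeries (h : TwistedFinite F B) : TwistedFinite G (PowerSeries B) := by
  rintro M hM ⟨N, hN⟩
  obtain ⟨J, r, g, hg, hgen⟩ := exists_generators hC hX hq hM hN h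
  refine ⟨r, g, hg, fun f hf => ?_⟩
  have hmem : ∀ c : Fin r → PowerSeries B, f - ∑ s, G (c s) • g s ∈ M := fun c =>
    sub_mem hf (sum_mem fun s _ => hM _ _ (hg s))
  have hadd : ∀ c c' : Fin r → PowerSeries B, f - ∑ s, G ((c + c') s) • g s =
      f - ∑ s, G (c s) • g s - ∑ s, G (c' s) • g s := by
    intro c c'
    simp only [Pi.add_apply, map_add, add_smul, Finset.sum_add_distrib]
    ring
  have hB : ∀ i ≤ q * J, ∃ c : Fin r → PowerSeries B, X ^ i ∣ f - ∑ s, G (c s) • g s := by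
    intro i
    induction i with
    | zero => exact fun _ => ⟨0, by simp⟩
    | succ i ih =>
      intro hi
      obtain ⟨c, hc⟩ := ih (by omega)
      obtain ⟨c', -, hc'⟩ := hgen i 0 (by rw [mul_add]; omega) (Or.inr rfl) _ (hmem c) (by simpa using hc)
      exact ⟨c + c', by rw [hadd]; simpa using hc'⟩
  have hD : ∀ (j : ℕ) (c : Fin r → PowerSeries B), ∃ c' : Fin r → PowerSeries B,
      X ^ (q * (J + j)) ∣ f - ∑ s, G (c s) • g s →
      (X ^ (q * (J + (j + 1))) ∣ f - ∑ s, G (c' s) • g s ∧ ∀ s, X ^ j ∣ c' s - c s) := by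
    intro j c
    by_cases hc : X ^ (q * (J + j)) ∣ f - ∑ s, G (c s) • g s
    swap
    · exact ⟨c, fun h => absurd h hc⟩
    suffices H : ∀ t ≤ q, ∃ c' : Fin r → PowerSeries B, X ^ (q * (J + j) + t) ∣ f - ∑ s, G (c' s) • g s ∧
        ∀ s, X ^ j ∣ c' s - c s by
      obtain ⟨c', h1, h2⟩ := H q le_rfl
      exact ⟨c', fun _ => ⟨by rwa [← add_assoc, mul_add, mul_one], h2⟩⟩
    intro t
    induction t with
    | zero => exact fun _ => ⟨c, by simpa using hc, by simp⟩
    | succ t ih =>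
      intro ht
      obtain ⟨c', h1, h2⟩ := ih (by omega)
      have e1 : q * (J + j) + t = q * J + t + q * j := by ring
      obtain ⟨c'', h3, h4⟩ := hgen (q * J + t) j (by rw [mul_add]; omega) (Or.inl (by omega)) _ (hmem c')
        (by rwa [← e1])
      refine ⟨c' + c'', by rw [hadd, ← add_assoc, e1]; exact h4, fun s => ?_⟩
      rw [Pi.add_apply, add_sub_right_comm]
      exact dvd_add (h2 s) (h3 s)
  choose! D hD using hD
  obtain ⟨c0, hc0⟩ := hB _ le_rfl
  let c : ℕ → Fin r → PowerSeries B := fun k => Nat.rec c0 (fun k c => D k c) k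
  have hc : ∀ j, X ^ (q * (J + j)) ∣ f - ∑ s, G (c j s) • g s := by
    intro j
    induction j with
    | zero => exact hc0
    | succ j ih => exact (hD j (c j) ih).1
  choose L hL using fun s => IsAdicComplete.exists_sub_mem (Ideal.span {(X : PowerSeries B)})
    (fun k => c (k + 1) s) (fun k => by
      rw [Ideal.span_singleton_pow, Ideal.mem_span_singleton]
      exact (hD (k + 1) (c (k + 1)) (hc (k + 1))).2 s)
  refine ⟨L, sub_eq_zero.1 (IsHausdorff.eq_zero_of_forall_mem (Ideal.span {(X : PowerSeries B)}) fun k => ?_)⟩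
  rw [Ideal.span_singleton_pow, Ideal.mem_span_singleton]
  have h1 : f - ∑ s, G (L s) • g s = (f - ∑ s, G (c (k + 1) s) • g s) - ∑ s, G (L s - c (k + 1) s) • g s := by
    simp only [map_sub, sub_smul, Finset.sum_sub_distrib]
    ring
  rw [h1]
  have hle : k ≤ q * (k + 1) := by nlinarith [Nat.pos_of_ne_zero hq]
  refine dvd_sub ((pow_dvd_pow _ (by nlinarith [Nat.pos_of_ne_zero hq])).trans (hc (k + 1)))
    (Finset.dvd_sum fun s _ => ?_)
  have h2 := hL s k
  rw [Ideal.span_singleton_pow, Ideal.mem_span_singleton] at h2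
  obtain ⟨u, hu⟩ := h2
  rw [hu, map_mul, map_pow, hX, ← pow_mul, smul_eq_mul]
  exact ((pow_dvd_pow _ hle).mul_right _).mul_right _

end

lemma mvPowerSeries {k : Type} [Field k] (p : ℕ) [Fact p.Prime] [CharP k p] (e n : ℕ)
    [ExpChar (MvPowerSeries (Fin n) k) p] :
    TwistedFinite (iterateFrobenius (MvPowerSeries (Fin n) k) p e) (MvPowerSeries (Fin n) k) := by
  have hchar : ∀ n, CharP (MvPowerSeries (Fin n) k) p := fun n =>
    charP_of_injective_ringHom (f := MvPowerSeries.C) (MvPowerSeries.C_injective) p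
  have hexp : ∀ n, ExpChar (MvPowerSeries (Fin n) k) p := fun n => ExpChar.prime Fact.out
  have key : ∀ n, TwistedFinite (iterateFrobenius (MvPowerSeries (Fin n) k) p e) (MvPowerSeries (Fin n) k) := by
    intro n
    induction n with
    | zero =>
      refine of_ringEquiv (F := iterateFrobenius k p e) (MvPowerSeries.isEmptyEquiv (Fin 0) k).symm.toRingEquiv
        (fun b => ?_) (of_field _)
      simp [iterateFrobenius_def]
    | succ n ih =>
      have h1 : ExpChar (PowerSeries (MvPowerSeries (Fin n) k)) p :=
        expChar_of_injective_ringHom (f := PowerSeries.C) PowerSeries.C_injective p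
      refine of_ringEquiv (F := iterateFrobenius (PowerSeries (MvPowerSeries (Fin n) k)) p e)
        (MvPowerSeries.finSuccEquiv k n).symm.toRingEquiv (fun b => ?_) ?_
      · simp [iterateFrobenius_def]
      · refine ih.powerSeries (q := p ^ e) (fun b => ?_) ?_ (pow_ne_zero _ (Fact.out : p.Prime).ne_zero)
        · simp [iterateFrobenius_def]
        · simp [iterateFrobenius_def]
  exact key n

end TwistedFinite

end

section

variable (A K L : Type) [CommRing A] [IsDomain A] [IsIntegrallyClosed A] [Field K] [Field L] [Algebra A K]
  [IsFractionRing A K] [Algebra K L] [Algebra A L] [IsScalarTower A K L] [FiniteDimensional K L]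

/-- Finiteness of the integral closure in a finite field extension which need not be separable. -/
theorem TwistedFinite.finite_integralClosure (p : ℕ) [ExpChar A p] [ExpChar K p]
    (hA : ∀ e, TwistedFinite (iterateFrobenius A p e) A) : Module.Finite A (integralClosure A L) := by
  classical
  let E := separableClosure K L
  have hinj : Function.Injective (algebraMap A K) := IsFractionRing.injective A K
  have : ExpChar L p := expChar_of_injective_algebraMap (algebraMap K L).injective p
  have : ExpChar E p := expChar_of_injective_algebraMap (algebraMap K E).injective p
  have : IsScalarTower A K E := by infer_instance
  have : IsScalarTower A E L := IsScalarTower.of_algebraMap_eq fun a => by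
    rw [IsScalarTower.algebraMap_apply A K L, IsScalarTower.algebraMap_apply A K E]
    rfl
  let e := IsPurelyInseparable.exponent E L
  let φ : L →+* E := IsPurelyInseparable.iterateFrobenius E L p (n := e) le_rfl
  have hφ : ∀ x, algebraMap E L (φ x) = x ^ p ^ e := fun x =>
    IsPurelyInseparable.algebraMap_iterateFrobenius E p le_rfl x
  obtain ⟨s, b, hb⟩ := FiniteDimensional.exists_is_basis_integral A K E
  have hφint : ∀ x : integralClosure A L, IsIntegral A (φ x) := by
    intro x
    rw [← isIntegral_algebraMap_iff (algebraMap E L).injective, hφ]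
    exact IsIntegral.pow x.2 _
  have hex : ∀ (x : integralClosure A L) (i : s), ∃ a, algebraMap A K a = Algebra.trace K E (φ x * b i) :=
    fun x i => IsIntegrallyClosed.isIntegral_iff.1 (Algebra.isIntegral_trace ((hφint x).mul (hb i)))
  choose τ hτ using hex
  have hadd : ∀ x y, τ (x + y) = τ x + τ y := by
    intro x y
    ext i
    refine hinj ?_
    rw [Pi.add_apply, map_add, hτ, hτ, hτ, ← map_add, ← add_mul]
    congr 2
    exact map_add φ _ _
  have hsmul : ∀ (a : A) x, τ (a • x) = iterateFrobenius A p e a • τ x := by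
    intro a x
    ext i
    refine hinj ?_
    have h := (Algebra.trace K E).map_smul (algebraMap A K (iterateFrobenius A p e a)) (φ x * b i)
    rw [smul_eq_mul] at h
    rw [Pi.smul_apply, smul_eq_mul, map_mul, hτ, hτ, ← h]
    congr 1
    rw [algebraMap_smul, ← smul_mul_assoc]
    congr 1
    refine (algebraMap E L).injective ?_
    have : ((a • x : integralClosure A L) : L) = algebraMap A L a * x := Algebra.smul_def _ _
    rw [hφ, this, Algebra.smul_def (iterateFrobenius A p e a), map_mul, hφ, mul_pow, ← IsScalarTower.algebraMap_apply A E L,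
      iterateFrobenius_def, map_pow]
  let τ' : integralClosure A L →+ (s → A) := AddMonoidHom.mk' τ hadd
  have hτinj : Function.Injective τ' := by
    rw [injective_iff_map_eq_zero]
    intro x hx
    have h1 : ∀ y, Algebra.traceForm K E (φ x) y = 0 := by
      intro y
      have : Algebra.traceForm K E (φ x) = 0 := by
        refine b.ext fun i => ?_
        rw [Algebra.traceForm_apply, ← hτ]
        have := congrFun hx i
        change τ x i = 0 at this
        rw [this, map_zero, LinearMap.zero_apply]
      rw [this, LinearMap.zero_apply]
    have h2 : φ x = 0 := (traceForm_nondegenerate K E).1 _ h1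
    exact Subtype.ext ((map_eq_zero φ).1 h2)
  let ε : s ≃ Fin (Fintype.card s) := Fintype.equivFin s
  let σ : integralClosure A L →+ (Fin (Fintype.card s) → A) :=
    AddMonoidHom.mk' (fun x i => τ x (ε.symm i)) (fun x y => by ext i; simp [hadd])
  have hσinj : Function.Injective σ := by
    intro x y h
    refine hτinj ?_
    ext i
    have := congrFun h (ε i)
    change τ x i = τ y i
    simpa [σ] using this
  have hσ : ∀ (a : A) x, σ (a • x) = iterateFrobenius A p e a • σ x := by
    intro a x
    ext i
    simp [σ, hsmul]
  have hσsum : ∀ {r : ℕ} (c : Fin r → A) (x : Fin r → integralClosure A L),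
      σ (∑ i, c i • x i) = ∑ i, iterateFrobenius A p e (c i) • σ (x i) := by
    intro r c x
    rw [map_sum]
    exact sum_congr rfl fun i _ => hσ _ _
  obtain ⟨r, g, hg, hgen⟩ := (hA e).pi (Fintype.card s) σ.range
    (by
      rintro a _ ⟨x, rfl⟩
      exact ⟨a • x, hσ a x⟩)
    ⟨Module.finrank K L, fun r v hv hc => by
      choose x hx using hv
      have h1 : LinearIndependent A x := by
        rw [Fintype.linearIndependent_iff]
        intro c h
        refine hc c ?_
        simp only [← hx]
        rw [← hσsum, h, map_zero]
      have h2 : LinearIndependent A (fun i => (x i : L)) :=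
        h1.map' (integralClosure A L).val.toLinearMap (LinearMap.ker_eq_bot.2 Subtype.val_injective)
      have h3 : LinearIndependent K (fun i => (x i : L)) := (LinearIndependent.iff_fractionRing A K).1 h2
      simpa using h3.fintype_card_le_finrank⟩
  choose x hx using hg
  refine ⟨Submodule.fg_iff_exists_fin_generating_family.2 ⟨r, x, ?_⟩⟩
  rw [eq_top_iff]
  rintro y -
  obtain ⟨c, hc⟩ := hgen (σ y) ⟨y, rfl⟩
  rw [Submodule.mem_span_range_iff_exists_fun]
  refine ⟨c, hσinj ?_⟩
  rw [hσsum, hc]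
  simp only [hx]

end

section

variable (A D : Type) [CommRing A] [IsDomain A] [CommRing D] [IsDomain D] [Algebra A D] [FaithfulSMul A D]
  [Module.Finite A D]

lemma finite_integralClosure_of_finite (L : Type) [Field L] [Algebra D L] [Algebra A L] [IsScalarTower A D L]
    (h : Module.Finite A (integralClosure A L)) : Module.Finite D (integralClosure D L) := by
  obtain ⟨r, g, hg⟩ := Module.Finite.exists_fin (R := A) (M := integralClosure A L)
  have hg' : ∀ i, IsIntegral D (g i : L) := fun i => (g i).2.tower_top
  refine ⟨Submodule.fg_iff_exists_fin_generating_family.2 ⟨r, fun i => ⟨g i, hg' i⟩, ?_⟩⟩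
  rw [eq_top_iff]
  rintro ⟨y, hy⟩ -
  have hy' : IsIntegral A y := isIntegral_trans y hy
  have h1 : (⟨y, hy'⟩ : integralClosure A L) ∈ Submodule.span A (Set.range g) := by rw [hg]; trivial
  obtain ⟨c, hc⟩ := (Submodule.mem_span_range_iff_exists_fun A).1 h1
  rw [Submodule.mem_span_range_iff_exists_fun]
  refine ⟨fun i => algebraMap A D (c i), Subtype.ext ?_⟩
  have h2 := congrArg (integralClosure A L).val hc
  rw [map_sum] at h2
  refine Eq.trans ?_ h2
  change (integralClosure D L).val _ = _
  rw [map_sum]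
  refine sum_congr rfl fun i _ => ?_
  exact algebraMap_smul D (c i) (g i : L)

/-- Transfer of a finiteness result over the fraction field of `A` to a finite extension of `A`. -/
lemma finite_integralClosure_fractionRing
    (h : ∀ (K L : Type) [Field K] [Field L] [Algebra A K] [IsFractionRing A K] [Algebra K L] [Algebra A L]
      [IsScalarTower A K L] [FiniteDimensional K L], Module.Finite A (integralClosure A L)) :
    Module.Finite D (integralClosure D (FractionRing D)) := by
  have hinj : Function.Injective (algebraMap A D) := FaithfulSMul.algebraMap_injective A D
  have : FaithfulSMul A (FractionRing D) := by
    rw [faithfulSMul_iff_algebraMap_injective, IsScalarTower.algebraMap_eq A D (FractionRing D)]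
    exact (IsFractionRing.injective D (FractionRing D)).comp hinj
  let _ : Algebra (FractionRing A) (FractionRing D) := FractionRing.liftAlgebra A (FractionRing D)
  have : IsScalarTower A (FractionRing A) (FractionRing D) := FractionRing.isScalarTower_liftAlgebra A _
  have : FiniteDimensional (FractionRing A) (FractionRing D) := by infer_instance
  exact finite_integralClosure_of_finite A D (FractionRing D) (h (FractionRing A) (FractionRing D))

end

/-- Prime avoidance for cosets of ideals. -/
lemma Ideal.exists_add_notMem_of_finset {R : Type} [CommRing R] (S : Finset (Ideal R)) (hS : ∀ P ∈ S, P.IsPrime)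
    (J : Ideal R) (a : R) (h : ∀ P ∈ S, a ∈ P → ¬ J ≤ P) : ∃ j ∈ J, ∀ P ∈ S, a + j ∉ P := by
  classical
  induction S using Finset.strongInduction with
  | H S ih =>
    rcases S.eq_empty_or_nonempty with rfl | hne
    · exact ⟨0, zero_mem _, by simp⟩
    obtain ⟨P, hP⟩ := Finset.exists_minimal hne
    have hPS := hP.prop
    have hPp := hS P hPS
    obtain ⟨j, hj, hj'⟩ := ih (S.erase P) (Finset.erase_ssubset hPS)
      (fun Q hQ => hS Q (Finset.mem_of_mem_erase hQ)) (fun Q hQ => h Q (Finset.mem_of_mem_erase hQ))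
    by_cases hjP : a + j ∈ P
    swap
    · refine ⟨j, hj, fun Q hQ => ?_⟩
      by_cases hQP : Q = P
      · rwa [hQP]
      · exact hj' Q (Finset.mem_erase.2 ⟨hQP, hQ⟩)
    have hJP : ¬ J ≤ P := fun hle => h P hPS (by
      have := P.sub_mem hjP (hle hj)
      rwa [add_sub_cancel_right] at this) hle
    obtain ⟨b, hb, hbP⟩ := Set.not_subset.1 hJP
    have h1 : ∀ Q ∈ S.erase P, ∃ c ∈ Q, c ∉ P := by
      intro Q hQ
      obtain ⟨hQP, hQS⟩ := Finset.mem_erase.1 hQ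
      by_contra! hc
      exact hQP (le_antisymm hc (hP.le_of_le hQS hc))
    choose! c hc hcP using h1
    refine ⟨j + b * ∏ Q ∈ S.erase P, c Q, add_mem hj (J.mul_mem_right _ hb), fun Q hQ => ?_⟩
    by_cases hQP : Q = P
    · subst hQP
      intro hmem
      rw [← add_assoc] at hmem
      have h2 := Q.sub_mem hmem hjP
      rw [add_sub_cancel_left] at h2
      rcases hPp.mem_or_mem h2 with h3 | h3
      · exact hbP h3
      · obtain ⟨Q', hQ', h4⟩ := (hPp.prod_mem_iff).1 h3
        exact hcP Q' hQ' h4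
    · intro hmem
      have hQ' := Finset.mem_erase.2 ⟨hQP, hQ⟩
      refine hj' Q hQ' ?_
      have h2 : b * ∏ Q ∈ S.erase P, c Q ∈ Q := Q.mul_mem_left _
        (Ideal.mem_of_dvd _ (Finset.dvd_prod_of_mem c hQ') (hc Q hQ'))
      have := Q.sub_mem hmem h2
      rwa [← add_assoc, add_sub_cancel_right] at this

section

variable {R T : Type} [CommRing R] [CommRing T] [IsLocalRing T] [IsNoetherianRing T]

lemma span_range_update_add {d : ℕ} {x : Fin d → R} {k : Fin d} {j : R}
    (hj : j ∈ Ideal.span (x '' {i | k < i})) :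
    Ideal.span (Set.range (Function.update x k (x k + j))) = Ideal.span (Set.range x) := by
  have hj1 : j ∈ Ideal.span (Set.range x) := Ideal.span_mono (Set.image_subset_range _ _) hj
  have hj2 : j ∈ Ideal.span (Set.range (Function.update x k (x k + j))) := by
    refine Ideal.span_mono ?_ hj
    rintro _ ⟨i, hi, rfl⟩
    exact ⟨i, Function.update_of_ne (ne_of_gt hi) _ _⟩
  apply le_antisymm
  · rw [Ideal.span_le]
    rintro _ ⟨i, rfl⟩
    by_cases hi : i = k
    · subst hi
      rw [Function.update_self]
      exact add_mem (Ideal.subset_span ⟨i, rfl⟩) hj1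
    · rw [Function.update_of_ne hi]
      exact Ideal.subset_span ⟨i, rfl⟩
  · rw [Ideal.span_le]
    rintro _ ⟨i, rfl⟩
    by_cases hi : i = k
    · subst hi
      have := Ideal.sub_mem _ (Ideal.subset_span ⟨i, rfl⟩ :
        Function.update x i (x i + j) i ∈ Ideal.span (Set.range (Function.update x i (x i + j)))) hj2
      rwa [Function.update_self, add_sub_cancel_right] at this
    · exact Ideal.subset_span ⟨i, Function.update_of_ne hi _ _⟩

lemma mem_of_span_range_eq {d : ℕ} {x x' : Fin d → R} (h : Ideal.span (Set.range x') = Ideal.span (Set.range x))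
    (f : R →+* T) (Q : Ideal T) (hQ : ∀ i, f (x' i) ∈ Q) (i : Fin d) : f (x i) ∈ Q := by
  have h1 : Ideal.span (Set.range x') ≤ Q.comap f := by
    rw [Ideal.span_le]
    rintro _ ⟨i, rfl⟩
    exact hQ i
  exact h1 (h ▸ Ideal.subset_span ⟨i, rfl⟩)

/-- The generators of a parameter ideal can be chosen such that all but the last one, together with a
given element of positive height, form a system of parameters. -/
theorem exists_parameters_with (f : R →+* T) {n : ℕ} (hdim : ringKrullDim T = (n + 1 : ℕ)) (x : Fin (n + 1) → R)
    (hx : ∀ Q : Ideal T, Q.IsPrime → (∀ i, f (x i) ∈ Q) → Q = maximalIdeal T)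
    (π : T) (hπ : ∀ Q : Ideal T, Q.IsPrime → π ∈ Q → 1 ≤ Q.height) :
    ∃ x' : Fin (n + 1) → R, Ideal.span (Set.range x') = Ideal.span (Set.range x) ∧
      ∀ Q : Ideal T, Q.IsPrime → π ∈ Q → (∀ i : Fin n, f (x' i.castSucc) ∈ Q) → Q = maximalIdeal T := by
  classical
  have hm : (maximalIdeal T).height = (n + 1 : ℕ) := by
    have := IsLocalRing.maximalIdeal_height_eq_ringKrullDim (R := T)
    rw [hdim] at this
    exact_mod_cast this
  have key : ∀ k ≤ n, ∃ x' : Fin (n + 1) → R, Ideal.span (Set.range x') = Ideal.span (Set.range x) ∧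
      ∀ Q : Ideal T, Q.IsPrime → π ∈ Q → (∀ i : Fin (n + 1), (i : ℕ) < k → f (x' i) ∈ Q) →
        ((k + 1 : ℕ) : ℕ∞) ≤ Q.height := by
    intro k
    induction k with
    | zero =>
      intro _
      exact ⟨x, rfl, fun Q hQ h1 _ => by simpa using hπ Q hQ h1⟩
    | succ k ih =>
      intro hk
      obtain ⟨x', hsp, hht⟩ := ih (by omega)
      let κ : Fin (n + 1) := ⟨k, by omega⟩
      let I : Ideal T := Ideal.span (insert π ((fun i => f (x' i)) '' {i | i < κ}))
      have hI : ∀ Q : Ideal T, I ≤ Q ↔ π ∈ Q ∧ ∀ i : Fin (n + 1), (i : ℕ) < k → f (x' i) ∈ Q := by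
        intro Q
        rw [Ideal.span_le, Set.insert_subset_iff, Set.image_subset_iff]
        exact Iff.rfl
      have hfin := Ideal.finite_minimalPrimes_of_isNoetherianRing T I
      let S : Finset (Ideal R) := ((hfin.toFinset.erase (maximalIdeal T)).image (Ideal.comap f))
      obtain ⟨j, hj, hav⟩ := Ideal.exists_add_notMem_of_finset S
        (by
          intro P hP
          obtain ⟨Q, hQ, rfl⟩ := Finset.mem_image.1 hP
          have hQ' := ((Set.Finite.mem_toFinset _).1 (Finset.mem_of_mem_erase hQ))
          have : Q.IsPrime := hQ'.1.1
          exact Ideal.comap_isPrime f Q)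
        (Ideal.span (Set.image x' {i | κ < i})) (x' κ)
        (by
          intro P hP h1 h2
          obtain ⟨Q, hQ, rfl⟩ := Finset.mem_image.1 hP
          obtain ⟨hQm, hQ'⟩ := Finset.mem_erase.1 hQ
          rw [Set.Finite.mem_toFinset] at hQ'
          have hQI := (hI Q).1 hQ'.1.2
          refine hQm (hx Q hQ'.1.1 (mem_of_span_range_eq hsp f Q fun i => ?_))
          rcases lt_trichotomy i κ with hi | rfl | hi
          · exact hQI.2 i hi
          · exact h1
          · exact h2 (Ideal.subset_span ⟨i, hi, rfl⟩))
      refine ⟨Function.update x' κ (x' κ + j), (span_range_update_add hj).trans hsp, fun Q hQ h1 h2 => ?_⟩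
      have hlt : ∀ i : Fin (n + 1), (i : ℕ) < k → f (x' i) ∈ Q := by
        intro i hi
        have h3 := h2 i (by omega)
        rwa [Function.update_of_ne (by intro h; rw [h] at hi; exact lt_irrefl _ hi)] at h3
      have hk' : f (x' κ + j) ∈ Q := by
        have h3 := h2 κ (Nat.lt_succ_self k)
        rwa [Function.update_self] at h3
      obtain ⟨Q0, hQ0, hle⟩ := Ideal.exists_minimalPrimes_le ((hI Q).2 ⟨h1, hlt⟩)
      have hQ0p : Q0.IsPrime := hQ0.1.1
      have hQ0I := (hI Q0).1 hQ0.1.2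
      have hht0 := hht Q0 hQ0p hQ0I.1 hQ0I.2
      rcases hle.eq_or_lt with heq | hlt'
      · subst heq
        have : Q0 = maximalIdeal T := by
          by_contra hne
          refine hav (Q0.comap f) (Finset.mem_image.2 ⟨Q0, Finset.mem_erase.2 ⟨hne, ?_⟩, rfl⟩) hk'
          exact (Set.Finite.mem_toFinset _).2 hQ0
        rw [this, hm]
        exact_mod_cast Nat.succ_le_succ hk
      · refine le_trans ?_ (Ideal.height_add_one_le_of_lt_of_isPrime hlt')
        push_cast at hht0 ⊢
        gcongr
  obtain ⟨x', hsp, hht⟩ := key n le_rfl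
  refine ⟨x', hsp, fun Q hQ h1 h2 => ?_⟩
  have h3 := hht Q hQ h1 (fun i hi => by
    have := h2 ⟨i, hi⟩
    exact this)
  rcases (IsLocalRing.le_maximalIdeal hQ.ne_top).eq_or_lt with heq | hlt
  · exact heq
  · have := Ideal.height_add_one_le_of_lt_of_isPrime hlt
    rw [hm] at this
    have h4 : ((n + 1 : ℕ) : ℕ∞) + 1 ≤ (n + 1 : ℕ) := (by gcongr : _ ≤ Q.height + 1).trans this
    have h5 : n + 1 + 1 ≤ n + 1 := by exact_mod_cast h4
    omega

lemma exists_parameters (T : Type) [CommRing T] [IsLocalRing T] [IsNoetherianRing T] : ∃ (d : ℕ) (x : Fin d → T),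
    ringKrullDim T = d ∧ (∀ i, x i ∈ maximalIdeal T) ∧
      ∀ Q : Ideal T, Q.IsPrime → (∀ i, x i ∈ Q) → Q = maximalIdeal T := by
  obtain ⟨s, hs, hc⟩ := Ideal.exists_finset_card_eq_height_of_isNoetherianRing (maximalIdeal T)
  refine ⟨s.card, fun i => (s.equivFin.symm i : T), ?_, fun i => ?_, fun Q hQ h => ?_⟩
  · rw [← IsLocalRing.maximalIdeal_height_eq_ringKrullDim, ← hc]
    rfl
  · exact hs.1.2 (Ideal.subset_span (s.equivFin.symm i).2)
  · refine le_antisymm (IsLocalRing.le_maximalIdeal hQ.ne_top) (hs.2 ⟨hQ, ?_⟩ (IsLocalRing.le_maximalIdeal hQ.ne_top))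
    rw [Ideal.span_le]
    intro a ha
    have := h (s.equivFin ⟨a, ha⟩)
    simpa using this

lemma exists_pow_le_of_forall_isPrime {I : Ideal T}
    (h : ∀ Q : Ideal T, Q.IsPrime → I ≤ Q → Q = maximalIdeal T) : ∃ N, maximalIdeal T ^ N ≤ I := by
  refine Ideal.exists_pow_le_of_le_radical_of_fg ?_ ((isNoetherianRing_iff_ideal_fg T).1 inferInstance _)
  rw [Ideal.radical_eq_sInf]
  refine le_sInf ?_
  rintro Q ⟨h1, h2⟩
  exact (h Q h2 h1).ge

end

section EqualChar

lemma exists_linearMap_apply_one_ne_zero_of_isFractionRing (A D K L : Type) [CommRing A] [IsDomain A] [CommRing D]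
    [IsDomain D] [Algebra A D] [Module.Finite A D] [Field K] [Field L] [Algebra A K] [IsFractionRing A K]
    [Algebra D L] [IsFractionRing D L] [Algebra A L] [IsScalarTower A D L] [Algebra K L] [IsScalarTower A K L] :
    ∃ φ : D →ₗ[A] A, φ 1 ≠ 0 := by
  obtain ⟨l, hl⟩ := (Algebra.linearMap K L).exists_leftInverse_of_injective
    (LinearMap.ker_eq_bot.2 (algebraMap K L).injective)
  obtain ⟨m, v, hv⟩ := Module.Finite.exists_fin (R := A) (M := D)
  obtain ⟨a, ha⟩ := IsLocalization.exist_integer_multiples_of_finite (nonZeroDivisors A)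
    (fun i => l (algebraMap D L (v i)))
  have hinj := IsFractionRing.injective A K
  let ψ : D →ₗ[A] K := (a : A) • (l.restrictScalars A).comp ((IsScalarTower.toAlgHom A D L).toLinearMap)
  have hψ : ∀ δ, ψ δ = (a : A) • l (algebraMap D L δ) := fun _ => rfl
  have hr : ∀ δ, ∃ b, algebraMap A K b = ψ δ := by
    intro δ
    have hδ : δ ∈ Submodule.span A (Set.range v) := by rw [hv]; trivial
    obtain ⟨c, rfl⟩ := (Submodule.mem_span_range_iff_exists_fun A).1 hδ
    choose b hb using ha
    refine ⟨∑ i, c i * b i, ?_⟩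
    rw [map_sum, map_sum]
    refine sum_congr rfl fun i _ => ?_
    rw [map_smul, hψ, map_mul, hb, Algebra.smul_def (c i)]
  choose φ hφ using hr
  refine ⟨{ toFun := φ, map_add' := fun x y => hinj ?_, map_smul' := fun c x => hinj ?_ }, ?_⟩
  · rw [map_add, hφ, hφ, hφ, map_add]
  · rw [smul_eq_mul, map_mul, hφ, hφ, map_smul, RingHom.id_apply, Algebra.smul_def]
  · intro h
    have h1 : algebraMap A K (φ 1) = algebraMap A K (a : A) := by
      have := LinearMap.congr_fun hl 1
      rw [LinearMap.comp_apply, Algebra.linearMap_apply, map_one, LinearMap.id_apply] at this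
      rw [hφ, hψ, map_one, this, Algebra.smul_def, mul_one]
    exact nonZeroDivisors.ne_zero a.2 ((hinj h1).symm.trans h)

lemma exists_linearMap_apply_one_ne_zero (A D : Type) [CommRing A] [IsDomain A] [CommRing D]
    [IsDomain D] [Algebra A D] [FaithfulSMul A D] [Module.Finite A D] : ∃ φ : D →ₗ[A] A, φ 1 ≠ 0 := by
  have hinj : Function.Injective (algebraMap A D) := FaithfulSMul.algebraMap_injective A D
  have : FaithfulSMul A (FractionRing D) := by
    rw [faithfulSMul_iff_algebraMap_injective, IsScalarTower.algebraMap_eq A D (FractionRing D)]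
    exact (IsFractionRing.injective D (FractionRing D)).comp hinj
  let _ : Algebra (FractionRing A) (FractionRing D) := FractionRing.liftAlgebra A (FractionRing D)
  have : IsScalarTower A (FractionRing A) (FractionRing D) := FractionRing.isScalarTower_liftAlgebra A _
  exact exists_linearMap_apply_one_ne_zero_of_isFractionRing A D (FractionRing A) (FractionRing D)

variable {k D : Type} [Field k] {n : ℕ} [CommRing D] [IsDomain D] [Algebra (MvPowerSeries (Fin n) k) D]
  [FaithfulSMul (MvPowerSeries (Fin n) k) D] [Module.Finite (MvPowerSeries (Fin n) k) D]

lemma false_of_relation_of_charP (p : ℕ) [hp : Fact p.Prime] [CharP k p] {N : ℕ} {s : Fin n → D}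
    (h : ∏ i, algebraMap (MvPowerSeries (Fin n) k) D (MvPowerSeries.X i) ^ N =
      ∑ i, s i * algebraMap (MvPowerSeries (Fin n) k) D (MvPowerSeries.X i) ^ (N + 1)) : False := by
  obtain ⟨φ, hφ⟩ := exists_linearMap_apply_one_ne_zero (MvPowerSeries (Fin n) k) D
  obtain ⟨a, ha⟩ := MvPowerSeries.exists_notMem_spanPow hφ
  have : CharP (MvPowerSeries (Fin n) k) p :=
    charP_of_injective_ringHom (f := MvPowerSeries.C) (MvPowerSeries.C_injective) p
  have : CharP D p := charP_of_injective_algebraMap (FaithfulSMul.algebraMap_injective (MvPowerSeries (Fin n) k) D) p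
  have : ExpChar D p := ExpChar.prime hp.out
  refine ha (p ^ a) (Nat.lt_pow_self hp.out.one_lt).le (MvPowerSeries.mem_of_mul_prod_X_pow_mem (N := N) ?_)
  have h1 := congrArg φ (congrArg (· ^ p ^ a) h)
  beta_reduce at h1
  rw [sum_pow_char_pow, map_sum, ← Finset.prod_pow] at h1
  have h2 : φ (∏ i, (algebraMap (MvPowerSeries (Fin n) k) D (MvPowerSeries.X i) ^ N) ^ p ^ a) =
      φ 1 * (∏ i, MvPowerSeries.X i ^ N) ^ p ^ a := by
    rw [← Finset.prod_pow]
    simp only [← map_pow, ← map_prod]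
    rw [Algebra.algebraMap_eq_smul_one, map_smul, smul_eq_mul, mul_comm]
  rw [← h2, h1]
  refine Ideal.sum_mem _ fun i _ => ?_
  rw [mul_pow, ← pow_mul, ← map_pow, mul_comm (s i ^ _), ← Algebra.smul_def, map_smul, smul_eq_mul]
  exact Ideal.mul_mem_right _ _ (Ideal.subset_span ⟨i, by simp, rfl⟩)

lemma false_of_relation_of_charZero [CharZero k] {N : ℕ} {s : Fin n → D}
    (h : ∏ i, algebraMap (MvPowerSeries (Fin n) k) D (MvPowerSeries.X i) ^ N =
      ∑ i, s i * algebraMap (MvPowerSeries (Fin n) k) D (MvPowerSeries.X i) ^ (N + 1)) : False := by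
  let A := MvPowerSeries (Fin n) k
  have hinj : Function.Injective (algebraMap A D) := FaithfulSMul.algebraMap_injective A D
  have : FaithfulSMul A (FractionRing D) := by
    rw [faithfulSMul_iff_algebraMap_injective, IsScalarTower.algebraMap_eq A D (FractionRing D)]
    exact (IsFractionRing.injective D (FractionRing D)).comp hinj
  let _ : Algebra (FractionRing A) (FractionRing D) := FractionRing.liftAlgebra A (FractionRing D)
  have : IsScalarTower A (FractionRing A) (FractionRing D) := FractionRing.isScalarTower_liftAlgebra A _
  have : FiniteDimensional (FractionRing A) (FractionRing D) := by infer_instance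
  have hex : ∀ δ : D, ∃ a, algebraMap A (FractionRing A) a =
      Algebra.trace (FractionRing A) (FractionRing D) (algebraMap D (FractionRing D) δ) := fun δ =>
    IsIntegrallyClosed.isIntegral_iff.1 (Algebra.isIntegral_trace
      ((Algebra.IsIntegral.isIntegral (R := A) δ).algebraMap))
  choose τ hτ using hex
  have hτs : ∀ (a : A) δ, algebraMap A (FractionRing A) (a * τ δ) =
      Algebra.trace (FractionRing A) (FractionRing D) (algebraMap D (FractionRing D) (algebraMap A D a * δ)) := by
    intro a δ
    rw [map_mul, hτ, map_mul, ← IsScalarTower.algebraMap_apply A D (FractionRing D),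
      IsScalarTower.algebraMap_apply A (FractionRing A) (FractionRing D), ← smul_eq_mul, ← map_smul,
      Algebra.smul_def]
  have h1 : (∏ i, MvPowerSeries.X i ^ N) * τ 1 = ∑ i, MvPowerSeries.X i ^ (N + 1) * τ (s i) := by
    refine IsFractionRing.injective A (FractionRing A) ?_
    rw [hτs, map_sum]
    simp only [hτs]
    rw [← map_sum, ← map_sum]
    congr 2
    simp only [map_prod, map_pow, mul_one]
    rw [h]
    exact sum_congr rfl fun i _ => mul_comm _ _
  have h2 : τ 1 = (Module.finrank (FractionRing A) (FractionRing D) : A) := by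
    refine IsFractionRing.injective A (FractionRing A) ?_
    rw [hτ, map_one, ← map_one (algebraMap (FractionRing A) (FractionRing D)), Algebra.trace_algebraMap,
      nsmul_eq_mul, mul_one, map_natCast]
  have h3 : τ 1 ∈ Ideal.span ((fun i => (MvPowerSeries.X i : A) ^ 1) '' (univ : Finset (Fin n))) := by
    refine MvPowerSeries.mem_of_mul_prod_X_pow_mem (N := N) ?_
    rw [pow_one, mul_one, mul_comm, h1]
    refine Ideal.sum_mem _ fun i _ => Ideal.mul_mem_right _ _ (Ideal.subset_span ⟨i, by simp, rfl⟩)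
  have h4 := (MvPowerSeries.mem_span_X_pow_iff _ _ _).1 h3 0 (by simp)
  rw [h2, MvPowerSeries.coeff_zero_eq_constantCoeff_apply, map_natCast] at h4
  exact Module.finrank_pos.ne' (Nat.cast_eq_zero.1 h4)

end EqualChar

section

variable {T : Type} [CommRing T] [IsDomain T] [IsLocalRing T] [IsNoetherianRing T] [IsAdicComplete (maximalIdeal T) T]

lemma exists_finite_injective_of_coefficientField {k : Type} [Field k] (β : k →+* T)
    (hβ : ∀ a, ∃ c, residue T (β c) = a) {d : ℕ} (hdim : ringKrullDim T = d) {x : Fin d → T}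
    (hx : ∀ i, x i ∈ maximalIdeal T)
    (hsop : ∀ Q : Ideal T, Q.IsPrime → (∀ i, x i ∈ Q) → Q = maximalIdeal T) :
    ∃ Ψ : MvPowerSeries (Fin d) k →+* T, (∀ i, Ψ (MvPowerSeries.X i) = x i) ∧ Function.Injective Ψ ∧ Ψ.Finite := by
  have hk : maximalIdeal k = ⊥ := IsLocalRing.isField_iff_maximalIdeal_eq.1 (Field.toIsField k)
  have : IsAdicComplete (maximalIdeal k) k := by rw [hk]; infer_instance
  obtain ⟨N, hN⟩ := exists_pow_le_of_forall_isPrime (I := Ideal.span (Set.range x)) (fun Q hQ h =>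
    hsop Q hQ fun i => h (Ideal.subset_span ⟨i, rfl⟩))
  obtain ⟨Ψ, -, h1, h2, h3⟩ := exists_finite_injective_eval β hβ (by rw [hk, Ideal.map_bot]; exact bot_le) hx
    (hN.trans le_sup_left) (d := d) (by rw [ringKrullDim_eq_zero_of_field, zero_add]) hdim.ge
  exact ⟨Ψ, h1, h2, h3⟩

end

lemma MvPowerSeries.dvd_of_forall_coeff {C : Type} [CommRing C] {n : ℕ} {c : C} {f : MvPowerSeries (Fin n) C}
    (h : ∀ m, c ∣ MvPowerSeries.coeff m f) : MvPowerSeries.C c ∣ f := by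
  choose g hg using h
  refine ⟨(show MvPowerSeries (Fin n) C from g), MvPowerSeries.ext fun m => ?_⟩
  rw [MvPowerSeries.coeff_C_mul, hg]
  rfl

section

variable {T : Type} [CommRing T] [IsDomain T] [IsLocalRing T] [IsNoetherianRing T] [IsAdicComplete (maximalIdeal T) T]

/-- Complete local domains of mixed characteristic are finite over regular local rings. -/
theorem exists_finite_injective_of_mixedChar (p : ℕ) [hp : Fact p.Prime] [CharZero T]
    (hpm : (p : T) ∈ maximalIdeal T) {n : ℕ} (hdim : ringKrullDim T = (n + 1 : ℕ)) {x : Fin n → T}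
    (hx : ∀ i, x i ∈ maximalIdeal T)
    (hsop : ∀ Q : Ideal T, Q.IsPrime → (p : T) ∈ Q → (∀ i, x i ∈ Q) → Q = maximalIdeal T) :
    ∃ (A : Type) (_ : CommRing A) (_ : IsDomain A) (_ : IsIntegrallyClosed A) (_ : IsNoetherianRing A)
      (_ : CharZero A) (k : Type) (_ : Field k) (_ : CharP k p) (_ : PerfectRing k p) (Ψ : A →+* T)
      (α : A →+* MvPowerSeries (Fin n) (WittVector p k)) (X : Fin n → A),
      (∀ a ≠ 0, ∃ (j : ℕ) (g : A), a = p ^ j * g ∧ MvPowerSeries.map WittVector.constantCoeff (α g) ≠ 0) ∧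
      (∀ i, α (X i) = MvPowerSeries.X i) ∧ (∀ i, Ψ (X i) = x i) ∧ Function.Injective Ψ ∧ Ψ.Finite := by
  obtain ⟨C, _, _, _, β, k, _, _, _, ω, hirr, hcomp, hβ, hω⟩ := exists_cohenRing p T hpm
  have hm : maximalIdeal C = Ideal.span {(p : C)} := hirr.maximalIdeal_eq
  have : IsAdicComplete (maximalIdeal C) C := by rwa [hm]
  have hmap : (maximalIdeal C).map β = Ideal.span {(p : T)} := by
    rw [hm, Ideal.map_span, Set.image_singleton, map_natCast]
  obtain ⟨N, hN⟩ := exists_pow_le_of_forall_isPrime (I := Ideal.span (Set.range x) ⊔ Ideal.span {(p : T)})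
    (fun Q hQ h => hsop Q hQ (h (Ideal.mem_sup_right (Ideal.mem_span_singleton_self _)))
      fun i => h (Ideal.mem_sup_left (Ideal.subset_span ⟨i, rfl⟩)))
  obtain ⟨Ψ, -, h1, h2, h3⟩ := exists_finite_injective_eval β hβ
    (by rw [hmap, Ideal.span_singleton_le_iff_mem]; exact hpm) hx (by rwa [hmap]) (d := n + 1)
    (by rw [IsDiscreteValuationRing.ringKrullDim_eq_one, add_comm]; rfl) hdim.ge
  have hchar : CharZero (MvPowerSeries (Fin n) C) := Ψ.charZero
  refine ⟨MvPowerSeries (Fin n) C, inferInstance, inferInstance, inferInstance, inferInstance, hchar, k, inferInstance,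
    inferInstance, inferInstance, Ψ, MvPowerSeries.map ω, MvPowerSeries.X, fun a ha => ?_,
    fun i => MvPowerSeries.map_X ω i, h1, h2, h3⟩
  obtain ⟨j, g, hg, rfl⟩ := WfDvdMonoid.max_power_factor' ha (x := (p : MvPowerSeries (Fin n) C)) (by
    intro hu
    have := hu.map (MvPowerSeries.constantCoeff (σ := Fin n) (R := C))
    rw [map_natCast] at this
    exact hirr.not_isUnit this)
  refine ⟨j, g, rfl, fun h0 => hg ?_⟩
  rw [← map_natCast (MvPowerSeries.C (σ := Fin n) (R := C))]
  refine MvPowerSeries.dvd_of_forall_coeff fun m => hω _ ?_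
  have := congrArg (MvPowerSeries.coeff m) h0
  simpa using this

lemma ringKrullDim_ne_zero_of_mem {π : T} (h0 : π ≠ 0) (hπ : π ∈ maximalIdeal T) {d : ℕ} {x : Fin d → T}
    (hx : ∀ Q : Ideal T, Q.IsPrime → (∀ i, x i ∈ Q) → Q = maximalIdeal T) : d ≠ 0 := by
  rintro rfl
  have := hx ⊥ Ideal.isPrime_bot (fun i => i.elim0)
  rw [← this] at hπ
  exact h0 hπ

lemma one_le_height_of_mem {π : T} (h0 : π ≠ 0) (Q : Ideal T) (hπ : π ∈ Q) : 1 ≤ Q.height := by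
  rw [Order.one_le_iff_ne_zero, Ne, Ideal.height_eq_zero_iff_eq_bot]
  rintro rfl
  exact h0 hπ

lemma charZero_residueField_or {T : Type} [CommRing T] [IsLocalRing T] :
    CharZero (ResidueField T) ∨ ∃ p : ℕ, p.Prime ∧ (p : T) ∈ maximalIdeal T := by
  obtain ⟨q, hq⟩ := CharP.exists (ResidueField T)
  rcases CharP.char_is_prime_or_zero (ResidueField T) q with h | rfl
  · refine Or.inr ⟨q, h, ?_⟩
    rw [← residue_eq_zero_iff, map_natCast, CharP.cast_eq_zero]
  · exact Or.inl (CharP.charP_to_charZero _)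

lemma finite_integralClosure_of_finite_of_charZero {A : Type} [CommRing A] [IsDomain A] [IsIntegrallyClosed A]
    [IsNoetherianRing A] [CharZero A] {Ψ : A →+* T} (hinj : Function.Injective Ψ) (hfin : Ψ.Finite) :
    Module.Finite T (integralClosure T (FractionRing T)) := by
  let _ : Algebra A T := Ψ.toAlgebra
  have : Module.Finite A T := hfin
  have : FaithfulSMul A T := (faithfulSMul_iff_algebraMap_injective A T).2 hinj
  refine finite_integralClosure_fractionRing A T fun K L _ _ _ _ _ _ _ _ => ?_
  have : CharZero K := charZero_of_injective_algebraMap (IsFractionRing.injective A K)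
  exact IsIntegralClosure.finite A K L (integralClosure A L)

variable (T) in
/-- The normalization of a complete local domain is finite. -/
theorem finite_integralClosure_of_complete : Module.Finite T (integralClosure T (FractionRing T)) := by
  obtain ⟨d, x, hdim, hx, hsop⟩ := exists_parameters T
  obtain ⟨p, hp⟩ := CharP.exists T
  rcases CharP.char_is_prime_or_zero T p with h | rfl
  · have : Fact p.Prime := ⟨h⟩
    obtain ⟨β, hβ⟩ := exists_coefficientField_of_charP p T
    have : CharP (ResidueField T) p := (RingHom.charP_iff β β.injective p).2 hp
    obtain ⟨Ψ, h1, h2, h3⟩ := exists_finite_injective_of_coefficientField β (fun a => ⟨a, hβ a⟩) hdim hx hsop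
    let _ : Algebra (MvPowerSeries (Fin d) (ResidueField T)) T := Ψ.toAlgebra
    have : Module.Finite (MvPowerSeries (Fin d) (ResidueField T)) T := h3
    have : FaithfulSMul (MvPowerSeries (Fin d) (ResidueField T)) T :=
      (faithfulSMul_iff_algebraMap_injective _ T).2 h2
    have : CharP (MvPowerSeries (Fin d) (ResidueField T)) p := (RingHom.charP_iff Ψ h2 p).2 hp
    have : ExpChar (MvPowerSeries (Fin d) (ResidueField T)) p := ExpChar.prime h
    refine finite_integralClosure_fractionRing (MvPowerSeries (Fin d) (ResidueField T)) T
      fun K L _ _ _ _ _ _ _ _ => ?_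
    have : ExpChar K p := expChar_of_injective_algebraMap
      (IsFractionRing.injective (MvPowerSeries (Fin d) (ResidueField T)) K) p
    exact TwistedFinite.finite_integralClosure _ K L p fun e => TwistedFinite.mvPowerSeries p e d
  · have : CharZero T := CharP.charP_to_charZero T
    rcases charZero_residueField_or (T := T) with h0 | ⟨p, hpp, hpm⟩
    · obtain ⟨β, hβ⟩ := exists_coefficientField_of_charZero T
      obtain ⟨Ψ, h1, h2, h3⟩ := exists_finite_injective_of_coefficientField β (fun a => ⟨a, hβ a⟩) hdim hx hsop
      have : CharZero (MvPowerSeries (Fin d) (ResidueField T)) := Ψ.charZero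
      exact finite_integralClosure_of_finite_of_charZero h2 h3
    · have : Fact p.Prime := ⟨hpp⟩
      have hp0 : (p : T) ≠ 0 := Nat.cast_ne_zero.2 hpp.ne_zero
      obtain ⟨n, rfl⟩ := Nat.exists_eq_succ_of_ne_zero (ringKrullDim_ne_zero_of_mem hp0 hpm hsop)
      obtain ⟨x', h1, h2⟩ := exists_parameters_with (RingHom.id T) hdim x hsop (p : T)
        (fun Q _ h => one_le_height_of_mem hp0 Q h)
      obtain ⟨A, _, _, _, _, _, k, _, _, _, Ψ, α, X, -, -, -, h3, h4⟩ := exists_finite_injective_of_mixedChar p hpm hdim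
        (x := fun i => x' i.castSucc)
        (fun i => mem_of_span_range_eq h1.symm (RingHom.id T) (maximalIdeal T) hx _) h2
      exact finite_integralClosure_of_finite_of_charZero h3 h4

/-- The monomial conjecture for parameters in finite extensions of complete local domains. -/
theorem false_of_forall_relation {R D : Type} [CommRing R] (f : R →+* T) [CommRing D] [IsDomain D] [Algebra T D]
    [Module.Finite T D] [FaithfulSMul T D] {d : ℕ} (hdim : ringKrullDim T = d) (x : Fin d → R)
    (hx : ∀ i, f (x i) ∈ maximalIdeal T)
    (hsop : ∀ Q : Ideal T, Q.IsPrime → (∀ i, f (x i) ∈ Q) → Q = maximalIdeal T)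
    (H : ∀ x' : Fin d → R, Ideal.span (Set.range x') = Ideal.span (Set.range x) → ∃ (N : ℕ) (s : Fin d → D),
      ∏ i, algebraMap T D (f (x' i)) ^ N = ∑ i, s i * algebraMap T D (f (x' i)) ^ (N + 1)) : False := by
  have hTD : Function.Injective (algebraMap T D) := FaithfulSMul.algebraMap_injective T D
  have hfinTD : (algebraMap T D).Finite := RingHom.finite_algebraMap.2 inferInstance
  have hequal : ∀ {k : Type} [Field k] (β : k →+* T), (∀ a, ∃ c, residue T (β c) = a) →
      (CharZero k ∨ ∃ p : ℕ, p.Prime ∧ CharP k p) → False := by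
    intro k _ β hβ hk
    obtain ⟨Ψ, h1, h2, h3⟩ := exists_finite_injective_of_coefficientField β hβ hdim hx hsop
    obtain ⟨N, s, hs⟩ := H x rfl
    let _ : Algebra (MvPowerSeries (Fin d) k) D := ((algebraMap T D).comp Ψ).toAlgebra
    have : Module.Finite (MvPowerSeries (Fin d) k) D := hfinTD.comp h3
    have : FaithfulSMul (MvPowerSeries (Fin d) k) D :=
      (faithfulSMul_iff_algebraMap_injective _ D).2 (hTD.comp h2)
    have hX : ∀ i, algebraMap (MvPowerSeries (Fin d) k) D (MvPowerSeries.X i) = algebraMap T D (f (x i)) :=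
      fun i => congrArg (algebraMap T D) (h1 i)
    simp only [← hX] at hs
    rcases hk with hk | ⟨p, hp, hk⟩
    · exact false_of_relation_of_charZero hs
    · have : Fact p.Prime := ⟨hp⟩
      exact false_of_relation_of_charP p hs
  obtain ⟨p, hp⟩ := CharP.exists T
  rcases CharP.char_is_prime_or_zero T p with h | rfl
  · have : Fact p.Prime := ⟨h⟩
    obtain ⟨β, hβ⟩ := exists_coefficientField_of_charP p T
    exact hequal β (fun a => ⟨a, hβ a⟩) (Or.inr ⟨p, h, (RingHom.charP_iff β β.injective p).2 hp⟩)
  have : CharZero T := CharP.charP_to_charZero T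
  rcases charZero_residueField_or (T := T) with h0 | ⟨p, hpp, hpm⟩
  · obtain ⟨β, hβ⟩ := exists_coefficientField_of_charZero T
    exact hequal β (fun a => ⟨a, hβ a⟩) (Or.inl h0)
  have : Fact p.Prime := ⟨hpp⟩
  have hp0 : (p : T) ≠ 0 := Nat.cast_ne_zero.2 hpp.ne_zero
  obtain ⟨n, rfl⟩ := Nat.exists_eq_succ_of_ne_zero (ringKrullDim_ne_zero_of_mem hp0 hpm hsop)
  obtain ⟨x', hsp, h2⟩ := exists_parameters_with f hdim x hsop (p : T)
    (fun Q _ h => one_le_height_of_mem hp0 Q h)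
  have hx' : ∀ i, f (x' i) ∈ maximalIdeal T := mem_of_span_range_eq hsp.symm f (maximalIdeal T) hx
  obtain ⟨A, _, _, _, _, _, k, _, _, _, Ψ, α, X, hα, hαX, hΨX, h3, h4⟩ :=
    exists_finite_injective_of_mixedChar p hpm hdim (x := fun i => f (x' i.castSucc)) (fun i => hx' _) h2
  obtain ⟨N, s, hs⟩ := H x' hsp
  let _ : Algebra A D := ((algebraMap T D).comp Ψ).toAlgebra
  have : Module.Finite A D := hfinTD.comp h4
  have : FaithfulSMul A D := (faithfulSMul_iff_algebraMap_injective _ D).2 (hTD.comp h3)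
  have hX : (fun i => algebraMap A D (X i)) = fun i => algebraMap T D (f (x' i.castSucc)) :=
    funext fun i => congrArg (algebraMap T D) (hΨX i)
  have hXi : ∀ i, algebraMap A D (X i) = algebraMap T D (f (x' i.castSucc)) := fun i => congrFun hX i
  let y : T := f (x' (Fin.last n))
  let z : Fin n → T := fun i => f (x' i.castSucc)
  have hmapz : ∀ a, (spanPow z a univ).map (algebraMap T D) = spanPow (fun i => algebraMap A D (X i)) a univ := by
    intro a
    rw [map_spanPow, hX]
  obtain ⟨Q, hQ⟩ := exists_pow_le_of_forall_isPrime (I := spanPow z (N + 1) univ ⊔ Ideal.span {y})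
    (fun P hP h => hsop P hP (mem_of_span_range_eq hsp f P fun i => by
      refine Fin.lastCases ?_ (fun i => ?_) i
      · exact h (Ideal.mem_sup_right (Ideal.mem_span_singleton_self _))
      · exact hP.mem_of_pow_mem (N + 1) (h (Ideal.mem_sup_left (Ideal.subset_span ⟨i, by simp, rfl⟩)))))
  obtain ⟨u, hu, v, hv, huv⟩ := Submodule.mem_sup.1 (hQ (Ideal.pow_mem_pow hpm Q))
  obtain ⟨w, rfl⟩ := Ideal.mem_span_singleton'.1 hv
  obtain ⟨M, hM⟩ := exists_pow_le_of_forall_isPrime (I := spanPow z 1 univ ⊔ Ideal.span {(p : T)})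
    (fun P hP h => h2 P hP (h (Ideal.mem_sup_right (Ideal.mem_span_singleton_self _))) fun i =>
      hP.mem_of_pow_mem 1 (h (Ideal.mem_sup_left (Ideal.subset_span ⟨i, by simp, rfl⟩))))
  refine false_of_relation p α hα X hαX (N := N) (Q := Q) (M := M) (y := algebraMap T D y)
    (w := algebraMap T D w) (s := s (Fin.last n)) ?_ ?_ ?_
  · rw [Fin.prod_univ_castSucc, Fin.sum_univ_castSucc] at hs
    simp only [hXi]
    rw [hs, add_sub_cancel_right]
    exact mem_spanPow.2 ⟨fun i => s i.castSucc, rfl⟩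
  · rw [← hmapz, ← neg_mem_iff, neg_sub]
    have : (p : D) ^ Q - algebraMap T D y * algebraMap T D w = algebraMap T D u := by
      have := congrArg (algebraMap T D) huv
      rw [map_add, map_mul, map_pow, map_natCast] at this
      rw [← this]; ring
    rw [this]
    exact Ideal.mem_map_of_mem _ hu
  · have := Ideal.mem_map_of_mem (algebraMap T D) (hM (Ideal.pow_mem_pow (hx' (Fin.last n)) M))
    rwa [Ideal.map_sup, hmapz, Ideal.map_span, Set.image_singleton, map_natCast, map_pow] at this

end

section Completion

variable (R : Type) [CommRing R] [IsLocalRing R] [IsNoetherianRing R]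

instance AdicCompletion.isNoetherianRing_maximalIdeal :
    IsNoetherianRing (AdicCompletion (maximalIdeal R) R) := by
  let T := AdicCompletion (maximalIdeal R) R
  obtain ⟨n, y, hy⟩ := Submodule.fg_iff_exists_fin_generating_family.1
    ((isNoetherianRing_iff_ideal_fg R).1 inferInstance (maximalIdeal R))
  have hmap : maximalIdeal T = Ideal.span (Set.range fun i => algebraMap R T (y i)) := by
    rw [AdicCompletion.maximalIdeal_eq_map]
    refine (congrArg (Ideal.map (algebraMap R T)) hy.symm).trans ((Ideal.map_span _ _).trans ?_)
    rw [← Set.range_comp]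
    rfl
  obtain ⟨Ψ, h1, h2⟩ := MvPowerSeries.exists_eval (maximalIdeal T) (algebraMap R T) (fun i => algebraMap R T (y i))
    (fun i => by rw [hmap]; exact Ideal.subset_span ⟨i, rfl⟩)
  let _ : Algebra (MvPowerSeries (Fin n) R) T := Ψ.toAlgebra
  let I : Ideal (MvPowerSeries (Fin n) R) := Ideal.span (Set.range MvPowerSeries.X)
  have hI : I.map (algebraMap (MvPowerSeries (Fin n) R) T) = maximalIdeal T := by
    rw [hmap, Ideal.map_span, ← Set.range_comp]
    exact congrArg _ (congrArg _ (funext h2))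
  have : IsHausdorff I T := IsHausdorff.of_map (S := T) (J := maximalIdeal T) hI.le
  have : Module.Finite (MvPowerSeries (Fin n) R) T := by
    refine Module.Finite.of_isAdicComplete I (fun _ : Fin 1 => (1 : T)) fun t => ?_
    obtain ⟨a, ha⟩ := (AdicCompletion.residueField_map_bijective R).2 (residue T t)
    obtain ⟨r, rfl⟩ := residue_surjective a
    refine ⟨fun _ => MvPowerSeries.C r, ?_⟩
    rw [Ideal.smul_top_eq_map, Submodule.restrictScalars_mem, hI, ← residue_eq_zero_iff, map_sub, sub_eq_zero, ← ha,
      Fin.sum_univ_one, Algebra.smul_def, mul_one, ResidueField.map_residue]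
    exact congrArg _ (h1 r).symm
  exact IsNoetherianRing.of_finite (MvPowerSeries (Fin n) R) T

instance AdicCompletion.faithfullyFlat_maximalIdeal :
    Module.FaithfullyFlat R (AdicCompletion (maximalIdeal R) R) :=
  Module.FaithfullyFlat.of_flat_of_isLocalHom

lemma AdicCompletion.ringKrullDim_maximalIdeal :
    ringKrullDim (AdicCompletion (maximalIdeal R) R) = ringKrullDim R := by
  let T := AdicCompletion (maximalIdeal R) R
  have hover : (maximalIdeal T).LiesOver (maximalIdeal R) :=
    ⟨(IsLocalRing.maximalIdeal_comap (algebraMap R T)).symm⟩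
  have h1 := Ideal.height_eq_height_add_of_liesOver_of_hasGoingDown (maximalIdeal R) (maximalIdeal T)
  have h2 : (maximalIdeal T).map (Ideal.Quotient.mk ((maximalIdeal R).map (algebraMap R T))) = ⊥ := by
    rw [AdicCompletion.maximalIdeal_eq_map]
    exact Ideal.map_quotient_self _
  have : Nontrivial (T ⧸ (maximalIdeal R).map (algebraMap R T)) := by
    rw [← AdicCompletion.maximalIdeal_eq_map]
    exact Ideal.Quotient.nontrivial_iff.2 (Ideal.IsPrime.ne_top inferInstance)
  rw [h2, Ideal.height_bot, add_zero] at h1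
  rw [← IsLocalRing.maximalIdeal_height_eq_ringKrullDim, ← IsLocalRing.maximalIdeal_height_eq_ringKrullDim, ← h1]

end Completion

section Quotient

variable {T : Type} [CommRing T] [IsLocalRing T] [IsNoetherianRing T]

instance isLocalRing_quotient (P : Ideal T) [P.IsPrime] : IsLocalRing (T ⧸ P) :=
  IsLocalRing.of_surjective' (Ideal.Quotient.mk P) Ideal.Quotient.mk_surjective

lemma map_maximalIdeal_quotient (P : Ideal T) [P.IsPrime] :
    (maximalIdeal T).map (Ideal.Quotient.mk P) = maximalIdeal (T ⧸ P) :=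
  IsLocalRing.eq_maximalIdeal (Ideal.IsMaximal.map_of_surjective_of_ker_le Ideal.Quotient.mk_surjective (by
    rw [Ideal.mk_ker]
    exact le_maximalIdeal (Ideal.IsPrime.ne_top inferInstance)))

instance isAdicComplete_quotient [IsAdicComplete (maximalIdeal T) T] (P : Ideal T) [P.IsPrime] :
    IsAdicComplete (maximalIdeal (T ⧸ P)) (T ⧸ P) where
  prec' f hf := by
    have h1 : ∀ n, ∃ e ∈ maximalIdeal T ^ n, Ideal.Quotient.mk P e = f (n + 1) - f n := by
      intro n
      have := (hf n.le_succ).symm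
      rw [SModEq.sub_mem, smul_eq_mul, Ideal.mul_top, ← map_maximalIdeal_quotient, ← Ideal.map_pow] at this
      exact (Ideal.mem_map_iff_of_surjective _ Ideal.Quotient.mk_surjective).1 this
    choose e he hef using h1
    obtain ⟨a, ha⟩ := Ideal.Quotient.mk_surjective (f 0)
    let g : ℕ → T := fun n => a + ∑ j ∈ range n, e j
    have hg : ∀ n, Ideal.Quotient.mk P (g n) = f n := by
      intro n
      induction n with
      | zero => simpa [g] using ha
      | succ n ih =>
        have : g (n + 1) = g n + e n := by simp only [g, sum_range_succ]; ring
        rw [this, map_add, ih, hef, add_sub_cancel]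
    obtain ⟨l, hl⟩ := IsAdicComplete.exists_sub_mem (maximalIdeal T) (fun n => g (n + 1)) (fun j => by
      have : g (j + 1 + 1) - g (j + 1) = e (j + 1) := by simp only [g, sum_range_succ]; ring
      rw [this]; exact he _)
    refine ⟨Ideal.Quotient.mk P l, fun n => ?_⟩
    have h2 : l - g n ∈ maximalIdeal T ^ n := by
      have h3 : l - g n = (l - g (n + 1)) + e n := by simp only [g, sum_range_succ]; ring
      rw [h3]
      exact add_mem (Ideal.pow_le_pow_right n.le_succ (hl n)) (he n)
    rw [SModEq.comm, SModEq.sub_mem, smul_eq_mul, Ideal.mul_top, ← map_maximalIdeal_quotient, ← Ideal.map_pow, ← hg,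
      ← map_sub]
    exact Ideal.mem_map_of_mem _ h2

lemma exists_minimalPrimes_ringKrullDim_quotient_eq {d : ℕ} (h : ringKrullDim T = d) :
    ∃ P ∈ minimalPrimes T, ringKrullDim (T ⧸ P) = d := by
  obtain ⟨l, -, hlen⟩ := Ideal.exists_ltSeries_length_eq_height (maximalIdeal T)
  obtain ⟨P, hP, hle⟩ := Ideal.exists_minimalPrimes_le (I := ⊥) (J := (l.head).asIdeal) bot_le
  refine ⟨P, hP, le_antisymm (h ▸ ringKrullDim_quotient_le P) ?_⟩
  have hd : l.length = d := by
    have := IsLocalRing.maximalIdeal_height_eq_ringKrullDim (R := T)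
    rw [h, ← hlen] at this
    exact_mod_cast this
  rw [ringKrullDim_quotient, ← hd]
  let l' : LTSeries (PrimeSpectrum.zeroLocus (R := T) P) :=
    ⟨l.length, fun i => ⟨l i, hle.trans (LTSeries.head_le l i)⟩, l.step⟩
  exact Order.LTSeries.length_le_krullDim l'

end Quotient

section

variable {R T : Type} [CommRing R] [CommRing T] [Algebra R T]

lemma exists_fractionRing_hom [Module.Flat R T] {P : Ideal T} (hP : P ∈ minimalPrimes T) [P.IsPrime] :
    ∃ g : FractionRing R →+* FractionRing (T ⧸ P), ∀ r, g (algebraMap R (FractionRing R) r) =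
      algebraMap T (FractionRing (T ⧸ P)) (algebraMap R T r) := by
  let f : R →+* FractionRing (T ⧸ P) := (algebraMap T (FractionRing (T ⧸ P))).comp (algebraMap R T)
  have hf : ∀ r : nonZeroDivisors R, IsUnit (f r) := by
    intro r
    have h1 : algebraMap R T r ∈ nonZeroDivisors T := by
      rw [mem_nonZeroDivisors_iff_right]
      intro t ht
      have h2 := Module.Flat.isSMulRegular_of_nonZeroDivisors (M := T) r.2
      refine h2 ?_
      simp only [Algebra.smul_def, mul_zero]
      rw [mul_comm, ht]
    have h2 : algebraMap R T r ∉ P := fun h =>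
      Set.disjoint_left.1 (Ideal.disjoint_nonZeroDivisors_of_mem_minimalPrimes hP) h h1
    rw [isUnit_iff_ne_zero]
    intro h0
    refine h2 (Ideal.Quotient.eq_zero_iff_mem.1 (IsFractionRing.injective (T ⧸ P) (FractionRing (T ⧸ P)) ?_))
    rw [map_zero, ← h0]
    rfl
  exact ⟨IsLocalization.lift hf, fun r => IsLocalization.lift_eq hf r⟩

lemma isIntegral_fractionRing_hom {P : Ideal T} [P.IsPrime] {g : FractionRing R →+* FractionRing (T ⧸ P)}
    (hg : ∀ r, g (algebraMap R (FractionRing R) r) = algebraMap T (FractionRing (T ⧸ P)) (algebraMap R T r))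
    {z : FractionRing R} (hz : IsIntegral R z) : IsIntegral (T ⧸ P) (g z) := by
  refine IsIntegral.tower_top (R := R) ?_
  obtain ⟨q, hq, h0⟩ := hz
  refine ⟨q, hq, ?_⟩
  have h1 := congrArg g h0
  rw [Polynomial.hom_eval₂, map_zero] at h1
  rw [← h1]
  congr 1
  ext r
  exact (hg r).symm

/-- The normalization is finite if this holds for the components of a faithfully flat extension. -/
theorem finite_intClosure_of_faithfullyFlat [IsNoetherianRing T] [IsReduced T] [Module.FaithfullyFlat R T]
    (h : ∀ (P : Ideal T) [P.IsPrime], Module.Finite (T ⧸ P) (integralClosure (T ⧸ P) (FractionRing (T ⧸ P)))) :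
    Module.Finite R (IntClosure R) := by
  classical
  let ι := minimalPrimes T
  have hfin : Finite ι := Set.finite_coe_iff.2 (minimalPrimes.finite_of_isNoetherianRing T)
  have hpr : ∀ P : ι, P.1.IsPrime := fun P => P.2.1.1
  choose g hg using fun P : ι => exists_fractionRing_hom (R := R) P.2
  let G : FractionRing R → ∀ P : ι, FractionRing (T ⧸ P.1) := fun z P => g P z
  let S : ∀ P : ι, Submodule T (FractionRing (T ⧸ P.1)) := fun P =>
    (Subalgebra.toSubmodule (integralClosure (T ⧸ P.1) (FractionRing (T ⧸ P.1)))).restrictScalars T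
  have hS : ∀ P, (S P).FG := by
    intro P
    have h1 : (Subalgebra.toSubmodule (integralClosure (T ⧸ P.1) (FractionRing (T ⧸ P.1)))).FG :=
      Module.Finite.iff_fg.1 (h P.1)
    exact Submodule.FG.restrictScalars_of_surjective h1 Ideal.Quotient.mk_surjective
  have hle : Submodule.span T (G '' (integralClosure R (FractionRing R) : Set (FractionRing R))) ≤
      Submodule.pi Set.univ S := by
    rw [Submodule.span_le]
    rintro _ ⟨z, hz, rfl⟩ P -
    exact isIntegral_fractionRing_hom (hg P) hz
  have hnoeth : IsNoetherian T (Submodule.pi Set.univ S) := isNoetherian_of_fg_of_noetherian _ (Submodule.fg_pi hS)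
  have hfg : (Submodule.span T (G '' (integralClosure R (FractionRing R) : Set (FractionRing R)))).FG :=
    (isNoetherian_submodule.1 hnoeth) _ hle
  obtain ⟨s, hs, hspan⟩ := (Submodule.fg_span_iff_fg_span_finset_subset _).1 hfg
  obtain ⟨v, hv, rfl⟩ := Finset.subset_set_image_iff.1 hs
  refine ⟨Submodule.fg_def.2 ⟨{z | (z : FractionRing R) ∈ v}, Set.Finite.preimage Subtype.val_injective.injOn v.finite_toSet, ?_⟩⟩
  rw [eq_top_iff]
  rintro ⟨z, hz⟩ -
  have hzs : G z ∈ Submodule.span T (G '' (v : Set (FractionRing R))) := by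
    rw [← Finset.coe_image, ← hspan]
    exact Submodule.subset_span ⟨z, hz, rfl⟩
  obtain ⟨τ, hτ⟩ := (Submodule.mem_span_image_finset_iff_exists_fun' T).1 hzs
  obtain ⟨b, hb⟩ := IsLocalization.exist_integer_multiples_of_finset (nonZeroDivisors R) (insert z v)
  choose! a ha using hb
  have hkey : algebraMap R T (a z) = ∑ u ∈ v, τ u * algebraMap R T (a u) := by
    rw [← sub_eq_zero]
    have hmem : algebraMap R T (a z) - ∑ u ∈ v, τ u * algebraMap R T (a u) ∈ sInf (⊥ : Ideal T).minimalPrimes := by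
      rw [Ideal.mem_sInf]
      intro P hP
      have hPp : P.IsPrime := hP.1.1
      have h1 : g ⟨P, hP⟩ z = ∑ u ∈ v, τ u • g ⟨P, hP⟩ u := by
        have := congrFun hτ ⟨P, hP⟩
        rw [Finset.sum_apply] at this
        exact this.symm
      have h2 : ∀ u ∈ insert z v, algebraMap T (FractionRing (T ⧸ P)) (algebraMap R T (a u)) =
          algebraMap T (FractionRing (T ⧸ P)) (algebraMap R T b) * g ⟨P, hP⟩ u := by
        intro u hu
        rw [← hg ⟨P, hP⟩, ha u hu, Algebra.smul_def, map_mul, hg ⟨P, hP⟩]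
      refine Ideal.Quotient.eq_zero_iff_mem.1 (IsFractionRing.injective (T ⧸ P) (FractionRing (T ⧸ P)) ?_)
      rw [map_zero]
      change algebraMap T (FractionRing (T ⧸ P)) (algebraMap R T (a z) - ∑ u ∈ v, τ u * algebraMap R T (a u)) = 0
      rw [map_sub, map_sum, h2 z (Finset.mem_insert_self _ _), h1, mul_sum, sub_eq_zero]
      refine sum_congr rfl fun u hu => ?_
      rw [map_mul, h2 u (Finset.mem_insert_of_mem hu), Algebra.smul_def]
      ring
    rw [Ideal.sInf_minimalPrimes] at hmem
    have : (⊥ : Ideal T).radical = ⊥ := Ideal.radical_bot_of_isReduced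
    rwa [this] at hmem
  have hmem : a z ∈ Submodule.span R (a '' (v : Set (FractionRing R))) := by
    have h1 : algebraMap R T (a z) ∈ (Ideal.span (a '' (v : Set (FractionRing R)))).map (algebraMap R T) := by
      rw [hkey]
      exact Ideal.sum_mem _ fun u hu => Ideal.mul_mem_left _ _
        (Ideal.mem_map_of_mem _ (Ideal.subset_span ⟨u, hu, rfl⟩))
    rw [← Ideal.mem_comap, Ideal.comap_map_eq_self_of_faithfullyFlat] at h1
    exact h1
  obtain ⟨c, hc⟩ := (Submodule.mem_span_image_finset_iff_exists_fun' R).1 hmem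
  have hvint : ∀ u ∈ v, u ∈ integralClosure R (FractionRing R) := fun u hu => by
    simpa using hv hu
  have hz' : z = ∑ u ∈ v, c u • u := by
    have hbu : IsUnit (algebraMap R (FractionRing R) b) := IsLocalization.map_units _ b
    refine hbu.mul_left_cancel ?_
    rw [← Algebra.smul_def, ← ha z (Finset.mem_insert_self _ _), ← hc, map_sum, mul_sum]
    refine sum_congr rfl fun u hu => ?_
    rw [smul_eq_mul, map_mul, ha u (Finset.mem_insert_of_mem hu), Algebra.smul_def, Algebra.smul_def]
    ring
  have h3 : (⟨z, hz⟩ : IntClosure R) = ∑ u : v, c u • ⟨u.1, hvint u u.2⟩ := by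
    refine Subtype.ext ?_
    change z = (integralClosure R (FractionRing R)).val _
    rw [map_sum, hz', ← Finset.sum_coe_sort]
    rfl
  rw [h3]
  exact Submodule.sum_mem _ fun u _ => Submodule.smul_mem _ _ (Submodule.subset_span u.2)

end

theorem finite_intClosure (R : Type) [CommRing R] [IsLocalRing R] [IsNoetherianRing R]
    (h : AnalyticallyUnramified R) : Module.Finite R (IntClosure R) := by
  have : IsReduced (AdicCompletion (maximalIdeal R) R) := h
  exact finite_intClosure_of_faithfullyFlat (T := AdicCompletion (maximalIdeal R) R)
    fun P _ => finite_integralClosure_of_complete (AdicCompletion (maximalIdeal R) R ⧸ P)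

/-! ## Cosyzygies and Čech cohomology -/

variable {R : Type} [CommRing R]

lemma Module.Injective.exists_comp_eq {E V W : Type} [AddCommGroup E] [Module R E] [Module.Injective R E]
    [AddCommGroup V] [Module R V] [AddCommGroup W] [Module R W] (u : V →ₗ[R] W) (g : V →ₗ[R] E)
    (h : ∀ v, u v = 0 → g v = 0) : ∃ f : W →ₗ[R] E, f ∘ₗ u = g := by
  obtain ⟨f, hf⟩ := Module.Injective.out (u.ker.liftQ u le_rfl)
    (LinearMap.ker_eq_bot.1 (Submodule.ker_liftQ_eq_bot _ _ _ le_rfl)) (u.ker.liftQ g h)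
  exact ⟨f, LinearMap.ext fun v => hf (Submodule.Quotient.mk v)⟩

/-- The elements annihilated by powers of the first `j` entries of `x`. -/
def tors (x : ℕ → R) (j : ℕ) (V : Type) [AddCommGroup V] [Module R V] : Submodule R V where
  carrier := {v | ∀ i < j, ∃ n, x i ^ n • v = 0}
  add_mem' := by
    intro v w hv hw i hi
    obtain ⟨n, hn⟩ := hv i hi
    obtain ⟨m, hm⟩ := hw i hi
    refine ⟨n + m, ?_⟩
    rw [smul_add, pow_add, mul_comm, mul_smul, hn, mul_comm, mul_smul, hm, smul_zero, smul_zero, add_zero]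
  zero_mem' := fun i _ => ⟨0, smul_zero _⟩
  smul_mem' := by
    intro r v hv i hi
    obtain ⟨n, hn⟩ := hv i hi
    exact ⟨n, by rw [smul_comm, hn, smul_zero]⟩

section

variable {x : ℕ → R} {j : ℕ} {V W : Type} [AddCommGroup V] [Module R V] [AddCommGroup W] [Module R W]

lemma map_mem_tors (f : V →ₗ[R] W) {v : V} (hv : v ∈ tors x j V) : f v ∈ tors x j W := by
  intro i hi
  obtain ⟨n, hn⟩ := hv i hi
  exact ⟨n, by rw [← map_smul, hn, map_zero]⟩

lemma mem_tors_of_map_mem {f : V →ₗ[R] W} (hf : Function.Injective f) {v : V} (hv : f v ∈ tors x j W) :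
    v ∈ tors x j V := by
  intro i hi
  obtain ⟨n, hn⟩ := hv i hi
  exact ⟨n, hf (by rw [map_smul, hn, map_zero])⟩

lemma mem_tors_succ {v : V} {n : ℕ} (hv : v ∈ tors x j V) (h : x j ^ n • v = 0) : v ∈ tors x (j + 1) V := by
  intro i hi
  rcases Nat.lt_succ_iff_lt_or_eq.1 hi with h' | rfl
  exacts [hv i h', ⟨n, h⟩]

lemma tors_succ_le : tors x (j + 1) V ≤ tors x j V := fun _ hv i hi => hv i (by omega)

/-- The torsion submodules of injective modules are divisible up to torsion. -/
lemma exists_pow_smul_eq_of_injective [IsNoetherianRing R] [Module.Injective R V] {v : V} (hv : v ∈ tors x j V)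
    (y : R) (n : ℕ) : ∃ v' ∈ tors x j V, ∃ k, y ^ (n + k) • v' = y ^ k • v := by
  choose! m hm using hv
  let J : Ideal R := Ideal.span ((fun i => x i ^ m i) '' (range j : Set ℕ))
  have hJ : ∀ r ∈ J, r • v = 0 := by
    intro r hr
    have hle : J ≤ (LinearMap.toSpanSingleton R V v).ker := by
      rw [Ideal.span_le]
      rintro _ ⟨i, hi, rfl⟩
      exact hm i (by simpa using hi)
    exact hle hr
  obtain ⟨k, hk⟩ := monotone_stabilizes_iff_noetherian.2 (inferInstance : IsNoetherian R R)
    ⟨fun k => (LinearMap.toSpanSingleton R R (y ^ k)).ker, fun a b hab r hr => by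
      obtain ⟨l, rfl⟩ := Nat.exists_eq_add_of_le hab
      rw [LinearMap.mem_ker, LinearMap.toSpanSingleton_apply, smul_eq_mul] at hr ⊢
      rw [pow_add, ← mul_assoc, hr, zero_mul]⟩
  have hk' : ∀ r, r * y ^ (n + k) = 0 → r * y ^ k = 0 := fun r hr => by
    have : r ∈ (LinearMap.toSpanSingleton R R (y ^ k)).ker := by
      have h1 : (LinearMap.toSpanSingleton R R (y ^ k)).ker = (LinearMap.toSpanSingleton R R (y ^ (n + k))).ker :=
        hk (n + k) (by omega)
      rw [h1]
      exact hr
    exact this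
  obtain ⟨c, hc⟩ := J.exists_pow_inf_eq_pow_smul (Submodule.span R {y ^ (n + k)})
  obtain ⟨f, hf⟩ := Module.Injective.exists_comp_eq
    ((Submodule.mkQ (J ^ (c + 1))).comp (LinearMap.toSpanSingleton R R (y ^ (n + k))))
    (LinearMap.toSpanSingleton R V (y ^ k • v)) (fun r hr => by
      have h1 : r * y ^ (n + k) ∈ J ^ (c + 1) := (Submodule.Quotient.mk_eq_zero _).1 hr
      have h2 : r * y ^ (n + k) ∈ J • Submodule.span R {y ^ (n + k)} := by
        have h3 := hc (c + 1) (by omega)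
        rw [Nat.add_sub_cancel_left, pow_one] at h3
        have h4 : r * y ^ (n + k) ∈ J ^ (c + 1) • (⊤ : Submodule R R) ⊓ Submodule.span R {y ^ (n + k)} :=
          ⟨by simpa using h1, Submodule.smul_mem _ _ (Submodule.mem_span_singleton_self _)⟩
        rw [h3] at h4
        exact Submodule.smul_mono le_rfl inf_le_right h4
      obtain ⟨s, hs, h5⟩ := Submodule.mem_smul_span_singleton.1 h2
      have h6 := hk' (r - s) (by rw [sub_mul, ← h5, smul_eq_mul, sub_self])
      rw [sub_mul, sub_eq_zero] at h6
      rw [LinearMap.toSpanSingleton_apply, smul_smul, h6, mul_comm, mul_smul, hJ s hs, smul_zero])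
  refine ⟨f (Submodule.Quotient.mk 1), fun i hi => ⟨m i * (c + 1), ?_⟩, k, ?_⟩
  · rw [← map_smul, ← Submodule.Quotient.mk_smul, smul_eq_mul, mul_one, pow_mul,
      (Submodule.Quotient.mk_eq_zero _).2, map_zero]
    exact Ideal.pow_mem_pow (show x i ^ m i ∈ J from Ideal.subset_span ⟨i, by simpa using hi, rfl⟩) _
  · have := LinearMap.congr_fun hf 1
    rw [LinearMap.toSpanSingleton_apply, one_smul] at this
    rw [← map_smul, ← this, ← Submodule.Quotient.mk_smul]
    simp

end

variable (R) in
/-- The cosyzygies in an injective resolution of the ring. -/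
structure InjRes where
  M : ℕ → ModuleCat.{0} R
  I : ℕ → ModuleCat.{0} R
  e : R ≃ₗ[R] M 0
  ι : ∀ j, M j →ₗ[R] I j
  π : ∀ j, I j →ₗ[R] M (j + 1)
  ι_inj : ∀ j, Function.Injective (ι j)
  π_surj : ∀ j, Function.Surjective (π j)
  π_ι : ∀ j t, π j (ι j t) = 0
  exact : ∀ j w, π j w = 0 → ∃ t, ι j t = w
  inj : ∀ j, Module.Injective R (I j)

namespace InjRes

variable [IsNoetherianRing R] (S : InjRes R) (x : ℕ → R)

attribute [instance] InjRes.inj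

lemma exists_mem_tors_ι_eq {i j : ℕ} {w : S.I i} (hw : w ∈ tors x j (S.I i)) (h : S.π i w = 0) :
    ∃ t ∈ tors x j (S.M i), S.ι i t = w := by
  obtain ⟨t, rfl⟩ := S.exact i w h
  exact ⟨t, mem_tors_of_map_mem (S.ι_inj i) hw, rfl⟩

lemma exists_mem_tors_π_eq (j : ℕ) : ∀ i, j ≤ i → ∀ z ∈ tors x j (S.M (i + 1)), ∃ w ∈ tors x j (S.I i), S.π i w = z := by
  induction j with
  | zero =>
    intro i _ z _
    obtain ⟨w, hw⟩ := S.π_surj i z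
    exact ⟨w, fun i hi => absurd hi (Nat.not_lt_zero i), hw⟩
  | succ j ih =>
    intro i hi z hz
    obtain ⟨i, rfl⟩ := Nat.exists_eq_add_of_le' (Nat.one_le_of_lt hi)
    obtain ⟨w, hw, rfl⟩ := ih (i + 1) (by omega) z (tors_succ_le hz)
    obtain ⟨k, hk⟩ := hz j (Nat.lt_succ_self j)
    obtain ⟨t, ht, htw⟩ := S.exists_mem_tors_ι_eq x (Submodule.smul_mem _ (x j ^ k) hw) (by rw [map_smul, hk])
    obtain ⟨v, hv, rfl⟩ := ih i (by omega) t ht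
    obtain ⟨v', hv', l, hl⟩ := exists_pow_smul_eq_of_injective hv (x j) k
    refine ⟨w - S.ι _ (S.π i v'), mem_tors_succ (n := l + k)
      (sub_mem hw (map_mem_tors _ (map_mem_tors _ hv'))) ?_, by rw [map_sub, S.π_ι, sub_zero]⟩
    rw [smul_sub, ← map_smul, ← map_smul, pow_add, mul_smul, ← htw, ← pow_add, add_comm l k, hl, map_smul, map_smul,
      sub_self]

/-- `z` corresponds to the Čech cohomology class of `a / (x 0 * ⋯ * x (j - 1)) ^ n`. -/
def Rep (n : ℕ) : ∀ j, R → S.M j → Prop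
  | 0, a, z => z = S.e a
  | j + 1, a, z => ∃ w ∈ tors x j (S.I j), ∃ t ∈ tors x j (S.M j),
      S.π j w = z ∧ x j ^ n • w = S.ι j t ∧ Rep n j a t

/-- The elements whose class vanishes. -/
def Bd : ∀ j, S.M j → Prop
  | 0, z => z = 0
  | j + 1, z => ∃ u ∈ tors x (j + 1) (S.I j), S.π j u = z

variable {S x} {n j : ℕ} {a b : R} {z z' : S.M j}

lemma Rep.mem_tors (h : S.Rep x n j a z) : z ∈ tors x j (S.M j) := by
  cases j with
  | zero => exact fun i hi => absurd hi (Nat.not_lt_zero i)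
  | succ j =>
    obtain ⟨w, hw, t, -, rfl, h1, -⟩ := h
    exact mem_tors_succ (n := n) (map_mem_tors _ hw) (by rw [← map_smul, h1, S.π_ι])

lemma Rep.smul (h : S.Rep x n j a z) (r : R) : S.Rep x n j (r * a) (r • z) := by
  induction j generalizing a with
  | zero => rw [show z = S.e a from h]; exact (map_smul S.e r a).symm
  | succ j ih =>
    obtain ⟨w, hw, t, ht, rfl, h1, h2⟩ := h
    exact ⟨r • w, Submodule.smul_mem _ r hw, r • t, Submodule.smul_mem _ r ht, map_smul _ _ _,
      by rw [smul_comm, h1, map_smul], ih h2⟩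

lemma Rep.sub (h : S.Rep x n j a z) (h' : S.Rep x n j b z') : S.Rep x n j (a - b) (z - z') := by
  induction j generalizing a b with
  | zero => rw [show z = S.e a from h, show z' = S.e b from h']; exact (map_sub S.e a b).symm
  | succ j ih =>
    obtain ⟨w, hw, t, ht, rfl, h1, h2⟩ := h
    obtain ⟨w', hw', t', ht', rfl, h1', h2'⟩ := h'
    exact ⟨w - w', sub_mem hw hw', t - t', sub_mem ht ht', map_sub _ _ _, by rw [smul_sub, h1, h1', map_sub],
      ih h2 h2'⟩

lemma Rep.level (h : S.Rep x n j a z) (k : ℕ) : S.Rep x (n + k) j (a * ∏ i ∈ range j, x i ^ k) z := by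
  induction j generalizing a with
  | zero => rw [show z = S.e a from h]; simp [Rep]
  | succ j ih =>
    obtain ⟨w, hw, t, ht, rfl, h1, h2⟩ := h
    refine ⟨w, hw, x j ^ k • t, Submodule.smul_mem _ _ ht, rfl, ?_, ?_⟩
    · rw [add_comm, pow_add, mul_smul, h1, map_smul]
    · have := (ih h2).smul (x j ^ k)
      rwa [mul_comm, mul_assoc, ← Finset.prod_range_succ] at this

lemma exists_rep (hz : z ∈ tors x j (S.M j)) : ∃ n a, S.Rep x n j a z := by
  induction j with
  | zero => exact ⟨0, S.e.symm z, by simp [Rep]⟩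
  | succ j ih =>
    obtain ⟨w, hw, rfl⟩ := S.exists_mem_tors_π_eq x j j le_rfl z (tors_succ_le hz)
    obtain ⟨k, hk⟩ := hz j (Nat.lt_succ_self j)
    obtain ⟨t, ht, htw⟩ := S.exists_mem_tors_ι_eq x (Submodule.smul_mem _ (x j ^ k) hw) (by rw [map_smul, hk])
    obtain ⟨n, a, h⟩ := ih ht
    exact ⟨n + k, _, w, hw, x j ^ n • t, Submodule.smul_mem _ _ ht, rfl,
      by rw [pow_add, mul_smul, ← htw, map_smul], (h.level k).smul (x j ^ n)⟩

variable (S x n j a) in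
lemma exists_rep_of_ring : ∃ k z, S.Rep x (n + k) j (a * ∏ i ∈ range j, x i ^ k) z := by
  induction j with
  | zero => exact ⟨0, S.e a, by simp [Rep]⟩
  | succ j ih =>
    obtain ⟨k, z, h⟩ := ih
    obtain ⟨v, hv, l, hl⟩ := exists_pow_smul_eq_of_injective (map_mem_tors (S.ι j) h.mem_tors) (x j) n
    refine ⟨k + l, S.π j v, v, hv, x j ^ (k + l) • z, Submodule.smul_mem _ _ h.mem_tors, rfl, ?_, ?_⟩
    · rw [show n + (k + l) = k + (n + l) by omega, pow_add, mul_smul, hl, ← mul_smul, ← pow_add, map_smul]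
    · have := (h.level l).smul (x j ^ (k + l))
      rwa [mul_comm, mul_assoc a, ← Finset.prod_mul_distrib, mul_assoc a, add_assoc,
        prod_congr rfl (fun i _ => (pow_add (x i) k l).symm), ← Finset.prod_range_succ] at this

lemma mul_prod_mem_spanPow {m j l : ℕ} {g : R} (h : g ∈ spanPow x m (range j)) :
    g * ∏ i ∈ range j, x i ^ l ∈ spanPow x (m + l) (range j) := by
  obtain ⟨c, rfl⟩ := mem_spanPow.1 h
  rw [Finset.sum_mul]
  refine Ideal.sum_mem _ fun i hi => ?_
  rw [mul_assoc]
  refine Ideal.mul_mem_left _ _ (Ideal.mem_of_dvd _ ?_ (Ideal.subset_span ⟨i, hi, rfl⟩))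
  change x i ^ (m + l) ∣ _
  rw [pow_add]
  exact mul_dvd_mul_left _ (Finset.dvd_prod_of_mem _ hi)

lemma spanPow_range_succ (m j : ℕ) :
    spanPow x m (range (j + 1)) = Ideal.span {x j ^ m} ⊔ spanPow x m (range j) := by
  rw [spanPow, spanPow, ← Ideal.span_union, Finset.range_add_one, Finset.coe_insert, Set.image_insert_eq,
    Set.insert_eq]

lemma Rep.mem_spanPow_of_bd (h : S.Rep x n j a z) (hz : S.Bd x j z) :
    ∃ k, a * ∏ i ∈ range j, x i ^ k ∈ spanPow x (n + k) (range j) := by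
  induction j generalizing n a with
  | zero =>
    have h1 : S.e a = 0 := by rw [← (show z = S.e a from h)]; exact hz
    exact ⟨0, by rw [S.e.map_eq_zero_iff.1 h1, zero_mul]; exact zero_mem _⟩
  | succ j ih =>
    obtain ⟨w, hw, t, ht, rfl, h1, h2⟩ := h
    obtain ⟨u, hu, huw⟩ := hz
    obtain ⟨s, hs, hsw⟩ := S.exists_mem_tors_ι_eq x (sub_mem hw (tors_succ_le hu)) (by rw [map_sub, huw, sub_self])
    obtain ⟨l, hl⟩ := hu j (Nat.lt_succ_self j)
    obtain ⟨m, b, hb⟩ := exists_rep hs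
    have h3 : x j ^ l • t - x j ^ (n + l) • s = 0 := by
      refine S.ι_inj j ?_
      rw [map_zero, map_sub, map_smul, map_smul, ← h1, hsw, smul_sub, pow_add, mul_smul, mul_smul, hl, smul_zero,
        sub_zero, smul_comm, sub_self]
    have h4 := ((h2.level m).smul (x j ^ l)).sub (((add_comm m n) ▸ hb.level n).smul (x j ^ (n + l)))
    obtain ⟨k, hk⟩ := ih h4 (by
      rw [h3]
      cases j with
      | zero => rfl
      | succ j => exact ⟨0, zero_mem _, map_zero _⟩)
    refine ⟨m + k + l, ?_⟩
    rw [spanPow_range_succ]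
    have h5 := mul_prod_mem_spanPow (l := l) (Ideal.mul_mem_left _ (x j ^ (m + k)) hk)
    rw [show n + m + k + l = n + (m + k + l) by omega] at h5
    have h6 : a * ∏ i ∈ range (j + 1), x i ^ (m + k + l) =
        x j ^ (m + k) * ((x j ^ l * (a * ∏ i ∈ range j, x i ^ m) -
          x j ^ (n + l) * (b * ∏ i ∈ range j, x i ^ n)) * ∏ i ∈ range j, x i ^ k) *
          (∏ i ∈ range j, x i ^ l) + x j ^ (n + (m + k + l)) * (b * (∏ i ∈ range j, x i ^ n) *
          (∏ i ∈ range j, x i ^ k) * (∏ i ∈ range j, x i ^ l)) := by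
      rw [Finset.prod_range_succ]
      simp only [pow_add, Finset.prod_mul_distrib]
      ring
    rw [h6]
    exact add_mem (Ideal.mem_sup_right h5)
      (Ideal.mem_sup_left (Ideal.mul_mem_right _ _ (Ideal.mem_span_singleton_self _)))

lemma Bd.exists_pow_smul_eq (h : S.Bd x j z) (y : R) (n : ℕ) :
    ∃ s ∈ tors x j (S.M j), ∃ k, y ^ (n + k) • s = y ^ k • z := by
  cases j with
  | zero => exact ⟨0, zero_mem _, 0, by rw [show z = 0 from h, smul_zero, smul_zero]⟩
  | succ j =>
    obtain ⟨u, hu, rfl⟩ := h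
    obtain ⟨v, hv, k, hk⟩ := exists_pow_smul_eq_of_injective hu y n
    exact ⟨S.π j v, map_mem_tors _ hv, k, by rw [← map_smul, hk, map_smul]⟩

lemma Rep.bd_of_mem_spanPow (h : S.Rep x n j a z) (ha : a ∈ spanPow x n (range j)) : S.Bd x j z := by
  induction j generalizing n a with
  | zero =>
    have h0 : a = 0 := by simpa [spanPow] using ha
    rw [show z = S.e a from h, h0]
    exact map_zero S.e
  | succ j ih =>
    obtain ⟨w, hw, t, ht, rfl, h1, h2⟩ := h
    rw [spanPow_range_succ] at ha
    obtain ⟨c, hc, a', ha', rfl⟩ := Submodule.mem_sup.1 ha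
    obtain ⟨b, rfl⟩ := Ideal.mem_span_singleton'.1 hc
    obtain ⟨k, t', h3⟩ := exists_rep_of_ring S x n j b
    have h4 := (h2.level k).sub (h3.smul (x j ^ n))
    obtain ⟨s, hs, l, hl⟩ := (ih h4 (by
      have : (b * x j ^ n + a') * ∏ i ∈ range j, x i ^ k - x j ^ n * (b * ∏ i ∈ range j, x i ^ k) =
        a' * ∏ i ∈ range j, x i ^ k := by ring
      rw [this]
      exact mul_prod_mem_spanPow ha')).exists_pow_smul_eq (x j) n
    refine ⟨w - S.ι j (t' + s), mem_tors_succ (n := n + l)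
      (sub_mem hw (map_mem_tors _ (add_mem h3.mem_tors hs))) ?_, by rw [map_sub, S.π_ι, sub_zero]⟩
    rw [smul_sub, ← map_smul, smul_add, hl, add_comm n l, pow_add, mul_smul, h1, mul_smul, ← smul_add,
      add_sub_cancel, map_smul, sub_self]

end InjRes

/-! ## Dimension shifting -/

variable {R : Type} [CommRing R]

variable (R) in
/-- An augmented projective resolution of `Q 0`. -/
structure AugRes where
  Q : ℕ → ModuleCat.{0} R
  d : ∀ i, Q (i + 1) →ₗ[R] Q i
  surj : Function.Surjective (d 0)
  d_d : ∀ i, d i ∘ₗ d (i + 1) = 0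
  exact : ∀ i v, d i v = 0 → ∃ w, d (i + 1) w = v
  proj : ∀ i, Module.Projective R (Q (i + 1))

attribute [instance] AugRes.proj

/-- A morphism of augmented resolutions. -/
structure AugRes.Hom (A B : AugRes R) where
  f : ∀ i, A.Q i →ₗ[R] B.Q i
  comm : ∀ i, f i ∘ₗ A.d i = B.d i ∘ₗ f (i + 1)

/-- The cocycle `f` corresponds to the homomorphism `g` under dimension shifting. -/
inductive Shift (A : AugRes R) (S : InjRes R) {k : ℕ} (g : A.Q 0 →ₗ[R] S.M k) :
    ∀ i j, (A.Q (i + 1) →ₗ[R] S.M j) → Prop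
  | base : Shift A S g 0 k (g ∘ₗ A.d 0)
  | step (i j : ℕ) (h : A.Q (i + 1) →ₗ[R] S.I j) (f : A.Q (i + 2) →ₗ[R] S.M j)
      (hf : S.ι j ∘ₗ f = h ∘ₗ A.d (i + 1)) (h' : Shift A S g i (j + 1) (S.π j ∘ₗ h)) : Shift A S g (i + 1) j f

section

variable {A B : AugRes R} {S : InjRes R} {k i j : ℕ} {g g' : A.Q 0 →ₗ[R] S.M k}

lemma AugRes.exists_eq_comp {V : Type} [AddCommGroup V] [Module R V] [Module.Injective R V]
    (h : A.Q (i + 1) →ₗ[R] V) (hh : h ∘ₗ A.d (i + 1) = 0) : ∃ v : A.Q i →ₗ[R] V, v ∘ₗ A.d i = h :=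
  Module.Injective.exists_comp_eq _ _ fun v hv => by
    obtain ⟨w, rfl⟩ := A.exact i v hv
    exact LinearMap.congr_fun hh w

lemma InjRes.exists_ι_comp_eq {V : Type} [AddCommGroup V] [Module R V] (h : V →ₗ[R] S.I j)
    (hh : S.π j ∘ₗ h = 0) : ∃ f : V →ₗ[R] S.M j, S.ι j ∘ₗ f = h := by
  choose f hf using fun v => S.exact j (h v) (LinearMap.congr_fun hh v)
  exact ⟨{ toFun := f
           map_add' := fun a b => S.ι_inj j (by rw [map_add, hf, hf, hf, map_add])
           map_smul' := fun r a => S.ι_inj j (by rw [RingHom.id_apply, map_smul, hf, hf, map_smul]) },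
    LinearMap.ext hf⟩

lemma InjRes.π_comp_ι : S.π j ∘ₗ S.ι j = 0 := LinearMap.ext (S.π_ι j)

lemma InjRes.ι_cancel {V : Type} [AddCommGroup V] [Module R V] {f f' : V →ₗ[R] S.M j}
    (h : S.ι j ∘ₗ f = S.ι j ∘ₗ f') : f = f' :=
  LinearMap.ext fun v => S.ι_inj j (LinearMap.congr_fun h v)

lemma Shift.comp_d {f : A.Q (i + 1) →ₗ[R] S.M j} (h : Shift A S g i j f) : f ∘ₗ A.d (i + 1) = 0 := by
  cases h with
  | base => rw [LinearMap.comp_assoc, A.d_d, LinearMap.comp_zero]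
  | step i j h f hf h' =>
    exact InjRes.ι_cancel (by rw [← LinearMap.comp_assoc, hf, LinearMap.comp_assoc, A.d_d]; simp)

lemma Shift.smul_add {f f' : A.Q (i + 1) →ₗ[R] S.M j} (h : Shift A S g i j f) (h' : Shift A S g' i j f') (r : R) :
    Shift A S (r • g + g') i j (r • f + f') := by
  induction h with
  | base =>
    cases h'
    rw [← LinearMap.smul_comp, ← LinearMap.add_comp]
    exact .base
  | step i j h f hf _ ih =>
    cases h' with
    | step _ _ h' _ hf' h1' =>
      refine .step i j (r • h + h') _ ?_ ?_
      · rw [LinearMap.comp_add, LinearMap.comp_smul, hf, hf', LinearMap.add_comp, LinearMap.smul_comp]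
      · rw [LinearMap.comp_add, LinearMap.comp_smul]
        exact ih h1'

lemma Shift.add {f f' : A.Q (i + 1) →ₗ[R] S.M j} (h : Shift A S g i j f) (h' : Shift A S g' i j f') :
    Shift A S (g + g') i j (f + f') := by
  simpa only [one_smul] using h.smul_add h' 1

lemma Shift.zero {f : A.Q (i + 1) →ₗ[R] S.M j} (h : Shift A S g i j f) :
    Shift A S (0 : A.Q 0 →ₗ[R] S.M k) i j 0 := by
  simpa only [neg_one_smul, neg_add_cancel] using h.smul_add h (-1)

lemma Shift.smul {f : A.Q (i + 1) →ₗ[R] S.M j} (h : Shift A S g i j f) (r : R) : Shift A S (r • g) i j (r • f) := by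
  simpa only [add_zero] using h.smul_add h.zero r

lemma Shift.exists_of_hom (g : A.Q 0 →ₗ[R] S.M k) : ∀ i j, j + i = k → ∃ f, Shift A S g i j f := by
  intro i
  induction i with
  | zero => rintro j rfl; exact ⟨_, .base⟩
  | succ i ih =>
    intro j hj
    obtain ⟨f, hf⟩ := ih (j + 1) (by omega)
    obtain ⟨h, rfl⟩ := Module.projective_lifting_property (S.π j) f (S.π_surj j)
    obtain ⟨f', hf'⟩ := S.exists_ι_comp_eq (h ∘ₗ A.d (i + 1)) (by rw [← LinearMap.comp_assoc, hf.comp_d])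
    exact ⟨f', .step i j h f' hf' hf⟩

lemma Shift.exists_of_cocycle (A : AugRes R) (S : InjRes R) (k : ℕ) : ∀ i j, j + i = k → ∀ f : A.Q (i + 1) →ₗ[R] S.M j,
    f ∘ₗ A.d (i + 1) = 0 → ∃ g : A.Q 0 →ₗ[R] S.M k, Shift A S g i j f := by
  intro i
  induction i with
  | zero =>
    rintro j rfl f hf
    have h0 : ∀ v, A.d 0 v = 0 → f v = 0 := fun v hv => by
      obtain ⟨w, rfl⟩ := A.exact 0 v hv
      exact LinearMap.congr_fun hf w
    obtain ⟨v, hv⟩ := Module.Injective.exists_comp_eq (A.d 0) (S.ι j ∘ₗ f) (fun v hv => by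
      rw [LinearMap.comp_apply, h0 v hv, map_zero])
    obtain ⟨g, hg⟩ := S.exists_ι_comp_eq v (LinearMap.ext fun a => by
      obtain ⟨b, rfl⟩ := A.surj a
      have := LinearMap.congr_fun hv b
      rw [LinearMap.comp_apply] at this
      rw [LinearMap.comp_apply, this]
      exact S.π_ι j _)
    have : f = g ∘ₗ A.d 0 := InjRes.ι_cancel (by rw [← LinearMap.comp_assoc, hg, hv])
    rw [this]
    exact ⟨g, .base⟩
  | succ i ih =>
    intro j hj f hf
    obtain ⟨h, hh⟩ := A.exists_eq_comp (S.ι j ∘ₗ f) (by rw [LinearMap.comp_assoc, hf, LinearMap.comp_zero])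
    obtain ⟨g, hg⟩ := ih (j + 1) (by omega) (S.π j ∘ₗ h) (by
      rw [LinearMap.comp_assoc, hh, ← LinearMap.comp_assoc, S.π_comp_ι, LinearMap.zero_comp])
    exact ⟨g, .step i j h f hh.symm hg⟩

lemma Shift.eq_comp_of_eq {g : A.Q 0 →ₗ[R] S.M (k + 1)} {f : A.Q (i + 2) →ₗ[R] S.M j} (h : Shift A S g (i + 1) j f)
    {u : A.Q (i + 1) →ₗ[R] S.M j} (hu : f = u ∘ₗ A.d (i + 1)) : ∃ q : A.Q 0 →ₗ[R] S.I k, g = S.π k ∘ₗ q := by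
  induction i generalizing j with
  | zero =>
    cases h with
    | step _ _ h _ hf h' =>
      obtain ⟨v, hv⟩ := A.exists_eq_comp (h - S.ι j ∘ₗ u) (by
        rw [LinearMap.sub_comp, ← hf, hu, LinearMap.comp_assoc, sub_self])
      have h1 : S.π j ∘ₗ h = (S.π j ∘ₗ v) ∘ₗ A.d 0 := by
        rw [LinearMap.comp_assoc, hv, LinearMap.comp_sub, ← LinearMap.comp_assoc, S.π_comp_ι, LinearMap.zero_comp,
          sub_zero]
      rw [h1] at h'
      generalize hy : (S.π j ∘ₗ v) ∘ₗ A.d 0 = y at h'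
      cases h' with
      | base =>
        refine ⟨v, LinearMap.ext fun a => ?_⟩
        obtain ⟨b, rfl⟩ := A.surj a
        exact (LinearMap.congr_fun hy b).symm
  | succ i ih =>
    cases h with
    | step _ _ h _ hf h' =>
      obtain ⟨v, hv⟩ := A.exists_eq_comp (h - S.ι j ∘ₗ u) (by
        rw [LinearMap.sub_comp, ← hf, hu, LinearMap.comp_assoc, sub_self])
      refine ih h' (u := S.π j ∘ₗ v) ?_
      rw [LinearMap.comp_assoc, hv, LinearMap.comp_sub, ← LinearMap.comp_assoc, S.π_comp_ι, LinearMap.zero_comp,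
        sub_zero]

lemma Shift.exists_eq_of_eq_comp {q : A.Q 0 →ₗ[R] S.I k} {f : A.Q (i + 2) →ₗ[R] S.M j}
    (h : Shift A S (S.π k ∘ₗ q) (i + 1) j f) : ∃ u : A.Q (i + 1) →ₗ[R] S.M j, f = u ∘ₗ A.d (i + 1) := by
  have key : ∀ {i j} (h : A.Q (i + 1) →ₗ[R] S.I j) (f : A.Q (i + 2) →ₗ[R] S.M j) (v : A.Q i →ₗ[R] S.I j),
      S.ι j ∘ₗ f = h ∘ₗ A.d (i + 1) → S.π j ∘ₗ h = S.π j ∘ₗ v ∘ₗ A.d i →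
      ∃ u : A.Q (i + 1) →ₗ[R] S.M j, f = u ∘ₗ A.d (i + 1) := by
    intro i j h f v hf hv
    obtain ⟨u, hu⟩ := S.exists_ι_comp_eq (h - v ∘ₗ A.d i) (by rw [LinearMap.comp_sub, hv, sub_self])
    exact ⟨u, InjRes.ι_cancel (by
      rw [← LinearMap.comp_assoc, hu, LinearMap.sub_comp, hf, LinearMap.comp_assoc, A.d_d, LinearMap.comp_zero,
        sub_zero])⟩
  induction i generalizing j with
  | zero =>
    cases h with
    | step _ _ h _ hf h' =>
      generalize hy : S.π j ∘ₗ h = y at h'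
      cases h' with
      | base => exact key h f q hf hy
  | succ i ih =>
    cases h with
    | step _ _ h _ hf h' =>
      obtain ⟨u, hu⟩ := ih h'
      obtain ⟨v, rfl⟩ := Module.projective_lifting_property (S.π j) u (S.π_surj j)
      exact key h f v hf hu

lemma Shift.comp {g : B.Q 0 →ₗ[R] S.M k} {f : B.Q (i + 1) →ₗ[R] S.M j} (h : Shift B S g i j f) (φ : AugRes.Hom A B) :
    Shift A S (g ∘ₗ φ.f 0) i j (f ∘ₗ φ.f (i + 1)) := by
  induction h with
  | base => rw [LinearMap.comp_assoc, ← φ.comm, ← LinearMap.comp_assoc]; exact .base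
  | step i j h f hf _ ih =>
    exact .step i j (h ∘ₗ φ.f (i + 1)) _
      (by rw [← LinearMap.comp_assoc, hf, LinearMap.comp_assoc, ← φ.comm, LinearMap.comp_assoc]) ih

end

variable (R) in
/-- Every ring has an injective resolution. -/
lemma InjRes.nonempty : Nonempty (InjRes R) := by
  have key : ∀ X : ModuleCat.{0} R, ∃ (I Y : ModuleCat.{0} R) (ι : X →ₗ[R] I) (π : I →ₗ[R] Y),
      Function.Injective ι ∧ Function.Surjective π ∧ (∀ t, π (ι t) = 0) ∧ (∀ w, π w = 0 → ∃ t, ι t = w) ∧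
      Module.Injective R I := by
    intro X
    obtain ⟨J, hJ, f, hf⟩ := EnoughInjectives.presentation X
    have h : Injective (ModuleCat.of R J) := hJ
    exact ⟨J, ModuleCat.of R (J ⧸ f.hom.range), f.hom, f.hom.range.mkQ, (ModuleCat.mono_iff_injective f).1 hf,
      Submodule.mkQ_surjective _, fun t => (Submodule.Quotient.mk_eq_zero _).2 ⟨t, rfl⟩,
      fun w hw => (Submodule.Quotient.mk_eq_zero _).1 hw, Module.injective_module_of_injective_object R J⟩
  choose I Y ι π h1 h2 h3 h4 h5 using key
  let M : ℕ → ModuleCat.{0} R := fun n => Nat.rec (ModuleCat.of R R) (fun _ => Y) n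
  exact ⟨{
    M := M
    I := fun j => I (M j)
    e := LinearEquiv.refl R R
    ι := fun j => ι (M j)
    π := fun j => π (M j)
    ι_inj := fun j => h1 (M j)
    π_surj := fun j => h2 (M j)
    π_ι := fun j => h3 (M j)
    exact := fun j => h4 (M j)
    inj := fun j => h5 (M j) }⟩

/-! ## Cocycles and `Ext` -/

variable {R : Type} [CommRing R]

/-- The augmented resolution underlying a projective resolution. -/
def augRes {N : ModuleCat.{0} R} (P : ProjectiveResolution N) : AugRes R where
  Q := fun | 0 => N | i + 1 => P.complex.X i
  d := fun | 0 => (P.π.f 0).hom | i + 1 => (P.complex.d (i + 1) i).hom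
  surj := (ModuleCat.epi_iff_surjective (P.π.f 0)).1 inferInstance
  d_d := by
    rintro (_ | i)
    · exact congrArg ModuleCat.Hom.hom P.complex_d_comp_π_f_zero
    · exact congrArg ModuleCat.Hom.hom (P.complex.d_comp_d (i + 2) (i + 1) i)
  exact := by
    rintro (_ | i) v hv
    · exact (ShortComplex.moduleCat_exact_iff _).1
        (ShortComplex.exact_of_g_is_cokernel (.mk _ _ P.complex_d_comp_π_f_zero) P.isColimitCokernelCofork) v hv
    · exact (ShortComplex.moduleCat_exact_iff _).1 (P.exact_succ i) v hv
  proj := fun i => (IsProjective.iff_projective (P.complex.X i)).2 (P.projective i)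

/-- The morphism of augmented resolutions lifting a homomorphism. -/
def augResHom {N N' : ModuleCat.{0} R} (ν : N ⟶ N') (P : ProjectiveResolution N) (P' : ProjectiveResolution N') :
    AugRes.Hom (augRes P) (augRes P') where
  f := fun | 0 => ν.hom | i + 1 => ((ProjectiveResolution.lift ν P P').f i).hom
  comm := by
    rintro (_ | i)
    · exact (congrArg ModuleCat.Hom.hom (ProjectiveResolution.lift_commutes_zero ν P P')).symm
    · exact (congrArg ModuleCat.Hom.hom ((ProjectiveResolution.lift ν P P').comm (i + 1) i)).symm

section

variable {N : ModuleCat.{0} R} (P : ProjectiveResolution N) (M : ModuleCat.{0} R) (i : ℕ)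

/-- The functor whose derived functors are `Ext`. -/
abbrev yonedaOp : ModuleCat.{0} R ⥤ (ModuleCat.{0} R)ᵒᵖ := ((linearYoneda R (ModuleCat.{0} R)).obj M).rightOp

/-- The complex computing `Ext`, in the opposite category. -/
abbrev homComplex : ChainComplex (ModuleCat.{0} R)ᵒᵖ ℕ :=
  ((yonedaOp M).mapHomologicalComplex _).obj P.complex

/-- The comparison of `Ext` with the homology of the complex of homomorphisms. -/
def extIso : ((yonedaOp M).leftDerived i).obj N ≅ (homComplex P M).homology i :=
  P.isoLeftDerivedObj _ i

/-- The map from cocycles to `Ext`. -/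
def cocyclesToExt : ((homComplex P M).opcycles i).unop ⟶
    ((Ext R (ModuleCat.{0} R) i).obj (Opposite.op N)).obj M :=
  ((extIso P M i).hom ≫ (homComplex P M).homologyι i).unop

/-- The inclusion of cocycles. -/
def cocyclesIncl : ((homComplex P M).opcycles i).unop ⟶ ModuleCat.of R (P.complex.X i ⟶ M) :=
  ((homComplex P M).pOpcycles i).unop

lemma cocyclesIncl_injective : Function.Injective (cocyclesIncl P M i) :=
  (ModuleCat.mono_iff_injective (cocyclesIncl P M i)).1 (inferInstanceAs (Mono ((homComplex P M).pOpcycles i).unop))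

lemma cocyclesToExt_surjective : Function.Surjective (cocyclesToExt P M i) :=
  (ModuleCat.epi_iff_surjective (cocyclesToExt P M i)).1 <| by
    have h1 : Mono ((homComplex P M).homologyι i) := ShortComplex.instMonoHomologyι _
    exact unop_epi_of_mono ((extIso P M i).hom ≫ (homComplex P M).homologyι i)

lemma d_cocyclesIncl (c : ((homComplex P M).opcycles i).unop) :
    P.complex.d (i + 1) i ≫ (cocyclesIncl P M i c : P.complex.X i ⟶ M) = 0 :=
  ConcreteCategory.congr_hom (congrArg Quiver.Hom.unop ((homComplex P M).d_pOpcycles (i + 1) i)) c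

lemma exists_cocyclesIncl_eq (f : P.complex.X i ⟶ M) (hf : P.complex.d (i + 1) i ≫ f = 0) :
    ∃ c, cocyclesIncl P M i c = f :=
  (ShortComplex.moduleCat_exact_iff _).1 (ShortComplex.exact_of_g_is_cokernel (.mk _ _
    ((homComplex P M).d_pOpcycles (i + 1) i)) ((homComplex P M).opcyclesIsCokernel (i + 1) i (by simp))).unop f hf

lemma cocyclesToExt_eq_zero_iff (c : ((homComplex P M).opcycles (i + 1)).unop) :
    cocyclesToExt P M (i + 1) c = 0 ↔
      ∃ u : P.complex.X i ⟶ M, cocyclesIncl P M (i + 1) c = P.complex.d (i + 1) i ≫ u := by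
  have hp : ∀ u : P.complex.X i ⟶ M, cocyclesIncl P M (i + 1) (((homComplex P M).fromOpcycles (i + 1) i).unop u) =
      P.complex.d (i + 1) i ≫ u := fun u =>
    ConcreteCategory.congr_hom (congrArg Quiver.Hom.unop ((homComplex P M).p_fromOpcycles (i + 1) i)) u
  let θ := (extIso P M (i + 1)).unop
  have hθ : Function.Injective θ.hom := (ModuleCat.mono_iff_injective θ.hom).1 inferInstance
  constructor
  · intro hc
    obtain ⟨u, hu⟩ := (ShortComplex.moduleCat_exact_iff _).1 (ShortComplex.exact_of_f_is_kernel (.mk _ _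
      ((homComplex P M).homologyι_comp_fromOpcycles (i + 1) i))
        ((homComplex P M).homologyIsKernel (i + 1) i (by simp))).unop c (hθ (hc.trans (map_zero _).symm))
    exact ⟨u, (congrArg (cocyclesIncl P M (i + 1)) hu.symm).trans (hp u)⟩
  · rintro ⟨u, hu⟩
    rw [← hp] at hu
    rw [cocyclesIncl_injective P M _ hu]
    have h1 := ConcreteCategory.congr_hom (congrArg Quiver.Hom.unop
      ((homComplex P M).homologyι_comp_fromOpcycles (i + 1) i)) u
    exact (congrArg θ.hom h1).trans (map_zero _)

lemma cocyclesToExt_naturality {N' : ModuleCat.{0} R} (ν : N ⟶ N') (P' : ProjectiveResolution N')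
    (c : ((homComplex P' M).opcycles i).unop) :
    ∃ c', (cocyclesIncl P M i c' : P.complex.X i ⟶ M) =
      (ProjectiveResolution.lift ν P P').f i ≫ (cocyclesIncl P' M i c : P'.complex.X i ⟶ M) ∧
      cocyclesToExt P M i c' = ((Ext R (ModuleCat.{0} R) i).map ν.op).app M (cocyclesToExt P' M i c) := by
  let φ := ((yonedaOp M).mapHomologicalComplex _).map
    (ProjectiveResolution.lift ν P P')
  refine ⟨(HomologicalComplex.opcyclesMap φ i).unop c, ?_, ?_⟩
  · exact ConcreteCategory.congr_hom (congrArg Quiver.Hom.unop (HomologicalComplex.p_opcyclesMap φ i)) c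
  · have h : ((yonedaOp M).leftDerived i).map ν ≫ (extIso P' M i).hom =
        (extIso P M i).hom ≫ HomologicalComplex.homologyMap φ i :=
      ProjectiveResolution.isoLeftDerivedObj_hom_naturality ν P P' (ProjectiveResolution.lift ν P P')
        (ProjectiveResolution.lift_commutes_zero ν P P') (yonedaOp M) i
    have h2 : ((yonedaOp M).leftDerived i).map ν ≫ (extIso P' M i).hom ≫
          (homComplex P' M).homologyι i =
        ((extIso P M i).hom ≫ (homComplex P M).homologyι i) ≫ HomologicalComplex.opcyclesMap φ i := by
      rw [← Category.assoc, h, Category.assoc, Category.assoc, ← HomologicalComplex.homologyι_naturality]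
    exact (ConcreteCategory.congr_hom (congrArg Quiver.Hom.unop h2) c).symm

end

/-! ## Local cohomology and cosyzygies -/

variable {R : Type} [CommRing R] (S : InjRes R) (d : ℕ)

/-- The correspondence between homomorphisms to a cosyzygy and `Ext`. -/
def extRel (N : ModuleCat.{0} R) :
    Submodule R ((N →ₗ[R] S.M d) × ((Ext R (ModuleCat.{0} R) d).obj (Opposite.op N)).obj (S.M 0)) where
  carrier := {p | ∃ c, Shift (augRes (projectiveResolution N)) S p.1 d 0
    (cocyclesIncl (projectiveResolution N) (S.M 0) d c).hom ∧ cocyclesToExt (projectiveResolution N) (S.M 0) d c = p.2}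
  add_mem' := by
    rintro ⟨g, ξ⟩ ⟨g', ξ'⟩ ⟨c, h1, h2⟩ ⟨c', h1', h2'⟩
    refine ⟨c + c', ?_, by rw [map_add, h2, h2']; rfl⟩
    rw [map_add]
    exact h1.add h1'
  zero_mem' := by
    obtain ⟨f, hf⟩ := Shift.exists_of_hom (A := augRes (projectiveResolution N)) (S := S) (k := d) 0 d 0 (zero_add d)
    refine ⟨0, ?_, map_zero _⟩
    rw [map_zero]
    exact hf.zero
  smul_mem' := by
    rintro r ⟨g, ξ⟩ ⟨c, h1, h2⟩
    refine ⟨r • c, ?_, by rw [map_smul, h2]; rfl⟩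
    rw [map_smul]
    exact h1.smul r

section

variable {S d} {N : ModuleCat.{0} R}

lemma exists_extRel (g : N →ₗ[R] S.M d) : ∃ ξ, (g, ξ) ∈ extRel S d N := by
  obtain ⟨f, hf⟩ := Shift.exists_of_hom (A := augRes (projectiveResolution N)) (S := S) g d 0 (zero_add d)
  obtain ⟨c, hc⟩ := exists_cocyclesIncl_eq (projectiveResolution N) (S.M 0) d (ModuleCat.ofHom f)
    (ModuleCat.hom_ext hf.comp_d)
  refine ⟨_, c, ?_, rfl⟩
  rw [hc]
  exact hf

lemma exists_extRel_hom (ξ : ((Ext R (ModuleCat.{0} R) d).obj (Opposite.op N)).obj (S.M 0)) :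
    ∃ g, (g, ξ) ∈ extRel S d N := by
  obtain ⟨c, rfl⟩ := cocyclesToExt_surjective (projectiveResolution N) (S.M 0) d ξ
  obtain ⟨g, hg⟩ := Shift.exists_of_cocycle (augRes (projectiveResolution N)) S d d 0 (zero_add d)
    (cocyclesIncl (projectiveResolution N) (S.M 0) d c).hom
    (congrArg ModuleCat.Hom.hom (d_cocyclesIncl (projectiveResolution N) (S.M 0) d c))
  exact ⟨g, c, hg, rfl⟩

lemma extRel_zero {g : N →ₗ[R] S.M (d + 1)} (h : (g, 0) ∈ extRel S (d + 1) N) :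
    ∃ q : N →ₗ[R] S.I d, g = S.π d ∘ₗ q := by
  obtain ⟨c, h1, h2⟩ := h
  obtain ⟨u, hu⟩ := (cocyclesToExt_eq_zero_iff _ _ _ c).1 h2
  exact h1.eq_comp_of_eq (u := u.hom) (congrArg ModuleCat.Hom.hom hu)

lemma eq_zero_of_extRel {q : N →ₗ[R] S.I d} {ξ} (h : (S.π d ∘ₗ q, ξ) ∈ extRel S (d + 1) N) : ξ = 0 := by
  obtain ⟨c, h1, rfl⟩ := h
  obtain ⟨u, hu⟩ := Shift.exists_eq_of_eq_comp (A := augRes (projectiveResolution N)) (q := q) h1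
  exact (cocyclesToExt_eq_zero_iff _ _ _ c).2 ⟨ModuleCat.ofHom u, ModuleCat.hom_ext hu⟩

lemma extRel_comp {N' : ModuleCat.{0} R} (ν : N ⟶ N') {g : N' →ₗ[R] S.M d} {ξ} (h : (g, ξ) ∈ extRel S d N') :
    (g ∘ₗ ν.hom, ((Ext R (ModuleCat.{0} R) d).map ν.op).app (S.M 0) ξ) ∈ extRel S d N := by
  obtain ⟨c, h1, rfl⟩ := h
  obtain ⟨c', hc', h2⟩ := cocyclesToExt_naturality (projectiveResolution N) (S.M 0) d ν (projectiveResolution N') c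
  refine ⟨c', ?_, h2⟩
  have := h1.comp (augResHom ν (projectiveResolution N) (projectiveResolution N'))
  have h3 := congrArg ModuleCat.Hom.hom hc'
  rw [ModuleCat.hom_comp] at h3
  rw [h3]
  exact this

end

variable (m : Ideal R)

/-- The system defining local cohomology. -/
abbrev lcDiagram := localCohomology.diagram (localCohomology.idealPowersDiagram m) d

/-- The `n`-th module of the system defining local cohomology. -/
abbrev extStage (n : ℕ) : ModuleCat.{0} R :=
  ((Ext R (ModuleCat.{0} R) d).obj (Opposite.op (ModuleCat.of R (R ⧸ m ^ n)))).obj (S.M 0)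

/-- The structure map from the `n`-th stage to local cohomology. -/
def toLocalCohomology (n : ℕ) : extStage S d m n ⟶ (localCohomology m d).obj (S.M 0) :=
  (Limits.colimit.ι (lcDiagram d m)
    (Opposite.op (Opposite.op n))).app (S.M 0)

/-- The quotient map between the cyclic modules of the system. -/
def powQuot {n n' : ℕ} (h : n ≤ n') : ModuleCat.of R (R ⧸ m ^ n') ⟶ ModuleCat.of R (R ⧸ m ^ n) :=
  ModuleCat.ofHom (Submodule.mapQ _ _ LinearMap.id (Ideal.pow_le_pow_right h))

/-- The transition maps of the system. -/
def extTransition {n n' : ℕ} (h : n ≤ n') : extStage S d m n ⟶ extStage S d m n' :=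
  ((Ext R (ModuleCat.{0} R) d).map (powQuot m h).op).app (S.M 0)

lemma toLocalCohomology_transition {n n' : ℕ} (h : n ≤ n') (ξ : extStage S d m n) :
    toLocalCohomology S d m n' (extTransition S d m h ξ) = toLocalCohomology S d m n ξ :=
  ConcreteCategory.congr_hom (congrArg (fun t => NatTrans.app t (S.M 0)) (Limits.colimit.w
    (lcDiagram d m) (homOfLE h).op.op)) ξ

lemma exists_toLocalCohomology_eq (ξ : (localCohomology m d).obj (S.M 0)) : ∃ n η, toLocalCohomology S d m n η = ξ := by
  obtain ⟨n, η, h⟩ := Limits.Concrete.isColimit_exists_rep _ (Limits.isColimitOfPreserves ((evaluation _ _).obj (S.M 0))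
    (Limits.colimit.isColimit (lcDiagram d m))) ξ
  exact ⟨n.unop.unop, η, h⟩

lemma exists_extTransition_eq_zero {n : ℕ} {ξ : extStage S d m n} (h : toLocalCohomology S d m n ξ = 0) :
    ∃ (n' : ℕ) (hn : n ≤ n'), extTransition S d m hn ξ = 0 := by
  obtain ⟨k, f, g, hk⟩ := Limits.Concrete.isColimit_exists_of_rep_eq _
    (Limits.isColimitOfPreserves ((evaluation _ _).obj (S.M 0))
    (Limits.colimit.isColimit (lcDiagram d m)))
    (i := Opposite.op (Opposite.op n)) (j := Opposite.op (Opposite.op n)) ξ 0 (h.trans (map_zero _).symm)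
  exact ⟨k.unop.unop, leOfHom f.unop.unop, hk.trans (map_zero _)⟩

/-- The correspondence between torsion elements of a cosyzygy and local cohomology. -/
def lcRel : Submodule R (S.M d × (localCohomology m d).obj (S.M 0)) where
  carrier := {p | ∃ n, ∃ q ∈ extRel S d (ModuleCat.of R (R ⧸ m ^ n)), q.1 (Submodule.Quotient.mk 1) = p.1 ∧
    toLocalCohomology S d m n q.2 = p.2}
  add_mem' := by
    rintro _ _ ⟨n, q, hq, h1, h2⟩ ⟨n', q', hq', h1', h2'⟩
    refine ⟨max n n', _, add_mem (extRel_comp (powQuot m (le_max_left n n')) hq)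
      (extRel_comp (powQuot m (le_max_right n n')) hq'), ?_, ?_⟩
    · exact congrArg₂ (· + ·) h1 h1'
    · refine (map_add (toLocalCohomology S d m (max n n')).hom _ _).trans (congrArg₂ (· + ·) ?_ ?_)
      · exact (toLocalCohomology_transition S d m (le_max_left n n') q.2).trans h2
      · exact (toLocalCohomology_transition S d m (le_max_right n n') q'.2).trans h2'
  zero_mem' := ⟨0, 0, zero_mem _, rfl, map_zero _⟩
  smul_mem' := by
    rintro r _ ⟨n, q, hq, h1, h2⟩
    exact ⟨n, r • q, Submodule.smul_mem _ r hq, congrArg (r • ·) h1,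
      (map_smul (toLocalCohomology S d m n).hom r q.2).trans (congrArg (r • ·) h2)⟩

section

variable {S d m}

/-- The homomorphism from a cyclic module given by a torsion element. -/
def cyclicHom {n : ℕ} {V : Type} [AddCommGroup V] [Module R V] (v : V) (hv : ∀ r ∈ m ^ n, r • v = 0) :
    (R ⧸ m ^ n) →ₗ[R] V := Submodule.liftQ _ (LinearMap.toSpanSingleton R V v) hv

lemma cyclicHom_one {n : ℕ} {V : Type} [AddCommGroup V] [Module R V] (v : V) (hv : ∀ r ∈ m ^ n, r • v = 0) :
    cyclicHom v hv (Submodule.Quotient.mk 1) = v := one_smul R v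

lemma smul_eq_zero_of_cyclic {n : ℕ} {V : Type} [AddCommGroup V] [Module R V] (g : (R ⧸ m ^ n) →ₗ[R] V) {r : R}
    (hr : r ∈ m ^ n) : r • g (Submodule.Quotient.mk 1) = 0 := by
  rw [← map_smul, ← Submodule.Quotient.mk_smul, smul_eq_mul, mul_one, (Submodule.Quotient.mk_eq_zero _).2 hr, map_zero]

lemma cyclic_hom_ext {n : ℕ} {V : Type} [AddCommGroup V] [Module R V] {g g' : (R ⧸ m ^ n) →ₗ[R] V}
    (h : g (Submodule.Quotient.mk 1) = g' (Submodule.Quotient.mk 1)) : g = g' :=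
  Submodule.linearMap_qext _ (LinearMap.ext_ring h)

lemma exists_lcRel {z : S.M d} {n : ℕ} (hz : ∀ r ∈ m ^ n, r • z = 0) : ∃ ξ, (z, ξ) ∈ lcRel S d m := by
  obtain ⟨ξ, hξ⟩ := exists_extRel (N := ModuleCat.of R (R ⧸ m ^ n)) (cyclicHom z hz)
  exact ⟨_, n, _, hξ, cyclicHom_one z hz, rfl⟩

lemma exists_lcRel_left (ξ : (localCohomology m d).obj (S.M 0)) :
    ∃ z, (z, ξ) ∈ lcRel S d m ∧ ∃ n, ∀ r ∈ m ^ n, r • z = 0 := by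
  obtain ⟨n, η, rfl⟩ := exists_toLocalCohomology_eq S d m ξ
  obtain ⟨g, hg⟩ := exists_extRel_hom η
  exact ⟨_, ⟨n, _, hg, rfl, rfl⟩, n, fun r hr => smul_eq_zero_of_cyclic g hr⟩

lemma exists_π_eq_of_lcRel_zero {z : S.M (d + 1)} (h : (z, 0) ∈ lcRel S (d + 1) m) :
    ∃ u, S.π d u = z ∧ ∃ n, ∀ r ∈ m ^ n, r • u = 0 := by
  obtain ⟨n, ⟨g, η⟩, hq, rfl, h2⟩ := h
  obtain ⟨n', hn, h3⟩ := exists_extTransition_eq_zero S (d + 1) m h2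
  have h4 := extRel_comp (powQuot m hn) hq
  obtain ⟨q, hq⟩ := extRel_zero (g := g ∘ₗ (powQuot m hn).hom) (by
    have h5 : ((Ext R (ModuleCat.{0} R) (d + 1)).map (powQuot m hn).op).app (S.M 0) η = 0 := h3
    rw [← h5]
    exact h4)
  exact ⟨q (Submodule.Quotient.mk 1), (LinearMap.congr_fun hq (Submodule.Quotient.mk 1)).symm, n',
    fun r hr => smul_eq_zero_of_cyclic q hr⟩

lemma eq_zero_of_lcRel {u : S.I d} {n : ℕ} (hu : ∀ r ∈ m ^ n, r • u = 0) {ξ}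
    (h : (S.π d u, ξ) ∈ lcRel S (d + 1) m) : ξ = 0 := by
  obtain ⟨n', ⟨g, η⟩, hq, h1, rfl⟩ := h
  have hu' : ∀ r ∈ m ^ max n' n, r • u = 0 := fun r hr => hu r (Ideal.pow_le_pow_right (le_max_right n' n) hr)
  have h4 := extRel_comp (powQuot m (le_max_left n' n)) hq
  have h5 : g ∘ₗ (powQuot m (le_max_left n' n)).hom = S.π d ∘ₗ cyclicHom u hu' :=
    cyclic_hom_ext (h1.trans (congrArg (S.π d) (cyclicHom_one u hu').symm))
  rw [h5] at h4
  have h6 := eq_zero_of_extRel h4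
  exact (toLocalCohomology_transition S (d + 1) m (le_max_left n' n) η).symm.trans
    ((congrArg (toLocalCohomology S (d + 1) m _) h6).trans (map_zero _))

end

/-! ## The relation in the integral closure -/

section

variable {R : Type} [CommRing R] [IsNoetherianRing R]

lemma exists_sum_smul_eq_of_injective {E B : Type} [AddCommGroup E] [Module R E] [Module.Injective R E] [AddCommGroup B]
    [Module R B] [Module.Finite R B] (b : B) (e : E) (h : ∀ v : B →ₗ[R] R, v b • e = 0) :
    ∃ (p q : ℕ) (r : Fin q → B) (a : Fin q → R) (ρ : Fin p → Fin q → R) (y : Fin p → E),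
      ∑ i, a i • r i = b ∧ (∀ k, ∑ i, ρ k i • r i = 0) ∧ ∀ i, ∑ k, ρ k i • y k = a i • e := by
  obtain ⟨q, π, hπ⟩ := Module.Finite.exists_fin' R B
  obtain ⟨a, rfl⟩ := hπ b
  obtain ⟨p, ρ, hρ⟩ := Submodule.fg_iff_exists_fin_generating_family.1 (IsNoetherian.noetherian π.ker)
  have hsum : ∀ w : Fin q → R, ∑ i, w i • π (Pi.single i 1) = π w := fun w => by
    conv_rhs => rw [pi_eq_sum_univ' w, map_sum]
    exact sum_congr rfl fun i _ => by
      rw [map_smul]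
  let u : (Fin q → R) →ₗ[R] (Fin p → R) := Matrix.mulVecLin (Matrix.of ρ)
  have hu : ∀ v k, u v k = ∑ i, ρ k i * v i := fun v k => rfl
  let α : (Fin q → R) →ₗ[R] R := ∑ i, a i • LinearMap.proj i
  have hα : ∀ v, α v = ∑ i, a i * v i := fun v => by simp [α]
  obtain ⟨f, hf⟩ := Module.Injective.exists_comp_eq u ((LinearMap.toSpanSingleton R E e).comp α) (fun v hv => by
    let g : (Fin q → R) →ₗ[R] R := ∑ i, v i • LinearMap.proj i
    have hg : ∀ w, g w = ∑ i, v i * w i := fun w => by simp [g]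
    have hk : π.ker ≤ g.ker := by
      rw [← hρ, Submodule.span_le]
      rintro _ ⟨k, rfl⟩
      have := congrFun hv k
      rw [hu] at this
      rw [SetLike.mem_coe, LinearMap.mem_ker, hg, ← Pi.zero_apply (M := fun _ => R) k, ← this]
      exact sum_congr rfl fun i _ => mul_comm _ _
    have h1 := h ((π.ker.liftQ g hk).comp (π.quotKerEquivOfSurjective hπ).symm.toLinearMap)
    have h2 : (π.quotKerEquivOfSurjective hπ).symm (π a) = Submodule.Quotient.mk a := by
      rw [LinearEquiv.symm_apply_eq]
      rfl
    rw [LinearMap.comp_apply, LinearEquiv.coe_coe, h2] at h1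
    have h3 : π.ker.liftQ g hk (Submodule.Quotient.mk a) = α v := by
      rw [hα]
      exact (hg a).trans (sum_congr rfl fun i _ => mul_comm _ _)
    rw [h3] at h1
    exact h1)
  refine ⟨p, q, fun i => π (Pi.single i 1), a, ρ, fun k => f (Pi.single k 1), hsum a, fun k => ?_, fun i => ?_⟩
  · rw [hsum]
    exact hρ.le (Submodule.subset_span ⟨k, rfl⟩)
  · have h1 := LinearMap.congr_fun hf (Pi.single i 1)
    have h2 : u (Pi.single i 1) = ∑ k, ρ k i • Pi.single k (1 : R) := by
      ext k
      rw [hu, Finset.sum_apply]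
      simp [Pi.single_apply]
    rw [LinearMap.comp_apply, h2, map_sum] at h1
    simp only [map_smul] at h1
    rw [h1, LinearMap.comp_apply, hα, LinearMap.toSpanSingleton_apply]
    simp [Pi.single_apply]

lemma apply_one_mem_conductorIdeal (v : IntClosure R →ₗ[R] R) : v 1 ∈ conductorIdeal R := by
  rw [conductorIdeal, Module.mem_annihilator]
  intro b
  obtain ⟨b, rfl⟩ := Submodule.Quotient.mk_surjective _ b
  rw [← Submodule.Quotient.mk_smul, Submodule.Quotient.mk_eq_zero]
  refine ⟨v b, ?_⟩
  obtain ⟨⟨p, s⟩, hs⟩ := IsLocalization.surj (nonZeroDivisors R) (b : FractionRing R)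
  have h1 : (s : R) • b = p • (1 : IntClosure R) := Subtype.ext (by
    rw [Algebra.smul_def, Algebra.smul_def, mul_one, MulMemClass.coe_mul, mul_comm]
    exact hs)
  have h2 := congrArg v h1
  rw [map_smul, map_smul, smul_eq_mul, smul_eq_mul] at h2
  refine Subtype.ext ((IsLocalization.map_units (FractionRing R) s).mul_left_cancel ?_)
  change algebraMap R (FractionRing R) s * algebraMap R (FractionRing R) (v b) =
    algebraMap R (FractionRing R) s * ((v 1 • b : IntClosure R) : FractionRing R)
  rw [← map_mul, h2, Algebra.smul_def, MulMemClass.coe_mul, ← mul_assoc, mul_comm (algebraMap R (FractionRing R) s),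
    mul_assoc, mul_comm _ (b : FractionRing R), hs, map_mul, mul_comm]
  rfl

lemma sum_sum_smul_eq {ι κ B : Type} [CommRing B] [Algebra R B] (t : Finset ι) (s : Finset κ) (c : ι → κ → R)
    (y : κ → R) (r : ι → B) : ∑ i ∈ t, (∑ j ∈ s, c i j * y j) • r i =
      - ∑ j ∈ s, (- ∑ i ∈ t, algebraMap R B (c i j) * r i) * algebraMap R B (y j) := by
  simp only [Finset.sum_smul, Finset.sum_mul, neg_mul, Finset.sum_neg_distrib, neg_neg]
  rw [Finset.sum_comm]
  refine sum_congr rfl fun j _ => sum_congr rfl fun i _ => ?_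
  rw [Algebra.smul_def, map_mul]
  ring

namespace InjRes

variable (S : InjRes R) (x : ℕ → R)

lemma Rep.zero (n : ℕ) : ∀ j, S.Rep x n j 0 0
  | 0 => (map_zero S.e).symm
  | j + 1 => ⟨0, zero_mem _, 0, zero_mem _, map_zero _, by rw [smul_zero, map_zero], Rep.zero n j⟩

/-- The submodule of all pairs of a numerator and the element it represents. -/
def repSubmodule (n j : ℕ) : Submodule R (R × S.M j) where
  carrier := {p | S.Rep x n j p.1 p.2}
  add_mem' := by
    rintro ⟨a, z⟩ ⟨b, w⟩ h h'
    have := Rep.sub h (Rep.sub (Rep.zero S x n j) h')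
    rwa [zero_sub, zero_sub, sub_neg_eq_add, sub_neg_eq_add] at this
  zero_mem' := Rep.zero S x n j
  smul_mem' := fun r _ h => Rep.smul h r

end InjRes

end

section

variable {R : Type} [CommRing R] [IsNoetherianRing R] [IsLocalRing R] {x : ℕ → R} {d : ℕ}

lemma exists_pow_smul_eq_zero_of_mem_tors (hx : ∀ Q : Ideal R, Q.IsPrime → (∀ i < d, x i ∈ Q) → Q = maximalIdeal R)
    {V : Type} [AddCommGroup V] [Module R V] {v : V} (hv : v ∈ tors x d V) :
    ∃ n, ∀ r ∈ maximalIdeal R ^ n, r • v = 0 := by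
  choose! m hm using hv
  obtain ⟨n, hn⟩ := exists_pow_le_of_forall_isPrime (I := (LinearMap.toSpanSingleton R V v).ker) (fun Q hQ hle =>
    hx Q hQ fun i hi => hQ.mem_of_pow_mem (m i) (hle (hm i hi)))
  exact ⟨n, fun r hr => hn hr⟩

lemma mem_tors_of_pow_smul_eq_zero (hx : ∀ i < d, x i ∈ maximalIdeal R) {V : Type} [AddCommGroup V] [Module R V]
    {v : V} {n : ℕ} (hv : ∀ r ∈ maximalIdeal R ^ n, r • v = 0) : v ∈ tors x d V :=
  fun i hi => ⟨n, hv _ (Ideal.pow_mem_pow (hx i hi) n)⟩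

theorem exists_relation_of_conductorIdeal_le [Module.Finite R (IntClosure R)]
    (hE : Module.Injective R (localCohMod R (d + 1) R)) (hxm : ∀ i < d + 1, x i ∈ maximalIdeal R)
    (hx : ∀ Q : Ideal R, Q.IsPrime → (∀ i < d + 1, x i ∈ Q) → Q = maximalIdeal R)
    (hc : conductorIdeal R ≤ spanPow x 1 (range (d + 1))) :
    ∃ (N : ℕ) (s : ℕ → IntClosure R), ∏ i ∈ range (d + 1), algebraMap R (IntClosure R) (x i) ^ N =
      ∑ i ∈ range (d + 1), s i * algebraMap R (IntClosure R) (x i) ^ (N + 1) := by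
  obtain ⟨S⟩ := InjRes.nonempty R
  let ε : localCohMod R (d + 1) R ≃ₗ[R] (localCohomology (maximalIdeal R) (d + 1)).obj (S.M 0) :=
    ((localCohomology (maximalIdeal R) (d + 1)).mapIso (S.e.toModuleIso)).toLinearEquiv
  have hbd : ∀ {z ξ}, (z, ξ) ∈ lcRel S (d + 1) (maximalIdeal R) → S.Bd x (d + 1) z → ξ = 0 := by
    rintro _ ξ h ⟨u, hu, rfl⟩
    obtain ⟨n, hn⟩ := exists_pow_smul_eq_zero_of_mem_tors hx hu
    exact eq_zero_of_lcRel hn h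
  obtain ⟨k, z, hz⟩ := S.exists_rep_of_ring x 1 (d + 1) 1
  rw [one_mul] at hz
  obtain ⟨n, hn⟩ := exists_pow_smul_eq_zero_of_mem_tors hx hz.mem_tors
  obtain ⟨ξ, hξ⟩ := exists_lcRel hn
  obtain ⟨p, q, r, a, ρ, y, h1, h2, h3⟩ := exists_sum_smul_eq_of_injective (1 : IntClosure R) (ε.symm ξ) (fun v => by
    rw [← map_smul, hbd (Submodule.smul_mem _ (v 1) hξ) ((hz.smul (v 1)).bd_of_mem_spanPow ?_), map_zero]
    exact InjRes.mul_prod_mem_spanPow (hc (apply_one_mem_conductorIdeal v)))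
  choose w hw hwn using fun k => exists_lcRel_left (S := S) (m := maximalIdeal R) (ε (y k))
  choose m b hb using fun k => InjRes.exists_rep (mem_tors_of_pow_smul_eq_zero hxm (hwn k).choose_spec)
  let l := ∑ k, m k
  have hb' : ∀ k', ∃ b', (b', w k') ∈ S.repSubmodule x (1 + k + l) (d + 1) := fun k' => by
    have := (hb k').level (1 + k + (l - m k'))
    have hle : m k' ≤ l := Finset.single_le_sum (fun _ _ => Nat.zero_le _) (mem_univ k')
    rw [show m k' + (1 + k + (l - m k')) = 1 + k + l by omega] at this
    exact ⟨_, this⟩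
  choose b' hb' using hb'
  have hz' : (∏ i ∈ range (d + 1), x i ^ (k + l), z) ∈ S.repSubmodule x (1 + k + l) (d + 1) := by
    have := hz.level l
    rw [← Finset.prod_mul_distrib, prod_congr rfl fun i _ => (pow_add (x i) k l).symm] at this
    exact this
  have hrel : ∀ i, ∃ t, ((∑ k', ρ k' i * b' k') - a i * ∏ i ∈ range (d + 1), x i ^ (k + l)) *
      ∏ i ∈ range (d + 1), x i ^ t ∈ spanPow x (1 + k + l + t) (range (d + 1)) := fun i => by
    have h4 := sub_mem (Submodule.sum_mem _ fun k' (_ : k' ∈ univ) => Submodule.smul_mem _ (ρ k' i) (hb' k'))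
      (Submodule.smul_mem _ (a i) hz')
    have h5 := sub_mem (Submodule.sum_mem _ fun k' (_ : k' ∈ univ) => Submodule.smul_mem _ (ρ k' i) (hw k'))
      (Submodule.smul_mem _ (a i) hξ)
    have h6 : S.Rep x (1 + k + l) (d + 1) ((∑ k', ρ k' i * b' k') - a i * ∏ i ∈ range (d + 1), x i ^ (k + l))
        ((∑ k', ρ k' i • w k') - a i • z) := by
      have : S.Rep x _ _ _ _ := h4
      simpa [Prod.fst_sum, Prod.snd_sum] using this
    have h7 : ((∑ k', ρ k' i • w k') - a i • z, 0) ∈ lcRel S (d + 1) (maximalIdeal R) := by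
      convert h5 using 1
      refine Prod.ext (by simp [Prod.fst_sum]) ?_
      have h8 := congrArg ε (h3 i)
      rw [map_sum, map_smul, LinearEquiv.apply_symm_apply] at h8
      simp only [map_smul] at h8
      rw [Prod.snd_sub, Prod.snd_sum]
      exact (sub_eq_zero.2 h8).symm
    obtain ⟨u, hu, n', hn'⟩ := exists_π_eq_of_lcRel_zero h7
    exact h6.mem_spanPow_of_bd ⟨u, mem_tors_of_pow_smul_eq_zero hxm hn', hu⟩
  choose t ht using hrel
  let T := ∑ i, t i
  have hT : ∀ i, ((∑ k', ρ k' i * b' k') - a i * ∏ i ∈ range (d + 1), x i ^ (k + l)) *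
      ∏ i ∈ range (d + 1), x i ^ T ∈ spanPow x (1 + k + l + T) (range (d + 1)) := fun i => by
    have hle : t i ≤ T := Finset.single_le_sum (fun _ _ => Nat.zero_le _) (mem_univ i)
    obtain ⟨t', ht'⟩ := Nat.exists_eq_add_of_le hle
    have := InjRes.mul_prod_mem_spanPow (l := t') (ht i)
    rwa [mul_assoc, ← Finset.prod_mul_distrib, prod_congr rfl fun j _ => (pow_add (x j) (t i) t').symm,
      add_assoc, ← ht'] at this
  choose c hc using fun i => mem_spanPow.1 (hT i)
  refine ⟨k + l + T, fun j => - ∑ i, algebraMap R _ (c i j) * r i, ?_⟩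
  have hA : ∑ i, (((∑ k', ρ k' i * b' k') - a i * ∏ i ∈ range (d + 1), x i ^ (k + l)) *
      ∏ i ∈ range (d + 1), x i ^ T) • r i = - ∏ j ∈ range (d + 1), algebraMap R _ (x j) ^ (k + l + T) := by
    have h4 : ∑ i, (∑ k', ρ k' i * b' k') • r i = 0 := by
      simp only [Finset.sum_smul]
      rw [Finset.sum_comm]
      refine Finset.sum_eq_zero fun k' _ => ?_
      simp only [mul_comm (ρ k' _), mul_smul]
      rw [← Finset.smul_sum, h2, smul_zero]
    have h5 : ∀ P P' : R, ∑ i, (((∑ k', ρ k' i * b' k') - a i * P) * P') • r i = - (algebraMap R _ (P * P')) := by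
      intro P P'
      simp only [mul_comm _ P', mul_smul, sub_smul]
      rw [← Finset.smul_sum, Finset.sum_sub_distrib, h4, zero_sub]
      simp only [smul_comm _ P]
      rw [← Finset.smul_sum, h1, smul_neg, ← mul_smul, mul_comm P', Algebra.algebraMap_eq_smul_one]
    rw [h5, ← Finset.prod_mul_distrib, prod_congr rfl fun j _ => (pow_add (x j) (k + l) T).symm, map_prod]
    simp only [map_pow]
  rw [← neg_inj, ← hA]
  simp only [← hc, ← map_pow]
  rw [show 1 + k + l + T = k + l + T + 1 by omega]
  exact sum_sum_smul_eq _ _ c _ r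

end

/-! ## The conductor and parameter ideals -/

lemma conductorIdeal_eq_top_of_maximalIdeal_eq_bot (R : Type) [CommRing R] [IsLocalRing R] (h : maximalIdeal R = ⊥) :
    conductorIdeal R = ⊤ := by
  rw [Ideal.eq_top_iff_one, conductorIdeal, Module.mem_annihilator]
  intro b
  obtain ⟨b, rfl⟩ := Submodule.Quotient.mk_surjective _ b
  rw [one_smul, Submodule.Quotient.mk_eq_zero]
  obtain ⟨⟨p, s⟩, hs⟩ := IsLocalization.surj (nonZeroDivisors R) (b : FractionRing R)
  have hu : IsUnit (s : R) := by
    rw [← notMem_maximalIdeal, h, Ideal.mem_bot]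
    exact nonZeroDivisors.ne_zero s.2
  obtain ⟨t, ht⟩ := hu.exists_right_inv
  refine ⟨t * p, Subtype.ext ((IsLocalization.map_units (FractionRing R) s).mul_right_cancel ?_)⟩
  refine Eq.trans ?_ hs.symm
  change algebraMap R (FractionRing R) (t * p) * algebraMap R (FractionRing R) s = algebraMap R (FractionRing R) p
  rw [← map_mul, mul_right_comm, mul_comm t, ht, one_mul]

lemma isReduced_of_analyticallyUnramified {R : Type} [CommRing R] [IsLocalRing R] [IsNoetherianRing R]
    (hau : AnalyticallyUnramified R) : IsReduced R := by
  have : IsReduced (AdicCompletion (maximalIdeal R) R) := hau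
  exact isReduced_of_injective (algebraMap R (AdicCompletion (maximalIdeal R) R))
    (FaithfulSMul.algebraMap_injective R (AdicCompletion (maximalIdeal R) R))

section

variable {R : Type} [CommRing R] [IsLocalRing R]

lemma IsSystemOfParameters.eq_maximalIdeal {d : ℕ} {x : Fin d → R} (hx : IsSystemOfParameters R x) {Q : Ideal R}
    (hQ : Q.IsPrime) (h : ∀ i, x i ∈ Q) : Q = maximalIdeal R := by
  refine le_antisymm (le_maximalIdeal hQ.ne_top) ?_
  rw [← hx.2.2, hQ.radical_le_iff, Ideal.span_le]
  rintro _ ⟨i, rfl⟩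
  exact h i

theorem exists_relation_of_conductorIdeal_le_span [IsNoetherianRing R] [Module.Finite R (IntClosure R)] {d : ℕ}
    (hE : Module.Injective R (localCohMod R (d + 1) R)) {x : Fin (d + 1) → R} (hx : IsSystemOfParameters R x)
    (hc : conductorIdeal R ≤ Ideal.span (Set.range x)) :
    ∃ (N : ℕ) (s : Fin (d + 1) → IntClosure R), ∏ i, algebraMap R (IntClosure R) (x i) ^ N =
      ∑ i, s i * algebraMap R (IntClosure R) (x i) ^ (N + 1) := by
  let y : ℕ → R := fun i => if h : i < d + 1 then x ⟨i, h⟩ else 0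
  have hy : ∀ i : Fin (d + 1), y i = x i := fun i => dif_pos i.2
  obtain ⟨N, s, h⟩ := exists_relation_of_conductorIdeal_le (x := y) hE
    (fun i hi => by rw [hy ⟨i, hi⟩]; exact hx.2.1 _)
    (fun Q hQ h => hx.eq_maximalIdeal hQ fun i => by rw [← hy]; exact h i i.2)
    (hc.trans (by
      rw [Ideal.span_le]
      rintro _ ⟨i, rfl⟩
      rw [← hy]
      exact Ideal.subset_span ⟨i, Finset.mem_coe.2 (mem_range.2 i.2), pow_one _⟩))
  refine ⟨N, fun i => s i, ?_⟩
  rw [Finset.prod_range, Finset.sum_range] at h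
  simpa only [hy] using h

theorem not_conductorIdeal_le [IsNoetherianRing R] (hau : AnalyticallyUnramified R) {d : ℕ}
    (hE : Module.Injective R (localCohMod R (d + 1) R)) {x : Fin (d + 1) → R} (hx : IsSystemOfParameters R x) :
    ¬ conductorIdeal R ≤ Ideal.span (Set.range x) := by
  intro hc
  have := finite_intClosure R hau
  let T := AdicCompletion (maximalIdeal R) R
  obtain ⟨P, hP, hdim⟩ := exists_minimalPrimes_ringKrullDim_quotient_eq (T := T) (d := d + 1)
    ((AdicCompletion.ringKrullDim_maximalIdeal R).trans hx.1.symm)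
  have hPp : P.IsPrime := hP.1.1
  obtain ⟨g, hg⟩ := exists_fractionRing_hom (R := R) hP
  let D := integralClosure (T ⧸ P) (FractionRing (T ⧸ P))
  have hD : Module.Finite (T ⧸ P) D := finite_integralClosure_of_complete (T ⧸ P)
  let f : R →+* T ⧸ P := (Ideal.Quotient.mk P).comp (algebraMap R T)
  have hmap : (maximalIdeal R).map f = maximalIdeal (T ⧸ P) := by
    rw [← Ideal.map_map, ← map_maximalIdeal_quotient, AdicCompletion.maximalIdeal_eq_map]
  have hmem : ∀ r ∈ maximalIdeal R, f r ∈ maximalIdeal (T ⧸ P) := fun r hr => by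
    rw [← hmap]
    exact Ideal.mem_map_of_mem f hr
  let γ : IntClosure R →+* D :=
    (g.comp (integralClosure R (FractionRing R)).val.toRingHom).codRestrict D.toSubring
      fun b => isIntegral_fractionRing_hom hg b.2
  have hγ : ∀ r, γ (algebraMap R (IntClosure R) r) = algebraMap (T ⧸ P) D (f r) := fun r => Subtype.ext (hg r)
  refine false_of_forall_relation (T := T ⧸ P) (D := D) f hdim x (fun i => hmem _ (hx.2.1 i))
    (fun Q hQ h => ?_) (fun x' hx' => ?_)
  · refine le_antisymm (le_maximalIdeal hQ.ne_top) ?_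
    rw [← hmap, Ideal.map_le_iff_le_comap, hx.eq_maximalIdeal (hQ.comap f) h]
  · obtain ⟨N, s, h⟩ := exists_relation_of_conductorIdeal_le_span hE (x := x')
      ⟨hx.1, fun i => (Ideal.span_le.2 (Set.range_subset_iff.2 hx.2.1))
        (hx' ▸ Ideal.subset_span ⟨i, rfl⟩), by rw [hx']; exact hx.2.2⟩ (by rw [hx']; exact hc)
    refine ⟨N, fun i => γ (s i), ?_⟩
    have := congrArg γ h
    rw [map_prod, map_sum] at this
    simpa only [map_mul, map_pow, hγ] using this

end

theorem stmt16 (R : Type) [CommRing R] [IsLocalRing R] [IsNoetherianRing R]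
    (hau : AnalyticallyUnramified R)
    (d : ℕ) (hdim : (d : WithBot (WithTop ℕ)) = ringKrullDim R)
    (hqgor : IsInjectiveHullOfResidueField R (localCohMod R d R)) :
    ∀ x : Fin d → R, IsSystemOfParameters R x →
      ¬ conductorIdeal R ≤ Ideal.span (Set.range x) := by
  intro x hx hc
  cases d with
  | zero =>
    have := isReduced_of_analyticallyUnramified hau
    have hbot : Ideal.span (Set.range x) = ⊥ := by rw [Set.range_eq_empty, Ideal.span_empty]
    have hm : maximalIdeal R = ⊥ := by
      rw [← hx.2.2, hbot]
      exact nilradical_eq_zero R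
    rw [conductorIdeal_eq_top_of_maximalIdeal_eq_bot R hm, hbot] at hc
    exact bot_ne_top (le_antisymm bot_le hc)
  | succ d => exact not_conductorIdeal_le hau hqgor.1 hx hc
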